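/- Let p be an odd prime and suppose (ℤ/p)^k acts effectively by homeomorphisms on a connected compact manifold M of dimension r with Euler characteristic χ(M). Then p^(k − ⌊r/2⌋) divides χ(M) (with the convention p^j = 1 for j ≤ 0). In particular, if (ℤ/3)^k acts effectively on M with 3 ∤ χ(M), then k ≤ ⌊r/2⌋. -/

import Mathlib

open CategoryTheory

/-- The singular chain complex of a topological space with coefficients in `R`. -/
noncomputable def singularChainComplex (R : Type) [CommRing R] (X : TopCat.{0}) :
    ChainComplex (ModuleCat R) ℕ :=
  (AlgebraicTopology.alternatingFaceMapComplex (ModuleCat R)).obj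
    (((CategoryTheory.SimplicialObject.whiskering _ _).obj (ModuleCat.free R)).obj
      (TopCat.toSSet.obj X))

/-- Singular homology of a topological space with coefficients in `R`. -/
noncomputable def singularHomology (R : Type) [CommRing R] (X : TopCat.{0}) (i : ℕ) :
    ModuleCat R :=
  (singularChainComplex R X).homology i

/-- The Euler characteristic of a space whose homology vanishes above degree `r`,
as the alternating sum of the ranks of its rational singular homology groups. -/
noncomputable def eulerCharUpTo (X : TopCat.{0}) (r : ℕ) : ℤ :=
  ∑ i ∈ Finset.range (r + 1),
    (-1 : ℤ) ^ i * (Module.finrank ℚ (singularHomology ℚ X i) : ℤ)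

set_option linter.unusedSectionVars false
set_option linter.unusedVariables false

open Filter (atTop)
open Fintype (ofFinite)
open Fin (succAbove)
open Int (castRingHom)
open Subtype (dist_eq)
open Set (indicator_of_mem indicator_of_notMem subset_union_left subset_union_right Icc inter_subset_right inter_subset_left univ not_subset image_mono)
open Finset (sum_eq_zero sum_eq_single sum_range_succ sum_congr sum_sub_distrib sum_const Ico sum_ite_eq' mem_Ico mem_coe mem_toList mem_erase mul_sum mem_filter sum_filter sum_comm sum_mul)
open Finsupp (linearCombination single lhom_ext' lsingle_apply supported mapDomain mapDomain_single single_mem_supported smul_single linearCombination_single supported_mono lmapDomain lmapDomain_apply mapRange mapRange_single)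
open LinearMap (ker mem_ker exact_iff prodMap inl inr comp_id ext_ring)
open Submodule (mkQ mkQ_apply mkQ_surjective mapQ liftQ map_mono map_comp smul_mem)
open List (map_cons mem_cons mem_append map_id mem_map ofFn)
open Function (comp_def Surjective Injective Exact Bijective invFun update_self update_of_ne)
open AddSubgroup (zmultiples mem_zmultiples mem_sup mem_zmultiples_iff zmultiples_le card_bot relIndex_comap map_comap_eq)
open Metric (closedBall ball isOpen_ball mem_ball isOpen_iff ball_subset_ball mem_ball_self thickening thickening_mono mem_thickening_iff)
open Module (finrank finrank_zero_of_subsingleton Dual End)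
open Topology (IsOpenEmbedding)
open AddAction (stabilizer)
open LinearEquiv (ofBijective)
open stdSimplex (sum_eq_one le_one)
open OpenPartialHomeomorph (univBall_source)
namespace PG

/-! ### Cochains on lists -/

section Cob
variable {M M' R : Type} [CommRing R]

/-- Coboundary of a function on lists. -/
def cob (f : List M → R) : List M → R
  | [] => 0
  | a :: l => f l - cob (fun m => f (a :: m)) l

/-- prism operator between two maps. -/
def prism (α β : M' → M) (f : List M → R) : List M' → R
  | [] => 0
  | a :: l => f (α a :: β a :: l.map β) - prism α β (fun m => f (α a :: m)) l

@[simp] lemma cob_nil (f : List M → R) : cob f [] = 0 := by simp [cob]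
lemma cob_cons (f : List M → R) (a : M) (l : List M) :
  cob f (a :: l) = f l - cob (fun m => f (a :: m)) l := by simp [cob]
@[simp] lemma prism_nil (α β : M' → M) (f : List M → R) : prism α β f [] = 0 := by simp [prism]
lemma prism_cons (α β : M' → M) (f : List M → R) (a : M') (l : List M') :
  prism α β f (a :: l) =
  f (α a :: β a :: l.map β) - prism α β (fun m => f (α a :: m)) l := by simp [prism]

lemma cob_add_apply (f g : List M → R) (l : List M) :
  cob (fun m => f m + g m) l = cob f l + cob g l := by
  induction l generalizing f g with
  | nil => simp
  | cons a l ih => simp only [cob_cons, ih]; ring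

lemma cob_smul_apply (c : R) (f : List M → R) (l : List M) :
  cob (fun m => c * f m) l = c * cob f l := by
  induction l generalizing f with
  | nil => simp
  | cons a l ih => simp only [cob_cons, ih]; ring

lemma cob_sub_apply (f g : List M → R) (l : List M) :
  cob (fun m => f m - g m) l = cob f l - cob g l := by
  induction l generalizing f g with
  | nil => simp
  | cons a l ih => simp only [cob_cons, ih]; ring

lemma prism_sub_apply (α β : M' → M) (f g : List M → R) (l : List M') :
  prism α β (fun m => f m - g m) l = prism α β f l - prism α β g l := by
  induction l generalizing f g with
  | nil => simp
  | cons a l ih => simp only [prism_cons, ih]; ring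

lemma cob_cob_apply (f : List M → R) (l : List M) : cob (cob f) l = 0 := by
  induction l generalizing f with
  | nil => simp
  | cons a l ih =>
    rw [cob_cons]
    simp only [cob_cons, cob_sub_apply]
    have := ih (fun m => f (a :: m))
    change cob f l - (cob f l - cob (cob (fun m => f (a :: m))) l) = 0
    rw [this]; ring

lemma cob_map_apply (ρ : M' → M) (f : List M → R) (l : List M') :
  cob (fun m => f (m.map ρ)) l = cob f (l.map ρ) := by
  induction l generalizing f with
  | nil => simp
  | cons a l ih =>
    simp only [cob_cons, map_cons]
    rw [← ih (fun m => f (ρ a :: m))]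

lemma prism_spec (α β : M' → M) (f : List M → R) (l : List M') :
  cob (prism α β f) l + prism α β (cob f) l = f (l.map β) - f (l.map α) := by
  induction l generalizing f with
  | nil => simp
  | cons a l ih =>
    have ih' := ih (fun m => f (α a :: m))
    simp only [cob_cons, prism_cons, map_cons, cob_sub_apply, prism_sub_apply]
    rw [cob_map_apply β (fun m => f (α a :: β a :: m))]
    change _ - (_ - cob (prism α β (fun m => f (α a :: m))) l) + (_ - (_ -
      prism α β (cob (fun m => f (α a :: m))) l)) = _
    linear_combination ih'

lemma cob_zero_of (f : List M → R) (l : List M) (h : ∀ l', l' ⊆ l → f l' = 0) :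
  cob f l = 0 := by
  induction l generalizing f with
  | nil => simp
  | cons a l ih =>
    rw [cob_cons, h l (by simp), ih (fun m => f (a :: m)) (fun l' hl' => h _ (by
      exact List.cons_subset_cons a hl'))]
    simp

lemma cob_congr_of (f g : List M → R) (l : List M) (h : ∀ l', l' ⊆ l → f l' = g l') :
  cob f l = cob g l := by
  have := cob_zero_of (fun m => f m - g m) l (fun l' hl' => by simp [h l' hl'])
  rw [cob_sub_apply] at this
  exact sub_eq_zero.mp this

lemma prism_zero_of (α β : M' → M) (f : List M → R) (l : List M')
  (h : ∀ l', l' ⊆ l.map α ++ l.map β → f l' = 0) : prism α β f l = 0 := by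
  induction l generalizing f with
  | nil => simp
  | cons a l ih =>
    rw [prism_cons, ih (fun m => f (α a :: m)), h, sub_zero]
    · intro x hx
      simp only [mem_cons, mem_append, map_cons] at hx ⊢
      tauto
    · intro l' hl'
      apply h
      intro x hx
      simp only [mem_cons, mem_append, map_cons] at hx ⊢
      rcases hx with hx | hx
      · tauto
      · have := hl' hx
        simp only [mem_append] at this
        tauto

lemma prism_map (α β : M' → M) (k' : M' → M') (k : M → M)
  (hα : ∀ x, α (k' x) = k (α x)) (hβ : ∀ x, β (k' x) = k (β x))
  (f : List M → R) (l : List M') :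
  prism α β f (l.map k') = prism α β (fun m => f (m.map k)) l := by
  induction l generalizing f with
  | nil => simp
  | cons a l ih =>
    simp only [map_cons, prism_cons, ih, hα, hβ]
    congr 2
    simp [comp_def, hβ]

/-- The coboundary as a linear map. -/
def cobL (M R : Type) [CommRing R] : (List M → R) →ₗ[R] (List M → R) where
  toFun := cob
  map_add' f g := funext fun l => cob_add_apply f g l
  map_smul' c f := funext fun l => cob_smul_apply c f l

@[simp] lemma cobL_apply (f : List M → R) : cobL M R f = cob f := rfl

lemma cob_cob (f : List M → R) : cob (cob f) = 0 := funext fun l => cob_cob_apply f l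
lemma cob_add (f g : List M → R) : cob (f + g) = cob f + cob g := (cobL M R).map_add f g
lemma cob_sub (f g : List M → R) : cob (f - g) = cob f - cob g := (cobL M R).map_sub f g
lemma cob_neg (f : List M → R) : cob (-f) = - cob f := (cobL M R).map_neg f
lemma cob_zero : cob (0 : List M → R) = 0 := (cobL M R).map_zero

/-- Functions supported on lists of length `n`. -/
def Len (M R : Type) [CommRing R] (n : ℕ) : Submodule R (List M → R) where
  carrier := {f | ∀ l, l.length ≠ n → f l = 0}
  add_mem' hf hg l hl := by simp [hf l hl, hg l hl]
  zero_mem' l _ := rfl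
  smul_mem' c f hf l hl := by simp [hf l hl]

lemma cob_len {n : ℕ} {f : List M → R} (hf : f ∈ Len M R n) : cob f ∈ Len M R (n + 1) := by
  intro l hl
  induction l generalizing f n with
  | nil => simp
  | cons a l ih =>
    simp only [List.length_cons, ne_eq, Nat.add_right_cancel_iff] at hl
    rw [cob_cons, hf l hl, zero_sub, neg_eq_zero]
    cases n with
    | zero =>
      apply cob_zero_of
      intro l' _
      exact hf _ (by simp)
    | succ n =>
      refine ih (n := n) ?_ hl
      intro l' hl'
      exact hf _ (by simpa using hl')

lemma prism_len {n : ℕ} (α β : M' → M) {f : List M → R} (hf : f ∈ Len M R (n + 1)) :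
  prism α β f ∈ Len M' R n := by
  intro l hl
  induction l generalizing f n with
  | nil => simp
  | cons a l ih =>
    rw [prism_cons, hf _ (by simpa using hl), zero_sub, neg_eq_zero]
    cases n with
    | zero =>
      clear ih
      apply prism_zero_of_len
      exact hf
    | succ n =>
      refine ih (n := n) ?_ (by simpa using hl)
      intro l' hl'
      exact hf _ (by simpa using hl')
where
  prism_zero_of_len {α β : M' → M} {f : List M → R} {a : M} {l : List M'}
      (hf : f ∈ Len M R (0 + 1)) : prism α β (fun m => f (a :: m)) l = 0 := by
    cases l with
    | nil => simp
    | cons b l =>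
      rw [prism_cons, hf _ (by simp), zero_sub, neg_eq_zero]
      have : (fun m => f (a :: α b :: m)) = (fun m => (fun _ => (0 : R)) m - (fun _ => 0) m) := by
        funext m; rw [hf _ (by simp)]; simp
      rw [this, prism_sub_apply, sub_self]

lemma indicator_len {n : ℕ} (S : Set (List M)) {f : List M → R} (hf : f ∈ Len M R n) :
  S.indicator f ∈ Len M R n := fun l hl => by
  by_cases h : l ∈ S
  · rw [indicator_of_mem h, hf l hl]
  · rw [indicator_of_notMem h]

end Cob

/-! ### Families -/

/-- A family of lists closed under taking lists with fewer members. -/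
structure Fam (M : Type) where
  car : Set (List M)
  nil' : [] ∈ car
  sub' : ∀ {l l' : List M}, l ∈ car → l' ⊆ l → l' ∈ car

namespace Fam
variable {M : Type}
instance : SetLike (Fam M) (List M) := ⟨Fam.car, fun a b h => by cases a; cases b; simp_all⟩
instance : PartialOrder (Fam M) := PartialOrder.lift (fun X : Fam M => X.car) (fun a b h => by cases a; cases b; simp_all)
lemma nil (X : Fam M) : [] ∈ X := X.nil'
lemma sub (X : Fam M) {l l' : List M} (h : l ∈ X) (h' : l' ⊆ l) : l' ∈ X := X.sub' h h'
instance : Max (Fam M) := ⟨fun X Y => ⟨X.car ∪ Y.car, Or.inl X.nil,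
  fun h h' => h.imp (fun h => X.sub h h') (fun h => Y.sub h h')⟩⟩
instance : Min (Fam M) := ⟨fun X Y => ⟨X.car ∩ Y.car, ⟨X.nil, Y.nil⟩,
  fun h h' => ⟨X.sub h.1 h', Y.sub h.2 h'⟩⟩⟩
@[simp] lemma mem_max {X Y : Fam M} {l : List M} : l ∈ X ⊔ Y ↔ l ∈ X ∨ l ∈ Y := Iff.rfl
@[simp] lemma mem_min {X Y : Fam M} {l : List M} : l ∈ X ⊓ Y ↔ l ∈ X ∧ l ∈ Y := Iff.rfl
@[ext] lemma ext {X Y : Fam M} (h : ∀ l, l ∈ X ↔ l ∈ Y) : X = Y := SetLike.ext h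

/-- Lists with all members in `A`. -/
def pow (A : Set M) : Fam M := ⟨{l | ∀ x ∈ l, x ∈ A}, by simp, fun h h' x hx => h x (h' hx)⟩
lemma mem_pow {A : Set M} {l : List M} : l ∈ pow A ↔ ∀ x ∈ l, x ∈ A := Iff.rfl
lemma pow_inter (A B : Set M) : pow (A ∩ B) = pow A ⊓ pow B := by
  ext l; simp only [mem_min, mem_pow, Set.mem_inter_iff]; exact forall₂_and
lemma pow_mono {A B : Set M} (h : A ⊆ B) : pow A ≤ pow B := fun _ hl x hx => h (hl x hx)
lemma pow_max_le (A B : Set M) {X : Fam M} (h : pow (A ∪ B) ≤ X) : pow A ⊔ pow B ≤ X := by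
  rintro l (hl | hl)
  · exact h (pow_mono subset_union_left hl)
  · exact h (pow_mono subset_union_right hl)
end Fam

open Fam

/-- Lists of diameter less than `ε`. -/
def Sm {M : Type} [MetricSpace M] (ε : ℝ) : Set (List M) :=
  {l | ∀ x ∈ l, ∀ y ∈ l, dist x y < ε}

section Small
variable {M R : Type} [MetricSpace M] [CommRing R]

lemma mem_Sm {ε : ℝ} {l : List M} : l ∈ Sm ε ↔ ∀ x ∈ l, ∀ y ∈ l, dist x y < ε := Iff.rfl
lemma Sm_mono {ε δ : ℝ} (h : ε ≤ δ) : (Sm ε : Set (List M)) ⊆ Sm δ :=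
  fun _ hl x hx y hy => (hl x hx y hy).trans_le h
lemma Sm_sub {ε : ℝ} {l l' : List M} (h : l ∈ Sm ε) (h' : l' ⊆ l) : l' ∈ Sm ε :=
  fun x hx y hy => h x (h' hx) y (h' hy)

/-- Functions vanishing on all sufficiently small lists of a family. -/
def N (R : Type) [CommRing R] (X : Fam M) : Submodule R (List M → R) where
  carrier := {f | ∃ ε > 0, ∀ l ∈ X, l ∈ Sm ε → f l = 0}
  add_mem' := by
    rintro f g ⟨ε, hε, h⟩ ⟨δ, hδ, h'⟩
    refine ⟨min ε δ, lt_min hε hδ, fun l hl hs => ?_⟩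
    simp [h l hl (Sm_mono (min_le_left _ _) hs), h' l hl (Sm_mono (min_le_right _ _) hs)]
  zero_mem' := ⟨1, one_pos, fun _ _ _ => rfl⟩
  smul_mem' := by
    rintro c f ⟨ε, hε, h⟩
    exact ⟨ε, hε, fun l hl hs => by simp [h l hl hs]⟩

lemma N_anti {X Y : Fam M} (h : X ≤ Y) : N R Y ≤ N R X :=
  fun _ ⟨ε, hε, h'⟩ => ⟨ε, hε, fun l hl => h' l (h hl)⟩

lemma N_max (X Y : Fam M) : N R (X ⊔ Y) = N R X ⊓ N R Y := by
  apply le_antisymm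
  · exact le_inf (N_anti fun _ h => Or.inl h) (N_anti fun _ h => Or.inr h)
  · rintro f ⟨⟨ε, hε, h⟩, ⟨δ, hδ, h'⟩⟩
    refine ⟨min ε δ, lt_min hε hδ, ?_⟩
    rintro l (hl | hl) hs
    · exact h l hl (Sm_mono (min_le_left _ _) hs)
    · exact h' l hl (Sm_mono (min_le_right _ _) hs)

lemma cob_N {X : Fam M} {f : List M → R} (hf : f ∈ N R X) : cob f ∈ N R X := by
  obtain ⟨ε, hε, h⟩ := hf
  exact ⟨ε, hε, fun l hl hs => cob_zero_of f l fun l' hl' => h l' (X.sub hl hl') (Sm_sub hs hl')⟩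

lemma N_of_zero {X : Fam M} {f : List M → R} (h : ∀ l ∈ X, f l = 0) : f ∈ N R X :=
  ⟨1, one_pos, fun l hl _ => h l hl⟩

end Small

/-! ### Group actions -/
section Action
variable {M R G : Type} [CommRing R] [AddCommGroup G] [AddAction G M]

/-- translate a list -/
def tr (g : G) (l : List M) : List M := l.map (g +ᵥ ·)

@[simp] lemma mem_tr {g : G} {l : List M} {x : M} : x ∈ tr g l ↔ ∃ y ∈ l, g +ᵥ y = x := by
  simp [tr]
@[simp] lemma tr_zero (l : List M) : tr (0 : G) l = l := by simp [tr]
lemma tr_tr (g h : G) (l : List M) : tr g (tr h l) = tr (g + h) l := by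
  simp [tr, comp_def, add_vadd]
@[simp] lemma length_tr (g : G) (l : List M) : (tr g l).length = l.length := by simp [tr]
@[simp] lemma tr_nil (g : G) : tr g ([] : List M) = [] := rfl

/-- translation on cochains -/
def trL (R : Type) [CommRing R] (g : G) : (List M → R) →ₗ[R] (List M → R) where
  toFun f := fun l => f (tr g l)
  map_add' _ _ := rfl
  map_smul' _ _ := rfl
@[simp] lemma trL_apply (g : G) (f : List M → R) (l : List M) : trL R g f l = f (tr g l) := rfl

lemma cob_trL (g : G) (f : List M → R) : cob (trL R g f) = trL R g (cob f) :=
  funext fun l => cob_map_apply (g +ᵥ ·) f l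

/-- invariant functions -/
def Inv (R : Type) [CommRing R] (M : Type) [AddAction G M] (K : AddSubgroup G) :
  Submodule R (List M → R) where
  carrier := {f | ∀ g ∈ K, ∀ l, f (tr g l) = f l}
  add_mem' hf hg g hk l := by simp [hf g hk, hg g hk]
  zero_mem' _ _ _ := rfl
  smul_mem' c f hf g hk l := by simp [hf g hk]

variable {K : AddSubgroup G}
lemma Inv_bot (f : List M → R) : f ∈ Inv R M (⊥ : AddSubgroup G) := by
  intro g hg l; obtain rfl : g = 0 := hg; simp
lemma Inv_anti {K K' : AddSubgroup G} (h : K ≤ K') : Inv R M K' ≤ Inv R M K :=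
  fun _ hf g hg => hf g (h hg)

lemma cob_Inv {f : List M → R} (hf : f ∈ Inv R M K) : cob f ∈ Inv R M K := by
  intro g hg l
  have := congrFun (cob_trL g f) l
  rw [trL_apply] at this
  rw [← this]; congr 1; funext l; exact hf g hg l

lemma indicator_Inv {S : Set (List M)} (hS : ∀ g ∈ K, ∀ l, tr g l ∈ S ↔ l ∈ S)
  {f : List M → R} (hf : f ∈ Inv R M K) : S.indicator f ∈ Inv R M K := by
  intro g hg l
  by_cases h : l ∈ S
  · rw [indicator_of_mem h, indicator_of_mem ((hS g hg l).2 h), hf g hg]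
  · rw [indicator_of_notMem h, indicator_of_notMem (mt (hS g hg l).1 h)]

/-- invariant family -/
def Fam.IsInv (X : Fam M) (K : AddSubgroup G) : Prop := ∀ g ∈ K, ∀ l, l ∈ X → tr g l ∈ X

lemma Fam.IsInv.iff {X : Fam M} (h : X.IsInv K) {g : G} (hg : g ∈ K) (l : List M) :
  tr g l ∈ X ↔ l ∈ X := by
  refine ⟨fun hl => ?_, h g hg l⟩
  have := h (-g) (neg_mem hg) _ hl
  rwa [tr_tr, neg_add_cancel, tr_zero] at this

lemma Fam.IsInv.max {X Y : Fam M} (h : X.IsInv K) (h' : Y.IsInv K) : (X ⊔ Y).IsInv K :=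
  fun g hg l hl => hl.imp (h g hg l) (h' g hg l)

/-- invariant set -/
def SInv (A : Set M) (K : AddSubgroup G) : Prop := ∀ g ∈ K, ∀ x ∈ A, g +ᵥ x ∈ A
lemma SInv.pow {A : Set M} (h : SInv A K) : (Fam.pow A).IsInv K := by
  intro g hg l hl x hx
  obtain ⟨y, hy, rfl⟩ := mem_tr.1 hx
  exact h g hg y (hl y hy)
lemma SInv.iff {A : Set M} (h : SInv A K) {g : G} (hg : g ∈ K) {x : M} : g +ᵥ x ∈ A ↔ x ∈ A := by
  refine ⟨fun hx => ?_, h g hg x⟩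
  have := h (-g) (neg_mem hg) _ hx
  rwa [neg_vadd_vadd] at this
lemma SInv.union {A B : Set M} (h : SInv A K) (h' : SInv B K) : SInv (A ∪ B) K :=
  fun g hg x hx => hx.imp (h g hg x) (h' g hg x)
lemma SInv.inter {A B : Set M} (h : SInv A K) (h' : SInv B K) : SInv (A ∩ B) K :=
  fun g hg x hx => ⟨h g hg x hx.1, h' g hg x hx.2⟩
lemma SInv.anti {A : Set M} {K K' : AddSubgroup G} (h : SInv A K') (hk : K ≤ K') : SInv A K :=
  fun g hg => h g (hk hg)
lemma SInv_bot (A : Set M) : SInv A (⊥ : AddSubgroup G) := by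
  intro g hg x hx; obtain rfl : g = 0 := hg; simpa

lemma prism_Inv {α β : M → M} (hα : ∀ g ∈ K, ∀ x, α (g +ᵥ x) = g +ᵥ α x)
  (hβ : ∀ g ∈ K, ∀ x, β (g +ᵥ x) = g +ᵥ β x) {f : List M → R} (hf : f ∈ Inv R M K) :
  prism α β f ∈ Inv R M K := by
  intro g hg l
  rw [tr, prism_map α β (g +ᵥ ·) (g +ᵥ ·) (hα g hg) (hβ g hg)]
  congr 1; funext m; exact hf g hg m

end Action

section Acyc
variable {M R G : Type} [MetricSpace M] [CommRing R] [AddCommGroup G] [AddAction G M]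

lemma tr_Sm [IsIsometricVAdd G M] (g : G) (ε : ℝ) (l : List M) : tr g l ∈ Sm ε ↔ l ∈ Sm ε := by
  constructor
  · intro h x hx y hy
    have := h (g +ᵥ x) (by simp [hx]) (g +ᵥ y) (by simp [hy])
    rwa [dist_vadd] at this
  · intro h x hx y hy
    obtain ⟨x, hx', rfl⟩ := mem_tr.1 hx
    obtain ⟨y, hy', rfl⟩ := mem_tr.1 hy
    rw [dist_vadd]; exact h x hx' y hy'

def P (R : Type) [CommRing R] (K : AddSubgroup G) (n : ℕ) (T : Fam M) :
  Submodule R (List M → R) := Len M R n ⊓ Inv R M K ⊓ N R T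

variable {K : AddSubgroup G}
lemma cob_P {n : ℕ} {T : Fam M} {f : List M → R} (hf : f ∈ P R K n T) : cob f ∈ P R K (n + 1) T :=
  ⟨⟨cob_len hf.1.1, cob_Inv hf.1.2⟩, cob_N hf.2⟩
lemma P_anti {n : ℕ} {S T : Fam M} (h : S ≤ T) : P R K n T ≤ P R K n S :=
  fun _ hf => ⟨hf.1, N_anti h hf.2⟩

/-- relative acyclicity in degree `n`. -/
def Acyc (R : Type) [CommRing R] (K : AddSubgroup G) (n : ℕ) (X T : Fam M) : Prop :=
  ∀ f ∈ P R K (n + 1) T, cob f ∈ N R X → ∃ g ∈ P R K n T, f - cob g ∈ N R X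

/-- `f` is exact on `X` relative to `T`. -/
def Ex (K : AddSubgroup G) (n : ℕ) (X T : Fam M) (f : List M → R) : Prop :=
  ∃ g ∈ P R K n T, f - cob g ∈ N R X

lemma Acyc_trans {n : ℕ} {X S T : Fam M} (hTS : T ≤ S) (hSX : S ≤ X)
  (h1 : Acyc R K n X S) (h2 : Acyc R K n S T) : Acyc R K n X T := by
  intro f hf hd
  obtain ⟨g, hg, hfg⟩ := h2 f hf (N_anti hSX hd)
  obtain ⟨u, hu, hfu⟩ := h1 (f - cob g)
    ⟨⟨sub_mem hf.1.1 (cob_len hg.1.1), sub_mem hf.1.2 (cob_Inv hg.1.2)⟩, hfg⟩ (by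
      rw [cob_sub, cob_cob, sub_zero]; exact hd)
  refine ⟨g + u, add_mem hg (P_anti hTS hu), ?_⟩
  rw [cob_add, ← sub_sub]; exact hfu

variable [IsIsometricVAdd G M]

/-- exact-vanishing representative -/
lemma P_exact_rep {n : ℕ} {T : Fam M} {f : List M → R} (hf : f ∈ P R K n T) :
  ∃ f' ∈ P R K n T, (∀ l ∈ T, f' l = 0) ∧ ∃ ε > 0, ∀ l ∈ Sm ε, f' l = f l := by
  obtain ⟨ε, hε, h⟩ := hf.2
  have h0 : ∀ l ∈ T, (Sm ε).indicator f l = 0 := by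
    intro l hl
    by_cases hs : l ∈ Sm ε
    · rw [indicator_of_mem hs, h l hl hs]
    · rw [indicator_of_notMem hs]
  exact ⟨(Sm ε).indicator f, ⟨⟨indicator_len _ hf.1.1,
    indicator_Inv (fun g _ l => tr_Sm g ε l) hf.1.2⟩, N_of_zero h0⟩, h0, ε, hε,
    fun l hl => indicator_of_mem hl f⟩

lemma N_of_eq_small {X : Fam M} {f f' : List M → R} (h : ∃ ε > 0, ∀ l ∈ Sm ε, f' l = f l) :
  f' - f ∈ N R X := by
  obtain ⟨ε, hε, h⟩ := h
  exact ⟨ε, hε, fun l _ hl => by simp [h l hl]⟩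

/-- It suffices to treat cochains vanishing exactly on `T` (one cochain version). -/
lemma Ex_of_rep {n : ℕ} {X T : Fam M} {f : List M → R} (hf : f ∈ P R K (n + 1) T)
  (h : ∀ f' ∈ P R K (n + 1) T, (∀ l ∈ T, f' l = 0) → (∀ Y : Fam M, f' - f ∈ N R Y) →
  Ex K n X T f') : Ex K n X T f := by
  obtain ⟨f', hf', h0, he⟩ := P_exact_rep hf
  obtain ⟨g, hg, hfg⟩ := h f' hf' h0 (fun Y => N_of_eq_small he)
  refine ⟨g, hg, ?_⟩
  have := sub_mem hfg (N_of_eq_small (X := X) he)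
  convert this using 1; abel

/-- The ρ-lemma. -/
lemma rho {n : ℕ} {X T : Fam M} {α β : M → M} (hα : ∀ g ∈ K, ∀ x, α (g +ᵥ x) = g +ᵥ α x)
  (hβ : ∀ g ∈ K, ∀ x, β (g +ᵥ x) = g +ᵥ β x) {f : List M → R} (hf : f ∈ P R K (n + 1) T)
  (h0 : ∀ l ∈ T, f l = 0) {ε : ℝ} (hd : ∀ l ∈ X, l ∈ Sm ε → cob f l = 0) {X' T' : Fam M}
  (hT : ∀ l ∈ T', l.map α ++ l.map β ∈ T) {δ : ℝ} (hδ : 0 < δ)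
  (hX : ∀ l ∈ X', l ∈ Sm δ → l ∉ T' → l.map α ++ l.map β ∈ X ∧ l.map α ++ l.map β ∈ Sm ε) :
  Ex K n X' T' ((fun l => f (l.map β)) - fun l => f (l.map α)) := by
  refine ⟨prism α β f, ⟨⟨prism_len _ _ hf.1.1, prism_Inv hα hβ hf.1.2⟩, ?_⟩, δ, hδ, ?_⟩
  · apply N_of_zero
    intro l hl
    exact prism_zero_of _ _ _ _ fun l' hl' => h0 _ (T.sub (hT l hl) hl')
  · intro l hl hs
    have := prism_spec α β f l
    simp only [Pi.sub_apply]
    rw [← this, add_sub_cancel_left]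
    by_cases hlT : l ∈ T'
    · exact prism_zero_of _ _ _ _ fun l' hl' => cob_zero_of _ _ fun l'' h'' =>
        h0 _ (T.sub (hT l hlT) (fun _ h => hl' (h'' h)))
    · obtain ⟨h1, h2⟩ := hX l hl hs hlT
      exact prism_zero_of _ _ _ _ fun l' hl' => hd _ (X.sub h1 hl') (Sm_sub h2 hl')

lemma rho_id {n : ℕ} {X X' T : Fam M} {ρ : M → M}
  (hρ : ∀ g ∈ K, ∀ x, ρ (g +ᵥ x) = g +ᵥ ρ x) {f : List M → R} (hf : f ∈ P R K (n + 1) T)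
  (h0 : ∀ l ∈ T, f l = 0) {ε : ℝ} (hd : ∀ l ∈ X, l ∈ Sm ε → cob f l = 0)
  (hT : ∀ l ∈ T, l ++ l.map ρ ∈ T) {δ : ℝ} (hδ : 0 < δ)
  (hX : ∀ l ∈ X', l ∈ Sm δ → l ∉ T → l ++ l.map ρ ∈ X ∧ l ++ l.map ρ ∈ Sm ε)
  (hXT : ∀ l ∈ X', l ∈ Sm δ → l.map ρ ∈ T) :
  Ex K n X' T f := by
  obtain ⟨g, hg, hfg⟩ := rho (α := id) (β := ρ) (X := X) (X' := X') (T' := T)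
    (fun _ _ _ => rfl) hρ hf h0 hd
    (by simpa using hT) hδ (by simpa using hX)
  refine ⟨-g, neg_mem hg, ?_⟩
  have h1 : (fun l => f (l.map ρ)) ∈ N R X' := ⟨δ, hδ, fun l hl hs => h0 _ (hXT l hl hs)⟩
  have := sub_mem h1 hfg
  convert this using 1
  rw [cob_neg]
  simp only [map_id]
  abel_nf

end Acyc

end PG
open PG.Fam

namespace PG

section Sel
variable {M G : Type} [AddCommGroup G] [AddAction G M]

/-- `K` acts freely on `D`. -/
def Free (K : AddSubgroup G) (D : Set M) : Prop := ∀ x ∈ D, ∀ g ∈ K, g +ᵥ x = x → g = 0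

lemma Free_bot (D : Set M) : Free (⊥ : AddSubgroup G) D := fun _ _ _ hg _ => hg
lemma Free.mono {K : AddSubgroup G} {D D' : Set M} (h : Free K D) (hD : D' ⊆ D) : Free K D' :=
  fun x hx => h x (hD hx)
lemma Free.anti {K K' : AddSubgroup G} {D : Set M} (h : Free K D) (hK : K' ≤ K) : Free K' D :=
  fun x hx g hg => h x hx g (hK hg)

lemma exists_sel {K : AddSubgroup G} {D : Set M} (hD : SInv D K) (hfree : Free K D)
  (S : M → M → Prop) (hS : ∀ g ∈ K, ∀ x y, S x y → S (g +ᵥ x) (g +ᵥ y))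
  (hex : ∀ x ∈ D, ∃ y, S x y) :
  ∃ ρ : M → M, (∀ g ∈ K, ∀ x, ρ (g +ᵥ x) = g +ᵥ ρ x) ∧ (∀ x ∈ D, S x (ρ x)) ∧
  ∀ x ∉ D, ρ x = x := by
  classical
  obtain ⟨r, hr1, hr2⟩ : ∃ r : M → M, (∀ x, ∃ k ∈ K, k +ᵥ r x = x) ∧
      ∀ g ∈ K, ∀ x, r (g +ᵥ x) = r x := by
    let s := AddAction.orbitRel K M
    refine ⟨fun x => (Quotient.mk s x).out, fun x => ?_, fun g hg x => ?_⟩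
    · have : s (Quotient.mk s x).out x := Quotient.exact (Quotient.out_eq _)
      obtain ⟨k, hk⟩ := s.symm this
      exact ⟨k, k.2, hk⟩
    · have : Quotient.mk s (g +ᵥ x) = Quotient.mk s x := Quotient.sound ⟨⟨g, hg⟩, rfl⟩
      simp only [this]
  choose κ hκ1 hκ2 using hr1
  have hrD : ∀ x ∈ D, r x ∈ D := fun x hx => by
    rw [← hκ2 x] at hx; exact (hD.iff (hκ1 x)).1 hx
  have hch : ∀ x, ∃ y, x ∈ D → S x y := fun x => by
    by_cases hx : x ∈ D
    · exact (hex x hx).imp fun y hy _ => hy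
    · exact ⟨x, fun h => (hx h).elim⟩
  choose c hc using hch
  refine ⟨fun x => if x ∈ D then κ x +ᵥ c (r x) else x, ?_, ?_, ?_⟩
  · intro g hg x
    by_cases hx : x ∈ D
    · have hgx := hD g hg x hx
      simp only [hx, hgx, if_true, hr2 g hg x]
      have h1 : (- (g + κ x) + κ (g +ᵥ x)) +ᵥ r x = r x := by
        rw [add_vadd]
        have := hκ2 (g +ᵥ x)
        rw [hr2 g hg x] at this
        rw [this, neg_vadd_eq_iff, add_vadd, hκ2 x]
      have h2 := hfree _ (hrD x hx) _
        (add_mem (neg_mem (add_mem hg (hκ1 x))) (hκ1 (g +ᵥ x))) h1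
      have h3 : κ (g +ᵥ x) = g + κ x := by rwa [neg_add_eq_zero, eq_comm] at h2
      rw [h3, add_vadd]
    · have hgx : g +ᵥ x ∉ D := mt (hD.iff hg).1 hx
      simp only [hx, hgx, if_false]
  · intro x hx
    simp only [hx, if_true]
    have := hS _ (hκ1 x) _ _ (hc (r x) (hrD x hx))
    rwa [hκ2 x] at this
  · intro x hx; simp [hx]
end Sel

section Top
variable {M : Type} [MetricSpace M]

/-- closed `η`-neighbourhood -/
def Nb (η : ℝ) (Y : Set M) : Set M := {x | ∃ y ∈ Y, dist x y ≤ η}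

lemma near_Sm {l : List M} {δ η : ℝ} (hη : 0 ≤ η) (hl : l ∈ Sm δ) {ρ : M → M}
  (h : ∀ x ∈ l, dist x (ρ x) ≤ η) : l ++ l.map ρ ∈ Sm (δ + 2 * η) := by
  have key : ∀ z ∈ l ++ l.map ρ, ∃ x ∈ l, dist x z ≤ η := by
    intro z hz
    rcases mem_append.1 hz with hz | hz
    · exact ⟨z, hz, by simpa⟩
    · obtain ⟨x, hx, rfl⟩ := mem_map.1 hz
      exact ⟨x, hx, h x hx⟩
  intro z hz w hw
  obtain ⟨x, hx, hxz⟩ := key z hz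
  obtain ⟨y, hy, hyw⟩ := key w hw
  have := hl x hx y hy
  have h1 := dist_triangle4 z x y w
  rw [dist_comm z x] at h1
  linarith

lemma Nb_closed [CompactSpace M] {Y : Set M} (hY : IsClosed Y) (η : ℝ) : IsClosed (Nb η Y) := by
  have : Nb η Y = Prod.fst '' ({q : M × M | dist q.1 q.2 ≤ η} ∩ (Prod.snd ⁻¹' Y)) := by
    ext x; constructor
    · rintro ⟨y, hy, h⟩; exact ⟨(x, y), ⟨h, hy⟩, rfl⟩
    · rintro ⟨⟨x, y⟩, ⟨h, hy⟩, rfl⟩; exact ⟨y, hy, h⟩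
  rw [this]
  have : IsClosed ({q : M × M | dist q.1 q.2 ≤ η} ∩ (Prod.snd ⁻¹' Y)) :=
    (isClosed_le continuous_dist continuous_const).inter (hY.preimage continuous_snd)
  exact (this.isCompact.image continuous_fst).isClosed

lemma exists_sep [CompactSpace M] {A B : Set M} (hA : IsClosed A) (hB : IsClosed B)
  (h : Disjoint A B) : ∃ δ > 0, ∀ a ∈ A, ∀ b ∈ B, δ ≤ dist a b := by
  obtain ⟨r, hr, h⟩ := Metric.exists_pos_forall_lt_edist hA.isCompact hB h
  refine ⟨r, by exact_mod_cast hr, fun a ha b hb => ?_⟩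
  have := h a ha b hb
  rw [edist_nndist] at this
  have h2 : r < nndist a b := by exact_mod_cast this
  rw [dist_nndist]; exact_mod_cast h2.le

lemma exists_near_inter [CompactSpace M] {A B : Set M} (hA : IsClosed A) (hB : IsClosed B)
  {η : ℝ} (hη : 0 < η) :
  ∃ δ > 0, ∀ a ∈ A, ∀ b ∈ B, dist a b < δ → ∃ z ∈ A ∩ B, dist a z < η := by
  have hC : IsClosed (A ∩ {x | ∀ z ∈ A ∩ B, η ≤ dist x z}) := by
    apply hA.inter
    have : {x | ∀ z ∈ A ∩ B, η ≤ dist x z} = ⋂ z ∈ A ∩ B, {x | η ≤ dist x z} := by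
      ext x; simp
    rw [this]
    exact isClosed_biInter fun z _ =>
      isClosed_le continuous_const (continuous_id.dist continuous_const)
  have hd : Disjoint (A ∩ {x | ∀ z ∈ A ∩ B, η ≤ dist x z}) B := by
    rw [Set.disjoint_left]
    rintro x ⟨hx, hx'⟩ hxB
    have := hx' x ⟨hx, hxB⟩
    simp at this; linarith
  obtain ⟨δ, hδ, h⟩ := exists_sep hC hB hd
  refine ⟨δ, hδ, fun a ha b hb hab => ?_⟩
  by_contra hcon
  push Not at hcon
  have := h a ⟨ha, hcon⟩ b hb
  linarith

end Top

section Lemmas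
variable {M R G : Type} [MetricSpace M] [CompactSpace M] [CommRing R] [AddCommGroup G]
  [AddAction G M] [IsIsometricVAdd G M] {K : AddSubgroup G}

lemma SInv.diff {A B : Set M} (h : SInv A K) (h' : SInv B K) : SInv (A \ B) K :=
  fun g hg x hx => ⟨h g hg x hx.1, fun hb => hx.2 ((h'.iff hg).1 hb)⟩

lemma Nb_SInv {Y : Set M} (h : SInv Y K) (η : ℝ) : SInv (Nb η Y) K := by
  rintro g hg x ⟨y, hy, hxy⟩
  exact ⟨g +ᵥ y, h g hg y hy, by rwa [dist_vadd]⟩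

lemma collar {n : ℕ} {X Y : Set M} (hYX : Y ⊆ X) (hXi : SInv X K) (hYi : SInv Y K)
  (hfree : Free K (X \ Y)) {f : List M → R} (hf : f ∈ P R K (n + 1) (pow Y))
  (hd : cob f ∈ N R (pow X)) : ∃ η > 0, Ex K n (pow (X ∩ Nb η Y)) (pow Y) f := by
  obtain ⟨ε₀, hε₀, hd₀⟩ := hd
  obtain ⟨f', hf', h0, ε₁, hε₁, he⟩ := P_exact_rep hf
  set ε := min ε₀ ε₁ with hεdef
  have hε : 0 < ε := lt_min hε₀ hε₁
  have hd' : ∀ l ∈ pow X, l ∈ Sm ε → cob f' l = 0 := by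
    intro l hl hs
    rw [cob_congr_of f' f l fun l' hl' => he l' (Sm_mono (min_le_right _ _) (Sm_sub hs hl'))]
    exact hd₀ l hl (Sm_mono (min_le_left _ _) hs)
  refine ⟨ε / 4, by positivity, ?_⟩
  obtain ⟨ρ, hρ1, hρ2, hρ3⟩ := exists_sel (K := K) (D := (X ∩ Nb (ε / 4) Y) \ Y)
    ((hXi.inter (Nb_SInv hYi _)).diff hYi) (hfree.mono fun x hx => ⟨hx.1.1, hx.2⟩)
    (fun x y => y ∈ Y ∧ dist x y ≤ ε / 4)
    (fun g hg x y h => ⟨hYi g hg y h.1, by rw [dist_vadd]; exact h.2⟩)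
    (fun x hx => hx.1.2)
  have hρY : ∀ x ∈ X ∩ Nb (ε / 4) Y, ρ x ∈ Y ∧ dist x (ρ x) ≤ ε / 4 := by
    intro x hx
    by_cases hxY : x ∈ Y
    · rw [hρ3 x (fun h => h.2 hxY)]
      exact ⟨hxY, by simp; positivity⟩
    · exact hρ2 x ⟨hx, hxY⟩
  have hρid : ∀ x ∈ Y, ρ x = x := fun x hx => hρ3 x fun h => h.2 hx
  obtain ⟨g, hg, hfg⟩ := rho_id (X := pow X) (X' := pow (X ∩ Nb (ε / 4) Y)) (T := pow Y)
    (ρ := ρ) hρ1 hf' h0 hd' (by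
      intro l hl x hx
      rcases mem_append.1 hx with hx | hx
      · exact hl x hx
      · obtain ⟨y, hy, rfl⟩ := mem_map.1 hx
        rw [hρid y (hl y hy)]; exact hl y hy) (δ := ε / 4) (by positivity) (by
      intro l hl hs _
      refine ⟨?_, Sm_mono (by linarith) (near_Sm (by positivity) hs fun x hx => (hρY x (hl x hx)).2)⟩
      intro x hx
      rcases mem_append.1 hx with hx | hx
      · exact (hl x hx).1
      · obtain ⟨y, hy, rfl⟩ := mem_map.1 hx
        exact hYX (hρY y (hl y hy)).1) (by
      intro l hl hs x hx
      obtain ⟨y, hy, rfl⟩ := mem_map.1 hx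
      exact (hρY y (hl y hy)).1)
  refine ⟨g, hg, ?_⟩
  have := sub_mem hfg (N_of_eq_small (X := pow (X ∩ Nb (ε / 4) Y)) ⟨ε₁, hε₁, he⟩)
  convert this using 1; abel

lemma excision (n : ℕ) {A B : Set M} (hA : IsClosed A) (hB : IsClosed B) (hAi : SInv A K)
  (hBi : SInv B K) (hfree : Free K (A \ B)) :
  Acyc R K n (pow (A ∪ B)) (pow A ⊔ pow B) := by
  intro f hf hd
  apply Ex_of_rep hf
  intro f' hf' h0 hff
  have hd' : cob f' ∈ N R (pow (A ∪ B)) := by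
    have := add_mem (cob_N (hff (pow (A ∪ B)))) hd
    rwa [cob_sub, sub_add_cancel] at this
  obtain ⟨ε, hε, hd⟩ := hd'
  by_cases hne : (A ∩ B).Nonempty
  · obtain ⟨ρ, hρ1, hρ2, hρ3⟩ := exists_sel (K := K) (D := A \ B) (hAi.diff hBi) hfree
      (fun x y => y ∈ A ∩ B ∧ ∀ z ∈ A ∩ B, dist x y ≤ dist x z)
      (fun g hg x y h => ⟨(hAi.inter hBi) g hg y h.1, fun z hz => by
        have := h.2 (-g +ᵥ z) ((hAi.inter hBi) (-g) (neg_mem hg) z hz)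
        rw [dist_vadd]
        rwa [← dist_vadd g x (-g +ᵥ z), vadd_neg_vadd] at this⟩)
      (fun x hx => by
        obtain ⟨y, hy, hmin⟩ := (hA.inter hB).isCompact.exists_isMinOn hne
          (f := fun y => dist x y) (by fun_prop)
        exact ⟨y, hy, fun z hz => hmin hz⟩)
    have hρB : ∀ x ∈ A ∪ B, ρ x ∈ B := by
      intro x hx
      by_cases hxB : x ∈ B
      · rw [hρ3 x fun h => h.2 hxB]; exact hxB
      · exact (hρ2 x ⟨hx.resolve_right hxB, hxB⟩).1.2
    have hρA : ∀ x ∈ A, ρ x ∈ A := by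
      intro x hx
      by_cases hxB : x ∈ B
      · rw [hρ3 x fun h => h.2 hxB]; exact hx
      · exact (hρ2 x ⟨hx, hxB⟩).1.1
    obtain ⟨δ₀, hδ₀, hδ⟩ := exists_near_inter hA hB (η := ε / 4) (by positivity)
    refine rho_id (X := pow (A ∪ B)) (ρ := ρ) hρ1 hf' h0 hd ?_ (δ := min δ₀ (ε / 4))
      (by positivity) ?_ ?_
    · rintro l (hl | hl)
      · left; intro x hx
        rcases mem_append.1 hx with hx | hx
        · exact hl x hx
        · obtain ⟨y, hy, rfl⟩ := mem_map.1 hx; exact hρA y (hl y hy)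
      · right; intro x hx
        rcases mem_append.1 hx with hx | hx
        · exact hl x hx
        · obtain ⟨y, hy, rfl⟩ := mem_map.1 hx; exact hρB y (Or.inr (hl y hy))
    · intro l hl hs hlT
      have hb : ∃ b ∈ l, b ∈ B := by
        by_contra hcon
        push Not at hcon
        exact hlT (Or.inl fun x hx => (hl x hx).resolve_right (hcon x hx))
      obtain ⟨b, hbl, hb⟩ := hb
      have hmove : ∀ x ∈ l, dist x (ρ x) ≤ ε / 4 := by
        intro x hx
        by_cases hxB : x ∈ B
        · rw [hρ3 x fun h => h.2 hxB]; simp; positivity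
        · have hxA := (hl x hx).resolve_right hxB
          obtain ⟨z, hz, hxz⟩ := hδ x hxA b hb ((hs x hx b hbl).trans_le (min_le_left _ _))
          exact ((hρ2 x ⟨hxA, hxB⟩).2 z hz).trans hxz.le
      refine ⟨?_, Sm_mono ?_ (near_Sm (by positivity) hs hmove)⟩
      · intro x hx
        rcases mem_append.1 hx with hx | hx
        · exact hl x hx
        · obtain ⟨y, hy, rfl⟩ := mem_map.1 hx
          exact Or.inr (hρB y (hl y hy))
      · have := min_le_right δ₀ (ε / 4); linarith
    · intro l hl hs
      right; intro x hx
      obtain ⟨y, hy, rfl⟩ := mem_map.1 hx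
      exact hρB y (hl y hy)
  · obtain ⟨δ, hδ, hsep⟩ := exists_sep hA hB
      (Set.disjoint_iff_inter_eq_empty.2 (Set.not_nonempty_iff_eq_empty.1 hne))
    refine ⟨0, zero_mem _, δ, hδ, fun l hl hs => ?_⟩
    rw [cob_zero, sub_zero]
    apply h0
    by_contra hcon
    rw [mem_max, not_or, mem_pow, mem_pow] at hcon
    push Not at hcon
    obtain ⟨⟨x, hx, hxA⟩, ⟨y, hy, hyB⟩⟩ := hcon
    have := hsep y ((hl y hy).resolve_right hyB) x ((hl x hx).resolve_left hxA)
    have := hs y hy x hx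
    linarith

lemma homotopy (n : ℕ) {Z S : Set M} (hZ : IsClosed Z) (hSZ : S ⊆ Z) {D : ℝ → M → M}
  (hD : ContinuousOn (fun q : ℝ × M => D q.1 q.2) (Icc 0 1 ×ˢ Z))
  (hDZ : ∀ t ∈ Icc (0:ℝ) 1, ∀ x ∈ Z, D t x ∈ Z)
  (hDS : ∀ t ∈ Icc (0:ℝ) 1, ∀ x ∈ S, D t x ∈ S)
  (h0 : ∀ x ∈ Z, D 0 x = x) (h1 : ∀ x ∈ Z, D 1 x ∈ S) :
  Acyc R (⊥ : AddSubgroup G) n (pow Z) (pow S) := by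
  intro f hf hd
  apply Ex_of_rep hf
  intro f' hf' hf0 hff
  have hd' : cob f' ∈ N R (pow Z) := by
    have := add_mem (cob_N (hff (pow Z))) hd
    rwa [cob_sub, sub_add_cancel] at this
  obtain ⟨ε, hε, hd⟩ := hd'
  have huc := (isCompact_Icc.prod hZ.isCompact).uniformContinuousOn_of_continuous hD
  rw [Metric.uniformContinuousOn_iff] at huc
  obtain ⟨δ, hδ, huc⟩ := huc ε hε
  obtain ⟨m, hm⟩ := exists_nat_one_div_lt hδ
  have hT : ∀ i : ℕ, i ≤ m + 1 → ((i : ℝ) / (m + 1)) ∈ Icc (0:ℝ) 1 := by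
    intro i hi
    refine ⟨by positivity, ?_⟩
    rw [div_le_one (by positivity)]; exact_mod_cast hi
  have key : ∀ i : ℕ, i ≤ m + 1 → Ex (⊥ : AddSubgroup G) n (pow Z) (pow S)
      (f' - fun l => f' (l.map (D ((i : ℝ) / (m + 1))))) := by
    intro i
    induction i with
    | zero =>
      intro _
      refine ⟨0, zero_mem _, ?_⟩
      rw [cob_zero, sub_zero]
      apply N_of_zero
      intro l hl
      have : l.map (D (((0 : ℕ) : ℝ) / (m + 1))) = l := by
        simp only [Nat.cast_zero, zero_div]
        conv_rhs => rw [← map_id l]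
        exact List.map_congr_left fun x hx => h0 x (hl x hx)
      rw [Pi.sub_apply, this, sub_self]
    | succ i ih =>
      intro hi
      obtain ⟨g, hg, hfg⟩ := ih (by omega)
      have ha := hT i (by omega)
      have hb := hT (i + 1) hi
      have hab : dist ((i : ℝ) / (m + 1)) (((i + 1 : ℕ) : ℝ) / (m + 1)) < δ := by
        rw [Real.dist_eq, ← sub_div]; push_cast
        rw [show ((i : ℝ) - (i + 1)) = -1 by ring, abs_div, abs_neg, abs_one,
          abs_of_pos (by positivity : (0:ℝ) < m + 1)]
        exact hm
      obtain ⟨g', hg', hfg'⟩ := rho (K := (⊥ : AddSubgroup G)) (X := pow Z) (X' := pow Z)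
        (T := pow S) (T' := pow S) (α := D ((i : ℝ) / (m + 1)))
        (β := D (((i + 1 : ℕ) : ℝ) / (m + 1)))
        (by intro g hg x; obtain rfl : g = 0 := hg; simp)
        (by intro g hg x; obtain rfl : g = 0 := hg; simp) hf' hf0 hd (by
          intro l hl x hx
          rcases mem_append.1 hx with hx | hx <;> obtain ⟨y, hy, rfl⟩ := mem_map.1 hx
          · exact hDS _ ha y (hl y hy)
          · exact hDS _ hb y (hl y hy)) hδ (by
          intro l hl hs _
          constructor
          · intro x hx
            rcases mem_append.1 hx with hx | hx <;> obtain ⟨y, hy, rfl⟩ := mem_map.1 hx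
            · exact hDZ _ ha y (hl y hy)
            · exact hDZ _ hb y (hl y hy)
          · have gen : ∀ s ∈ Icc (0:ℝ) 1, ∀ t ∈ Icc (0:ℝ) 1, dist s t < δ →
                ∀ x ∈ l, ∀ y ∈ l, dist (D s x) (D t y) < ε := fun s hs' t ht hst x hx y hy =>
              huc (s, x) ⟨hs', hl x hx⟩ (t, y) ⟨ht, hl y hy⟩ (by
                rw [Prod.dist_eq]; exact max_lt hst (hs x hx y hy))
            intro x hx y hy
            rcases mem_append.1 hx with hx | hx <;>
              obtain ⟨x, hx', rfl⟩ := mem_map.1 hx <;>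
              rcases mem_append.1 hy with hy | hy <;>
              obtain ⟨y, hy', rfl⟩ := mem_map.1 hy
            · exact gen _ ha _ ha (by simpa) x hx' y hy'
            · exact gen _ ha _ hb hab x hx' y hy'
            · exact gen _ hb _ ha (by rwa [dist_comm]) x hx' y hy'
            · exact gen _ hb _ hb (by simpa) x hx' y hy')
      refine ⟨g - g', sub_mem hg hg', ?_⟩
      have := sub_mem hfg hfg'
      rw [cob_sub]
      convert this using 1
      abel
  obtain ⟨g, hg, hfg⟩ := key (m + 1) le_rfl
  refine ⟨g, hg, ?_⟩
  have : (fun l => f' (l.map (D (((m + 1 : ℕ) : ℝ) / (m + 1))))) ∈ N R (pow Z) := by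
    apply N_of_zero
    intro l hl
    apply hf0
    intro x hx
    obtain ⟨y, hy, rfl⟩ := mem_map.1 hx
    have h11 : (((m + 1 : ℕ) : ℝ) / (m + 1)) = 1 := by
      push_cast; exact div_self (by positivity)
    rw [h11]; exact h1 y (hl y hy)
  have := add_mem hfg this
  convert this using 1
  abel

/-- splitting -/
lemma N_split {X Y : Fam M} {f : List M → R} (hf : f ∈ N R (X ⊓ Y)) :
  ((X : Set (List M))ᶜ).indicator f ∈ N R X ∧
  f - ((X : Set (List M))ᶜ).indicator f ∈ N R Y := by
  constructor
  · apply N_of_zero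
    intro l hl
    exact indicator_of_notMem (by simpa using hl) _
  · obtain ⟨ε, hε, h⟩ := hf
    refine ⟨ε, hε, fun l hl hs => ?_⟩
    by_cases hX : l ∈ X
    · rw [Pi.sub_apply, indicator_of_notMem (by simpa using hX), sub_zero]
      exact h l ⟨hX, hl⟩ hs
    · rw [Pi.sub_apply, indicator_of_mem (by simpa using hX), sub_self]

lemma gluing {n : ℕ} {A B S : Set M} (hA : IsClosed A) (hB : IsClosed B) (hSA : S ⊆ A)
  (hSB : S ⊆ B) (hac : Acyc R (⊥ : AddSubgroup G) n (pow (A ∩ B)) (pow S))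
  {f : List M → R} (hf : f ∈ P R (⊥ : AddSubgroup G) (n + 2) (pow S))
  (hd : cob f ∈ N R (pow (A ∪ B)))
  (hfA : Ex (⊥ : AddSubgroup G) (n + 1) (pow A) (pow S) f)
  (hfB : Ex (⊥ : AddSubgroup G) (n + 1) (pow B) (pow S) f) :
  Ex (⊥ : AddSubgroup G) (n + 1) (pow (A ∪ B)) (pow S) f := by
  obtain ⟨g, hg, hfg⟩ := hfA
  obtain ⟨g', hg', hfg'⟩ := hfB
  obtain ⟨u, hu, hwu⟩ := hac (g - g') (sub_mem hg hg') (by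
    have := sub_mem (N_anti (pow_mono (inter_subset_right (s := A) (t := B))) hfg')
      (N_anti (pow_mono inter_subset_left) hfg)
    rw [cob_sub]; convert this using 1; abel)
  rw [pow_inter] at hwu
  obtain ⟨h1, h2⟩ := N_split hwu
  set a := ((pow A : Set (List M))ᶜ).indicator (g - g' - cob u) with ha
  have haL : a ∈ Len M R (n + 1) :=
    indicator_len _ (sub_mem (sub_mem hg.1.1 hg'.1.1) (cob_len hu.1.1))
  have hv : g - a ∈ P R (⊥ : AddSubgroup G) (n + 1) (pow S) :=
    ⟨⟨sub_mem hg.1.1 haL, Inv_bot _⟩, sub_mem hg.2 (N_anti (pow_mono hSA) h1)⟩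
  have hvA : f - cob (g - a) ∈ N R (pow A) := by
    have := add_mem hfg (cob_N h1)
    rw [cob_sub]; convert this using 1; abel
  have hvB : f - cob (g - a) ∈ N R (pow B) := by
    have h3 := sub_mem hfg' (cob_N h2)
    have h4 : cob (g - g' - cob u - a) = cob (g - a) - cob g' := by
      rw [cob_sub, cob_sub, cob_sub, cob_cob, cob_sub]; abel
    rw [h4] at h3
    convert h3 using 1; abel
  obtain ⟨w, hw, hfw⟩ := excision (K := (⊥ : AddSubgroup G)) (R := R) (n + 1) hA hB (SInv_bot _)
    (SInv_bot _) (Free_bot _) (f - cob (g - a))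
    ⟨⟨sub_mem hf.1.1 (cob_len hv.1.1), Inv_bot _⟩, by rw [N_max]; exact ⟨hvA, hvB⟩⟩ (by
      rw [cob_sub, cob_cob, sub_zero]; exact hd)
  refine ⟨g - a + w, add_mem hv (P_anti ?_ hw), ?_⟩
  · intro l hl; exact Or.inl (pow_mono hSA hl)
  · rw [cob_add, ← sub_sub]; exact hfw

lemma Acyc_point {n : ℕ} (x : M) {S : Set M} (hS : IsClosed S) :
  Acyc R (⊥ : AddSubgroup G) (n + 1) (pow ({x} ∪ S)) (pow S) := by
  by_cases hxS : x ∈ S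
  · rw [Set.union_eq_self_of_subset_left (by simpa using hxS)]
    intro f hf _
    exact ⟨0, zero_mem _, by rw [cob_zero, sub_zero]; exact hf.2⟩
  intro f hf ⟨ε, hε, hd⟩
  obtain ⟨ε', hε', hf0⟩ := hf.2
  obtain ⟨δ, hδ, hsep⟩ := exists_sep (A := {x}) (B := S) isClosed_singleton hS
    (by simpa using hxS)
  set g : List M → R := (pow {x} : Set (List M)).indicator (fun l => f (x :: l)) with hg
  have hgL : g ∈ Len M R (n + 1) :=
    indicator_len _ fun l hl => hf.1.1 _ (by simpa using hl)
  have hgS : ∀ l ∈ pow S, g l = 0 := by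
    intro l hl
    by_cases h1 : l ∈ (pow {x} : Set (List M))
    · cases l with
      | nil => exact hgL _ (by simp)
      | cons a l =>
        have e1 : a = x := h1 a (by simp)
        have e2 := hl a (by simp)
        exact (hxS (e1 ▸ e2)).elim
    · exact indicator_of_notMem h1 _
  refine ⟨g, ⟨⟨hgL, Inv_bot _⟩, N_of_zero hgS⟩, min δ (min ε ε'), by positivity, ?_⟩
  intro l hl hs
  have hcase : l ∈ pow {x} ∨ l ∈ pow S := by
    by_contra hcon
    rw [not_or, mem_pow, mem_pow] at hcon
    push Not at hcon
    obtain ⟨⟨a, ha, hax⟩, ⟨b, hb, hbS⟩⟩ := hcon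
    have := hsep b ((hl b hb).resolve_right hbS) a ((hl a ha).resolve_left hax)
    have := (hs b hb a ha).trans_le (min_le_left _ _)
    linarith
  rcases hcase with hx | hS'
  · have e1 : cob g l = cob (fun m => f (x :: m)) l := cob_congr_of _ _ _ fun l' hl' =>
      indicator_of_mem (show l' ∈ pow {x} from (pow {x}).sub hx hl') _
    rw [Pi.sub_apply, e1]
    have hx' : ∀ y ∈ x :: l, y = x := by
      intro y hy
      rcases mem_cons.1 hy with rfl | hy
      · rfl
      · exact hx y hy
    have h3 := hd (x :: l) (fun y hy => Or.inl (hx' y hy)) (by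
      intro y hy z hz
      rw [hx' y hy, hx' z hz, dist_self]; exact hε)
    rwa [cob_cons] at h3
  · rw [Pi.sub_apply, cob_zero_of g l fun l' hl' => hgS l' ((pow S).sub hS' hl'), sub_zero]
    exact hf0 l hS' (Sm_mono ((min_le_right _ _).trans (min_le_right _ _)) hs)

end Lemmas
end PG

namespace PG

section CD
variable {M R G : Type} [MetricSpace M] [CompactSpace M] [CommRing R] [AddCommGroup G]
  [AddAction G M] [IsIsometricVAdd G M] {K : AddSubgroup G}

/-- cohomological dimension of the set `Z` is at most `m` -/
def CD (R G : Type) [CommRing R] [AddCommGroup G] [AddAction G M] (Z : Set M) (m : ℕ) : Prop :=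
  ∀ Z' ⊆ Z, IsClosed Z' → ∀ S : Set M, IsClosed S → ∀ n > m,
    Acyc R (⊥ : AddSubgroup G) n (pow (Z' ∪ S)) (pow S)

lemma CD.mono {Z Z' : Set M} {m : ℕ} (h : CD R G Z m) (hZ : Z' ⊆ Z) : CD R G Z' m :=
  fun Z'' h'' => h Z'' (h''.trans hZ)

lemma CD.union {Z Z' : Set M} {m : ℕ} (hZ : IsClosed Z) (hZ' : IsClosed Z')
  (h : CD R G Z m) (h' : CD R G Z' m) : CD R G (Z ∪ Z') m := by
  intro W hW hWc S hS n hn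
  have e : W ∪ S = (W ∩ Z) ∪ ((W ∩ Z') ∪ S) := by
    rw [← Set.union_assoc, ← Set.inter_union_distrib_left, Set.inter_eq_left.2 hW]
  rw [e]
  refine Acyc_trans (S := pow ((W ∩ Z') ∪ S)) (pow_mono subset_union_right)
    (pow_mono subset_union_right) ?_ ?_
  · exact h _ inter_subset_right (hWc.inter hZ) _ ((hWc.inter hZ').union hS) n hn
  · exact h' _ inter_subset_right (hWc.inter hZ') _ hS n hn

lemma CD_empty (m : ℕ) : CD R G (∅ : Set M) m := by
  intro Z hZ _ S hS n _ f hf _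
  rw [Set.subset_empty_iff.1 hZ, Set.empty_union]
  exact ⟨0, zero_mem _, by rw [cob_zero, sub_zero]; exact hf.2⟩

lemma CD_biUnion {ι : Type} (s : Finset ι) (Z : ι → Set M) (hZ : ∀ i, IsClosed (Z i)) {m : ℕ}
  (h : ∀ i ∈ s, CD R G (Z i) m) : CD R G (⋃ i ∈ s, Z i) m := by
  classical
  induction s using Finset.induction_on with
  | empty => simpa using CD_empty m
  | insert a s ha ih =>
    rw [Finset.set_biUnion_insert]
    exact CD.union (hZ a) (isClosed_biUnion_finset fun i _ => hZ i) (h a (by simp))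
      (ih fun i hi => h i (by simp [hi]))

lemma CD_subsingleton {Z : Set M} (hZ : Z.Subsingleton) : CD R G Z 0 := by
  intro Z' hZ' _ S hS n hn
  rcases (hZ.anti hZ').eq_empty_or_singleton with h | ⟨x, h⟩
  · exact CD_empty (R := R) (G := G) 0 Z' h.subset (by rw [h]; exact isClosed_empty) S hS n hn
  · rw [h]
    obtain ⟨n, rfl⟩ : ∃ m, n = m + 1 := ⟨n - 1, by omega⟩
    exact Acyc_point x hS

lemma slice_nhd {Z' S : Set M} (hZ' : IsClosed Z') (hS : IsClosed S) {h : M → ℝ}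
  (hh : ContinuousOn h Z') {n : ℕ} (t : ℝ)
  (hac : Acyc R (⊥ : AddSubgroup G) n (pow ((Z' ∩ h ⁻¹' {t}) ∪ S)) (pow S))
  {f : List M → R} (hf : f ∈ P R (⊥ : AddSubgroup G) (n + 1) (pow S))
  (hd : cob f ∈ N R (pow (Z' ∪ S))) :
  ∃ η > 0, Ex (⊥ : AddSubgroup G) n (pow ((Z' ∩ h ⁻¹' (Set.Ioo (t - η) (t + η))) ∪ S)) (pow S) f := by
  set T := (Z' ∩ h ⁻¹' {t}) ∪ S with hT
  have hTc : IsClosed T := (hh.preimage_isClosed_of_isClosed hZ' isClosed_singleton).union hS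
  have hTX : T ⊆ Z' ∪ S := Set.union_subset_union_left _ inter_subset_left
  obtain ⟨g, hg, hfg⟩ := hac f hf (N_anti (pow_mono hTX) hd)
  obtain ⟨η₀, hη₀, u, hu, hfu⟩ := collar (K := (⊥ : AddSubgroup G)) (n := n) (X := Z' ∪ S) (Y := T)
    hTX (SInv_bot _) (SInv_bot _) (Free_bot _) (f := f - cob g)
    ⟨⟨sub_mem hf.1.1 (cob_len hg.1.1), Inv_bot _⟩, hfg⟩
    (by rw [cob_sub, cob_cob, sub_zero]; exact hd)
  -- compactness
  set C := Z' ∩ {x | ∀ y ∈ T, η₀ ≤ dist x y} with hC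
  have hCc : IsClosed C := by
    apply hZ'.inter
    have : {x | ∀ y ∈ T, η₀ ≤ dist x y} = ⋂ z ∈ T, {x | η₀ ≤ dist x z} := by
      ext x; simp
    rw [this]
    exact isClosed_biInter fun z _ =>
      isClosed_le continuous_const (continuous_id.dist continuous_const)
  have hpos : ∃ η > 0, ∀ x ∈ C, η ≤ |h x - t| := by
    rcases C.eq_empty_or_nonempty with hE | hne
    · exact ⟨1, one_pos, by simp [hE]⟩
    obtain ⟨x, hx, hmin⟩ := hCc.isCompact.exists_isMinOn hne (f := fun x => |h x - t|)
      (((hh.mono inter_subset_left).sub continuousOn_const).abs)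
    refine ⟨|h x - t|, ?_, fun y hy => hmin hy⟩
    rw [gt_iff_lt, abs_pos, sub_ne_zero]
    intro hxt
    have := hx.2 x (Or.inl ⟨hx.1, hxt⟩)
    rw [dist_self] at this; linarith
  obtain ⟨η, hη, hCη⟩ := hpos
  refine ⟨η, hη, g + u, add_mem hg (P_anti (pow_mono subset_union_right) hu), ?_⟩
  rw [cob_add, ← sub_sub]
  refine N_anti (pow_mono ?_) hfu
  rintro x (⟨hx, hxt⟩ | hx)
  · refine ⟨Or.inl hx, ?_⟩
    by_contra hcon
    have hxC : x ∈ C := by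
      refine ⟨hx, fun y hy => ?_⟩
      by_contra hlt
      exact hcon ⟨y, hy, (not_le.1 hlt).le⟩
    have := hCη x hxC
    have h2 : |h x - t| < η := by
      rw [abs_lt]; constructor <;> linarith [hxt.1, hxt.2]
    linarith
  · exact ⟨Or.inr hx, x, Or.inr hx, by rw [dist_self]; exact hη₀.le⟩

lemma CD_slice {Z : Set M} {h : M → ℝ} (hZ : IsClosed Z) (hh : ContinuousOn h Z) {d : ℕ}
  (hfib : ∀ t, CD R G (Z ∩ h ⁻¹' {t}) d) : CD R G Z (d + 1) := by
  intro Z' hZ'Z hZ' S hS n hn f hf hd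
  obtain ⟨n, rfl⟩ : ∃ m, n = m + 1 := ⟨n - 1, by omega⟩
  have hh' := hh.mono hZ'Z
  have hcl : ∀ s : Set ℝ, IsClosed s → IsClosed ((Z' ∩ h ⁻¹' s) ∪ S) := fun s hs =>
    (hh'.preimage_isClosed_of_isClosed hZ' hs).union hS
  have hfib' : ∀ t, ∀ m > d, Acyc R (⊥ : AddSubgroup G) m (pow ((Z' ∩ h ⁻¹' {t}) ∪ S)) (pow S) :=
    fun t m hm => hfib t _ (Set.inter_subset_inter_left _ hZ'Z)
      (hh'.preimage_isClosed_of_isClosed hZ' isClosed_singleton) S hS m hm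
  obtain ⟨a, b, hab, hbd⟩ : ∃ a b : ℝ, a ≤ b ∧ ∀ x ∈ Z', h x ∈ Icc a b := by
    obtain ⟨c, hc⟩ := ((hZ'.isCompact.image_of_continuousOn hh').isBounded).subset_closedBall 0
    refine ⟨-|c|, |c|, by linarith [abs_nonneg c], fun x hx => ?_⟩
    have := hc ⟨x, hx, rfl⟩
    rw [mem_closedBall_zero_iff, Real.norm_eq_abs] at this
    exact abs_le.1 (this.trans (le_abs_self c))
  choose η hη hEx using fun t => slice_nhd hZ' hS hh' t (hfib' t (n + 1) (by omega)) hf hd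
  obtain ⟨t, ht0, htm, ⟨m, hm⟩, hti⟩ := exists_monotone_Icc_subset_open_cover_Icc (ι := ℝ) hab
    (c := fun i => {s : Icc a b | (s : ℝ) ∈ Set.Ioo (i - η i) (i + η i)})
    (fun i => isOpen_Ioo.preimage continuous_subtype_val)
    (fun s _ => by
      rw [Set.mem_iUnion]
      exact ⟨s, by constructor <;> linarith [hη s]⟩)
  have key : ∀ j : ℕ, Ex (⊥ : AddSubgroup G) (n + 1)
      (pow ((Z' ∩ h ⁻¹' (Icc a (t j))) ∪ S)) (pow S) f := by
    intro j
    induction j with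
    | zero =>
      obtain ⟨g, hg, hfg⟩ := hfib' a (n + 1) (by omega) f hf
        (N_anti (pow_mono (Set.union_subset_union_left _ inter_subset_left)) hd)
      refine ⟨g, hg, ?_⟩
      rw [ht0]
      simpa using hfg
    | succ j ih =>
      have hle : (t j : ℝ) ≤ t (j + 1) := htm (Nat.le_succ j)
      have ha : a ≤ t j := (t j).2.1
      obtain ⟨i, hi⟩ := hti j
      have e : (Z' ∩ h ⁻¹' (Icc a (t (j + 1)))) ∪ S =
          ((Z' ∩ h ⁻¹' (Icc a (t j))) ∪ S) ∪
            ((Z' ∩ h ⁻¹' (Icc (t j : ℝ) (t (j + 1)))) ∪ S) := by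
        rw [← Set.Icc_union_Icc_eq_Icc ha hle, Set.preimage_union, Set.inter_union_distrib_left]
        ext x; simp only [Set.mem_union]; tauto
      have e2 : ((Z' ∩ h ⁻¹' (Icc a (t j))) ∪ S) ∩
            ((Z' ∩ h ⁻¹' (Icc (t j : ℝ) (t (j + 1)))) ∪ S) =
            (Z' ∩ h ⁻¹' {(t j : ℝ)}) ∪ S := by
        rw [← Set.inter_union_distrib_right, ← Set.inter_inter_distrib_left, ← Set.preimage_inter]
        congr 3
        ext x; simp only [Set.mem_inter_iff, Set.mem_Icc, Set.mem_singleton_iff]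
        constructor
        · rintro ⟨⟨_, h1⟩, h2, _⟩; exact le_antisymm h1 h2
        · rintro rfl; exact ⟨⟨ha, le_rfl⟩, le_rfl, hle⟩
      rw [e]
      refine gluing (hcl _ isClosed_Icc) (hcl _ isClosed_Icc) subset_union_right
        subset_union_right ?_ hf ?_ ih ?_
      · rw [e2]; exact hfib' _ n (by omega)
      · rw [← e]
        exact N_anti (pow_mono (Set.union_subset_union_left _ inter_subset_left)) hd
      · obtain ⟨g, hg, hfg⟩ := hEx i
        refine ⟨g, hg, N_anti (pow_mono (Set.union_subset_union_left _
          (Set.inter_subset_inter_right _ fun x hx => ?_))) hfg⟩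
        have hxm : h x ∈ Icc a b := ⟨ha.trans hx.1, hx.2.trans (t (j + 1)).2.2⟩
        exact hi (show (⟨h x, hxm⟩ : Icc a b) ∈ Icc (t j) (t (j + 1)) from hx)
  obtain ⟨g, hg, hfg⟩ := key m
  refine ⟨g, hg, ?_⟩
  rw [hm m le_rfl] at hfg
  have hsub : Z' ⊆ Z' ∩ h ⁻¹' Icc a b := fun x hx => ⟨hx, hbd x hx⟩
  exact N_anti (pow_mono (Set.union_subset_union_left _ hsub)) hfg

lemma CD_of_inj {m : ℕ} (Z : Set M) (hZ : IsClosed Z) (h : Fin m → M → ℝ)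
  (hh : ∀ i, ContinuousOn (h i) Z) (hinj : ∀ x ∈ Z, ∀ y ∈ Z, (∀ i, h i x = h i y) → x = y) :
  CD R G Z m := by
  induction m generalizing Z with
  | zero => exact CD_subsingleton fun x hx y hy => hinj x hx y hy fun i => i.elim0
  | succ m ih =>
    apply CD_slice (h := h 0) hZ (hh 0)
    intro t
    refine ih _ ((hh 0).preimage_isClosed_of_isClosed hZ isClosed_singleton) (fun i => h i.succ)
      (fun i => (hh _).mono inter_subset_left) ?_
    intro x hx y hy hxy
    refine hinj x hx.1 y hy.1 fun i => ?_
    refine Fin.cases ?_ hxy i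
    exact (Set.mem_singleton_iff.1 hx.2).trans (Set.mem_singleton_iff.1 hy.2).symm

/-! ### Boundedness for free actions -/

/-- translates of `B` by `K` -/
def sat (K : AddSubgroup G) (B : Set M) : Set M := {x | ∃ k ∈ K, k +ᵥ x ∈ B}

lemma sat_SInv (B : Set M) : SInv (sat K B) K := by
  rintro g hg x ⟨k, hk, hx⟩
  exact ⟨k - g, sub_mem hk hg, by rwa [sub_eq_add_neg, add_vadd, neg_vadd_vadd]⟩

lemma subset_sat (B : Set M) : B ⊆ sat K B := fun x hx => ⟨0, zero_mem _, by simpa⟩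

variable [Finite G]

lemma sat_closed {B : Set M} (hB : IsClosed B) : IsClosed (sat K B) := by
  have : sat K B = ⋃ k : K, (fun x => (k : G) +ᵥ x) ⁻¹' B := by
    ext x; simp [sat]
  rw [this]
  exact isClosed_iUnion_of_finite fun k => hB.preimage (isometry_vadd M (k : G)).continuous

lemma Acyc_sat {B W : Set M} (hB : IsClosed B) (hW : IsClosed W) (hWi : SInv W K) {δ : ℝ}
  (hδ : 0 < δ) (hsep : ∀ g ∈ K, g ≠ 0 → ∀ b ∈ B, ∀ b' ∈ B, δ ≤ dist (g +ᵥ b) b')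
  {n : ℕ} (hn : 0 < n)
  (hac : Acyc R (⊥ : AddSubgroup G) n (pow (B ∪ W)) (pow W)) :
  Acyc R K n (pow (sat K B ∪ W)) (pow W) := by
  classical
  have hfree : Free K (sat K B) := by
    rintro x ⟨k, hk, hx⟩ g hg hgx
    by_contra hne
    have := hsep g hg hne _ hx _ hx
    rw [vadd_comm, hgx, dist_self] at this
    linarith
  have := ofFinite K
  have uniq : ∀ k ∈ K, ∀ k' ∈ K, ∀ x y, dist x y < δ → k +ᵥ x ∈ B → k' +ᵥ y ∈ B → k = k' := by
    intro k hk k' hk' x y hxy hx hy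
    by_contra hne
    have := hsep (k - k') (sub_mem hk hk') (sub_ne_zero.2 hne) _ hy _ hx
    rw [← add_vadd, sub_add_cancel, dist_vadd, dist_comm] at this
    linarith
  intro f hf hd
  obtain ⟨g, hg, ε, hε, hfg⟩ := hac f ⟨⟨hf.1.1, Inv_bot _⟩, hf.2⟩
    (N_anti (pow_mono (Set.union_subset_union_left _ (subset_sat B))) hd)
  set g' : List M → R := (pow B : Set (List M)).indicator g with hg'
  have hg0 : g [] = 0 := hg.1.1 [] (by simpa using hn.ne)
  set q : List M → R := fun l => ∑ k : K, g' (tr (k : G) l) with hq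
  have hqP : q ∈ P R K n (pow W) := by
    refine ⟨⟨fun l hl => ?_, fun h hh l => ?_⟩, ?_⟩
    · refine sum_eq_zero fun k _ => ?_
      exact indicator_len _ hg.1.1 _ (by simpa using hl)
    · simp only [hq, tr_tr]
      exact Fintype.sum_equiv (Equiv.addRight (⟨h, hh⟩ : K)) _ _ fun k => by simp
    · obtain ⟨ε', hε', h'⟩ := hg.2
      refine ⟨ε', hε', fun l hl hs => sum_eq_zero fun k _ => ?_⟩
      rw [hg', Set.indicator_apply]
      split_ifs
      · exact h' _ (hWi.pow _ k.2 _ hl) ((tr_Sm _ _ _).2 hs)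
      · rfl
  have hcob : f - cob q ∈ N R (pow (sat K B) ⊔ pow W) := by
    rw [N_max]
    refine ⟨⟨min ε δ, lt_min hε hδ, ?_⟩, sub_mem hf.2 (cob_N hqP.2)⟩
    intro l hl hs
    rcases l with _ | ⟨x, l⟩
    · simp [hf.1.1 [] (by simp)]
    obtain ⟨k, hk, hx⟩ := hl x (by simp)
    have hδl := Sm_mono (min_le_right _ _) hs
    have hB' : ∀ y ∈ x :: l, k +ᵥ y ∈ B := by
      intro y hy
      obtain ⟨k', hk', hy'⟩ := hl y hy
      rwa [uniq k hk k' hk' x y (hδl _ (by simp) _ hy) hx hy']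
    have hval : ∀ l', l' ⊆ x :: l → q l' = trL R k g l' := by
      intro l' hl'
      rcases l' with _ | ⟨y, l'⟩
      · simp only [hq, tr_nil, trL]
        show ∑ k : K, g' [] = g []
        rw [hg0, hg']
        refine sum_eq_zero fun k _ => ?_
        rw [Set.indicator_apply]; split_ifs <;> simp [hg0]
      · simp only [hq]
        rw [sum_eq_single (⟨k, hk⟩ : K)]
        · show g' (tr k _) = g (tr k _)
          rw [hg', indicator_of_mem]
          show tr k _ ∈ pow B
          rw [mem_pow]
          intro z hz
          obtain ⟨w, hw, rfl⟩ := mem_tr.1 hz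
          exact hB' w (hl' hw)
        · intro k' _ hne
          rw [hg', indicator_of_notMem]
          intro hmem
          have hmem : tr (k' : G) (y :: l') ∈ pow B := hmem
          have h2 : (k' : G) +ᵥ y ∈ B := hmem _ (by simp)
          have hyl : y ∈ x :: l := hl' (by simp)
          exact hne (Subtype.ext (uniq k' k'.2 k hk y y (hδl _ hyl _ hyl) h2 (hB' y hyl)))
        · simp
    have h3 := hfg (tr k (x :: l)) (by
      show tr k _ ∈ pow _
      rw [mem_pow]
      intro z hz
      obtain ⟨w, hw, rfl⟩ := mem_tr.1 hz
      exact Or.inl (hB' w hw)) ((tr_Sm _ _ _).2 (Sm_mono (min_le_left _ _) hs))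
    have h4 : f (tr k (x :: l)) - cob g (tr k (x :: l)) = 0 := h3
    rw [hf.1.2 k hk] at h4
    show f (x :: l) - cob q (x :: l) = 0
    rw [cob_congr_of _ _ _ hval, cob_trL]
    exact h4
  obtain ⟨q2, hq2, h2⟩ := excision n (sat_closed hB) hW (sat_SInv B) hWi
      (hfree.mono Set.sdiff_subset) (f - cob q)
      ⟨⟨sub_mem hf.1.1 (cob_len hqP.1.1), sub_mem hf.1.2 (cob_Inv hqP.1.2)⟩, hcob⟩
      (by rw [cob_sub, cob_cob, sub_zero]; exact hd)
  refine ⟨q + q2, add_mem hqP ⟨hq2.1, ?_⟩, ?_⟩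
  · have h5 := hq2.2
    rw [N_max] at h5; exact h5.2
  rw [cob_add, ← sub_sub]; exact h2

lemma Bdd {X Y : Set M} (hX : IsClosed X) (hY : IsClosed Y) (hYX : Y ⊆ X) (hXi : SInv X K)
  (hYi : SInv Y K) (hfree : Free K (X \ Y)) {r : ℕ} (hCD : CD R G (univ : Set M) r) {n : ℕ}
  (hn : r < n) : Acyc R K n (pow X) (pow Y) := by
  classical
  intro f hf hd
  obtain ⟨η, hη, g, hg, hfg⟩ := collar hYX hXi hYi hfree hf hd
  have : ∀ x : M, ∃ ε > 0, x ∈ X → (∀ y ∈ Y, η ≤ dist x y) → ∃ δ > 0, ∀ g ∈ K, g ≠ 0 →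
      ∀ b ∈ closedBall x ε, ∀ b' ∈ closedBall x ε, δ ≤ dist (g +ᵥ b) b' := by
    intro x
    by_cases hx : x ∈ X ∧ (∀ y ∈ Y, η ≤ dist x y)
    swap
    · exact ⟨1, one_pos, fun h1 h2 => (hx ⟨h1, h2⟩).elim⟩
    have hxY : x ∉ Y := fun h => by have := hx.2 x h; rw [dist_self] at this; linarith
    have h1 : ∀ g : G, ∃ a > 0, g ∈ K → g ≠ 0 → a ≤ dist (g +ᵥ x) x := by
      intro g
      by_cases h : g ∈ K ∧ g ≠ 0
      · exact ⟨dist (g +ᵥ x) x, dist_pos.2 fun e => h.2 (hfree x ⟨hx.1, hxY⟩ g h.1 e),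
          fun _ _ => le_rfl⟩
      · exact ⟨1, one_pos, fun h1 h2 => (h ⟨h1, h2⟩).elim⟩
    choose a ha h1 using h1
    have := ofFinite G
    obtain ⟨e, he, hea⟩ : ∃ e > 0, ∀ g, e ≤ a g := by
      obtain ⟨g0, -, h0⟩ := Finset.exists_min_image Finset.univ a ⟨0, by simp⟩
      exact ⟨a g0, ha g0, fun g => h0 g (by simp)⟩
    refine ⟨e / 4, by linarith, fun _ _ => ⟨e / 2, by linarith, ?_⟩⟩
    intro g hg hne b hb b' hb'
    have h2 := (hea g).trans (h1 g hg hne)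
    rw [Metric.mem_closedBall] at hb hb'
    have h3 : dist (g +ᵥ b) (g +ᵥ x) ≤ e / 4 := by rwa [dist_vadd]
    have h4 := dist_triangle4 (g +ᵥ x) (g +ᵥ b) b' x
    rw [dist_comm (g +ᵥ x) (g +ᵥ b)] at h4
    linarith
  choose ε hε hsep using this
  set C : Set M := {x | x ∈ X ∧ ∀ y ∈ Y, η ≤ dist x y} with hC
  have hCc : IsClosed C := by
    have : C = X ∩ ⋂ y ∈ Y, {x | η ≤ dist x y} := by ext x; simp [hC]
    rw [this]
    exact hX.inter (isClosed_biInter fun y _ => isClosed_le continuous_const (by fun_prop))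
  obtain ⟨t, htC, hcov⟩ := hCc.isCompact.elim_nhds_subcover (fun x => closedBall x (ε x))
    (fun x _ => Metric.closedBall_mem_nhds _ (hε x))
  set Y' : Set M := X ∩ Nb η Y with hY'
  have hY'c : IsClosed Y' := hX.inter (Nb_closed hY η)
  have hY'i : SInv Y' K := hXi.inter (Nb_SInv hYi η)
  have key : ∀ s : Finset M, s ⊆ t →
      IsClosed ((⋃ x ∈ s, sat K (X ∩ closedBall x (ε x))) ∪ Y') ∧
      SInv ((⋃ x ∈ s, sat K (X ∩ closedBall x (ε x))) ∪ Y') K ∧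
      Acyc R K n (pow ((⋃ x ∈ s, sat K (X ∩ closedBall x (ε x))) ∪ Y')) (pow Y') := by
    intro s
    induction s using Finset.induction_on with
    | empty =>
      intro _
      simp only [Finset.notMem_empty, Set.iUnion_of_empty, Set.iUnion_empty, Set.empty_union]
      refine ⟨hY'c, hY'i, fun f hf _ => ⟨0, zero_mem _, ?_⟩⟩
      rw [cob_zero, sub_zero]; exact hf.2
    | insert x s hx ih =>
      intro hs
      obtain ⟨h1, h2, h3⟩ := ih fun y hy => hs (by simp [hy])
      have hxC := htC x (hs (by simp))
      rw [Finset.set_biUnion_insert, Set.union_assoc]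
      have hBc : IsClosed (X ∩ closedBall x (ε x)) := hX.inter Metric.isClosed_closedBall
      refine ⟨(sat_closed hBc).union h1, (sat_SInv _).union h2, ?_⟩
      refine Acyc_trans (pow_mono subset_union_right) (pow_mono subset_union_right) ?_ h3
      obtain ⟨δ, hδ, hsepx⟩ := hsep x hxC.1 hxC.2
      exact Acyc_sat hBc h1 h2 hδ (fun g hg hne b hb b' hb' => hsepx g hg hne b hb.2 b' hb'.2)
        (by omega) (hCD _ (Set.subset_univ _) hBc _ h1 n hn)
  obtain ⟨-, -, hac⟩ := key t subset_rfl
  have hXe : (⋃ x ∈ t, sat K (X ∩ closedBall x (ε x))) ∪ Y' = X := by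
    apply Set.Subset.antisymm
    · apply Set.union_subset _ inter_subset_left
      refine Set.iUnion₂_subset fun x _ => ?_
      rintro z ⟨k, hk, hz⟩
      exact (hXi.iff hk).1 hz.1
    · intro x hx
      by_cases hxY : x ∈ Nb η Y
      · exact Or.inr ⟨hx, hxY⟩
      · left
        have hxC : x ∈ C := ⟨hx, fun y hy => by
          by_contra hlt
          exact hxY ⟨y, hy, (not_le.1 hlt).le⟩⟩
        obtain ⟨z, hz, hxz⟩ := Set.mem_iUnion₂.1 (hcov hxC)
        exact Set.mem_iUnion₂.2 ⟨z, hz, subset_sat _ ⟨hx, hxz⟩⟩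
  rw [hXe] at hac
  obtain ⟨g2, hg2, h2⟩ := hac (f - cob g)
    ⟨sub_mem hf.1 (cob_P hg).1, hfg⟩ (by rw [cob_sub, cob_cob, sub_zero]; exact hd)
  have hYY' : Y ⊆ Y' := fun y hy => ⟨hYX hy, y, hy, by rw [dist_self]; exact hη.le⟩
  refine ⟨g + g2, add_mem hg ⟨hg2.1, N_anti (pow_mono hYY') hg2.2⟩, ?_⟩
  · rw [cob_add, ← sub_sub]; exact h2

end CD
end PG

namespace PG

/-! ### Chain complexes over a field -/

/-- chain complexes of vector spaces, homology `H n` is taken at spot `n + 1` -/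
structure Cx (F : Type) [Field F] where
  V : ℕ → Type
  [acg : ∀ n, AddCommGroup (V n)]
  [mod : ∀ n, Module F (V n)]
  d : ∀ n, V (n + 1) →ₗ[F] V n
  dd : ∀ n x, d n (d (n + 1) x) = 0

attribute [instance] Cx.acg Cx.mod

namespace Cx
variable {F : Type} [Field F]

/-- homology -/
abbrev H (C : Cx F) (n : ℕ) : Type :=
  ker (C.d n) ⧸ (LinearMap.range (C.d (n + 1))).submoduleOf (ker (C.d n))

/-- class of a cycle -/
abbrev cls (C : Cx F) (n : ℕ) : ker (C.d n) →ₗ[F] C.H n := mkQ _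

lemma cls_zero {C : Cx F} {n : ℕ} (x : ker (C.d n)) :
  C.cls n x = 0 ↔ ∃ y, C.d (n + 1) y = x := by
  rw [cls, mkQ_apply, Submodule.Quotient.mk_eq_zero]
  exact LinearMap.mem_range

lemma cls_eq {C : Cx F} {n : ℕ} (x x' : ker (C.d n)) :
  C.cls n x = C.cls n x' ↔ ∃ y, C.d (n + 1) y = x - x' := by
  rw [← sub_eq_zero, ← map_sub, cls_zero]; rfl

lemma cls_surj (C : Cx F) (n : ℕ) : Surjective (C.cls n) := mkQ_surjective _

/-- chain maps -/
structure Hom (C D : Cx F) where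
  f : ∀ n, C.V n →ₗ[F] D.V n
  comm : ∀ n x, D.d n (f (n + 1) x) = f n (C.d n x)

/-- composition -/
def Hom.comp {C D E : Cx F} (g : Hom D E) (f : Hom C D) : Hom C E :=
  ⟨fun n => g.f n ∘ₗ f.f n, fun n x => by simp [g.comm, f.comm]⟩

/-- map on cycles -/
def Hom.zmap {C D : Cx F} (f : Hom C D) (n : ℕ) :
  ker (C.d n) →ₗ[F] ker (D.d n) :=
  (f.f (n + 1)).restrict fun x hx => by
    rw [mem_ker] at *; rw [f.comm, hx, map_zero]

/-- induced map on homology -/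
def Hom.map {C D : Cx F} (f : Hom C D) (n : ℕ) : C.H n →ₗ[F] D.H n :=
  mapQ _ _ (f.zmap n) (by
    rintro x hx
    obtain ⟨y, hy⟩ := hx
    exact ⟨f.f (n + 2) y, by rw [f.comm, hy]; rfl⟩)

@[simp] lemma Hom.map_cls {C D : Cx F} (f : Hom C D) (n : ℕ) (x : ker (C.d n)) :
  f.map n (C.cls n x) = D.cls n (f.zmap n x) := rfl

lemma Hom.comp_map {C D E : Cx F} (g : Hom D E) (f : Hom C D) (n : ℕ) (x : C.H n) :
  (g.comp f).map n x = g.map n (f.map n x) := by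
  obtain ⟨x, rfl⟩ := C.cls_surj n x
  rfl

/-- short exact sequences -/
structure Ses {A B C : Cx F} (f : Hom A B) (g : Hom B C) : Prop where
  inj : ∀ n, Injective (f.f n)
  ex : ∀ n, Exact (f.f n) (g.f n)
  surj : ∀ n, Surjective (g.f n)

namespace Ses
variable {A B C : Cx F} {f : Hom A B} {g : Hom B C}

lemma gf (S : Ses f g) (n : ℕ) (x : A.V n) : g.f n (f.f n x) = 0 := (S.ex n).apply_apply_eq_zero x

lemma exists_sec (S : Ses f g) (n : ℕ) : ∃ s : C.V n →ₗ[F] B.V n, ∀ c, g.f n (s c) = c := by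
  obtain ⟨s, hs⟩ := (g.f n).exists_rightInverse_of_surjective (LinearMap.range_eq_top.2 (S.surj n))
  exact ⟨s, fun c => LinearMap.congr_fun hs c⟩

lemma exists_ret (S : Ses f g) (n : ℕ) : ∃ s : B.V n →ₗ[F] A.V n, ∀ c, s (f.f n c) = c := by
  obtain ⟨s, hs⟩ := (f.f n).exists_leftInverse_of_injective (LinearMap.ker_eq_bot.2 (S.inj n))
  exact ⟨s, fun c => LinearMap.congr_fun hs c⟩

lemma exists_δ (S : Ses f g) (n : ℕ) : ∃ δ : C.H (n + 1) →ₗ[F] A.H n,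
  ∀ (c : ker (C.d (n + 1))) (a : ker (A.d n)) (b : B.V (n + 2)),
  g.f _ b = c → B.d _ b = f.f _ a → δ (C.cls _ c) = A.cls _ a := by
  obtain ⟨s, hs⟩ := S.exists_sec (n + 2)
  obtain ⟨t, ht⟩ := S.exists_ret (n + 1)
  have h1 : ∀ c : ker (C.d (n + 1)),
      f.f _ (t (B.d (n + 1) (s c))) = B.d (n + 1) (s c) := by
    intro c
    obtain ⟨a, ha⟩ := (S.ex _ (B.d (n + 1) (s c))).1 (by rw [← g.comm, hs]; exact c.2)
    rw [← ha, ht]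
  have h2 : ∀ c : ker (C.d (n + 1)), t (B.d (n + 1) (s c)) ∈ ker (A.d n) := by
    intro c
    rw [mem_ker]
    apply S.inj
    rw [← f.comm, h1, B.dd, map_zero]
  let z : ker (C.d (n + 1)) →ₗ[F] ker (A.d n) :=
    LinearMap.codRestrict _ (t ∘ₗ B.d (n + 1) ∘ₗ s ∘ₗ (ker (C.d (n + 1))).subtype) h2
  have h3 : ∀ (c : ker (C.d (n + 1))) (a : ker (A.d n)) (b : B.V (n + 2)),
      g.f _ b = c → B.d _ b = f.f _ a → A.cls _ (z c) = A.cls _ a := by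
    intro c a b hb hab
    rw [cls_eq]
    obtain ⟨a', ha'⟩ := (S.ex _ (s c - b)).1 (by rw [map_sub, hs, hb, sub_self])
    refine ⟨a', ?_⟩
    apply S.inj
    rw [← f.comm, ha', map_sub, map_sub, hab]
    exact congrArg₂ _ (h1 c).symm rfl
  refine ⟨liftQ _ (A.cls n ∘ₗ z) ?_, fun c a b hb hab => h3 c a b hb hab⟩
  rintro c ⟨y, hy⟩
  rw [mem_ker, LinearMap.comp_apply]
  obtain ⟨b', hb'⟩ := S.surj _ y
  rw [h3 c 0 (B.d _ b') ((g.comm _ _).symm.trans (by rw [hb', hy]; rfl)) (by rw [B.dd]; simp), map_zero]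

/-- connecting map -/
noncomputable def δ (S : Ses f g) (n : ℕ) : C.H (n + 1) →ₗ[F] A.H n := (S.exists_δ n).choose

lemma δ_eq (S : Ses f g) (n : ℕ) (c : ker (C.d (n + 1))) (a : ker (A.d n))
  (b : B.V (n + 2)) (h : g.f _ b = c) (h' : B.d _ b = f.f _ a) :
  S.δ n (C.cls _ c) = A.cls _ a := (S.exists_δ n).choose_spec c a b h h'

lemma lift (S : Ses f g) (n : ℕ) (c : ker (C.d (n + 1))) :
  ∃ (a : ker (A.d n)) (b : B.V (n + 2)), g.f _ b = c ∧ B.d _ b = f.f _ a := by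
  obtain ⟨b, hb⟩ := S.surj _ (c : C.V (n + 2))
  obtain ⟨a, ha⟩ := (S.ex _ (B.d (n + 1) b)).1 (by rw [← g.comm, hb]; exact c.2)
  refine ⟨⟨a, ?_⟩, b, hb, ha.symm⟩
  rw [mem_ker]
  apply S.inj
  rw [← f.comm, ha, B.dd, map_zero]

lemma exact_B (S : Ses f g) (n : ℕ) : Exact (f.map n) (g.map n) := by
  intro x
  obtain ⟨x, rfl⟩ := B.cls_surj n x
  constructor
  · intro h
    rw [Hom.map_cls, cls_zero] at h
    obtain ⟨y, hy⟩ := h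
    obtain ⟨b, hb⟩ := S.surj _ y
    obtain ⟨a, ha⟩ := (S.ex _ ((x : B.V (n + 1)) - B.d _ b)).1 (by
      rw [map_sub, ← g.comm, hb, hy]; exact sub_self _)
    have hak : a ∈ ker (A.d n) := by
      rw [mem_ker]; apply S.inj
      rw [← f.comm, ha, map_sub, B.dd, sub_zero, map_zero]; exact x.2
    refine ⟨A.cls n ⟨a, hak⟩, ?_⟩
    rw [Hom.map_cls, cls_eq]
    refine ⟨-b, ?_⟩
    show _ = f.f _ a - _
    rw [ha, map_neg]; abel
  · rintro ⟨y, hy⟩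
    obtain ⟨y, rfl⟩ := A.cls_surj n y
    rw [← hy, Hom.map_cls, Hom.map_cls, cls_zero]
    exact ⟨0, by rw [map_zero]; exact (S.gf _ _).symm⟩

lemma exact_C (S : Ses f g) (n : ℕ) : Exact (g.map (n + 1)) (S.δ n) := by
  intro x
  obtain ⟨c, rfl⟩ := C.cls_surj _ x
  constructor
  · intro h
    obtain ⟨a, b, hb, hab⟩ := S.lift n c
    rw [S.δ_eq n c a b hb hab, cls_zero] at h
    obtain ⟨a', ha'⟩ := h
    refine ⟨B.cls _ ⟨b - f.f _ a', ?_⟩, ?_⟩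
    · rw [mem_ker, map_sub, hab, f.comm, ha', sub_self]
    · rw [Hom.map_cls]
      congr 1
      ext
      show g.f _ (b - f.f _ a') = _
      rw [map_sub, hb, S.gf, sub_zero]
  · rintro ⟨y, hy⟩
    obtain ⟨b, rfl⟩ := B.cls_surj _ y
    rw [← hy, Hom.map_cls, S.δ_eq n _ 0 b rfl, map_zero]
    rw [Submodule.coe_zero, map_zero]; exact b.2

lemma exact_A (S : Ses f g) (n : ℕ) : Exact (S.δ n) (f.map n) := by
  intro x
  obtain ⟨a, rfl⟩ := A.cls_surj _ x
  constructor
  · intro h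
    rw [Hom.map_cls, cls_zero] at h
    obtain ⟨b, hb⟩ := h
    have hc : g.f _ b ∈ ker (C.d (n + 1)) := by
      rw [mem_ker, g.comm, hb]; exact S.gf _ _
    exact ⟨C.cls _ ⟨g.f _ b, hc⟩, S.δ_eq n _ a b rfl hb⟩
  · rintro ⟨y, hy⟩
    obtain ⟨c, rfl⟩ := C.cls_surj _ y
    obtain ⟨a', b, hb, hab⟩ := S.lift n c
    rw [← hy, S.δ_eq n c a' b hb hab, Hom.map_cls, cls_zero]
    exact ⟨b, hab⟩

lemma surj_zero (S : Ses f g) (h0 : Subsingleton (B.V 0)) : Surjective (g.map 0) := by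
  intro x
  obtain ⟨c, rfl⟩ := C.cls_surj _ x
  obtain ⟨b, hb⟩ := S.surj _ (c : C.V 1)
  exact ⟨B.cls 0 ⟨b, Subsingleton.elim _ _⟩, by rw [Hom.map_cls]; congr 1; ext; exact hb⟩

lemma δ_nat (S : Ses f g) {A' B' C' : Cx F} {f' : Hom A' B'} {g' : Hom B' C'} (S' : Ses f' g')
  (α : Hom A A') (β : Hom B B') (γ : Hom C C')
  (h1 : ∀ n x, β.f n (f.f n x) = f'.f n (α.f n x))
  (h2 : ∀ n x, γ.f n (g.f n x) = g'.f n (β.f n x)) (n : ℕ) (x : C.H (n + 1)) :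
  S'.δ n (γ.map _ x) = α.map _ (S.δ n x) := by
  obtain ⟨c, rfl⟩ := C.cls_surj _ x
  obtain ⟨a, b, hb, hab⟩ := S.lift n c
  rw [S.δ_eq n c a b hb hab, Hom.map_cls, Hom.map_cls]
  apply S'.δ_eq n _ _ (β.f _ b)
  · rw [← h2, hb]; rfl
  · rw [β.comm, hab, h1]; rfl

end Ses

/-! ### dimensions -/
section dims
variable {A B C : Type} [AddCommGroup A] [AddCommGroup B] [AddCommGroup C] [Module F A]
    [Module F B] [Module F C] {f : A →ₗ[F] B} {g : B →ₗ[F] C}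

lemma exact_finite (h : Exact f g) (hA : Module.Finite F A) (hC : Module.Finite F C) :
  Module.Finite F B := by
  have h1 : Module.Finite F (ker g) := by
    rw [exact_iff.1 h]; infer_instance
  have h2 : Module.Finite F (B ⧸ ker g) :=
    Module.Finite.equiv g.quotKerEquivRange.symm
  exact Module.Finite.of_submodule_quotient (ker g)

lemma exact_finrank (h : Exact f g) (hB : Module.Finite F B) :
  finrank F B = finrank F (LinearMap.range f) +
  finrank F (LinearMap.range g) := by
  rw [← exact_iff.1 h, ← LinearMap.finrank_range_add_finrank_ker g, add_comm]

lemma exact_finrank_le (h : Exact f g) (hA : Module.Finite F A)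
  (hC : Module.Finite F C) :
  finrank F B ≤ finrank F A + finrank F C := by
  rw [exact_finrank h (exact_finite h hA hC)]
  exact add_le_add (LinearMap.finrank_range_le f) (Submodule.finrank_le _)

lemma exact_sub (h : Exact f g) (hA : Subsingleton A) (hC : Subsingleton C) :
  Subsingleton B := by
  refine subsingleton_of_forall_eq 0 fun b => ?_
  obtain ⟨a, rfl⟩ := (h b).1 (Subsingleton.elim _ _)
  rw [Subsingleton.elim a 0, map_zero]
end dims

/-- finite homology -/
def Fin (C : Cx F) : Prop := ∀ n, Module.Finite F (C.H n)

/-- homology vanishes above `r` -/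
def Bd (C : Cx F) (r : ℕ) : Prop := ∀ n > r, Subsingleton (C.H n)

/-- Betti number -/
noncomputable def b (C : Cx F) (n : ℕ) : ℕ := finrank F (C.H n)

/-- Euler characteristic -/
noncomputable def chi (C : Cx F) (r : ℕ) : ℤ := ∑ n ∈ Finset.range (r + 1), (-1) ^ n * (C.b n : ℤ)

namespace Ses
variable {A B C : Cx F} {f : Hom A B} {g : Hom B C}

lemma fin_B (S : Ses f g) (hA : A.Fin) (hC : C.Fin) : B.Fin :=
  fun n => exact_finite (S.exact_B n) (hA n) (hC n)
lemma fin_C (S : Ses f g) (h0 : Subsingleton (B.V 0)) (hA : A.Fin) (hB : B.Fin) : C.Fin := by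
  intro n
  cases n with
  | zero => have := hB 0; exact Module.Finite.of_surjective _ (S.surj_zero h0)
  | succ n => exact exact_finite (S.exact_C n) (hB (n + 1)) (hA n)
lemma bd_B (S : Ses f g) {r : ℕ} (hA : A.Bd r) (hC : C.Bd r) : B.Bd r :=
  fun n hn => exact_sub (S.exact_B n) (hA n hn) (hC n hn)

lemma chi_add (S : Ses f g) (h0 : Subsingleton (B.V 0)) (hA : A.Fin) (hC : C.Fin) {r : ℕ}
  (hr : C.Bd r) : B.chi r = A.chi r + C.chi r := by
  have hB := S.fin_B hA hC
  have hr := hr (r + 1) (by omega)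
  have e1 : ∀ n, (A.b n : ℤ) = finrank F (LinearMap.range (S.δ n)) +
      finrank F (LinearMap.range (f.map n)) := fun n => by
    exact_mod_cast exact_finrank (S.exact_A n) (hA n)
  have e2 : ∀ n, (B.b n : ℤ) = finrank F (LinearMap.range (f.map n)) +
      finrank F (LinearMap.range (g.map n)) := fun n => by
    exact_mod_cast exact_finrank (S.exact_B n) (hB n)
  have e3 : ∀ n, (C.b (n + 1) : ℤ) = finrank F (LinearMap.range (g.map (n + 1))) +
      finrank F (LinearMap.range (S.δ n)) := fun n => by
    exact_mod_cast exact_finrank (S.exact_C n) (hC (n + 1))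
  have e4 : (C.b 0 : ℤ) = finrank F (LinearMap.range (g.map 0)) := by
    rw [LinearMap.range_eq_top.2 (S.surj_zero h0), finrank_top]; rfl
  have key : ∀ m : ℕ, A.chi m + C.chi m - B.chi m =
      (-1) ^ m * (finrank F (LinearMap.range (S.δ m)) : ℤ) := by
    intro m
    induction m with
    | zero => simp only [chi, zero_add, Finset.sum_range_one, e1, e2, e4, pow_zero]; ring
    | succ m ih =>
      simp only [chi] at ih ⊢
      rw [sum_range_succ, sum_range_succ _ (m + 1), sum_range_succ _ (m + 1),
        e1 (m + 1), e2 (m + 1), e3 m]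
      linear_combination ih
  have hz : finrank F (LinearMap.range (S.δ r)) = 0 := by
    have h := LinearMap.finrank_range_le (S.δ r)
    have := finrank_zero_of_subsingleton (R := F) (M := C.H (r + 1))
    omega
  have := key r
  rw [hz] at this
  push_cast at this
  linarith
end Ses

/-- product complex -/
def prod (A B : Cx F) : Cx F where
  V n := A.V n × B.V n
  d n := prodMap (A.d n) (B.d n)
  dd n x := Prod.ext (A.dd n _) (B.dd n _)

/-- first projection -/
def fst (A B : Cx F) : Hom (A.prod B) A := ⟨fun n => LinearMap.fst F _ _, fun _ _ => rfl⟩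
/-- second projection -/
def snd (A B : Cx F) : Hom (A.prod B) B := ⟨fun n => LinearMap.snd F _ _, fun _ _ => rfl⟩

lemma prod_bij (A B : Cx F) (n : ℕ) :
  Bijective (((fst A B).map n).prod ((snd A B).map n)) := by
  constructor
  · rw [injective_iff_map_eq_zero]
    intro x hx
    obtain ⟨x, rfl⟩ := (A.prod B).cls_surj n x
    obtain ⟨y1, h1⟩ := (cls_zero ((fst A B).zmap n x)).1 (congrArg Prod.fst hx)
    obtain ⟨y2, h2⟩ := (cls_zero ((snd A B).zmap n x)).1 (congrArg Prod.snd hx)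
    rw [cls_zero]
    exact ⟨(y1, y2), Prod.ext h1 h2⟩
  · rintro ⟨x, y⟩
    obtain ⟨x, rfl⟩ := A.cls_surj n x
    obtain ⟨y, rfl⟩ := B.cls_surj n y
    exact ⟨(A.prod B).cls n ⟨(x, y), Prod.ext x.2 y.2⟩, rfl⟩

lemma prod_b {A B : Cx F} {n : ℕ} (hA : Module.Finite F (A.H n)) (hB : Module.Finite F (B.H n)) :
  (A.prod B).b n = A.b n + B.b n := by
  rw [b, (ofBijective _ (prod_bij A B n)).finrank_eq, Module.finrank_prod]; rfl

lemma prod_fin {A B : Cx F} {n : ℕ} :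
  Module.Finite F ((A.prod B).H n) ↔ Module.Finite F (A.H n) ∧ Module.Finite F (B.H n) := by
  rw [Module.Finite.equiv_iff (ofBijective _ (prod_bij A B n))]
  constructor
  · intro h
    exact ⟨Module.Finite.of_surjective (LinearMap.fst F (A.H n) (B.H n)) LinearMap.fst_surjective,
      Module.Finite.of_surjective (LinearMap.snd F (A.H n) (B.H n)) LinearMap.snd_surjective⟩
  · rintro ⟨h1, h2⟩; infer_instance

end Cx
end PG

namespace PG

/-! ### Filtered cochain objects and their dual complexes -/
section FCsec

lemma dual_ext {F V V' : Type} [Field F] [AddCommGroup V] [Module F V] [AddCommGroup V']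
  [Module F V'] (t : V →ₗ[F] V') (S : Submodule F V) (φ : Dual F V)
  (h : ∀ v ∈ S, t v = 0 → φ v = 0) : ∃ ψ : Dual F V', ∀ v ∈ S, ψ (t v) = φ v := by
  have : φ ∘ₗ S.subtype ∈ LinearMap.range (t ∘ₗ S.subtype).dualMap := by
    rw [LinearMap.range_dualMap_eq_dualAnnihilator_ker, Submodule.mem_dualAnnihilator]
    intro w hw
    exact h w w.2 hw
  obtain ⟨ψ, hψ⟩ := this
  exact ⟨ψ, fun v hv => LinearMap.congr_fun hψ ⟨v, hv⟩⟩

/-- A cochain module with a tower of graded subcomplexes. -/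
structure FC (F V : Type) [Field F] [AddCommGroup V] [Module F V] where
  d : V →ₗ[F] V
  dd : ∀ v, d (d v) = 0
  W : ℕ → ℕ → Submodule F V
  anti : ∀ n {i j}, i ≤ j → W j n ≤ W i n
  dW : ∀ {i n v}, v ∈ W i n → d v ∈ W i (n + 1)

namespace FC
variable {F V V' V'' : Type} [Field F] [AddCommGroup V] [Module F V] [AddCommGroup V']
    [Module F V'] [AddCommGroup V''] [Module F V'']

def LZ (A : FC F V) (n : ℕ) : Submodule F (Dual F V) where
  carrier := {φ | ∃ i, ∀ v ∈ A.W i n, φ v = 0}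
  add_mem' := by
    rintro φ ψ ⟨i, hi⟩ ⟨j, hj⟩
    refine ⟨max i j, fun v hv => ?_⟩
    rw [LinearMap.add_apply, hi v (A.anti n (le_max_left _ _) hv),
      hj v (A.anti n (le_max_right _ _) hv), add_zero]
  zero_mem' := ⟨0, fun _ _ => rfl⟩
  smul_mem' := by
    rintro c φ ⟨i, hi⟩
    exact ⟨i, fun v hv => by rw [LinearMap.smul_apply, hi v hv, smul_zero]⟩


/-- the dual chain complex -/
def L (A : FC F V) : Cx F where
  V n := Dual F V ⧸ A.LZ n
  d n := mapQ _ _ A.d.dualMap (by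
    rintro φ ⟨i, hi⟩
    exact ⟨i, fun v hv => hi _ (A.dW hv)⟩)
  dd n x := by
    obtain ⟨φ, rfl⟩ := mkQ_surjective _ x
    simp only [mkQ_apply, Submodule.mapQ_apply]
    have : A.d.dualMap (A.d.dualMap φ) = 0 := by
      ext v
      show φ (A.d (A.d v)) = 0
      rw [A.dd, map_zero]
    rw [this]; rfl

/-- class of a functional -/
def cl (A : FC F V) (n : ℕ) : Dual F V →ₗ[F] A.L.V n := mkQ (A.LZ n)

lemma cl_surj (A : FC F V) (n : ℕ) : Surjective (A.cl n) := mkQ_surjective _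

lemma cl_zero {A : FC F V} {n : ℕ} {φ : Dual F V} :
  A.cl n φ = 0 ↔ ∃ i, ∀ v ∈ A.W i n, φ v = 0 := by
  exact (Submodule.Quotient.mk_eq_zero (A.LZ n) (x := φ))

lemma cl_eq {A : FC F V} {n : ℕ} {φ ψ : Dual F V} :
  A.cl n φ = A.cl n ψ ↔ ∃ i, ∀ v ∈ A.W i n, φ v = ψ v := by
  rw [← sub_eq_zero, ← map_sub, cl_zero]
  simp only [LinearMap.sub_apply, sub_eq_zero]

lemma d_cl (A : FC F V) (n : ℕ) (φ : Dual F V) :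
  A.L.d n (A.cl (n + 1) φ) = A.cl n (φ ∘ₗ A.d) := rfl

/-- morphisms -/
structure Map (A : FC F V) (B : FC F V') (t : V →ₗ[F] V') : Prop where
  comm : ∀ v, t (A.d v) = B.d (t v)
  le : ∀ n i', ∃ i, ∀ v ∈ A.W i n, t v ∈ B.W i' n

/-- induced chain map -/
def Map.L {A : FC F V} {B : FC F V'} {t : V →ₗ[F] V'} (h : Map A B t) : Cx.Hom B.L A.L where
  f n := mapQ _ _ t.dualMap (by
    rintro φ ⟨i, hi⟩
    obtain ⟨j, hj⟩ := h.le n i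
    exact ⟨j, fun v hv => hi _ (hj v hv)⟩)
  comm n x := by
    obtain ⟨φ, rfl⟩ := mkQ_surjective _ x
    show A.cl n ((φ ∘ₗ t) ∘ₗ A.d) = A.cl n ((φ ∘ₗ B.d) ∘ₗ t)
    congr 1
    ext v
    exact congrArg φ (h.comm v)

lemma Map.L_cl {A : FC F V} {B : FC F V'} {t : V →ₗ[F] V'} (h : Map A B t) (n : ℕ)
  (φ : Dual F V') : h.L.f n (B.cl n φ) = A.cl n (φ ∘ₗ t) := rfl

lemma Map.comp {A : FC F V} {B : FC F V'} {C : FC F V''} {t : V →ₗ[F] V'} {s : V' →ₗ[F] V''}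
  (h' : Map B C s) (h : Map A B t) : Map A C (s ∘ₗ t) where
  comm v := by simp [h.comm, h'.comm]
  le n i' := by
    obtain ⟨i, hi⟩ := h'.le n i'
    obtain ⟨j, hj⟩ := h.le n i
    exact ⟨j, fun v hv => hi _ (hj v hv)⟩

/-- pro-exactness gives exactness -/
lemma ses {A : FC F V} {B : FC F V'} {C : FC F V''} {j : V →ₗ[F] V'} {q : V' →ₗ[F] V''}
  (hj : Map A B j) (hq : Map B C q)
  (inj : ∀ n, ∃ i, ∀ v ∈ A.W i n, j v = 0 → v = 0)
  (qj : ∀ n, ∃ i, ∀ v ∈ A.W i n, q (j v) = 0)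
  (mid : ∀ n i, ∃ i', ∀ v ∈ B.W i' n, q v = 0 → ∃ a ∈ A.W i n, j a = v)
  (sur : ∀ n i, ∃ i', ∀ w ∈ C.W i' n, ∃ v ∈ B.W i n, q v = w) : Cx.Ses hq.L hj.L where
  inj n := by
    rw [injective_iff_map_eq_zero]
    intro x hx
    obtain ⟨φ, rfl⟩ := C.cl_surj n x
    rw [Map.L_cl, cl_zero] at hx
    obtain ⟨i, hi⟩ := hx
    obtain ⟨i', hi'⟩ := sur n i
    refine cl_zero.2 ⟨i', fun w hw => ?_⟩
    obtain ⟨v, hv, rfl⟩ := hi' w hw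
    exact hi v hv
  ex n := by
    intro x
    obtain ⟨ψ, rfl⟩ := B.cl_surj n x
    constructor
    · intro h
      rw [Map.L_cl, cl_zero] at h
      obtain ⟨i, hi⟩ := h
      obtain ⟨i', hi'⟩ := mid n i
      obtain ⟨φ, hφ⟩ := dual_ext q (B.W i' n) ψ (by
        intro v hv h0
        obtain ⟨a, ha, rfl⟩ := hi' v hv h0
        exact hi a ha)
      exact ⟨C.cl n φ, by rw [Map.L_cl, cl_eq]; exact ⟨i', hφ⟩⟩
    · rintro ⟨y, hy⟩
      obtain ⟨φ, rfl⟩ := C.cl_surj n y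
      rw [← hy, Map.L_cl, Map.L_cl, cl_zero]
      obtain ⟨i, hi⟩ := qj n
      exact ⟨i, fun v hv => by simp [hi v hv]⟩
  surj n := by
    intro x
    obtain ⟨φ, rfl⟩ := A.cl_surj n x
    obtain ⟨i, hi⟩ := inj n
    obtain ⟨ψ, hψ⟩ := dual_ext j (A.W i n) φ fun v hv h0 => by rw [hi v hv h0, map_zero]
    exact ⟨B.cl n ψ, by rw [Map.L_cl, cl_eq]; exact ⟨i, hψ⟩⟩

/-- vanishing -/
lemma L_sub {A : FC F V} {n : ℕ}
  (h : ∀ i, ∃ i' ≥ i, ∀ v ∈ A.W i' (n + 1), A.d v = 0 → ∃ w ∈ A.W i n, A.d w = v) :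
  Subsingleton (A.L.H n) := by
  refine subsingleton_of_forall_eq 0 fun x => ?_
  obtain ⟨⟨x, hx⟩, rfl⟩ := Cx.cls_surj _ n x
  obtain ⟨φ, rfl⟩ := A.cl_surj (n + 1) x
  rw [mem_ker, d_cl, cl_zero] at hx
  obtain ⟨i, hi⟩ := hx
  obtain ⟨i', hii, hi'⟩ := h i
  obtain ⟨χ, hχ⟩ := dual_ext A.d (A.W i' (n + 1)) φ fun v hv h0 => by
    obtain ⟨w, hw, rfl⟩ := hi' v hv h0
    exact hi w hw
  rw [Cx.cls_zero]
  exact ⟨A.cl _ χ, by rw [d_cl]; exact cl_eq.2 ⟨i', hχ⟩⟩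

lemma L_V0 {A : FC F V} {i : ℕ} (h : ∀ v ∈ A.W i 0, v = 0) : Subsingleton (A.L.V 0) := by
  refine subsingleton_of_forall_eq 0 fun x => ?_
  obtain ⟨φ, rfl⟩ := A.cl_surj 0 x
  exact cl_zero.2 ⟨i, fun v hv => by rw [h v hv, map_zero]⟩

/-- image of a filtered cochain object -/
def im (A : FC F V) (s : V →ₗ[F] V) (hs : ∀ v, s (A.d v) = A.d (s v)) : FC F V where
  d := A.d
  dd := A.dd
  W i n := (A.W i n).map s
  anti n _ _ h := map_mono (A.anti n h)
  dW := by
    rintro i n _ ⟨v, hv, rfl⟩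
    exact ⟨A.d v, A.dW hv, hs v⟩

/-- product -/
def prod (A : FC F V) (B : FC F V') : FC F (V × V') where
  d := prodMap A.d B.d
  dd v := Prod.ext (A.dd _) (B.dd _)
  W i n := (A.W i n).prod (B.W i n)
  anti n _ _ h := fun v hv => ⟨A.anti n h hv.1, B.anti n h hv.2⟩
  dW hv := ⟨A.dW hv.1, B.dW hv.2⟩

/-- product comparison -/
def prodHom (A : FC F V) (B : FC F V') : Cx.Hom (Cx.prod A.L B.L) (A.prod B).L where
  f n := LinearMap.coprod
    (mapQ _ _ (LinearMap.fst F V V').dualMap (by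
      rintro φ ⟨i, hi⟩
      exact ⟨i, fun v hv => hi _ hv.1⟩))
    (mapQ _ _ (LinearMap.snd F V V').dualMap (by
      rintro φ ⟨i, hi⟩
      exact ⟨i, fun v hv => hi _ hv.2⟩))
  comm n x := by
    obtain ⟨x, y⟩ := x
    obtain ⟨φ, rfl⟩ := A.cl_surj _ x
    obtain ⟨ψ, rfl⟩ := B.cl_surj _ y
    show (A.prod B).cl n ((φ ∘ₗ LinearMap.fst F V V' + ψ ∘ₗ LinearMap.snd F V V') ∘ₗ (A.prod B).d)
      = (A.prod B).cl n ((φ ∘ₗ A.d) ∘ₗ LinearMap.fst F V V' + (ψ ∘ₗ B.d) ∘ₗ LinearMap.snd F V V')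
    rfl

lemma prodHom_bij (A : FC F V) (B : FC F V') (n : ℕ) :
  Bijective ((prodHom A B).f n) := by
  constructor
  · rw [injective_iff_map_eq_zero]
    rintro ⟨x, y⟩ h
    obtain ⟨φ, rfl⟩ := A.cl_surj _ x
    obtain ⟨ψ, rfl⟩ := B.cl_surj _ y
    have h : (A.prod B).cl n (φ ∘ₗ LinearMap.fst F V V' + ψ ∘ₗ LinearMap.snd F V V') = 0 := h
    obtain ⟨i, hi⟩ := cl_zero.1 h
    refine Prod.ext (cl_zero.2 ⟨i, fun v hv => ?_⟩) (cl_zero.2 ⟨i, fun v hv => ?_⟩)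
    · simpa using hi (v, 0) ⟨hv, zero_mem _⟩
    · simpa using hi (0, v) ⟨zero_mem _, hv⟩
  · intro x
    obtain ⟨φ, rfl⟩ := (A.prod B).cl_surj _ x
    refine ⟨(A.cl n (φ ∘ₗ inl F V V'), B.cl n (φ ∘ₗ inr F V V')), ?_⟩
    show (A.prod B).cl n ((φ ∘ₗ inl F V V') ∘ₗ LinearMap.fst F V V' +
      (φ ∘ₗ inr F V V') ∘ₗ LinearMap.snd F V V') = _
    congr 1
    ext v <;> simp [show ((0 : V), (0 : V')) = 0 from rfl]

end FC

namespace Cx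
variable {F : Type} [Field F] {A B C D : Cx F}

lemma Ses.precomp {f : Hom A B} {g : Hom B C} (S : Ses f g) (e : Hom D A)
  (he : ∀ n, Bijective (e.f n)) : Ses (f.comp e) g where
  inj n := (S.inj n).comp (he n).1
  ex n := by
    intro x
    rw [S.ex n x]
    constructor
    · rintro ⟨y, rfl⟩
      obtain ⟨z, rfl⟩ := (he n).2 y
      exact ⟨z, rfl⟩
    · rintro ⟨y, rfl⟩; exact ⟨_, rfl⟩
  surj := S.surj

end Cx
end FCsec
end PG

namespace PG

/-! ### Free cyclic actions, abstractly -/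
section Dat
variable {F V : Type} [Field F] [AddCommGroup V] [Module F V]

/-- `s'` and `s` are complementary operators: `ker s = im s'`. -/
structure Pair (A : FC F V) (s s' : End F V) : Prop where
  sd : ∀ v, s (A.d v) = A.d (s v)
  sd' : ∀ v, s' (A.d v) = A.d (s' v)
  sW : ∀ {i n v}, v ∈ A.W i n → s v ∈ A.W i n
  sW' : ∀ {i n v}, v ∈ A.W i n → s' v ∈ A.W i n
  ss : ∀ v, s (s' v) = 0
  ker : ∀ {i n v}, v ∈ A.W i n → s v = 0 → ∃ w ∈ A.W i n, s' w = v

namespace Pair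
variable {A : FC F V} {s s' : End F V}

lemma incl (P : Pair A s s') : FC.Map (A.im s' P.sd') A LinearMap.id where
  comm _ := rfl
  le n i := ⟨i, by rintro _ ⟨v, hv, rfl⟩; exact P.sW' hv⟩

lemma quo (P : Pair A s s') : FC.Map A (A.im s P.sd) s where
  comm := P.sd
  le n i := ⟨i, fun v hv => ⟨v, hv, rfl⟩⟩

lemma ses (P : Pair A s s') : Cx.Ses P.quo.L P.incl.L := by
  refine FC.ses P.incl P.quo ?_ ?_ ?_ ?_
  · exact fun n => ⟨0, fun v hv h => h⟩
  · refine fun n => ⟨0, ?_⟩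
    rintro _ ⟨v, hv, rfl⟩
    exact P.ss v
  · refine fun n i => ⟨i, fun v hv h => ?_⟩
    obtain ⟨w, hw, rfl⟩ := P.ker hv h
    exact ⟨_, ⟨w, hw, rfl⟩, rfl⟩
  · refine fun n i => ⟨i, ?_⟩
    rintro _ ⟨v, hv, rfl⟩
    exact ⟨v, hv, rfl⟩

end Pair

lemma im_V0 {A : FC F V} {s : End F V} (sd : ∀ v, s (A.d v) = A.d (s v))
  (h0 : ∀ v ∈ A.W 0 0, v = 0) : ∀ v ∈ (A.im s sd).W 0 0, v = 0 := by
  rintro _ ⟨v, hv, rfl⟩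
  rw [h0 v hv, map_zero]

/-- the operators: `true` is the norm, `false` is `g - 1`. -/
def sop (p : ℕ) (g : End F V) : Bool → End F V
  | true => ∑ k ∈ Finset.range p, g ^ k
  | false => g - 1

/-- A free action datum of a cyclic group of order `p`. -/
structure FDat (A : FC F V) (p : ℕ) (g m : End F V) : Prop where
  gd : ∀ v, g (A.d v) = A.d (g v)
  gW : ∀ {i n v}, v ∈ A.W i n → g v ∈ A.W i n
  mW : ∀ {i n v}, v ∈ A.W i n → m v ∈ A.W i n
  gp : g ^ p = 1
  sum : ∀ {i n v}, v ∈ A.W i n → ∑ k ∈ Finset.range p, (g ^ k) (m ((g ^ (p - k)) v)) = v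

section ops
variable {p : ℕ} {g : End F V}

lemma sop_commute {h : End F V} (hg : Commute h g) (b : Bool) : Commute h (sop p g b) := by
  cases b
  · exact hg.sub_right (Commute.one_right h)
  · exact Commute.sum_right _ _ _ fun k _ => hg.pow_right k

lemma sop_mem {W : Submodule F V} (hW : ∀ v ∈ W, g v ∈ W) (b : Bool) {v : V} (hv : v ∈ W) :
  sop p g b v ∈ W := by
  have hk : ∀ k : ℕ, (g ^ k) v ∈ W := by
    intro k
    induction k with
    | zero => simpa
    | succ k ih => rw [pow_succ', End.mul_apply]; exact hW _ ih
  cases b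
  · exact sub_mem (hW v hv) hv
  · simp only [sop, LinearMap.sum_apply]; exact sum_mem fun k _ => hk k

lemma sop_mul (gp : g ^ p = 1) (b : Bool) : sop p g b * sop p g (!b) = 0 := by
  have h1 : (g - 1) * ∑ k ∈ Finset.range p, g ^ k = 0 := by rw [mul_geom_sum, gp, sub_self]
  cases b
  · exact h1
  · have h2 : (∑ k ∈ Finset.range p, g ^ k) * (g - 1) = 0 := by rw [geom_sum_mul, gp, sub_self]
    exact h2

lemma sop_true [hp : Fact p.Prime] [CharP F p] : sop p g true = sop p g false ^ (p - 1) := by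
  have h : ∑ k ∈ Finset.range p, (Polynomial.X : Polynomial F) ^ k
      = (Polynomial.X - 1) ^ (p - 1) := by
    have h0 : (Polynomial.X - 1 : Polynomial F) ≠ 0 := by
      simpa using Polynomial.X_sub_C_ne_zero (1 : F)
    apply mul_left_cancel₀ h0
    rw [mul_geom_sum, ← pow_succ', Nat.sub_add_cancel hp.1.one_le, sub_pow_char, one_pow]
  have := congrArg (Polynomial.aeval g) h
  simpa [sop] using this

lemma sop_pow [hp : Fact p.Prime] [CharP F p] (gp : g ^ p = 1) (b : Bool) :
  sop p g b ^ p = 0 := by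
  have h : sop p g false ^ p = 0 := by
    have : CharP (End F V) p ∨ Subsingleton V := by
      by_cases hV : Subsingleton V
      · exact Or.inr hV
      · left
        rw [not_subsingleton_iff_nontrivial] at hV
        exact charP_of_injective_algebraMap (FaithfulSMul.algebraMap_injective F (End F V)) p
    rcases this with h | h
    · show (g - 1) ^ p = 0
      rw [sub_pow_char_of_commute p (Commute.one_right g), gp, one_pow, sub_self]
    · exact Subsingleton.elim _ _
  cases b
  · exact h
  · rw [sop_true, ← pow_mul, mul_comm, pow_mul, h, zero_pow]
    have := hp.1.two_le; omega

end ops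

namespace FDat
variable {A : FC F V} {p : ℕ} {g m : End F V}

lemma pow_mem (D : FDat A p g m) {i n : ℕ} {v : V} (hv : v ∈ A.W i n) (k : ℕ) :
  (g ^ k) v ∈ A.W i n := by
  induction k with
  | zero => simpa
  | succ k ih => rw [pow_succ', End.mul_apply]; exact D.gW ih

lemma sop_d (D : FDat A p g m) (b : Bool) (v : V) : sop p g b (A.d v) = A.d (sop p g b v) := by
  have : Commute A.d g := LinearMap.ext fun v => (D.gd v).symm
  exact (LinearMap.congr_fun (sop_commute (p := p) this b) v).symm

lemma pair (D : FDat A p g m) (b : Bool) : Pair A (sop p g b) (sop p g (!b)) where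
  sd := D.sop_d b
  sd' := D.sop_d _
  sW hv := sop_mem (fun _ h => D.gW h) b hv
  sW' hv := sop_mem (fun _ h => D.gW h) _ hv
  ss v := LinearMap.congr_fun (sop_mul D.gp b) v
  ker := by
    intro i n v hv h
    cases b
    · have hg : g v = v := by simpa [sop, sub_eq_zero] using h
      have hk : ∀ k : ℕ, (g ^ k) v = v := by
        intro k
        induction k with
        | zero => simp
        | succ k ih => rw [pow_succ, End.mul_apply, hg, ih]
      refine ⟨m v, D.mW hv, ?_⟩
      have := D.sum hv
      simp only [hk] at this
      simpa [sop] using this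
    · have h1 : ∑ k ∈ Finset.range p, m ((g ^ (p - k)) v) = 0 := by
        rw [← map_sum]
        have : ∑ k ∈ Finset.range p, (g ^ (p - k)) v = sop p g true v := by
          simp only [sop, LinearMap.sum_apply]
          rcases Nat.eq_zero_or_pos p with rfl | hp
          · simp
          rw [← Finset.sum_range_reflect]
          have : ∀ k ∈ Finset.range p, (g ^ (p - (p - 1 - k))) v = (g ^ (k + 1)) v := by
            intro k hk
            have := Finset.mem_range.1 hk
            congr 2; omega
          rw [sum_congr rfl this]
          have e := sum_range_succ (fun k => (g ^ k) v) p
          rw [Finset.sum_range_succ', D.gp, pow_zero] at e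
          exact add_right_cancel e
        rw [this, h, map_zero]
      refine ⟨∑ k ∈ Finset.range p, ∑ j ∈ Finset.range k, (g ^ j) (m ((g ^ (p - k)) v)),
        sum_mem fun k _ => sum_mem fun j _ => D.pow_mem (D.mW (D.pow_mem hv _)) j, ?_⟩
      rw [map_sum]
      have h2 : ∀ k (w : V), sop p g (!true) (∑ j ∈ Finset.range k, (g ^ j) w) = (g ^ k) w - w := by
        intro k w
        have := LinearMap.congr_fun (mul_geom_sum g k) w
        simpa [sop] using this
      simp only [h2]
      rw [sum_sub_distrib, h1, sub_zero]
      exact D.sum hv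

/-- restriction of a datum to the image of a commuting operator -/
lemma im (D : FDat A p g m) {s : End F V} (sd : ∀ v, s (A.d v) = A.d (s v))
  (hg : Commute s g) (hm : Commute s m) : FDat (A.im s sd) p g m where
  gd := D.gd
  gW := by
    rintro i n _ ⟨v, hv, rfl⟩
    exact ⟨g v, D.gW hv, LinearMap.congr_fun hg v⟩
  mW := by
    rintro i n _ ⟨v, hv, rfl⟩
    exact ⟨m v, D.mW hv, LinearMap.congr_fun hm v⟩
  gp := D.gp
  sum := by
    rintro i n _ ⟨v, hv, rfl⟩
    conv_rhs => rw [← D.sum hv]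
    rw [map_sum]
    refine sum_congr rfl fun k _ => ?_
    have e1 : ∀ k w, (g ^ k) (s w) = s ((g ^ k) w) := fun k w =>
      (LinearMap.congr_fun (hg.pow_right k) w).symm
    have e2 : ∀ w, m (s w) = s (m w) := fun w => (LinearMap.congr_fun hm w).symm
    rw [e1, e2, e1]

section seq

lemma hi (D : FDat A p g m) {d N : ℕ} (hN : (A.im _ (D.sop_d true)).L.Bd N) (hA : A.L.Bd d) (b : Bool) :
  (A.im _ (D.sop_d b)).L.Bd d := by
  have step : ∀ b n, n > d → Subsingleton ((A.im _ (D.sop_d !b)).L.H (n + 1)) →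
      Subsingleton ((A.im _ (D.sop_d b)).L.H n) := fun b n hn h =>
    Cx.exact_sub ((D.pair b).ses.exact_A n) h (hA n hn)
  have hN' : ∀ b n, n > max N d → Subsingleton ((A.im _ (D.sop_d b)).L.H n) := by
    intro b n hn
    cases b
    · exact step false n (by omega) (hN (n + 1) (by omega))
    · exact hN n (by omega)
  have : ∀ k n b, n > d → n + k > max N d → Subsingleton ((A.im _ (D.sop_d b)).L.H n) := by
    intro k
    induction k with
    | zero => exact fun n b _ h => hN' b n h
    | succ k ih => exact fun n b hn h => step b n hn (ih (n + 1) (!b) (by omega) (by omega))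
  exact fun n hn => this (max N d) n b hn (by omega)

lemma fin_sop (D : FDat A p g m) {N : ℕ} (hN : (A.im _ (D.sop_d true)).L.Bd N) (hA : A.L.Fin) (b : Bool) :
  (A.im _ (D.sop_d b)).L.Fin := by
  have step : ∀ b n, Module.Finite F ((A.im _ (D.sop_d !b)).L.H (n + 1)) →
      Module.Finite F ((A.im _ (D.sop_d b)).L.H n) := fun b n h =>
    Cx.exact_finite ((D.pair b).ses.exact_A n) h (hA n)
  have hN' : ∀ n, n > N → Module.Finite F ((A.im _ (D.sop_d true)).L.H n) := by
    intro n hn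
    have := hN n hn
    exact Module.Finite.of_finite
  have : ∀ k n b, n + k > N → Module.Finite F ((A.im _ (D.sop_d b)).L.H n) := by
    intro k
    induction k with
    | zero =>
      intro n b h
      cases b
      · exact step false n (hN' (n + 1) (by omega))
      · exact hN' n h
    | succ k ih => exact fun n b h => step b n (ih (n + 1) (!b) (by omega))
  exact fun n => this (N + 1) n b (by omega)

lemma lo (D : FDat A p g m) {a : ℕ} (h0 : ∀ v ∈ A.W 0 0, v = 0) (hA : ∀ n < a, Subsingleton (A.L.H n)) :
  ∀ n < a, ∀ b, Subsingleton ((A.im _ (D.sop_d b)).L.H n) := by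
  intro n
  induction n with
  | zero =>
    intro hn b
    have := hA 0 hn
    cases b
    · exact ((D.pair true).ses.surj_zero (FC.L_V0 h0)).subsingleton
    · exact ((D.pair false).ses.surj_zero (FC.L_V0 h0)).subsingleton
  | succ n ih =>
    intro hn b
    cases b
    · exact Cx.exact_sub ((D.pair true).ses.exact_C n) (hA _ hn) (ih (by omega) _)
    · exact Cx.exact_sub ((D.pair false).ses.exact_C n) (hA _ hn) (ih (by omega) _)

end seq
end FDat
end Dat
end PG

namespace PG

section
variable {F V V' : Type} [Field F] [AddCommGroup V] [Module F V] [AddCommGroup V'] [Module F V']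

lemma FC.ext_of {A B : FC F V} (hd : A.d = B.d) (hW : A.W = B.W) : A = B := by
  cases A; cases B; cases hd; cases hW; rfl

lemma FC.im_eq {A : FC F V} {s s' : End F V} (h : s = s') (sd sd') :
  A.im s sd = A.im s' sd' := by subst h; rfl

namespace FDat
variable {A : FC F V} {p : ℕ} {g m : End F V}

lemma chi_mul [hp : Fact p.Prime] [CharP F p] (D : FDat A p g m) (h0 : ∀ v ∈ A.W 0 0, v = 0)
  {r : ℕ} (hN : (A.im _ (D.sop_d true)).L.Bd r) (hfin : A.L.Fin) :
  A.L.chi r = p * (A.im _ (D.sop_d true)).L.chi r := by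
  have hS := D.fin_sop hN hfin true
  set S := A.im _ (D.sop_d true) with hSdef
  set t := sop p g false with ht
  have td : ∀ k v, (t ^ k) (A.d v) = A.d ((t ^ k) v) := by
    intro k v
    induction k with
    | zero => rfl
    | succ k ih => rw [pow_succ', End.mul_apply, ih, D.sop_d]; rfl
  have hSt : S = A.im (t ^ (p - 1)) (td _) := FC.im_eq sop_true _ _
  have key : ∀ k < p, (A.im (t ^ (p - 1 - k)) (td _)).L.Fin ∧ (A.im (t ^ (p - 1 - k)) (td _)).L.Bd r ∧
      (A.im (t ^ (p - 1 - k)) (td _)).L.chi r = (k + 1 : ℕ) * S.L.chi r := by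
    intro k
    induction k with
    | zero => intro _; rw [Nat.sub_zero, ← hSt]; exact ⟨hS, hN, by simp⟩
    | succ k ih =>
      intro hk
      obtain ⟨h1, h2, h3⟩ := ih (by omega)
      obtain ⟨j, hj⟩ : ∃ j, p - 1 - (k + 1) = j := ⟨_, rfl⟩
      have hj1 : p - 1 - k = j + 1 := by omega
      have hj2 : p - 1 = (k + 1) + j := by omega
      rw [hj]
      simp only [hj1] at h1 h2 h3
      have m1 : FC.Map (A.im (t ^ (j + 1)) (td _)) (A.im (t ^ j) (td _)) LinearMap.id := by
        refine ⟨fun _ => rfl, fun n i => ⟨i, ?_⟩⟩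
        rintro _ ⟨v, hv, rfl⟩
        exact ⟨t v, sop_mem (fun _ h => D.gW h) _ hv, by
          rw [← End.mul_apply, ← pow_succ]; rfl⟩
      have m2 : FC.Map (A.im (t ^ j) (td _)) S (t ^ (k + 1)) := by
        refine ⟨td _, fun n i => ⟨i, ?_⟩⟩
        rintro _ ⟨v, hv, rfl⟩
        rw [hSt]
        exact ⟨v, hv, by rw [hj2, pow_add t (k + 1) j]; rfl⟩
      have ss : Cx.Ses m2.L m1.L := by
        refine FC.ses m1 m2 ?_ ?_ ?_ ?_
        · exact fun n => ⟨0, fun v hv h => h⟩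
        · refine fun n => ⟨0, ?_⟩
          rintro _ ⟨v, hv, rfl⟩
          show (t ^ (k + 1)) ((t ^ (j + 1)) v) = 0
          rw [← End.mul_apply, ← pow_add, show k + 1 + (j + 1) = p by omega,
            sop_pow D.gp]; rfl
        · refine fun n i => ⟨i, ?_⟩
          rintro _ ⟨v, hv, rfl⟩ h
          have h' : sop p g true v = 0 := by
            rw [sop_true, ← ht, hj2, pow_add]; exact h
          obtain ⟨w, hw, rfl⟩ := (D.pair true).ker hv h'
          exact ⟨_, ⟨w, hw, rfl⟩, by rw [pow_succ]; rfl⟩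
        · refine fun n i => ⟨i, ?_⟩
          rw [hSt]
          rintro _ ⟨v, hv, rfl⟩
          exact ⟨_, ⟨v, hv, rfl⟩, by rw [hj2, pow_add t (k + 1) j]; rfl⟩
      refine ⟨ss.fin_B hS h1, ss.bd_B hN h2, ?_⟩
      rw [ss.chi_add (FC.L_V0 (im_V0 _ h0)) hS h1 h2, h3]
      push_cast; ring
  have := (key (p - 1) (by have := hp.1.pos; omega)).2.2
  rw [show p - 1 + 1 = p by have := hp.1.pos; omega] at this
  rw [← this]
  congr 2
  refine FC.ext_of rfl ?_
  funext i n
  show _ = (A.W i n).map _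
  rw [Nat.sub_self, pow_zero]
  exact (Submodule.map_id _).symm

end FDat

/-- Sphere-like complexes -/
def Sph (C : Cx F) (d : ℕ) : Prop := C.Fin ∧ ∀ n, C.b n = if n = d then 1 else 0

/-- Smith theory datum -/
structure SDat (A Q : FC F V) (B : FC F V') (res : V →ₗ[F] V') (p : ℕ)
    (g m : End F V) : Prop where
  D : FDat Q p g m
  hd : Q.d = A.d
  le : ∀ {i n v}, v ∈ Q.W i n → v ∈ A.W i n
  hres : FC.Map A B res
  ker : ∀ {i n v}, v ∈ A.W i n → res v = 0 → v ∈ Q.W i n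
  zero : ∀ {i n v}, v ∈ Q.W i n → res v = 0
  lift : ∀ {i n w}, w ∈ B.W i n → ∃ v ∈ A.W i n, res v = w ∧ g v = v
  resW : ∀ {i n v}, v ∈ A.W i n → res v ∈ B.W i n

namespace SDat
variable {A Q : FC F V} {B : FC F V'} {res : V →ₗ[F] V'} {p : ℕ} {g m : End F V}

lemma sop_fix [CharP F p] {u : V} (hu : g u = u) (b : Bool) : sop p g b u = 0 := by
  have hk : ∀ k : ℕ, (g ^ k) u = u := by
    intro k
    induction k with
    | zero => simp
    | succ k ih => rw [pow_succ, End.mul_apply, hu, ih]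
  cases b
  · simp [sop, hu]
  · simp only [sop, LinearMap.sum_apply, hk, sum_const, Finset.card_range]
    rw [← Nat.cast_smul_eq_nsmul F, CharP.cast_eq_zero, zero_smul]

lemma incl (S : SDat A Q B res p g m) : FC.Map Q A LinearMap.id where
  comm v := by simp [S.hd]
  le n i := ⟨i, fun v hv => S.le hv⟩

lemma ses0 (S : SDat A Q B res p g m) : Cx.Ses S.hres.L S.incl.L := by
  refine FC.ses S.incl S.hres ?_ ?_ ?_ ?_
  · exact fun n => ⟨0, fun v hv h => h⟩
  · exact fun n => ⟨0, fun v hv => S.zero hv⟩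
  · exact fun n i => ⟨i, fun v hv h => ⟨v, S.ker hv h, rfl⟩⟩
  · refine fun n i => ⟨i, fun w hw => ?_⟩
    obtain ⟨v, hv, h, _⟩ := S.lift hw
    exact ⟨v, hv, h⟩

lemma decomp (S : SDat A Q B res p g m) {i n v} (hv : v ∈ A.W i n) :
  ∃ u, g u = u ∧ v - u ∈ Q.W i n := by
  obtain ⟨u, hu, h1, h2⟩ := S.lift (S.resW hv)
  exact ⟨u, h2, S.ker (sub_mem hv hu) (by rw [map_sub, h1, sub_self])⟩

lemma map1 (S : SDat A Q B res p g m) (b : Bool) :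
  FC.Map (Q.im _ (S.D.sop_d b)) A LinearMap.id where
  comm v := by simp [S.hd, FC.im]
  le n i := ⟨i, by
    rintro _ ⟨v, hv, rfl⟩
    exact S.le (sop_mem (fun _ h => S.D.gW h) b hv)⟩

lemma map2 [CharP F p] (S : SDat A Q B res p g m) (b : Bool) :
  FC.Map A ((Q.im _ (S.D.sop_d b)).prod B) ((sop p g b).prod res) where
  comm v := by
    have := S.D.sop_d b v
    rw [S.hd] at this
    exact Prod.ext (by simpa [FC.prod, FC.im, S.hd] using this) (S.hres.comm v)
  le n i := ⟨i, fun v hv => by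
    obtain ⟨u, hu, hq⟩ := S.decomp hv
    exact ⟨⟨_, hq, by rw [map_sub, sop_fix hu, sub_zero]; rfl⟩, S.resW hv⟩⟩

lemma ses1 [CharP F p] (S : SDat A Q B res p g m) (b : Bool) :
  Cx.Ses ((S.map2 b).L.comp (FC.prodHom _ _)) (S.map1 !b).L := by
  refine Cx.Ses.precomp (FC.ses (S.map1 !b) (S.map2 b) ?_ ?_ ?_ ?_) _ (FC.prodHom_bij _ _)
  · exact fun n => ⟨0, fun v hv h => h⟩
  · refine fun n => ⟨0, ?_⟩
    rintro _ ⟨v, hv, rfl⟩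
    exact Prod.ext (LinearMap.congr_fun (sop_mul S.D.gp b) v)
      (S.zero (sop_mem (fun _ h => S.D.gW h) _ hv))
  · refine fun n i => ⟨i, fun v hv h => ?_⟩
    obtain ⟨w, hw, rfl⟩ := (S.D.pair b).ker (S.ker hv (congrArg Prod.snd h)) (congrArg Prod.fst h)
    exact ⟨_, ⟨w, hw, rfl⟩, rfl⟩
  · refine fun n i => ⟨i, ?_⟩
    rintro ⟨_, w⟩ ⟨⟨q, hq, rfl⟩, hw⟩
    obtain ⟨v, hv, h, hg⟩ := S.lift hw
    refine ⟨q + v, add_mem (S.le hq) hv, Prod.ext ?_ ?_⟩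
    · show sop p g b (q + v) = sop p g b q
      rw [map_add, sop_fix hg, add_zero]
    · show res (q + v) = w
      rw [map_add, S.zero hq, h, zero_add]

lemma prod_sub {C D : Cx F} {n : ℕ} (h : Subsingleton ((C.prod D).H n)) :
  Subsingleton (C.H n) ∧ Subsingleton (D.H n) := by
  have := (Cx.prod_bij C D n).2.subsingleton
  exact ⟨(Prod.fst_surjective (α := C.H n) (β := D.H n)).subsingleton,
    (Prod.snd_surjective (α := C.H n) (β := D.H n)).subsingleton⟩

lemma bd [CharP F p] (S : SDat A Q B res p g m) {N : ℕ} (hA : A.L.Bd N)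
  (hN : (Q.im _ (S.D.sop_d true)).L.Bd N) :
  B.L.Bd N ∧ ∀ b, (Q.im _ (S.D.sop_d b)).L.Bd N := by
  have h1 : ∀ n > N, Subsingleton ((Q.im _ (S.D.sop_d false)).L.H n) ∧ Subsingleton (B.L.H n) :=
    fun n hn => prod_sub (Cx.exact_sub ((S.ses1 false).exact_A n) (hN (n + 1) (by omega)) (hA n hn))
  refine ⟨fun n hn => (h1 n hn).2, fun b => ?_⟩
  cases b
  · exact fun n hn => (h1 n hn).1
  · exact hN

lemma fin [CharP F p] (S : SDat A Q B res p g m) {N : ℕ} (hA : A.L.Bd N) (hf : A.L.Fin)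
  (hN : (Q.im _ (S.D.sop_d true)).L.Bd N) :
  B.L.Fin ∧ ∀ b, (Q.im _ (S.D.sop_d b)).L.Fin := by
  obtain ⟨h1, h2⟩ := S.bd hA hN
  have : ∀ k n, n + k > N → Module.Finite F (B.L.H n) ∧
      ∀ b, Module.Finite F ((Q.im _ (S.D.sop_d b)).L.H n) := by
    intro k
    induction k with
    | zero =>
      intro n hn
      have e1 := h1 n hn
      refine ⟨Module.Finite.of_finite, fun b => ?_⟩
      have e2 := h2 b n hn
      exact Module.Finite.of_finite
    | succ k ih =>
      intro n hn
      have : ∀ b, _ := fun b => Cx.prod_fin.1 (Cx.exact_finite ((S.ses1 b).exact_A n)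
        ((ih (n + 1) (by omega)).2 _) (hf n))
      exact ⟨(this true).2, fun b => (this b).1⟩
  exact ⟨fun n => (this (N + 1) n (by omega)).1, fun b n => (this (N + 1) n (by omega)).2 b⟩

lemma ineq [CharP F p] (S : SDat A Q B res p g m) {N : ℕ} (hA : A.L.Bd N) (hf : A.L.Fin)
  (hN : (Q.im _ (S.D.sop_d true)).L.Bd N) (b : Bool) (n : ℕ) :
  (Q.im _ (S.D.sop_d b)).L.b n + B.L.b n ≤ (Q.im _ (S.D.sop_d !b)).L.b (n + 1) + A.L.b n := by
  obtain ⟨h1, h2⟩ := S.fin hA hf hN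
  rw [← Cx.prod_b (h2 b n) (h1 n)]
  exact Cx.exact_finrank_le ((S.ses1 b).exact_A n) (h2 _ _) (hf n)

lemma sum_le [CharP F p] (S : SDat A Q B res p g m) {N : ℕ} (hA : A.L.Bd N) (hf : A.L.Fin)
  (hN : (Q.im _ (S.D.sop_d true)).L.Bd N) (n : ℕ) :
  ∑ i ∈ Ico n (N + 1), B.L.b i ≤ ∑ i ∈ Ico n (N + 1), A.L.b i := by
  have : ∀ k n b, n + k = N + 1 → (Q.im _ (S.D.sop_d b)).L.b n + ∑ i ∈ Ico n (N + 1), B.L.b i ≤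
      ∑ i ∈ Ico n (N + 1), A.L.b i := by
    intro k
    induction k with
    | zero =>
      intro n b hn
      have := (S.bd hA hN).2 b n (by omega)
      rw [Cx.b, finrank_zero_of_subsingleton]
      simp [show n = N + 1 by omega]
    | succ k ih =>
      intro n b hn
      rw [Finset.sum_eq_sum_Ico_succ_bot (show n < N + 1 by omega) (fun i => B.L.b i),
        Finset.sum_eq_sum_Ico_succ_bot (show n < N + 1 by omega) (fun i => A.L.b i)]
      have := ih (n + 1) (!b) (by omega)
      have := S.ineq hA hf hN b n
      omega
  by_cases h : n ≤ N + 1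
  · have := this (N + 1 - n) n true (by omega)
    omega
  · rw [Finset.Ico_eq_empty (by omega)]; simp

lemma V0 (S : SDat A Q B res p g m) (h0 : ∀ v ∈ A.W 0 0, v = 0) : ∀ v ∈ Q.W 0 0, v = 0 :=
  fun v hv => h0 v (S.le hv)

lemma finQ [CharP F p] (S : SDat A Q B res p g m) (h0 : ∀ v ∈ A.W 0 0, v = 0)
  {N : ℕ} (hA : A.L.Bd N) (hf : A.L.Fin)
  (hN : (Q.im _ (S.D.sop_d true)).L.Bd N) : Q.L.Fin :=
  S.ses0.fin_C (FC.L_V0 h0) (S.fin hA hf hN).1 hf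

lemma bdQ [CharP F p] (S : SDat A Q B res p g m)
  {N : ℕ} (hA : A.L.Bd N) (hN : (Q.im _ (S.D.sop_d true)).L.Bd N) : Q.L.Bd N :=
  (S.D.pair true).ses.bd_B hN ((S.bd hA hN).2 false)

lemma chi_eq [hp : Fact p.Prime] [CharP F p] (S : SDat A Q B res p g m)
  (h0 : ∀ v ∈ A.W 0 0, v = 0) {N : ℕ} (hA : A.L.Bd N) (hf : A.L.Fin)
  (hN : (Q.im _ (S.D.sop_d true)).L.Bd N) :
  A.L.chi N = B.L.chi N + p * (Q.im _ (S.D.sop_d true)).L.chi N := by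
  rw [← S.D.chi_mul (S.V0 h0) hN (S.finQ h0 hA hf hN)]
  exact S.ses0.chi_add (FC.L_V0 h0) (S.fin hA hf hN).1 (S.finQ h0 hA hf hN) (S.bdQ hA hN)

lemma eq_zero [CharP F p] (S : SDat A Q B res p g m)
  {N : ℕ} (hA : A.L.Bd N) (hf : A.L.Fin)
  (hN : (Q.im _ (S.D.sop_d true)).L.Bd N) (hb : ∀ n, A.L.b n = B.L.b n) (n : ℕ) :
  Subsingleton (Q.L.H n) := by
  have key : ∀ k n b, n + k = N + 1 → (Q.im _ (S.D.sop_d b)).L.b n = 0 := by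
    intro k
    induction k with
    | zero =>
      intro n b hn
      have := (S.bd hA hN).2 b n (by omega)
      rw [Cx.b, finrank_zero_of_subsingleton]
    | succ k ih =>
      intro n b hn
      have h1 := ih (n + 1) (!b) (by omega)
      have h2 := S.ineq hA hf hN b n
      rw [h1, hb] at h2
      omega
  have : ∀ b, Subsingleton ((Q.im _ (S.D.sop_d b)).L.H n) := by
    intro b
    by_cases h : n ≤ N + 1
    · have := (S.fin hA hf hN).2 b n
      exact Module.finrank_zero_iff.1 (key (N + 1 - n) n b (by omega))
    · exact (S.bd hA hN).2 b n (by omega)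
  exact Cx.exact_sub ((S.D.pair true).ses.exact_B n) (this true) (this false)

lemma sph_chi {C : Cx F} {d N : ℕ} (h : Sph C d) (hd : d ≤ N) : C.chi N = (-1) ^ d := by
  unfold Cx.chi
  rw [sum_eq_single d]
  · simp [h.2 d]
  · intro n _ hn; simp [h.2 n, hn]
  · intro hh; simp at hh; omega

lemma sph [hp : Fact p.Prime] [CharP F p] (hodd : p ≠ 2) (S : SDat A Q B res p g m)
  (h0 : ∀ v ∈ A.W 0 0, v = 0) {N : ℕ} (hA : A.L.Bd N)
  (hN : (Q.im _ (S.D.sop_d true)).L.Bd N) {d : ℕ} (hS : Sph A.L d) :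
  ∃ e ≤ d, Sph B.L e ∧ e % 2 = d % 2 := by
  have hf := hS.1
  have hdN : d ≤ N := by
    by_contra h
    have := hA d (by omega)
    have h1 := hS.2 d
    rw [Cx.b, finrank_zero_of_subsingleton] at h1
    simp at h1
  have hB := (S.bd hA hN).1
  have hBf := (S.fin hA hf hN).1
  have c := S.chi_eq h0 hA hf hN
  rw [sph_chi hS hdN] at c
  have s0 := S.sum_le hA hf hN 0
  have s1 := S.sum_le hA hf hN (d + 1)
  have t0 : ∑ i ∈ Ico 0 (N + 1), A.L.b i = 1 := by
    rw [sum_congr rfl fun i _ => hS.2 i, sum_ite_eq', if_pos (by rw [mem_Ico]; omega)]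
  have t1 : ∑ i ∈ Ico (d + 1) (N + 1), A.L.b i = 0 := by
    rw [sum_congr rfl fun i _ => hS.2 i, sum_ite_eq', if_neg (by rw [mem_Ico]; omega)]
  rw [t0] at s0
  rw [t1] at s1
  have hz : ∀ n, n ∉ Ico 0 (N + 1) → B.L.b n = 0 := by
    intro n hn
    have := hB n (by rw [mem_Ico] at hn; omega)
    rw [Cx.b, finrank_zero_of_subsingleton]
  have hex : ∃ e, B.L.b e ≠ 0 := by
    by_contra! hh
    have : B.L.chi N = 0 := by simp [Cx.chi, hh]
    rw [this, zero_add] at c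
    have hd : (p : ℤ) ∣ (-1) ^ d := ⟨_, c⟩
    have := Int.isUnit_iff_natAbs_eq.1 (isUnit_of_dvd_unit hd (isUnit_one.neg.pow d))
    rw [Int.natAbs_natCast] at this
    exact hp.1.one_lt.ne' this
  obtain ⟨e, he⟩ := hex
  have heN : e ∈ Ico 0 (N + 1) := by by_contra h; exact he (hz e h)
  have h1 : ∀ n ≠ e, B.L.b n = 0 := by
    intro n hn
    by_contra h
    have hnN : n ∈ Ico 0 (N + 1) := by by_contra h'; exact h (hz n h')
    have : B.L.b n + B.L.b e ≤ ∑ i ∈ Ico 0 (N + 1), B.L.b i := by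
      rw [← Finset.sum_pair hn]
      apply Finset.sum_le_sum_of_subset
      intro x hx
      simp only [Finset.mem_insert, Finset.mem_singleton] at hx
      rcases hx with rfl | rfl <;> assumption
    omega
  have h2 : B.L.b e = 1 := by
    have := Finset.single_le_sum (f := fun i => B.L.b i) (fun _ _ => Nat.zero_le _) heN
    omega
  have hBS : Sph B.L e := ⟨hBf, fun n => by
    split_ifs with h
    · rw [h, h2]
    · exact h1 n h⟩
  refine ⟨e, ?_, hBS, ?_⟩
  · by_contra h
    have := Finset.single_le_sum (f := fun i => B.L.b i) (fun _ _ => Nat.zero_le _)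
      (show e ∈ Ico (d + 1) (N + 1) by rw [mem_Ico] at heN ⊢; omega)
    omega
  · rw [sph_chi hBS (by rw [mem_Ico] at heN; omega)] at c
    have hd : (p : ℤ) ∣ (-1) ^ d - (-1) ^ e := ⟨(Q.im _ (S.D.sop_d true)).L.chi N, by rw [c]; ring⟩
    have hp3 : (3 : ℤ) ≤ p := by have := hp.1.two_le; omega
    rcases Nat.even_or_odd d with h | h <;> rcases Nat.even_or_odd e with h' | h'
    · rw [Nat.even_iff] at h h'; omega
    · rw [h.neg_one_pow, h'.neg_one_pow] at hd
      have := Int.le_of_dvd (by norm_num) hd; omega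
    · rw [h.neg_one_pow, h'.neg_one_pow] at hd
      rw [← dvd_neg] at hd
      have := Int.le_of_dvd (by norm_num) hd; omega
    · rw [Nat.odd_iff] at h h'; omega

end SDat
end
end PG

namespace PG

section
variable {F V V' : Type} [Field F] [AddCommGroup V] [Module F V] [AddCommGroup V'] [Module F V']

lemma FC.Map.zero_map {A : FC F V} {B : FC F V'} {t : V →ₗ[F] V'} (h : FC.Map A B t) (ht : t = 0) (n : ℕ)
  (x : B.L.H n) : h.L.map n x = 0 := by
  subst ht
  obtain ⟨⟨x, hx⟩, rfl⟩ := Cx.cls_surj _ n x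
  obtain ⟨φ, rfl⟩ := B.cl_surj (n + 1) x
  rw [Cx.Hom.map_cls]
  have : h.L.zmap n ⟨B.cl (n + 1) φ, hx⟩ = 0 := by
    ext
    show A.cl (n + 1) (φ ∘ₗ (0 : V →ₗ[F] V')) = 0
    rw [LinearMap.comp_zero, map_zero]
  rw [this, map_zero]

lemma FC.Map.map_comp {V'' : Type} [AddCommGroup V''] [Module F V''] {A : FC F V} {B : FC F V'}
  {C : FC F V''} {t : V →ₗ[F] V'} {s : V' →ₗ[F] V''} {u : V →ₗ[F] V''} (h : FC.Map A B t)
  (h' : FC.Map B C s) (h'' : FC.Map A C u) (e : ∀ v, u v = s (t v)) (n : ℕ) (x : C.L.H n) :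
  h.L.map n (h'.L.map n x) = h''.L.map n x := by
  obtain rfl : u = s ∘ₗ t := LinearMap.ext e
  rw [← Cx.Hom.comp_map]
  obtain ⟨⟨x, hx⟩, rfl⟩ := Cx.cls_surj _ n x
  obtain ⟨φ, rfl⟩ := C.cl_surj (n + 1) x
  rfl

lemma exists_dual_ne {U : Type} [AddCommGroup U] [Module F U] {v : U} (hv : v ≠ 0) :
  ∃ w : Dual F U, w v ≠ 0 := by
  by_contra! h
  exact hv ((Module.forall_dual_apply_eq_zero_iff F v).1 h)

lemma FC.Map.pow_map {A : FC F V} {s : End F V} (h : FC.Map A A s) (n k : ℕ) :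
  ∃ hk : FC.Map A A (s ^ k), ∀ x, hk.L.map n x = ((h.L.map n) ^ k : End F (A.L.H n)) x := by
  induction k with
  | zero =>
    refine ⟨⟨fun _ => rfl, fun n i => ⟨i, fun v hv => hv⟩⟩, fun x => ?_⟩
    obtain ⟨x, rfl⟩ := Cx.cls_surj _ n x
    obtain ⟨x, hx⟩ := x
    obtain ⟨φ, rfl⟩ := A.cl_surj (n + 1) x
    rfl
  | succ k ih =>
    obtain ⟨hk, e⟩ := ih
    have hk' : FC.Map A A (s ^ (k + 1)) := by rw [pow_succ]; exact hk.comp h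
    refine ⟨hk', fun x => ?_⟩
    refine Eq.trans ?_ (congrArg (fun T : End F (A.L.H n) => T x) (pow_succ' (h.L.map n) k).symm)
    rw [End.mul_apply, ← e]
    exact (FC.Map.map_comp h hk hk' (fun v => by rw [pow_succ]; rfl) n x).symm

lemma one_dim {U : Type} [AddCommGroup U] [Module F U] (h1 : finrank F U = 1) :
  ∃ v : U, v ≠ 0 ∧ ∀ w : U, ∃ c : F, c • v = w := finrank_eq_one_iff'.1 h1

lemma nilp_one {U : Type} [AddCommGroup U] [Module F U] (h1 : finrank F U = 1)
  (T : End F U) {k : ℕ} (hT : T ^ k = 0) : T = 0 := by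
  obtain ⟨v, hv, hs⟩ := finrank_eq_one_iff'.1 h1
  obtain ⟨c, hc⟩ := hs (T v)
  have hk : ∀ j, (T ^ j) v = c ^ j • v := by
    intro j
    induction j with
    | zero => simp
    | succ j ih => rw [pow_succ, End.mul_apply, ← hc, map_smul, ih, smul_smul, pow_succ']
  have h2 := hk k
  rw [hT, LinearMap.zero_apply] at h2
  have h3 : c = 0 := by
    rcases smul_eq_zero.1 h2.symm with h | h
    · exact eq_zero_of_pow_eq_zero h
    · exact absurd h hv
  ext u
  obtain ⟨a, rfl⟩ := hs u
  rw [map_smul, ← hc, h3]; simp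

namespace FDat
variable {A : FC F V} {p : ℕ} {g m : End F V}

lemma pair' (D : FDat A p g m) (b : Bool) : Pair A (sop p g (!b)) (sop p g b) := by
  cases b
  · exact D.pair true
  · exact D.pair false

/-- bottom degree -/
lemma bot [hp : Fact p.Prime] [CharP F p] (D : FDat A p g m) (h0 : ∀ v ∈ A.W 0 0, v = 0) {a : ℕ}
  (hlo : ∀ n < a, Subsingleton (A.L.H n)) (h1 : finrank F (A.L.H a) = 1) (b : Bool) :
  (∀ x, (D.pair' b).quo.L.map a x = 0) ∧ Bijective ((D.pair' b).incl.L.map a) := by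
  have hsur : ∀ b, Surjective ((D.pair' b).incl.L.map a) := by
    intro b
    cases a with
    | zero => exact (D.pair' b).ses.surj_zero (FC.L_V0 h0)
    | succ a =>
      intro x
      have := D.lo h0 hlo a (by omega) (!b)
      exact ((D.pair' b).ses.exact_C a x).1 (Subsingleton.elim _ _)
  have hz : ∀ b x, (D.pair' b).quo.L.map a x = 0 := by
    intro b x
    have hs := hsur (!b)
    have hM : FC.Map A A (sop p g (!b)) := ⟨D.sop_d _, fun n i => ⟨i, fun v hv => (D.pair' b).sW hv⟩⟩
    obtain ⟨y, rfl⟩ := hs x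
    obtain ⟨hk, e⟩ := hM.pow_map a p
    have hT : (hM.L.map a : End F (A.L.H a)) = 0 := by
      apply nilp_one h1 (k := p)
      refine LinearMap.ext fun x => ?_
      rw [← e, FC.Map.zero_map _ (sop_pow D.gp _)]; rfl
    rw [FC.Map.map_comp (D.pair' b).quo (D.pair' !b).incl hM (fun _ => rfl)]
    exact LinearMap.congr_fun hT y
  refine ⟨hz b, ?_, hsur b⟩
  rw [injective_iff_map_eq_zero]
  intro x hx
  obtain ⟨y, rfl⟩ := ((D.pair' b).ses.exact_B a x).1 hx
  exact hz b y

end FDat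

/-- rank two data -/
structure R2 (Q : FC F V) (p : ℕ) (g m h m' : End F V) : Prop where
  Dg : FDat Q p g m
  Dh : FDat Q p h m'
  gh : Commute g h
  gm : Commute g m'
  hm : Commute h m

namespace R2
variable {Q : FC F V} {p : ℕ} {g m h m' : End F V}

lemma symm (D : R2 Q p g m h m') : R2 Q p h m' g m := ⟨D.Dh, D.Dg, D.gh.symm, D.hm, D.gm⟩

lemma DB (D : R2 Q p g m h m') : FDat (Q.im _ (D.Dg.sop_d true)) p h m' :=
  D.Dh.im _ (sop_commute D.gh.symm _).symm (sop_commute D.gm.symm _).symm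

lemma res (D : R2 Q p g m h m') (b : Bool) :
  FC.Map ((Q.im _ (D.Dg.sop_d true)).im _ (D.DB.sop_d b)) (Q.im _ (D.Dh.sop_d b)) LinearMap.id where
  comm _ := rfl
  le n i := ⟨i, by
    rintro _ ⟨_, ⟨v, hv, rfl⟩, rfl⟩
    exact ⟨_, sop_mem (fun _ h => D.Dg.gW h) _ hv, rfl⟩⟩

lemma half [hp : Fact p.Prime] [CharP F p] (D : R2 Q p g m h m') (h0 : ∀ v ∈ Q.W 0 0, v = 0) {a d : ℕ}
  (ha : finrank F (Q.L.H a) = 1)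
  (hz : ∀ n < d, n ≠ a → Subsingleton (Q.L.H n)) (k : ℕ) (hk : a + k ≤ d) (b : Bool) :
  ∃ (w : Dual F (((Q.im _ (D.Dg.sop_d true)).im _ (D.DB.sop_d b)).L.H (a + k)))
  (x : (Q.im _ (D.Dh.sop_d b)).L.H (a + k)),
  w ((D.res b).L.map _ x) ≠ 0 ∧ (k ≠ 0 → ∀ y, w ((D.DB.pair' b).incl.L.map _ y) = 0) := by
  have hlo : ∀ n < a, Subsingleton (Q.L.H n) := fun n hn => hz n (by omega) (by omega)
  induction k generalizing b with
  | zero =>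
    have e1 := (D.Dg.bot h0 hlo ha true).2
    have e2 := (D.Dh.bot h0 hlo ha b).2
    have e3 := (D.DB.bot (im_V0 _ h0) (fun n hn => D.Dg.lo h0 hlo n hn true) (by
      exact (ofBijective _ e1).symm.finrank_eq.trans ha) b).2
    obtain ⟨v, hv, hs⟩ := one_dim ha
    have hne : (D.res b).L.map a ((D.Dh.pair' b).incl.L.map a v) ≠ 0 := by
      have : (D.res b).L.map a ((D.Dh.pair' b).incl.L.map a v) =
        (D.DB.pair' b).incl.L.map a ((D.Dg.pair' true).incl.L.map a v) := by
        have hm := (D.Dh.pair' b).incl.comp (D.res b)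
        rw [FC.Map.map_comp _ _ hm (fun _ => rfl)]
        exact (FC.Map.map_comp _ _ hm (fun _ => rfl) _ _).symm
      rw [this]
      intro h
      exact hv ((injective_iff_map_eq_zero _).1 e1.1 v ((injective_iff_map_eq_zero _).1 e3.1 _ h))
    obtain ⟨w, hw⟩ := exists_dual_ne (F := F) hne
    exact ⟨w, _, hw, fun h => absurd rfl h⟩
  | succ k ih =>
    obtain ⟨w, x, h1, _⟩ := ih (by omega) (!b)
    have hs : ∃ x', (D.Dh.pair' b).ses.δ (a + k) x' = x := by
      refine ((D.Dh.pair' b).ses.exact_A (a + k) x).1 ?_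
      cases k with
      | zero => exact (D.Dh.bot h0 hlo ha b).1 x
      | succ k =>
        have := hz (a + (k + 1)) (by omega) (by omega)
        exact Subsingleton.elim _ _
    obtain ⟨x', rfl⟩ := hs
    refine ⟨w ∘ₗ (D.DB.pair' b).ses.δ (a + k), x', ?_, fun _ y => ?_⟩
    · rw [LinearMap.comp_apply]
      intro hh
      apply h1
      rw [← hh]
      congr 1
      symm
      have hQB : FC.Map (Q.im _ (D.Dg.sop_d true)) Q LinearMap.id := (D.Dg.pair' true).incl
      refine Cx.Ses.δ_nat (D.Dh.pair' b).ses (D.DB.pair' b).ses (D.res (!b)).L hQB.L (D.res b).L ?_ ?_ _ _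
      · intro n x
        obtain ⟨φ, rfl⟩ := FC.cl_surj _ n x
        rfl
      · intro n x
        obtain ⟨φ, rfl⟩ := FC.cl_surj _ n x
        rfl
    · exact (congrArg w (((D.DB.pair' b).ses.exact_C (a + k)).apply_apply_eq_zero y)).trans (map_zero w)

lemma contra [hp : Fact p.Prime] [CharP F p] (D : R2 Q p g m h m') (h0 : ∀ v ∈ Q.W 0 0, v = 0) {a d N : ℕ}
  (had : a < d) (ha : finrank F (Q.L.H a) = 1) (hd : finrank F (Q.L.H d) = 1)
  (hz : ∀ n, n ≠ d → n ≠ a → Subsingleton (Q.L.H n))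
  (hg : (Q.im _ (D.Dg.sop_d true)).L.Bd N) (hh : (Q.im _ (D.Dh.sop_d true)).L.Bd N)
  (hgh : ((Q.im _ (D.Dg.sop_d true)).im _ (D.DB.sop_d true)).L.Bd N) : False := by
  have key : ∀ C, C = ((Q.im _ (D.Dg.sop_d true)).im _ (D.DB.sop_d true)) →
    ∃ (hM : FC.Map C (Q.im _ (D.Dg.sop_d true)) LinearMap.id)
      (hM' : FC.Map C (Q.im _ (D.Dh.sop_d true)) LinearMap.id) (w : Dual F (C.L.H d))
      (x : (Q.im _ (D.Dh.sop_d true)).L.H d),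
      w (hM'.L.map _ x) ≠ 0 ∧ ∀ y, w (hM.L.map _ y) = 0 := by
    rintro C rfl
    obtain ⟨k, rfl⟩ : ∃ k, d = a + k := ⟨d - a, by omega⟩
    obtain ⟨w, x, h1, h2⟩ := D.half h0 ha (fun n hn h => hz n (by omega) h) k le_rfl true
    exact ⟨(D.DB.pair' true).incl, D.res true, w, x, h1, h2 (by omega)⟩
  have key' : ∀ C, C = ((Q.im _ (D.Dh.sop_d true)).im _ (D.symm.DB.sop_d true)) →
    ∃ (hM : FC.Map C (Q.im _ (D.Dh.sop_d true)) LinearMap.id)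
      (hM' : FC.Map C (Q.im _ (D.Dg.sop_d true)) LinearMap.id) (w : Dual F (C.L.H d))
      (x : (Q.im _ (D.Dg.sop_d true)).L.H d),
      w (hM'.L.map _ x) ≠ 0 ∧ ∀ y, w (hM.L.map _ y) = 0 := by
    rintro C rfl
    obtain ⟨k, rfl⟩ : ∃ k, d = a + k := ⟨d - a, by omega⟩
    obtain ⟨w, x, h1, h2⟩ := D.symm.half h0 ha (fun n hn h => hz n (by omega) h) k le_rfl true
    exact ⟨(D.symm.DB.pair' true).incl, D.symm.res true, w, x, h1, h2 (by omega)⟩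
  obtain ⟨hM, hM', w, x, h1, h2⟩ := key _ rfl
  obtain ⟨kM, kM', u, y, h3, h4⟩ := key' ((Q.im _ (D.Dg.sop_d true)).im _ (D.DB.sop_d true)) (by
    refine FC.ext_of rfl ?_
    funext i n
    show ((Q.W i n).map _).map _ = ((Q.W i n).map _).map _
    rw [← map_comp, ← map_comp]
    congr 1
    exact (sop_commute (sop_commute D.gh _).symm _).eq)
  have hb : Q.L.Bd d := fun n hn => hz n (by omega) (by omega)
  have i1 : Injective ((D.Dg.pair' false).quo.L.map d) := by
    rw [injective_iff_map_eq_zero]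
    intro x hx
    obtain ⟨y, rfl⟩ := ((D.Dg.pair' false).ses.exact_A d x).1 hx
    have := D.Dg.hi hg hb false (d + 1) (by omega)
    rw [Subsingleton.elim y 0, map_zero]
  have i2 : Injective ((D.DB.pair' false).quo.L.map d) := by
    rw [injective_iff_map_eq_zero]
    intro x hx
    obtain ⟨y, rfl⟩ := ((D.DB.pair' false).ses.exact_A d x).1 hx
    have := D.DB.hi hgh (D.Dg.hi hg hb true) false (d + 1) (by omega)
    rw [Subsingleton.elim y 0, map_zero]
  obtain ⟨v, hv, hs⟩ := one_dim hd
  have i3 := i1.comp i2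
  -- `L_d(C)` is at most one-dimensional
  obtain ⟨c, hc⟩ := hs ((D.Dg.pair' false).quo.L.map d ((D.DB.pair' false).quo.L.map d (hM'.L.map _ x)))
  obtain ⟨c', hc'⟩ := hs ((D.Dg.pair' false).quo.L.map d ((D.DB.pair' false).quo.L.map d (kM'.L.map _ y)))
  have hc0 : c ≠ 0 := by
    rintro rfl
    rw [zero_smul] at hc
    have := (injective_iff_map_eq_zero _).1 i2 _ ((injective_iff_map_eq_zero _).1 i1 _ hc.symm)
    exact h1 (by rw [this, map_zero])
  have e : kM'.L.map _ y = (c' * c⁻¹) • hM'.L.map _ x := by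
    apply i2
    apply i1
    rw [map_smul, map_smul, ← hc, ← hc', smul_smul, inv_mul_cancel_right₀ hc0]
  apply h3
  rw [e, map_smul]
  have := h4 x
  erw [this]
  simp

end R2
end
end PG

namespace PG

lemma Fam.min_le_r {M : Type} {X Y : Fam M} : X ⊓ Y ≤ Y := fun _ h => h.2
lemma Fam.min_le_l {M : Type} {X Y : Fam M} : X ⊓ Y ≤ X := fun _ h => h.1
lemma Fam.le_max_l {M : Type} {X Y : Fam M} : X ≤ X ⊔ Y := fun _ h => Or.inl h
lemma Fam.le_max_r {M : Type} {X Y : Fam M} : Y ≤ X ⊔ Y := fun _ h => Or.inr h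

namespace Cx
variable {F : Type} [Field F]

/-- same homology -/
def Qi (C D : Cx F) : Prop := ∀ n, Nonempty (C.H n ≃ₗ[F] D.H n)

namespace Qi
variable {C D E : Cx F}
lemma of_hom (f : Hom C D) (h : ∀ n, Bijective (f.map n)) : Qi C D :=
  fun n => ⟨ofBijective _ (h n)⟩
lemma rfl' : Qi C C := fun _ => ⟨LinearEquiv.refl _ _⟩
lemma symm (h : Qi C D) : Qi D C := fun n => ⟨(h n).some.symm⟩
lemma trans (h : Qi C D) (h' : Qi D E) : Qi C E := fun n => ⟨(h n).some.trans (h' n).some⟩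
lemma fin (h : Qi C D) (hC : C.Fin) : D.Fin := fun n => by
  have := hC n
  exact Module.Finite.equiv (h n).some
lemma b (h : Qi C D) (n : ℕ) : C.b n = D.b n := (h n).some.finrank_eq
lemma bd (h : Qi C D) {r : ℕ} (hC : C.Bd r) : D.Bd r := fun n hn => by
  have := hC n hn
  exact (h n).some.symm.toEquiv.subsingleton
lemma sph (h : Qi C D) {r : ℕ} (hC : Sph C r) : Sph D r :=
  ⟨h.fin hC.1, fun n => by rw [← h.b, hC.2]⟩
lemma chi (h : Qi C D) (r : ℕ) : C.chi r = D.chi r := by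
  unfold Cx.chi
  exact sum_congr rfl fun n _ => by rw [h.b]
end Qi

lemma sph_sub {C : Cx F} {d n : ℕ} (h : Sph C d) (hn : n ≠ d) : Subsingleton (C.H n) := by
  have := h.1 n
  have h2 : finrank F (C.H n) = 0 := by have := h.2 n; rw [if_neg hn] at this; exact this
  exact Module.finrank_zero_iff.1 h2

namespace Ses
variable {A B C : Cx F} {f : Hom A B} {g : Hom B C}

lemma bij_f (S : Ses f g) (hC : ∀ n, Subsingleton (C.H n)) (n : ℕ) : Bijective (f.map n) := by
  have h1 := hC n
  have h2 := hC (n + 1)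
  constructor
  · rw [injective_iff_map_eq_zero]
    intro x hx
    obtain ⟨y, rfl⟩ := (S.exact_A n x).1 hx
    rw [Subsingleton.elim y 0, map_zero]
  · intro x
    exact (S.exact_B n x).1 (Subsingleton.elim _ _)

lemma bij_g (S : Ses f g) (h0 : Subsingleton (B.V 0)) (hA : ∀ n, Subsingleton (A.H n)) (n : ℕ) :
  Bijective (g.map n) := by
  constructor
  · rw [injective_iff_map_eq_zero]
    intro x hx
    obtain ⟨y, rfl⟩ := (S.exact_B n x).1 hx
    have := hA n
    rw [Subsingleton.elim y 0, map_zero]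
  · cases n with
    | zero => exact S.surj_zero h0
    | succ n =>
      intro x
      have := hA n
      exact (S.exact_C n x).1 (Subsingleton.elim _ _)

lemma bij_δ (S : Ses f g) {n : ℕ} (h1 : Subsingleton (B.H (n + 1))) (h2 : Subsingleton (B.H n)) :
  Bijective (S.δ n) := by
  constructor
  · rw [injective_iff_map_eq_zero]
    intro x hx
    obtain ⟨y, rfl⟩ := (S.exact_C n x).1 hx
    rw [Subsingleton.elim y 0, map_zero]
  · intro x
    exact (S.exact_A n x).1 (Subsingleton.elim _ _)
end Ses
end Cx

section Germs
variable {M : Type} [MetricSpace M] [CompactSpace M]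

/-- towers of families -/
structure Tow (M : Type) where
  T : ℕ → Fam M
  mono : ∀ {i j}, i ≤ j → T i ≤ T j

/-- constant tower -/
def Tow.const (X : Fam M) : Tow M := ⟨fun _ => X, fun _ => le_rfl⟩
/-- enlarged tower -/
def Tow.sup (τ : Tow M) (X : Fam M) : Tow M := ⟨fun i => τ.T i ⊔ X, fun h l hl => hl.imp (fun h' => τ.mono h h') id⟩

variable (F : Type) [Field F]

/-- germs of cochains on a family -/
abbrev Germ (X : Fam M) := (List M → F) ⧸ N F X

/-- class of a cochain -/
abbrev gm (X : Fam M) : (List M → F) →ₗ[F] Germ F X := (N F X).mkQ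

variable {F}
lemma gm_eq_zero {X : Fam M} {f : List M → F} : gm F X f = 0 ↔ f ∈ N F X :=
  Submodule.Quotient.mk_eq_zero (N F X) (x := f)
lemma gm_eq {X : Fam M} {f f' : List M → F} : gm F X f = gm F X f' ↔ f - f' ∈ N F X :=
  Submodule.Quotient.eq (N F X)
lemma gm_surj (X : Fam M) : Surjective (gm F X) := mkQ_surjective _

variable (F)
/-- restriction of germs -/
def resG {S X : Fam M} (h : S ≤ X) : Germ F X →ₗ[F] Germ F S :=
  mapQ _ _ LinearMap.id (N_anti h)
variable {F}
lemma resG_gm {S X : Fam M} (h : S ≤ X) (f : List M → F) : resG F h (gm F X f) = gm F S f := rfl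
lemma resG_id {X : Fam M} (h : X ≤ X) : resG F h = LinearMap.id := by
  ext f; rfl

lemma N_split' {X Y : Fam M} {n : ℕ} {f : List M → F} (hn : f ∈ Len M F n) (hf : f ∈ N F (X ⊓ Y)) :
  ∃ f' ∈ Len M F n, f' ∈ N F Y ∧ f - f' ∈ N F X := by
  obtain ⟨h1, h2⟩ := N_split (R := F) hf
  exact ⟨_, sub_mem hn (indicator_len _ hn), h2, by simpa using h1⟩

variable (F)
/-- the filtered germ complex of `X` relative to the tower -/
def E (X : Fam M) (τ : Tow M) : FC F (Germ F X) where
  d := mapQ _ _ (cobL M F) (fun _ hf => cob_N hf)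
  dd v := by
    obtain ⟨f, rfl⟩ := gm_surj X v
    show gm F X (cob (cob f)) = 0
    rw [cob_cob, map_zero]
  W i n := (Len M F n ⊓ N F (τ.T i)).map (gm F X)
  anti n _ _ h := map_mono (inf_le_inf_left _ (N_anti (τ.mono h)))
  dW := by
    rintro i n _ ⟨f, hf, rfl⟩
    exact ⟨cob f, ⟨cob_len hf.1, cob_N hf.2⟩, rfl⟩
variable {F}

lemma E_d {X : Fam M} {τ : Tow M} (f : List M → F) : (E F X τ).d (gm F X f) = gm F X (cob f) := rfl

lemma mem_W {X : Fam M} {τ : Tow M} {i n : ℕ} {v : Germ F X} :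
  v ∈ (E F X τ).W i n ↔ ∃ f ∈ Len M F n, f ∈ N F (X ⊓ τ.T i) ∧ gm F X f = v := by
  constructor
  · rintro ⟨f, hf, rfl⟩
    exact ⟨f, hf.1, N_anti min_le_r hf.2, rfl⟩
  · rintro ⟨f, hn, hf, rfl⟩
    obtain ⟨f', h1, h2, h3⟩ := N_split' hn hf
    exact ⟨f', ⟨h1, h2⟩, (gm_eq.2 h3).symm⟩

lemma E_congr {X : Fam M} {τ τ' : Tow M} (h : ∀ i, X ⊓ τ.T i = X ⊓ τ'.T i) : E F X τ = E F X τ' := by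
  refine FC.ext_of rfl ?_
  funext i n
  ext v
  rw [mem_W, mem_W, h]

lemma E_h0 (X : Fam M) (τ : Tow M) : ∀ v ∈ (E F X τ).W 0 0, v = 0 := by
  rintro _ ⟨f, hf, rfl⟩
  obtain ⟨ε, hε, h⟩ := hf.2
  have : f = 0 := by
    funext l
    by_cases hl : l.length = 0
    · obtain rfl := List.length_eq_zero_iff.1 hl
      exact h [] (Fam.nil _) (by simp [mem_Sm])
    · exact hf.1 l hl
  rw [this, map_zero]

lemma E_V0 (X : Fam M) (τ : Tow M) : Subsingleton ((E F X τ).L.V 0) := FC.L_V0 (E_h0 X τ)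

/-- restriction maps -/
lemma E_map {S X : Fam M} (h : S ≤ X) {τ τ' : Tow M} (hτ : ∀ i, ∃ j, S ⊓ τ.T i ≤ τ'.T j) :
  FC.Map (E F X τ') (E F S τ) (resG F h) where
  comm v := by obtain ⟨f, rfl⟩ := gm_surj X v; rfl
  le n i := by
    obtain ⟨j, hj⟩ := hτ i
    refine ⟨j, ?_⟩
    rintro _ ⟨f, hf, rfl⟩
    exact mem_W.2 ⟨f, hf.1, N_anti hj hf.2, rfl⟩

/-- the sequence of a triple -/
lemma E_incl_le {X : Fam M} (S : Fam M) (τ : Tow M) : ∀ i, ∃ j, X ⊓ τ.T i ≤ (τ.sup S).T j :=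
  fun i => ⟨i, fun _ h => Or.inl h.2⟩
lemma E_res_le {S : Fam M} (τ : Tow M) : ∀ i, ∃ j, S ⊓ τ.T i ≤ τ.T j :=
  fun i => ⟨i, fun _ h => h.2⟩

lemma E_ses {S X : Fam M} (h : S ≤ X) (τ : Tow M) :
  Cx.Ses (E_map (F := F) h (E_res_le τ)).L (E_map (F := F) (le_refl X) (E_incl_le S τ)).L := by
  refine FC.ses (E_map (F := F) (le_refl X) (E_incl_le S τ)) (E_map (F := F) h (E_res_le τ)) ?_ ?_ ?_ ?_
  · exact fun n => ⟨0, fun v hv h => by rwa [resG_id] at h⟩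
  · refine fun n => ⟨0, ?_⟩
    rintro _ ⟨f, hf, rfl⟩
    have h2 := hf.2
    rw [resG_gm, resG_gm, gm_eq_zero]
    exact N_anti (show S ≤ (τ.sup S).T 0 from fun _ h => Or.inr h) h2
  · refine fun n i => ⟨i, ?_⟩
    rintro _ ⟨f, hf, rfl⟩ h0
    rw [resG_gm, gm_eq_zero] at h0
    refine ⟨gm F X f, ⟨f, ⟨hf.1, ?_⟩, rfl⟩, rfl⟩
    show f ∈ N F (τ.T i ⊔ S)
    rw [N_max]
    exact ⟨hf.2, h0⟩
  · refine fun n i => ⟨i, ?_⟩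
    rintro _ ⟨f, hf, rfl⟩
    exact ⟨gm F X f, ⟨f, hf, rfl⟩, rfl⟩

/-- interleaved towers -/
lemma E_qi {X : Fam M} {τ τ' : Tow M} (h : ∀ i, ∃ j, X ⊓ τ.T i ≤ τ'.T j)
  (h' : ∀ i, ∃ j, X ⊓ τ'.T i ≤ τ.T j) : ∀ n,
  Bijective ((E_map (F := F) (le_refl X) h).L.map n) := by
  intro n
  have e1 : ∀ x, (E_map (F := F) (le_refl X) h).L.map n ((E_map (F := F) (le_refl X) h').L.map n x) = x := by
    intro x
    obtain ⟨⟨x, hx⟩, rfl⟩ := Cx.cls_surj _ n x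
    obtain ⟨φ, rfl⟩ := FC.cl_surj _ _ x
    rw [Cx.Hom.map_cls, Cx.Hom.map_cls]
    congr 1
    ext
    show (E F X τ').cl (n + 1) ((φ ∘ₗ resG F _) ∘ₗ resG F _) = _
    rw [resG_id]; rfl
  have e2 : ∀ x, (E_map (F := F) (le_refl X) h').L.map n ((E_map (F := F) (le_refl X) h).L.map n x) = x := by
    intro x
    obtain ⟨⟨x, hx⟩, rfl⟩ := Cx.cls_surj _ n x
    obtain ⟨φ, rfl⟩ := FC.cl_surj _ _ x
    rw [Cx.Hom.map_cls, Cx.Hom.map_cls]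
    congr 1
    ext
    show (E F X τ).cl (n + 1) ((φ ∘ₗ resG F _) ∘ₗ resG F _) = _
    rw [resG_id]; rfl
  exact ⟨Function.LeftInverse.injective e2, Function.RightInverse.surjective e1⟩

variable {G : Type} [AddCommGroup G] [AddAction G M] [IsIsometricVAdd G M]

variable (G) in
lemma E_sub {X : Fam M} {τ : Tow M} {n : ℕ}
  (h : ∀ i, Acyc F (⊥ : AddSubgroup G) n X (X ⊓ τ.T i)) : Subsingleton ((E F X τ).L.H n) := by
  refine FC.L_sub fun i => ⟨i, le_rfl, ?_⟩
  intro v hv h0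
  obtain ⟨f, h1, h2, rfl⟩ := mem_W.1 hv
  rw [E_d, gm_eq_zero] at h0
  obtain ⟨g, hg, hfg⟩ := h i f ⟨⟨h1, Inv_bot f⟩, h2⟩ h0
  exact ⟨gm F X g, mem_W.2 ⟨g, hg.1.1, hg.2, rfl⟩, (gm_eq.2 hfg).symm⟩

lemma Acyc_rel {K : AddSubgroup G} {X S Z : Fam M} {n : ℕ} (hZX : Z ≤ X) (hZ : Z.IsInv K)
  (h1 : Acyc F K n X S) (h2 : ∀ m, n = m + 1 → Acyc F K m Z (Z ⊓ S)) :
  Acyc F K n X (S ⊔ Z) := by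
  intro f hf hd
  have hfN : f ∈ N F S ⊓ N F Z := by rw [← N_max]; exact hf.2
  obtain ⟨g, hg, hfg⟩ := h1 f ⟨hf.1, hfN.1⟩ hd
  cases n with
  | zero =>
    have : g = 0 := by
      obtain ⟨ε, hε, h⟩ := hg.2
      funext l
      by_cases hl : l.length = 0
      · obtain rfl := List.length_eq_zero_iff.1 hl
        exact h [] (Fam.nil _) (by simp [mem_Sm])
      · exact hg.1.1 l hl
    exact ⟨0, zero_mem _, by rw [this] at hfg; exact hfg⟩
  | succ m =>
    obtain ⟨u, hu, hgu⟩ := h2 m rfl g ⟨hg.1, N_anti min_le_r hg.2⟩ (by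
      have := sub_mem hfN.2 (N_anti hZX hfg)
      simpa using this)
    obtain ⟨a, b⟩ := N_split hu.2
    set u' := u - (Z : Set (List M))ᶜ.indicator u with hu'
    have hP : u' ∈ P F K m S := ⟨⟨sub_mem hu.1.1 (indicator_len _ hu.1.1),
      sub_mem hu.1.2 (indicator_Inv (fun g hg l => not_congr (hZ.iff hg l)) hu.1.2)⟩, b⟩
    refine ⟨g - cob u', ?_, ?_⟩
    · refine ⟨⟨sub_mem hg.1.1 (cob_P hP).1.1, sub_mem hg.1.2 (cob_P hP).1.2⟩, ?_⟩
      rw [N_max]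
      refine ⟨sub_mem hg.2 (cob_P hP).2, ?_⟩
      have : g - cob u' = (g - cob u) + cob ((Z : Set (List M))ᶜ.indicator u) := by
        rw [hu', cob_sub]; abel
      rw [this]
      exact add_mem hgu (cob_N a)
    · rw [cob_sub, cob_cob, sub_zero]; exact hfg


/-- excision relative to a further closed set -/
lemma excision_rel {K : AddSubgroup G} [Finite G] {A B C : Set M} (n : ℕ) (hA : IsClosed A) (hB : IsClosed B)
  (hC : IsClosed C) (hCs : C ⊆ A ∪ B)
  (hAi : SInv A K) (hBi : SInv B K) (hCi : SInv C K) (hfree : Free K (A \ B)) :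
  Acyc F K n (pow (A ∪ B)) (pow A ⊔ pow B ⊔ pow C) := by
  refine Acyc_rel (pow_mono hCs) hCi.pow (excision n hA hB hAi hBi hfree) fun m _ => ?_
  have h1 := excision (R := F) m (hA.inter hC) (hB.inter hC) (hAi.inter hCi) (hBi.inter hCi) (K := K)
    (hfree.mono (by rintro x ⟨⟨h1, h2⟩, h3⟩; exact ⟨h1, fun h => h3 ⟨h, h2⟩⟩))
  rw [← Set.union_inter_distrib_right, Set.inter_eq_right.2 hCs] at h1
  have e : pow (A ∩ C) ⊔ pow (B ∩ C) = pow C ⊓ (pow A ⊔ pow B) := by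
    ext l
    simp only [pow_inter, mem_max, mem_min]
    tauto
  rwa [e] at h1

end Germs
end PG

namespace PG

section Equi
variable {M : Type} [MetricSpace M] [CompactSpace M] {F : Type} [Field F]
  {G : Type} [AddCommGroup G] [AddAction G M] [IsIsometricVAdd G M]

variable (F) in
/-- the action on germs -/
def aG {X : Fam M} (g : G) (h : ∀ l ∈ X, tr g l ∈ X) : End F (Germ F X) :=
  mapQ _ _ (trL F g) (by
    rintro f ⟨ε, hε, hf⟩
    exact ⟨ε, hε, fun l hl hs => hf _ (h l hl) ((tr_Sm g ε l).2 hs)⟩)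

lemma aG_gm {X : Fam M} (g : G) (h : ∀ l ∈ X, tr g l ∈ X) (f : List M → F) :
  aG F g h (gm F X f) = gm F X (trL F g f) := rfl

variable (F) in
/-- multiplication by an indicator -/
noncomputable def mS (X : Fam M) (B : Set (List M)) : End F (Germ F X) :=
  mapQ _ _ ({ toFun := fun f => B.indicator f
              map_add' := fun f g => Set.indicator_add _ _ _
              map_smul' := fun c f => Set.indicator_const_smul B c f } : (List M → F) →ₗ[F] (List M → F)) (by
    rintro f ⟨ε, hε, hf⟩
    refine ⟨ε, hε, fun l hl hs => ?_⟩
    show B.indicator f l = 0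
    by_cases h : l ∈ B
    · rw [indicator_of_mem h, hf l hl hs]
    · rw [indicator_of_notMem h])

lemma mS_gm {X : Fam M} (B : Set (List M)) (f : List M → F) :
  mS F X B (gm F X f) = gm F X (B.indicator f) := rfl

lemma aG_comm {X : Fam M} {g g' : G} (h : ∀ l ∈ X, tr g l ∈ X) (h' : ∀ l ∈ X, tr g' l ∈ X) :
  Commute (aG F g h) (aG F g' h') := by
  refine LinearMap.ext fun v => ?_
  obtain ⟨f, rfl⟩ := gm_surj X v
  show gm F X (trL F g (trL F g' f)) = gm F X (trL F g' (trL F g f))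
  congr 1
  funext l
  simp only [trL_apply, tr_tr, add_comm]

lemma aG_mS {X : Fam M} {g : G} (h : ∀ l ∈ X, tr g l ∈ X) {B : Set (List M)}
  (hB : ∀ l, tr g l ∈ B ↔ l ∈ B) : Commute (aG F g h) (mS F X B) := by
  refine LinearMap.ext fun v => ?_
  obtain ⟨f, rfl⟩ := gm_surj X v
  show gm F X (trL F g (B.indicator f)) = gm F X (B.indicator (trL F g f))
  congr 1
  funext l
  by_cases hl : l ∈ B
  · rw [trL_apply, indicator_of_mem hl, indicator_of_mem ((hB l).2 hl), trL_apply]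
  · rw [trL_apply, indicator_of_notMem hl, indicator_of_notMem (fun h => hl ((hB l).1 h))]

lemma aG_pow {X : Fam M} {g : G} (h : ∀ l ∈ X, tr g l ∈ X) (k : ℕ) (f : List M → F) :
  (aG F g h ^ k) (gm F X f) = gm F X (trL F (k • g) f) := by
  induction k generalizing f with
  | zero =>
    show gm F X f = _
    congr 1
    funext l; simp
  | succ k ih =>
    rw [pow_succ, End.mul_apply, aG_gm, ih]
    congr 1
    funext l
    simp only [trL_apply, tr_tr, succ_nsmul']

variable (F) in
/-- invariant germs -/
def EK (K : AddSubgroup G) (X : Fam M) (τ : Tow M) : FC F (Germ F X) where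
  d := (E F X τ).d
  dd := (E F X τ).dd
  W i n := (P F K n (τ.T i)).map (gm F X)
  anti n _ _ h := map_mono (P_anti (τ.mono h))
  dW := by
    rintro i n _ ⟨f, hf, rfl⟩
    exact ⟨cob f, cob_P hf, rfl⟩

lemma EK_bot (X : Fam M) (τ : Tow M) : EK F (⊥ : AddSubgroup G) X τ = E F X τ := by
  refine FC.ext_of rfl ?_
  funext i n
  show Submodule.map _ (P F (⊥ : AddSubgroup G) n (τ.T i)) = Submodule.map _ _
  congr 1
  ext f
  exact ⟨fun h => ⟨h.1.1, h.2⟩, fun h => ⟨⟨h.1, Inv_bot f⟩, h.2⟩⟩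

lemma EK_sub {K : AddSubgroup G} {X : Fam M} {τ : Tow M} {n : ℕ} (hX : X.IsInv K)
  (h : ∀ i, Acyc F K n X (X ⊓ τ.T i)) : Subsingleton ((EK F K X τ).L.H n) := by
  refine FC.L_sub fun i => ⟨i, le_rfl, ?_⟩
  rintro _ ⟨f, hf, rfl⟩ h0
  have h0 : cob f ∈ N F X := gm_eq_zero.1 h0
  obtain ⟨g, hg, hfg⟩ := h i f ⟨hf.1, N_anti min_le_r hf.2⟩ h0
  obtain ⟨a, b⟩ := N_split hg.2
  refine ⟨gm F X g, ⟨g - (X : Set (List M))ᶜ.indicator g, ⟨⟨sub_mem hg.1.1 (indicator_len _ hg.1.1),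
    sub_mem hg.1.2 (indicator_Inv (fun g hg l => not_congr (hX.iff hg l)) hg.1.2)⟩, b⟩, ?_⟩, ?_⟩
  · rw [gm_eq]
    simpa using a
  · exact (gm_eq.2 hfg).symm

lemma tr_free {K : AddSubgroup G} {X Y : Set M} (hfree : Free K (X \ Y)) {l : List M} (h : l ∈ pow X)
  (h' : l ∉ pow Y) {g : G} (hg : g ∈ K) (e : tr g l = l) : g = 0 := by
  rw [mem_pow] at h'
  push Not at h'
  obtain ⟨x, hx, hxY⟩ := h'
  refine hfree x ⟨h x hx, hxY⟩ g hg ?_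
  have : l.map (g +ᵥ ·) = l.map id := by rw [map_id]; exact e
  exact List.map_inj_left.1 this x hx

lemma exists_B {p : ℕ} [hp : Fact p.Prime] {K : AddSubgroup G} {g : G} (hgK : g ∉ K) (hgp : p • g = 0)
  {X Y : Set M} (hfree : Free (K ⊔ zmultiples g) (X \ Y)) :
  ∃ B : Set (List M), (∀ k ∈ K, ∀ l, tr k l ∈ B ↔ l ∈ B) ∧
  ∀ l, l ∈ pow X → l ∉ pow Y → ∃! j, j ∈ Finset.range p ∧ tr (j • g) l ∈ B := by
  classical
  set K' := K ⊔ zmultiples g with hK'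
  have hgK' : g ∈ K' := (le_sup_right : _ ≤ K') (mem_zmultiples g)
  have hnK : ∀ n : ℤ, n • g ∈ K → (p : ℤ) ∣ n := by
    intro n hn
    by_contra h
    have hc : IsCoprime n (p : ℤ) :=
      ((Nat.prime_iff_prime_int.1 hp.out).coprime_iff_not_dvd.2 h).symm
    obtain ⟨a, b, hab⟩ := hc
    apply hgK
    have : g = a • (n • g) + b • ((p : ℤ) • g) := by
      rw [← mul_zsmul, ← mul_zsmul, ← add_zsmul, hab, one_zsmul]
    rw [this]
    refine add_mem (zsmul_mem hn _) ?_
    rw [natCast_zsmul, hgp, zsmul_zero]; exact zero_mem _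
  -- orbit representatives
  let s : Setoid (List M) := ⟨fun l l' => ∃ k ∈ K', tr k l = l',
    fun l => ⟨0, zero_mem _, tr_zero l⟩,
    by rintro l _ ⟨k, hk, rfl⟩; exact ⟨-k, neg_mem hk, by rw [tr_tr, neg_add_cancel, tr_zero]⟩,
    by rintro l _ _ ⟨k, hk, rfl⟩ ⟨k', hk', rfl⟩; exact ⟨k' + k, add_mem hk' hk, by rw [tr_tr]⟩⟩
  let rep : List M → List M := fun l => (Quotient.mk s l).out
  have hrep : ∀ l, ∃ k ∈ K', tr k (rep l) = l := fun l => Quotient.exact (Quotient.out_eq (Quotient.mk s l))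
  have hrepk : ∀ l, ∀ k ∈ K', rep (tr k l) = rep l := by
    intro l k hk
    have : Quotient.mk s (tr k l) = Quotient.mk s l :=
      Quotient.sound (s.symm ⟨k, hk, rfl⟩)
    simp only [rep, this]
  refine ⟨{l | ∃ k ∈ K, tr k (rep l) = l}, ?_, ?_⟩
  · intro k hk l
    have hk' : k ∈ K' := (le_sup_left : K ≤ K') hk
    simp only [Set.mem_ofPred_eq, hrepk l k hk']
    constructor
    · rintro ⟨u, hu, h⟩
      refine ⟨-k + u, add_mem (neg_mem hk) hu, ?_⟩
      rw [← tr_tr, h, tr_tr, neg_add_cancel, tr_zero]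
    · rintro ⟨u, hu, h⟩
      exact ⟨k + u, add_mem hk hu, by rw [← tr_tr, h]⟩
  · intro l hX hY
    obtain ⟨u, hu, hul⟩ := hrep l
    obtain ⟨a, ha, b, hb, rfl⟩ := mem_sup.1 hu
    obtain ⟨c, rfl⟩ := mem_zmultiples_iff.1 hb
    have key : ∀ j : ℕ, (∃ k ∈ K, tr k (rep (tr (j • g) l)) = tr (j • g) l) ↔ (p : ℤ) ∣ c + j := by
      intro j
      rw [hrepk l (j • g) (nsmul_mem hgK' j)]
      constructor
      · rintro ⟨k, hk, h⟩
        apply hnK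
        have h1 : tr (-k + (j • g)) l = rep l := by rw [← tr_tr, ← h, tr_tr, neg_add_cancel, tr_zero]
        have h2 : tr (a + c • g + (-k + j • g)) l = l := by rw [← tr_tr, h1, hul]
        have h3 := tr_free hfree hX hY (add_mem hu (add_mem (neg_mem ((le_sup_left : K ≤ K') hk)) (nsmul_mem hgK' j))) h2
        have h4 : (c + j) • g = k - a := by
          rw [add_zsmul, natCast_zsmul]
          have : c • g + j • g = (a + c • g + (-k + j • g)) + (k - a) := by abel
          rw [this, h3, zero_add]
        rw [h4]; exact sub_mem hk ha
      · rintro ⟨e, he⟩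
        refine ⟨a, ha, ?_⟩
        nth_rewrite 2 [← hul]
        rw [tr_tr]
        congr 1
        have : c • g + j • g = 0 := by
          rw [← natCast_zsmul, ← add_zsmul, he, mul_comm, mul_zsmul, natCast_zsmul, hgp, zsmul_zero]
        rw [add_comm, add_assoc, this, add_zero]
    have hp0 : (p : ℤ) ≠ 0 := by exact_mod_cast hp.out.ne_zero
    have hpp : (0 : ℤ) < p := by exact_mod_cast hp.out.pos
    refine ⟨((-c) % p).toNat, ⟨?_, ?_⟩, ?_⟩
    · rw [Finset.mem_range]
      have := Int.emod_lt_of_pos (-c) hpp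
      omega
    · refine (key _).2 ?_
      rw [Int.toNat_of_nonneg (Int.emod_nonneg _ hp0)]
      have := Int.emod_add_mul_ediv (-c) p
      exact ⟨-((-c) / p), by linarith⟩
    · rintro j ⟨hj, h⟩
      have h := (key j).1 h
      rw [Finset.mem_range] at hj
      have : (-c) % p = j := by
        have h2 : (-c) % p = (j : ℤ) % p := by
          refine (Int.emod_emod_of_dvd _ (dvd_refl _)).symm.trans ?_
          rw [Int.emod_emod_of_dvd _ (dvd_refl _)]
          apply Int.ModEq.symm
          rw [Int.modEq_iff_dvd]
          have : -c - (j:ℤ) = -(c + j) := by ring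
          rw [this]; exact (dvd_neg).2 h
        rw [h2]
        exact Int.emod_eq_of_lt (by omega) (by omega)
      omega

lemma B_sum {p : ℕ} {g : G} {B : Set (List M)} (hgp : p • g = 0) {l : List M}
  (h : ∃! j, j ∈ Finset.range p ∧ tr (j • g) l ∈ B) (f : List M → F) :
  ∑ k ∈ Finset.range p, B.indicator (trL F ((p - k) • g) f) (tr (k • g) l) = f l := by
  classical
  obtain ⟨j, ⟨hj, hjB⟩, hu⟩ := h
  rw [sum_eq_single j]
  · rw [indicator_of_mem hjB, trL_apply, tr_tr, ← add_nsmul,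
      Nat.sub_add_cancel (Finset.mem_range.1 hj).le, hgp, tr_zero]
  · intro k hk hkj
    rw [indicator_of_notMem]
    exact fun hB => hkj (hu k ⟨hk, hB⟩)
  · exact fun h => (h hj).elim

/-- good invariant setting -/
structure Good (p : ℕ) (K : AddSubgroup G) (g : G) (X Y : Set M) (τ : Tow M) (B : Set (List M)) : Prop where
  gp : p • g = 0
  hX : SInv X (K ⊔ zmultiples g)
  hτ : ∀ i, (τ.T i).IsInv (K ⊔ zmultiples g)
  hY : ∀ i, pow Y ≤ τ.T i
  BK : ∀ k ∈ K, ∀ l, tr k l ∈ B ↔ l ∈ B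
  Bg : ∀ l, l ∈ pow X → l ∉ pow Y → ∃! j, j ∈ Finset.range p ∧ tr (j • g) l ∈ B

namespace Good
variable {p : ℕ} {K : AddSubgroup G} {g : G} {X Y : Set M} {τ : Tow M} {B : Set (List M)}

lemma gX (D : Good p K g X Y τ B) : ∀ l ∈ pow X, tr g l ∈ pow X :=
  D.hX.pow g ((le_sup_right : _ ≤ K ⊔ zmultiples g) (mem_zmultiples g))

lemma trP (D : Good p K g X Y τ B) {K0 : AddSubgroup G} {i n : ℕ} {f : List M → F}
  (hf : f ∈ P F K0 n (τ.T i)) : trL F g f ∈ P F K0 n (τ.T i) := by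
  refine ⟨⟨fun l hl => hf.1.1 _ (by rwa [length_tr]), fun k hk l => ?_⟩, ?_⟩
  · rw [trL_apply, trL_apply, tr_tr, add_comm, ← tr_tr, hf.1.2 k hk]
  · obtain ⟨ε, hε, h⟩ := hf.2
    exact ⟨ε, hε, fun l hl hs => h _ (D.hτ i g ((le_sup_right : _ ≤ K ⊔ zmultiples g)
      (mem_zmultiples g)) l hl) ((tr_Sm g ε l).2 hs)⟩

lemma BP (D : Good p K g X Y τ B) {K0 : AddSubgroup G} (hK : K0 ≤ K) {i n : ℕ} {f : List M → F}
  (hf : f ∈ P F K0 n (τ.T i)) : B.indicator f ∈ P F K0 n (τ.T i) := by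
  refine ⟨⟨indicator_len _ hf.1.1, indicator_Inv (fun k hk => D.BK k (hK hk)) hf.1.2⟩, ?_⟩
  obtain ⟨ε, hε, h⟩ := hf.2
  refine ⟨ε, hε, fun l hl hs => ?_⟩
  by_cases hB : l ∈ B
  · rw [indicator_of_mem hB, h l hl hs]
  · rw [indicator_of_notMem hB]

lemma fdat (D : Good p K g X Y τ B) {K0 : AddSubgroup G} (hK : K0 ≤ K) :
  FDat (EK F K0 (pow X) τ) p (aG F g D.gX) (mS F (pow X) B) where
  gd v := by
    obtain ⟨f, rfl⟩ := gm_surj _ v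
    show gm F _ (trL F g (cob f)) = gm F _ (cob (trL F g f))
    rw [cob_trL]
  gW := by
    rintro i n _ ⟨f, hf, rfl⟩
    exact ⟨_, D.trP hf, rfl⟩
  mW := by
    rintro i n _ ⟨f, hf, rfl⟩
    exact ⟨_, D.BP hK hf, rfl⟩
  gp := by
    refine LinearMap.ext fun v => ?_
    obtain ⟨f, rfl⟩ := gm_surj _ v
    rw [aG_pow, D.gp]
    show _ = gm F _ f
    congr 1
    funext l; simp
  sum := by
    rintro i n _ ⟨f, hf, rfl⟩
    simp only [aG_pow, mS_gm]
    rw [← map_sum, gm_eq]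
    obtain ⟨ε, hε, h⟩ := hf.2
    refine ⟨ε, hε, fun l hl hs => ?_⟩
    rw [Pi.sub_apply, Finset.sum_apply, sub_eq_zero]
    simp only [trL_apply]
    by_cases hY : l ∈ pow Y
    · rw [h l (D.hY i hY) hs]
      refine sum_eq_zero fun k hk => ?_
      by_cases hB : tr (k • g) l ∈ B
      · rw [indicator_of_mem hB, trL_apply, tr_tr, ← add_nsmul,
          Nat.sub_add_cancel (Finset.mem_range.1 hk).le, D.gp, tr_zero, h l (D.hY i hY) hs]
      · rw [indicator_of_notMem hB]
    · exact B_sum D.gp (D.Bg l hl hY) f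

lemma sop_gm (D : Good p K g X Y τ B) (f : List M → F) : sop p (aG F g D.gX) true (gm F _ f) =
  gm F _ (∑ k ∈ Finset.range p, trL F (k • g) f) := by
  show (∑ k ∈ Finset.range p, aG F g D.gX ^ k) (gm F _ f) = _
  rw [LinearMap.sum_apply, map_sum]
  exact sum_congr rfl fun k _ => aG_pow _ k f

lemma im_eq (D : Good p K g X Y τ B) (hp : 0 < p) {K0 : AddSubgroup G} (hK : K0 ≤ K) :
  (EK F K0 (pow X) τ).im _ ((D.fdat (F := F) hK).sop_d true) =
      EK F (K0 ⊔ zmultiples g) (pow X) τ := by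
  refine FC.ext_of rfl ?_
  funext i n
  have hsum : ∀ f ∈ P F K0 n (τ.T i), ∑ k ∈ Finset.range p, trL F (k • g) f ∈
      P F (K0 ⊔ zmultiples g) n (τ.T i) := by
    intro f hf
    have hk : ∀ k : ℕ, trL F (k • g) f ∈ P F K0 n (τ.T i) := by
      intro k
      induction k with
      | zero => simpa [show trL F (0 : G) f = f from funext fun l => by simp] using hf
      | succ k ih =>
        have := D.trP ih
        convert this using 1
        funext l
        simp only [trL_apply, tr_tr, succ_nsmul]
    have h1 := sum_mem (t := Finset.range p) fun k _ => hk k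
    refine ⟨⟨h1.1.1, ?_⟩, h1.2⟩
    have hgi : ∀ l, (∑ k ∈ Finset.range p, trL F (k • g) f) (tr g l) = (∑ k ∈ Finset.range p, trL F (k • g) f) l := by
      intro l
      simp only [Finset.sum_apply, trL_apply, tr_tr, ← succ_nsmul]
      obtain ⟨q, rfl⟩ : ∃ q, p = q + 1 := ⟨p - 1, by omega⟩
      rw [sum_range_succ, Finset.sum_range_succ']
      rw [D.gp, zero_nsmul]
    have : K0 ⊔ zmultiples g ≤
        { carrier := {a : G | ∀ l, (∑ k ∈ Finset.range p, trL F (k • g) f) (tr a l) = (∑ k ∈ Finset.range p, trL F (k • g) f) l}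
          zero_mem' := fun l => by rw [tr_zero]
          add_mem' := fun {a b} ha hb l => by rw [← tr_tr, ha, hb]
          neg_mem' := fun {a} ha l => by
            have := ha (tr (-a) l)
            rw [tr_tr, add_neg_cancel, tr_zero] at this
            exact this.symm : AddSubgroup G } := by
      refine sup_le (fun a ha => h1.1.2 a ha) ?_
      rw [zmultiples_le]
      exact hgi
    exact fun a ha => this ha
  apply le_antisymm
  · rintro _ ⟨_, ⟨f, hf, rfl⟩, rfl⟩
    rw [D.sop_gm]
    exact ⟨_, hsum f hf, rfl⟩
  · rintro _ ⟨f, hf, rfl⟩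
    have hf' : f ∈ P F K0 n (τ.T i) := ⟨⟨hf.1.1, Inv_anti le_sup_left hf.1.2⟩, hf.2⟩
    refine ⟨gm F _ (B.indicator f), ⟨_, D.BP hK hf', rfl⟩, ?_⟩
    rw [D.sop_gm, gm_eq]
    obtain ⟨ε, hε, h⟩ := hf.2
    have hinv : ∀ (k : ℕ) l, f (tr (k • g) l) = f l := fun k l => hf.1.2 _
      (nsmul_mem ((le_sup_right : _ ≤ K0 ⊔ zmultiples g) (mem_zmultiples g)) k) l
    refine ⟨ε, hε, fun l hl hs => ?_⟩
    have e : (∑ k ∈ Finset.range p, trL F (k • g) (B.indicator f)) l =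
        ∑ k ∈ Finset.range p, B.indicator (trL F ((p - k) • g) f) (tr (k • g) l) := by
      rw [Finset.sum_apply]
      refine sum_congr rfl fun k _ => ?_
      rw [trL_apply]
      congr 1
      funext l'
      exact (hinv _ _).symm
    rw [Pi.sub_apply, e, sub_eq_zero]
    by_cases hY : l ∈ pow Y
    · rw [h l (D.hY i hY) hs]
      refine sum_eq_zero fun k hk => ?_
      by_cases hB : tr (k • g) l ∈ B
      · rw [indicator_of_mem hB, trL_apply, hinv, hinv, h l (D.hY i hY) hs]
      · rw [indicator_of_notMem hB]
    · exact B_sum D.gp (D.Bg l hl hY) f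

end Good
end Equi
end PG

namespace PG

/-- towers of closed sets -/
structure ATow (M : Type) [TopologicalSpace M] where
  A : ℕ → Set M
  mono : ∀ {i j}, i ≤ j → A i ⊆ A j
  closed : ∀ i, IsClosed (A i)

/-- the associated tower of families -/
def ATow.tow {M : Type} [TopologicalSpace M] (a : ATow M) : Tow M := ⟨fun i => pow (a.A i), fun h => pow_mono (a.mono h)⟩

/-- invariant towers -/
def ATow.IsI {M G : Type} [TopologicalSpace M] [AddCommGroup G] [AddAction G M] (a : ATow M) (K : AddSubgroup G) : Prop :=
  ∀ i, SInv (a.A i) K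

/-- empty tower -/
def ATow.nul (M : Type) [TopologicalSpace M] : ATow M := ⟨fun _ => ∅, fun _ => le_rfl, fun _ => isClosed_empty⟩

section Smith
variable {M : Type} [MetricSpace M] [CompactSpace M] {F : Type} [Field F]
  {G : Type} [AddCommGroup G] [AddAction G M] [IsIsometricVAdd G M] [Finite G]

lemma EK_bd {K : AddSubgroup G} {X Y : Set M} {a : ATow M} (hX : IsClosed X) (hY : IsClosed Y) (hYX : Y ⊆ X)
  (hXi : SInv X K) (hYi : SInv Y K) (ha : a.IsI K) (hfree : Free K (X \ Y)) {r : ℕ}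
  (hCD : CD F G (univ : Set M) r) : (EK F K (pow X) (a.tow.sup (pow Y))).L.Bd r := by
  intro n hn
  refine EK_sub hXi.pow fun i => ?_
  have e : pow X ⊓ (a.tow.sup (pow Y)).T i = pow (X ∩ a.A i) ⊔ pow Y := by
    ext l
    show l ∈ pow X ∧ (l ∈ pow (a.A i) ∨ l ∈ pow Y) ↔ _
    rw [mem_max, pow_inter, mem_min]
    constructor
    · rintro ⟨h, h1 | h1⟩
      exacts [Or.inl ⟨h, h1⟩, Or.inr h1]
    · rintro (h | h)
      exacts [⟨h.1, Or.inl h.2⟩, ⟨pow_mono hYX h, Or.inr h⟩]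
  rw [e]
  have hs : X ∩ a.A i ∪ Y ⊆ X := Set.union_subset inter_subset_left hYX
  refine Acyc_trans (S := pow (X ∩ a.A i ∪ Y)) (pow_max_le _ _ le_rfl) (pow_mono hs) ?_ ?_
  · exact Bdd hX ((hX.inter (a.closed i)).union hY) hs hXi ((hXi.inter (ha i)).union hYi)
      (hfree.mono (Set.sdiff_subset_sdiff_right subset_union_right)) hCD hn
  · exact excision n (hX.inter (a.closed i)) hY (hXi.inter (ha i)) hYi
      (hfree.mono (Set.sdiff_subset_sdiff_left inter_subset_left))

lemma E_bd {X Y : Set M} {a : ATow M} (hX : IsClosed X) (hY : IsClosed Y) (hYX : Y ⊆ X) {r : ℕ}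
  (hCD : CD F G (univ : Set M) r) : (E F (pow X) (a.tow.sup (pow Y))).L.Bd r := by
  rw [← EK_bot (G := G)]
  exact EK_bd hX hY hYX (SInv_bot _) (SInv_bot _) (fun _ => SInv_bot _) (Free_bot _) hCD

lemma pow_empty_le (X : Fam M) : pow ∅ ≤ X := by
  intro l hl
  have : l = [] := List.eq_nil_iff_forall_not_mem.2 fun x hx => hl x hx
  rw [this]; exact Fam.nil _

lemma E_sup_empty (X : Fam M) (τ : Tow M) : E F X (τ.sup (pow ∅)) = E F X τ :=
  E_congr fun i => by
    ext l
    show l ∈ X ∧ (l ∈ τ.T i ∨ l ∈ pow ∅) ↔ l ∈ X ∧ l ∈ τ.T i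
    exact ⟨fun h => ⟨h.1, h.2.elim id fun h => pow_empty_le _ h⟩, fun h => ⟨h.1, Or.inl h.2⟩⟩

lemma E_bd' {X : Set M} {a : ATow M} (hX : IsClosed X) {r : ℕ}
  (hCD : CD F G (univ : Set M) r) : (E F (pow X) a.tow).L.Bd r := by
  rw [← E_sup_empty]
  exact E_bd hX isClosed_empty (Set.empty_subset _) hCD

variable {p : ℕ} [hp : Fact p.Prime]

lemma Good.mk' {K : AddSubgroup G} {g : G} (hgK : g ∉ K) (hgp : p • g = 0) {X Y : Set M} {a : ATow M}
  (hXi : SInv X (K ⊔ zmultiples g)) (hYi : SInv Y (K ⊔ zmultiples g))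
  (ha : a.IsI (K ⊔ zmultiples g)) (hfree : Free (K ⊔ zmultiples g) (X \ Y)) :
  ∃ B, Good p K g X Y (a.tow.sup (pow Y)) B := by
  obtain ⟨B, h1, h2⟩ := exists_B hgK hgp hfree
  exact ⟨B, hgp, hXi, fun i => (ha i).pow.max hYi.pow, fun i => le_max_r, h1, h2⟩

lemma FC.im_congr {V : Type} [AddCommGroup V] [Module F V] {A A' : FC F V} (h : A = A') (s : End F V)
  (h1 : ∀ v, s (A.d v) = A.d (s v)) (h2 : ∀ v, s (A'.d v) = A'.d (s v)) : A.im s h1 = A'.im s h2 := by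
  subst h; rfl

/-- fixed points -/
def fixS (X : Set M) (g : G) : Set M := {x ∈ X | g +ᵥ x = x}

lemma fixS_closed {X : Set M} (hX : IsClosed X) (g : G) : IsClosed (fixS X g) :=
  hX.inter (isClosed_eq (isometry_vadd M g).continuous continuous_id)
lemma fixS_sub (X : Set M) (g : G) : fixS X g ⊆ X := fun _ h => h.1
lemma fixS_inv {X : Set M} {K : AddSubgroup G} (hX : SInv X K) (g : G) : SInv (fixS X g) K :=
  fun k hk x hx => ⟨hX k hk x hx.1, by rw [vadd_comm, hx.2]⟩

lemma zm_free {g : G} (hgp : p • g = 0) {x : M} (hx : g +ᵥ x ≠ x) {h : G} (hh : h ∈ zmultiples g)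
  (hhx : h +ᵥ x = x) : h = 0 := by
  obtain ⟨c, rfl⟩ := mem_zmultiples_iff.1 hh
  by_cases hc : (p : ℤ) ∣ c
  · obtain ⟨e, rfl⟩ := hc
    rw [mul_comm, mul_zsmul, natCast_zsmul, hgp, zsmul_zero]
  · exfalso
    have hcop : IsCoprime c (p : ℤ) :=
      ((Nat.prime_iff_prime_int.1 hp.out).coprime_iff_not_dvd.2 hc).symm
    obtain ⟨a, b, hab⟩ := hcop
    have hst : c • g ∈ stabilizer G x := hhx
    have h2 : g = a • (c • g) := by
      have : g = a • (c • g) + b • ((p : ℤ) • g) := by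
        rw [← mul_zsmul, ← mul_zsmul, ← add_zsmul, hab, one_zsmul]
      rwa [natCast_zsmul, hgp, zsmul_zero, add_zero] at this
    have h3 : g ∈ stabilizer G x := by rw [h2]; exact zsmul_mem hst a
    exact hx h3

lemma fixS_free {X : Set M} {g : G} (hgp : p • g = 0) :
  Free (zmultiples g) (X \ fixS X g) := by
  intro x hx h hh hhx
  exact zm_free hgp (fun h => hx.2 ⟨hx.1, h⟩) hh hhx

/-- Smith data for a cyclic group -/
lemma smith {g : G} (hgp : p • g = 0) (hg0 : g ≠ 0) {X : Set M} {a : ATow M} (hX : IsClosed X)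
  (hXi : SInv X (zmultiples g)) (ha : a.IsI (zmultiples g)) {r : ℕ}
  (hCD : CD F G (univ : Set M) r) (hgX : ∀ l ∈ pow X, tr g l ∈ pow X) :
  ∃ m, ∃ S : SDat (E F (pow X) a.tow) (E F (pow X) (a.tow.sup (pow (fixS X g)))) (E F (pow (fixS X g)) a.tow)
  (resG F (pow_mono (fixS_sub X g))) p (aG F g hgX) m,
  ((E F (pow X) (a.tow.sup (pow (fixS X g)))).im _ (S.D.sop_d true)).L.Bd r := by
  set S := fixS X g with hS
  have eb : (⊥ : AddSubgroup G) ⊔ zmultiples g = zmultiples g := bot_sup_eq _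
  obtain ⟨B, D⟩ := Good.mk' (p := p) (K := (⊥ : AddSubgroup G)) (g := g) hg0 hgp (X := X) (Y := S) (a := a)
    (by rwa [eb]) (by rw [eb]; exact fixS_inv hXi g) (by rwa [eb]) (by rw [eb]; exact fixS_free hgp)
  have hfd := D.fdat (F := F) (le_refl ⊥)
  rw [EK_bot] at hfd
  refine ⟨mS F (pow X) B, ⟨hfd, rfl, ?_, E_map _ (E_res_le _), ?_, ?_, ?_, ?_⟩, ?_⟩
  · rintro i n _ ⟨f, hf, rfl⟩
    exact ⟨f, ⟨hf.1, N_anti le_max_l hf.2⟩, rfl⟩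
  · rintro i n _ ⟨f, hf, rfl⟩ h0
    rw [resG_gm, gm_eq_zero] at h0
    refine ⟨f, ⟨hf.1, ?_⟩, rfl⟩
    show f ∈ N F (a.tow.T i ⊔ pow S)
    rw [N_max]
    exact ⟨hf.2, h0⟩
  · rintro i n _ ⟨f, hf, rfl⟩
    rw [resG_gm, gm_eq_zero]
    exact N_anti le_max_r hf.2
  · rintro i n _ ⟨f, hf, rfl⟩
    have hm : ∀ l, l ∈ pow S → (pow S : Set (List M)).indicator f l = f l := fun l hl =>
      indicator_of_mem (s := (pow S : Set (List M))) hl f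
    have hnm : ∀ l, l ∉ pow S → (pow S : Set (List M)).indicator f l = 0 := fun l hl =>
      indicator_of_notMem (s := (pow S : Set (List M))) hl f
    refine ⟨gm F _ ((pow S : Set (List M)).indicator f), ⟨_, ⟨indicator_len _ hf.1, ?_⟩, rfl⟩, ?_, ?_⟩
    · obtain ⟨ε, hε, h⟩ := hf.2
      refine ⟨ε, hε, fun l hl hs => ?_⟩
      by_cases hB : l ∈ pow S
      · rw [hm l hB, h l hl hs]
      · rw [hnm l hB]
    · rw [resG_gm, gm_eq]
      refine N_of_zero fun l hl => ?_
      rw [Pi.sub_apply, hm l hl, sub_self]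
    · rw [aG_gm]
      congr 1
      funext l
      rw [trL_apply]
      have hiff := (fixS_inv hXi g).pow.iff (mem_zmultiples g) l
      by_cases hl : l ∈ pow S
      · have : tr g l = l := by
          show l.map _ = l
          conv_rhs => rw [← map_id l]
          exact List.map_inj_left.2 fun x hx => (hl x hx).2
        rw [this]
      · rw [hnm l hl, hnm _ fun h => hl (hiff.1 h)]
  · rintro i n _ ⟨f, hf, rfl⟩
    exact ⟨f, hf, rfl⟩
  · have e := D.im_eq (F := F) hp.out.pos (le_refl ⊥)
    rw [FC.im_congr (EK_bot (F := F) (G := G) (pow X) _) _ _ (hfd.sop_d true), eb] at e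
    rw [e]
    exact EK_bd hX (fixS_closed hX g) (fixS_sub X g) hXi (fixS_inv hXi g) ha (fixS_free hgp) hCD

section smithcor
variable [CharP F p] {g : G} {X : Set M} {a : ATow M} {r : ℕ}

lemma smith_sph (hodd : p ≠ 2) (hgp : p • g = 0) (hg0 : g ≠ 0) (hX : IsClosed X)
  (hXi : SInv X (zmultiples g)) (ha : a.IsI (zmultiples g))
  (hCD : CD F G (univ : Set M) r) {d : ℕ} (h : Sph (E F (pow X) a.tow).L d) :
  ∃ e ≤ d, Sph (E F (pow (fixS X g)) a.tow).L e ∧ e % 2 = d % 2 := by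
  obtain ⟨m, S, hN⟩ := smith (F := F) hgp hg0 hX hXi ha hCD (hXi.pow g (mem_zmultiples g))
  exact S.sph hodd (E_h0 _ _) (E_bd' hX hCD) hN h

lemma smith_fin (hgp : p • g = 0) (hg0 : g ≠ 0) (hX : IsClosed X)
  (hXi : SInv X (zmultiples g)) (ha : a.IsI (zmultiples g))
  (hCD : CD F G (univ : Set M) r) (h : (E F (pow X) a.tow).L.Fin) :
  (E F (pow (fixS X g)) a.tow).L.Fin := by
  obtain ⟨m, S, hN⟩ := smith (F := F) hgp hg0 hX hXi ha hCD (hXi.pow g (mem_zmultiples g))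
  exact (S.fin (E_bd' hX hCD) h hN).1

lemma smith_zero (hgp : p • g = 0) (hg0 : g ≠ 0) (hX : IsClosed X)
  (hXi : SInv X (zmultiples g)) (ha : a.IsI (zmultiples g))
  (hCD : CD F G (univ : Set M) r) {d : ℕ} (h : Sph (E F (pow X) a.tow).L d)
  (h' : Sph (E F (pow (fixS X g)) a.tow).L d) (n : ℕ) :
  Subsingleton ((E F (pow X) (a.tow.sup (pow (fixS X g)))).L.H n) := by
  obtain ⟨m, S, hN⟩ := smith (F := F) hgp hg0 hX hXi ha hCD (hXi.pow g (mem_zmultiples g))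
  exact S.eq_zero (E_bd' hX hCD) h.1 hN (fun n => by rw [h.2, h'.2]) n
end smithcor

lemma card_sup_dvd (K : AddSubgroup G) {g : G} (hgp : p • g = 0) :
  Nat.card ↥(K ⊔ zmultiples g) ∣ Nat.card K * p := by
  have h1 : Nat.card ↥(K ⊔ zmultiples g) ∣ Nat.card (K × zmultiples g) := by
    let f : K × zmultiples g →+ G := (K.subtype.comp (AddMonoidHom.fst _ _)) +
      ((zmultiples g).subtype.comp (AddMonoidHom.snd _ _))
    have e : f.range = K ⊔ zmultiples g := by
      ext x
      rw [mem_sup]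
      constructor
      · rintro ⟨⟨a, b⟩, rfl⟩; exact ⟨a, a.2, b, b.2, rfl⟩
      · rintro ⟨a, ha, b, hb, rfl⟩; exact ⟨(⟨a, ha⟩, ⟨b, hb⟩), rfl⟩
    rw [← e]
    exact AddSubgroup.card_range_dvd f
  rw [Nat.card_prod, Nat.card_zmultiples] at h1
  exact h1.trans (Nat.mul_dvd_mul_left _ (addOrderOf_dvd_iff_nsmul_eq_zero.2 hgp))

lemma chi_dvd_aux [CharP F p] {K : AddSubgroup G} (hexp : ∀ g ∈ K, p • g = 0) {X Y : Set M} {a : ATow M} (hX : IsClosed X)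
  (hY : IsClosed Y) (hYX : Y ⊆ X)
  (hXi : SInv X K) (hYi : SInv Y K) (ha : a.IsI K) (hfree : Free K (X \ Y)) {r : ℕ}
  (hCD : CD F G (univ : Set M) r) (n : ℕ) (K0 : AddSubgroup G) (hK : K0 ≤ K)
  (hn : Nat.card K ≤ Nat.card K0 + n)
  (hfin : (EK F K0 (pow X) (a.tow.sup (pow Y))).L.Fin) :
  (Nat.card K : ℤ) ∣ Nat.card K0 * (EK F K0 (pow X) (a.tow.sup (pow Y))).L.chi r := by
  induction n generalizing K0 with
  | zero =>
    have : K0 = K := AddSubgroup.eq_of_le_of_card_ge hK hn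
    rw [this]; exact dvd_mul_right _ _
  | succ n ih =>
    by_cases hKK : K ≤ K0
    · rw [le_antisymm hK hKK]; exact dvd_mul_right _ _
    obtain ⟨g, hgK, hg0⟩ := not_subset.1 hKK
    have hle : K0 ⊔ zmultiples g ≤ K := sup_le hK (zmultiples_le.2 hgK)
    have hgp := hexp g hgK
    obtain ⟨B, D⟩ := Good.mk' (p := p) hg0 hgp (hXi.anti hle) (hYi.anti hle) (fun i => (ha i).anti hle)
      (hfree.anti hle)
    have hD := D.fdat (F := F) (le_refl K0)
    have e := D.im_eq (F := F) hp.out.pos (le_refl K0)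
    have hb : ((EK F K0 (pow X) (a.tow.sup (pow Y))).im _ (hD.sop_d true)).L.Bd r := by
      rw [e]
      exact EK_bd hX hY hYX (hXi.anti hle) (hYi.anti hle) (fun i => (ha i).anti hle) (hfree.anti hle) hCD
    have h0 : ∀ v ∈ (EK F K0 (pow X) (a.tow.sup (pow Y))).W 0 0, v = 0 := by
      rintro _ ⟨f, hf, rfl⟩
      exact E_h0 (pow X) (a.tow.sup (pow Y)) _ ⟨f, ⟨hf.1.1, hf.2⟩, rfl⟩
    have hf1 := hD.fin_sop hb hfin true
    have hchi := hD.chi_mul h0 hb hfin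
    rw [e] at hf1 hchi
    have hlt : Nat.card K0 < Nat.card ↥(K0 ⊔ zmultiples g) := by
      have hle2 : Nat.card K0 ≤ Nat.card ↥(K0 ⊔ zmultiples g) :=
        Nat.card_le_card_of_injective (AddSubgroup.inclusion le_sup_left) (AddSubgroup.inclusion_injective _)
      refine lt_of_le_of_ne hle2 fun h => hg0 ?_
      have : K0 = K0 ⊔ zmultiples g := AddSubgroup.eq_of_le_of_card_ge le_sup_left h.ge
      rw [this]
      exact (le_sup_right : _ ≤ K0 ⊔ zmultiples g) (mem_zmultiples g)
    have := ih _ hle (by omega) hf1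
    rw [hchi]
    refine this.trans ?_
    rw [← mul_assoc]
    exact mul_dvd_mul_right (by exact_mod_cast card_sup_dvd K0 hgp) _

lemma chi_dvd [CharP F p] {K : AddSubgroup G} (hexp : ∀ g ∈ K, p • g = 0) {X Y : Set M} {a : ATow M} (hX : IsClosed X)
  (hY : IsClosed Y) (hYX : Y ⊆ X)
  (hXi : SInv X K) (hYi : SInv Y K) (ha : a.IsI K) (hfree : Free K (X \ Y)) {r : ℕ}
  (hCD : CD F G (univ : Set M) r)
  (hfin : (E F (pow X) (a.tow.sup (pow Y))).L.Fin) :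
  (Nat.card K : ℤ) ∣ (E F (pow X) (a.tow.sup (pow Y))).L.chi r := by
  rw [← EK_bot (G := G)] at hfin ⊢
  have := chi_dvd_aux hexp hX hY hYX hXi hYi ha hfree hCD (Nat.card K) ⊥ bot_le (by omega) hfin
  rwa [card_bot, Nat.cast_one, one_mul] at this

/-- the rank two contradiction -/
lemma rank2 [CharP F p] {g h : G} (hgp : p • g = 0) (hhp : p • h = 0) (hgh : g ∉ zmultiples h)
  (hhg : h ∉ zmultiples g) {X Y : Set M} {a : ATow M} (hX : IsClosed X)
  (hY : IsClosed Y) (hYX : Y ⊆ X)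
  (hXi : SInv X (zmultiples g ⊔ zmultiples h))
  (hYi : SInv Y (zmultiples g ⊔ zmultiples h))
  (ha : a.IsI (zmultiples g ⊔ zmultiples h))
  (hfree : Free (zmultiples g ⊔ zmultiples h) (X \ Y)) {r : ℕ}
  (hCD : CD F G (univ : Set M) r) {e d : ℕ} (hed : e < d)
  (he : finrank F ((E F (pow X) (a.tow.sup (pow Y))).L.H e) = 1)
  (hd : finrank F ((E F (pow X) (a.tow.sup (pow Y))).L.H d) = 1)
  (hz : ∀ n, n ≠ d → n ≠ e → Subsingleton ((E F (pow X) (a.tow.sup (pow Y))).L.H n)) : False := by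
  have hc := sup_comm (zmultiples g) (zmultiples h)
  obtain ⟨B, D⟩ := Good.mk' (p := p) hgh hgp (hc ▸ hXi) (hc ▸ hYi) (a := a) (hc ▸ ha) (hc ▸ hfree)
  obtain ⟨B', D'⟩ := Good.mk' (p := p) hhg hhp hXi hYi (a := a) ha hfree
  have D1 := D.fdat (F := F) (K0 := ⊥) bot_le
  have D2 := D'.fdat (F := F) (K0 := ⊥) bot_le
  have e1 := D.im_eq (F := F) hp.out.pos (K0 := ⊥) bot_le
  have e2 := D'.im_eq (F := F) hp.out.pos (K0 := ⊥) bot_le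
  have e3 := D'.im_eq (F := F) hp.out.pos (le_refl _)
  rw [bot_sup_eq] at e1 e2
  have R : R2 (EK F ⊥ (pow X) (a.tow.sup (pow Y))) p (aG F g D.gX) (mS F (pow X) B) (aG F h D'.gX) (mS F (pow X) B') :=
    ⟨D1, D2, aG_comm _ _, aG_mS _ (D'.BK g (mem_zmultiples g)),
      aG_mS _ (D.BK h (mem_zmultiples h))⟩
  have hle1 : zmultiples g ≤ zmultiples g ⊔ zmultiples h := le_sup_left
  have hle2 : zmultiples h ≤ zmultiples g ⊔ zmultiples h := le_sup_right
  rw [← EK_bot (G := G)] at he hd hz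
  refine R.contra (N := r) ?_ hed he hd hz ?_ ?_ ?_
  · rw [EK_bot]; exact E_h0 _ _
  · rw [e1]
    exact EK_bd hX hY hYX (hXi.anti hle1) (hYi.anti hle1) (fun i => (ha i).anti hle1) (hfree.anti hle1) hCD
  · rw [e2]
    exact EK_bd hX hY hYX (hXi.anti hle2) (hYi.anti hle2) (fun i => (ha i).anti hle2) (hfree.anti hle2) hCD
  · rw [FC.im_congr e1 _ _ ((D'.fdat (F := F) (le_refl _)).sop_d true), e3]
    exact EK_bd hX hY hYX hXi hYi ha hfree hCD

end Smith
end PG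

namespace PG

section Local
variable {M : Type} [MetricSpace M] [CompactSpace M] {F : Type} [Field F]
  {G : Type} [AddCommGroup G] [AddAction G M] [IsIsometricVAdd G M] [Finite G]

/-- excision for unions with towers -/
lemma E_exc (G : Type) [AddCommGroup G] [AddAction G M] [IsIsometricVAdd G M] [Finite G]
  {A B : Set M} {a : ATow M} (hA : IsClosed A) (hB : IsClosed B) :
  Cx.Qi (E F (pow B) (a.tow.sup (pow (A ∩ B)))).L (E F (pow (A ∪ B)) (a.tow.sup (pow A))).L := by
  have hS : pow B ≤ pow (A ∪ B) := pow_mono subset_union_right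
  have S := E_ses (F := F) hS (a.tow.sup (pow A))
  have e : E F (pow B) (a.tow.sup (pow (A ∩ B))) = E F (pow B) (a.tow.sup (pow A)) := E_congr fun i => by
    ext l
    show l ∈ pow B ∧ (l ∈ _ ∨ l ∈ pow (A ∩ B)) ↔ l ∈ pow B ∧ (l ∈ _ ∨ l ∈ pow A)
    rw [pow_inter, mem_min]; tauto
  rw [e]
  refine Cx.Qi.of_hom _ (S.bij_f fun n => E_sub G fun i => ?_)
  have e2 : pow (A ∪ B) ⊓ ((a.tow.sup (pow A)).sup (pow B)).T i = pow A ⊔ pow B ⊔ pow ((A ∪ B) ∩ a.A i) := by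
    ext l
    show l ∈ pow (A ∪ B) ∧ ((l ∈ pow (a.A i) ∨ l ∈ pow A) ∨ l ∈ pow B) ↔ _
    rw [mem_max, mem_max, pow_inter, mem_min]
    have h1 : l ∈ pow A → l ∈ pow (A ∪ B) := fun h => pow_mono subset_union_left h
    have h2 : l ∈ pow B → l ∈ pow (A ∪ B) := fun h => hS h
    tauto
  rw [e2]
  exact excision_rel n hA hB ((hA.union hB).inter (a.closed i)) inter_subset_left (SInv_bot _) (SInv_bot _)
    (SInv_bot _) (Free_bot _)

/-- triple sequence -/
lemma E_triple {T S X : Set M} {a : ATow M} (hT : T ⊆ S) (hS : S ⊆ X) :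
  ∃ (f : Cx.Hom (E F (pow S) (a.tow.sup (pow T))).L (E F (pow X) (a.tow.sup (pow T))).L)
  (g : Cx.Hom (E F (pow X) (a.tow.sup (pow T))).L (E F (pow X) (a.tow.sup (pow S))).L), Cx.Ses f g := by
  have e : E F (pow X) ((a.tow.sup (pow T)).sup (pow S)) = E F (pow X) (a.tow.sup (pow S)) := E_congr fun i => by
    ext l
    show l ∈ pow X ∧ ((l ∈ _ ∨ l ∈ pow T) ∨ l ∈ pow S) ↔ l ∈ pow X ∧ (l ∈ _ ∨ l ∈ pow S)
    have : l ∈ pow T → l ∈ pow S := fun h => pow_mono hT h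
    tauto
  rw [← e]
  exact ⟨_, _, E_ses (F := F) (pow_mono hS) (a.tow.sup (pow T))⟩

/-- relative pairs -/
lemma E_rel_sub (G : Type) [AddCommGroup G] [AddAction G M] [IsIsometricVAdd G M] {T X : Set M} {n : ℕ}
  (hT : T ⊆ X) (h : Acyc F (⊥ : AddSubgroup G) n (pow X) (pow T)) :
  Subsingleton ((E F (pow X) ((ATow.nul M).tow.sup (pow T))).L.H n) := by
  refine E_sub G fun i => ?_
  have : pow X ⊓ ((ATow.nul M).tow.sup (pow T)).T i = pow T := by
    ext l
    show l ∈ pow X ∧ (l ∈ pow ∅ ∨ l ∈ pow T) ↔ _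
    have h1 : l ∈ pow ∅ → l ∈ pow T := fun h => pow_empty_le _ h
    have h2 : l ∈ pow T → l ∈ pow X := fun h => pow_mono hT h
    tauto
  rw [this]; exact h

lemma Acyc_union {A B : Set M} {n : ℕ} (hA : IsClosed A) (hB : IsClosed B)
  (h : Acyc F (⊥ : AddSubgroup G) n (pow B) (pow (A ∩ B))) :
  Acyc F (⊥ : AddSubgroup G) n (pow (A ∪ B)) (pow A) := by
  refine Acyc_trans (S := pow A ⊔ pow B) le_max_l (pow_max_le _ _ le_rfl)
    (excision n hA hB (SInv_bot _) (SInv_bot _) (Free_bot _)) ?_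
  intro f hf hd
  obtain ⟨g, hg, hfg⟩ := h f ⟨hf.1, N_anti (pow_mono inter_subset_left) hf.2⟩ (N_anti le_max_r hd)
  have hg2 := hg.2
  rw [pow_inter] at hg2
  obtain ⟨h1, h2⟩ := N_split hg2
  have hgl : (pow A : Set (List M))ᶜ.indicator g ∈ Len M F n := indicator_len _ hg.1.1
  refine ⟨_, ⟨⟨hgl, Inv_bot _⟩, h1⟩, ?_⟩
  rw [N_max]
  refine ⟨sub_mem hf.2 (cob_N h1), ?_⟩
  have := add_mem hfg (cob_N h2)
  rwa [cob_sub, sub_add_sub_cancel] at this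

/-- bottom: a point -/
lemma E_point (G : Type) [AddCommGroup G] [AddAction G M] [IsIsometricVAdd G M] (x : M) :
  Sph (E F (pow {x}) ((ATow.nul M).tow.sup (pow ∅))).L 0 := by
  set C := E F (pow {x}) ((ATow.nul M).tow.sup (pow ∅)) with hC
  have hsub : ∀ n, Subsingleton (C.L.H (n + 1)) := fun n => by
    refine E_rel_sub G (Set.empty_subset _) ?_
    have := Acyc_point (R := F) (G := G) (n := n) x (S := ∅) isClosed_empty
    rwa [Set.union_empty] at this
  have hV0 : Subsingleton (C.L.V 0) := E_V0 _ _
  have hx : ∀ l : List M, l.length = 1 → l ∈ pow {x} → l = [x] := by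
    intro l h1 h2
    obtain ⟨y, rfl⟩ := List.length_eq_one_iff.1 h1
    have : y = x := h2 y (by simp)
    rw [this]
  have hsm : ∀ ε > (0:ℝ), [x] ∈ (Sm ε : Set (List M)) := by
    intro ε hε
    rw [mem_Sm]; simp [hε]
  -- evaluation functional
  let ev : Germ F (pow {x}) →ₗ[F] F := (N F (pow {x})).liftQ (LinearMap.proj [x]) (by
    rintro f ⟨ε, hε, h⟩
    exact h [x] (fun y hy => by simpa using hy) (hsm ε hε))
  have ev_gm : ∀ f, ev (gm F _ f) = f [x] := fun f => rfl
  have hW : ∀ i, ∀ v ∈ C.W i 1, ev v = 0 → v = 0 := by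
    intro i v hv h0
    obtain ⟨f, h1, h2, rfl⟩ := mem_W.1 hv
    rw [ev_gm] at h0
    rw [gm_eq_zero]
    refine N_of_zero fun l hl => ?_
    by_cases hll : l.length = 1
    · rw [hx l hll hl, h0]
    · exact h1 l hll
  have hdW : ∀ i, ∀ v ∈ C.W i 1, C.d v = 0 := by
    intro i v hv
    obtain ⟨f, h1, h2, rfl⟩ := mem_W.1 hv
    rw [E_d, gm_eq_zero]
    refine N_of_zero fun l hl => ?_
    by_cases hll : l.length = 2
    · obtain ⟨y, z, rfl⟩ := List.length_eq_two.1 hll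
      have h1 : y = x := hl y (by simp)
      have h2 : z = x := hl z (by simp)
      subst h1; subst h2
      simp [cob]
    · exact cob_len h1 l hll
  have hbd : ∀ y, C.L.d 1 y = 0 := by
    intro y
    obtain ⟨φ, rfl⟩ := C.cl_surj 2 y
    rw [FC.d_cl, FC.cl_zero]
    exact ⟨0, fun v hv => by rw [LinearMap.comp_apply, hdW 0 v hv, map_zero]⟩
  have hone : ∃ u : C.L.H 0, u ≠ 0 ∧ ∀ w : C.L.H 0, ∃ c : F, c • u = w := by
    refine ⟨C.L.cls 0 ⟨C.cl 1 ev, Subsingleton.elim _ _⟩, ?_, ?_⟩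
    · rw [Ne, Cx.cls_zero]
      rintro ⟨y, hy⟩
      rw [hbd] at hy
      have hy2 := (FC.cl_zero (A := C) (n := 1) (φ := ev)).1 hy.symm
      obtain ⟨i, hi⟩ := hy2
      have := hi (gm F _ (Set.indicator {[x]} 1)) (mem_W.2 ⟨_, ?_, ?_, rfl⟩)
      · rw [ev_gm] at this; simp at this
      · intro l hl
        rw [indicator_of_notMem]
        rintro rfl
        simp at hl
      · refine N_of_zero fun l hl => ?_
        rw [indicator_of_notMem]
        rintro rfl
        have h2 : [x] ∈ pow (∅ : Set M) := by
          rcases hl.2 with h | h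
          exacts [h, h]
        exact h2 x (by simp)
    · intro w
      obtain ⟨⟨z, hz⟩, rfl⟩ := C.L.cls_surj 0 w
      obtain ⟨φ, rfl⟩ := C.cl_surj 1 z
      obtain ⟨ψ, hψ⟩ := dual_ext ev (C.W 0 1) φ fun v hv h0 => by rw [hW 0 v hv h0, map_zero]
      refine ⟨ψ 1, ?_⟩
      rw [← map_smul]
      congr 1
      refine Subtype.ext ?_
      show ψ 1 • C.cl 1 ev = C.cl 1 φ
      rw [← map_smul, FC.cl_eq]
      refine ⟨0, fun v hv => ?_⟩
      rw [← hψ v hv, LinearMap.smul_apply, smul_eq_mul, mul_comm, ← smul_eq_mul, ← map_smul, smul_eq_mul, mul_one]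
  obtain ⟨u, hu, hw⟩ := hone
  have h1 : finrank F (C.L.H 0) = 1 := finrank_eq_one u hu hw
  refine ⟨fun n => ?_, fun n => ?_⟩
  · cases n with
    | zero => exact Module.finite_of_finrank_eq_succ h1
    | succ n => have := hsub n; infer_instance
  · cases n with
    | zero => exact h1
    | succ n =>
      have := hsub n
      rw [if_neg (by omega)]
      exact finrank_zero_of_subsingleton

/-- suspension step -/
lemma sph_step {T1 B Q : Set M} (G : Type) [AddCommGroup G] [AddAction G M] [IsIsometricVAdd G M] [Finite G]
  (hT1 : IsClosed T1) (hB : IsClosed B) (hQ : T1 ∪ B ⊆ Q)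
  (hac : ∀ n, Acyc F (⊥ : AddSubgroup G) n (pow Q) (pow T1)) {k : ℕ}
  (h : Sph (E F (pow B) ((ATow.nul M).tow.sup (pow (T1 ∩ B)))).L k) :
  Sph (E F (pow Q) ((ATow.nul M).tow.sup (pow (T1 ∪ B)))).L (k + 1) := by
  have h2 := (E_exc (F := F) G (a := ATow.nul M) hT1 hB).sph h
  obtain ⟨f, g, S⟩ := E_triple (F := F) (a := ATow.nul M) (T := T1) (S := T1 ∪ B) (X := Q) subset_union_left hQ
  have hz : ∀ n, Subsingleton ((E F (pow Q) ((ATow.nul M).tow.sup (pow T1))).L.H n) := fun n =>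
    E_rel_sub G (subset_union_left.trans hQ) (hac n)
  have h0 : Subsingleton ((E F (pow Q) ((ATow.nul M).tow.sup (pow (T1 ∪ B)))).L.H 0) := by
    have := hz 0
    exact Surjective.subsingleton (S.surj_zero (E_V0 _ _))
  have e : ∀ n, Nonempty ((E F (pow Q) ((ATow.nul M).tow.sup (pow (T1 ∪ B)))).L.H (n + 1) ≃ₗ[F]
      (E F (pow (T1 ∪ B)) ((ATow.nul M).tow.sup (pow T1))).L.H n) := fun n =>
    ⟨ofBijective (S.δ n) (S.bij_δ (hz _) (hz _))⟩
  refine ⟨fun n => ?_, fun n => ?_⟩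
  · cases n with
    | zero => infer_instance
    | succ n => have := h2.1 n; exact Module.Finite.equiv (e n).some.symm
  · cases n with
    | zero => exact finrank_zero_of_subsingleton
    | succ n =>
      show finrank F _ = _
      rw [(e n).some.finrank_eq]
      have := h2.2 n
      simpa [Cx.b] using this
end Local
end PG

namespace PG

section Cubes
variable {M : Type} [MetricSpace M] [CompactSpace M] {F : Type} [Field F]
  {G : Type} [AddCommGroup G] [AddAction G M] [IsIsometricVAdd G M] [Finite G] {r : ℕ}
  {c : (Fin r → ℝ) → M}

lemma homotopy_c (hc : IsOpenEmbedding c) {Q T : Set (Fin r → ℝ)} (hQ : IsCompact Q) (hT : T ⊆ Q)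
  {h : ℝ → (Fin r → ℝ) → (Fin r → ℝ)} (hh : Continuous fun q : ℝ × (Fin r → ℝ) => h q.1 q.2)
  (hhQ : ∀ t ∈ Icc (0:ℝ) 1, ∀ x ∈ Q, h t x ∈ Q) (hhT : ∀ t ∈ Icc (0:ℝ) 1, ∀ x ∈ T, h t x ∈ T)
  (h0 : ∀ x ∈ Q, h 0 x = x) (h1 : ∀ x ∈ Q, h 1 x ∈ T) (n : ℕ) :
  Acyc F (⊥ : AddSubgroup G) n (pow (c '' Q)) (pow (c '' T)) := by
  have hinv : ∀ x, invFun c (c x) = x := Function.leftInverse_invFun hc.injective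
  have hcont : ContinuousOn (invFun c) (Set.range c) := by
    have e := hc.toOpenPartialHomeomorph.continuousOn_symm
    refine ContinuousOn.congr e ?_ |>.mono ?_
    · rintro _ ⟨x, _, rfl⟩
      rw [hinv]
      exact (hc.toOpenPartialHomeomorph_left_inv).symm
    · simp
  refine homotopy n (hQ.image hc.continuous).isClosed (image_mono hT)
    (D := fun s x => c (h s (invFun c x))) ?_ ?_ ?_ ?_ ?_
  · refine hc.continuous.comp_continuousOn (hh.comp_continuousOn (continuousOn_fst.prodMk ?_))
    refine hcont.comp continuousOn_snd ?_
    rintro ⟨s, x⟩ ⟨_, ⟨y, _, rfl⟩⟩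
    exact ⟨y, rfl⟩
  · rintro t ht _ ⟨x, hx, rfl⟩
    rw [hinv]; exact ⟨_, hhQ t ht x hx, rfl⟩
  · rintro t ht _ ⟨x, hx, rfl⟩
    rw [hinv]; exact ⟨_, hhT t ht x hx, rfl⟩
  · rintro _ ⟨x, hx, rfl⟩
    rw [hinv, h0 x hx]
  · rintro _ ⟨x, hx, rfl⟩
    rw [hinv]; exact ⟨_, h1 x hx, rfl⟩

/-- faces of the cube -/
def cQ (r k : ℕ) : Set (Fin r → ℝ) := {y | (∀ i, |y i| ≤ 1) ∧ ∀ i : Fin r, k ≤ i → y i = 1}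
/-- their boundaries -/
def cB (r k : ℕ) : Set (Fin r → ℝ) := {y ∈ cQ r k | ∃ i : Fin r, (i : ℕ) < k ∧ |y i| = 1}

lemma cQ_compact (r k : ℕ) : IsCompact (cQ r k) := by
  refine Metric.isCompact_of_isClosed_isBounded ?_ ?_
  · refine IsClosed.and ?_ ?_
    · simp only [Set.ofPred_forall]
      exact isClosed_iInter fun i => isClosed_le ((continuous_apply i).abs) continuous_const
    · simp only [Set.ofPred_forall]
      exact isClosed_iInter fun i => isClosed_iInter fun _ => isClosed_eq (continuous_apply i) continuous_const
  · refine (Metric.isBounded_closedBall (x := (0 : Fin r → ℝ)) (r := 1)).subset fun y hy => ?_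
    rw [mem_closedBall_zero_iff, pi_norm_le_iff_of_nonneg zero_le_one]
    exact hy.1

lemma cQ_sph (G : Type) [AddCommGroup G] [AddAction G M] [IsIsometricVAdd G M] [Finite G]
  (hc : IsOpenEmbedding c) (k : ℕ) (hk : k ≤ r) :
  Sph (E F (pow (c '' cQ r k)) ((ATow.nul M).tow.sup (pow (c '' cB r k)))).L k := by
  induction k with
  | zero =>
    have h1 : cQ r 0 = {fun _ => 1} := by
      ext y
      constructor
      · rintro ⟨_, h⟩; funext i; exact h i (Nat.zero_le _)
      · rintro rfl; exact ⟨fun i => by simp, fun i _ => rfl⟩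
    have h2 : cB r 0 = ∅ := by
      ext y
      simp [cB]
    rw [h1, h2, Set.image_singleton, Set.image_empty]
    exact E_point G _
  | succ k ih =>
    have ih := ih (by omega)
    let kk : Fin r := ⟨k, by omega⟩
    let T1 : Set (Fin r → ℝ) := {y ∈ cQ r (k + 1) | y kk = -1 ∨ ∃ i : Fin r, (i : ℕ) < k ∧ |y i| = 1}
    have hlt : ∀ i : Fin r, (i : ℕ) < k + 1 ↔ i = kk ∨ (i : ℕ) < k := fun i => by
      rw [Fin.ext_iff]; show _ ↔ (i : ℕ) = k ∨ _; omega
    have hle : ∀ i : Fin r, k ≤ (i : ℕ) ↔ i = kk ∨ k + 1 ≤ (i : ℕ) := fun i => by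
      rw [Fin.ext_iff]; show _ ↔ (i : ℕ) = k ∨ _; omega
    have e1 : T1 ∩ cQ r k = cB r k := by
      ext y
      constructor
      · rintro ⟨⟨h1, h2⟩, h3⟩
        refine ⟨h3, h2.resolve_left ?_⟩
        rw [h3.2 kk le_rfl]; norm_num
      · rintro ⟨h1, h2⟩
        exact ⟨⟨⟨h1.1, fun i hi => h1.2 i (by omega)⟩, Or.inr h2⟩, h1⟩
    have e2 : T1 ∪ cQ r k = cB r (k + 1) := by
      ext y
      constructor
      · rintro (⟨h1, h2⟩ | h)
        · refine ⟨h1, ?_⟩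
          rcases h2 with h2 | ⟨i, hi, h2⟩
          · exact ⟨kk, by show k < k + 1; omega, by rw [h2]; norm_num⟩
          · exact ⟨i, by omega, h2⟩
        · exact ⟨⟨h.1, fun i hi => h.2 i (by omega)⟩, kk, by show k < k + 1; omega, by rw [h.2 kk le_rfl]; norm_num⟩
      · rintro ⟨h1, i, hi, h2⟩
        rcases (hlt i).1 hi with rfl | hi
        · rcases eq_or_eq_neg_of_abs_eq h2 with h3 | h3
          · right
            refine ⟨h1.1, fun i hi => ?_⟩
            rcases (hle i).1 hi with rfl | hi
            exacts [h3, h1.2 i hi]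
          · exact Or.inl ⟨h1, Or.inl h3⟩
        · exact Or.inl ⟨h1, Or.inr ⟨i, hi, h2⟩⟩
    have hT1c : IsClosed T1 := by
      have : T1 = cQ r (k + 1) ∩ ({y | y kk = -1} ∪ ⋃ i : Fin r, ⋃ _ : (i : ℕ) < k, {y | |y i| = 1}) := by
        ext y; simp [T1, and_or_left]
      rw [this]
      refine (cQ_compact r (k + 1)).isClosed.inter ((isClosed_eq (continuous_apply _) continuous_const).union ?_)
      exact isClosed_iUnion_of_finite fun i => isClosed_iUnion_of_finite fun _ =>
        isClosed_eq (continuous_apply i).abs continuous_const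
    have hT1Q : T1 ⊆ cQ r (k + 1) := fun y h => h.1
    have hT1 : IsClosed (c '' T1) := (((cQ_compact r (k + 1)).of_isClosed_subset hT1c hT1Q).image hc.continuous).isClosed
    have hB : IsClosed (c '' cQ r k) := ((cQ_compact r k).image hc.continuous).isClosed
    rw [← e1, Set.image_inter hc.injective] at ih
    rw [← e2, Set.image_union]
    refine sph_step G hT1 hB ?_ ?_ ih
    · rw [← Set.image_union, e2]
      exact image_mono fun y h => h.1
    · refine homotopy_c hc (cQ_compact r (k + 1)) hT1Q
        (h := fun s y => Function.update y kk ((1 - s) * y kk - s)) ?_ ?_ ?_ ?_ ?_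
      · refine Continuous.update continuous_snd kk ?_
        fun_prop
      · rintro t ⟨ht0, ht1⟩ y hy
        refine ⟨fun i => ?_, fun i hi => ?_⟩
        · by_cases h : i = kk
          · subst h
            rw [update_self]
            have := abs_le.1 (hy.1 kk)
            rw [abs_le]; constructor <;> nlinarith
          · rw [update_of_ne h]; exact hy.1 i
        · have h : i ≠ kk := by rintro rfl; have : k + 1 ≤ k := hi; omega
          rw [update_of_ne h]; exact hy.2 i hi
      · rintro t ⟨ht0, ht1⟩ y hy
        refine ⟨⟨fun i => ?_, fun i hi => ?_⟩, ?_⟩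
        · by_cases h : i = kk
          · subst h
            rw [update_self]
            have := abs_le.1 (hy.1.1 kk)
            rw [abs_le]; constructor <;> nlinarith
          · rw [update_of_ne h]; exact hy.1.1 i
        · have h : i ≠ kk := by rintro rfl; have : k + 1 ≤ k := hi; omega
          rw [update_of_ne h]; exact hy.1.2 i hi
        · rcases hy.2 with h | ⟨i, hi, h⟩
          · left; rw [update_self, h]; ring
          · right
            have h' : i ≠ kk := by rintro rfl; have : k < k := hi; omega
            exact ⟨i, hi, by rw [update_of_ne h']; exact h⟩
      · intro y hy
        simp
      · intro y hy
        refine ⟨⟨fun i => ?_, fun i hi => ?_⟩, ?_⟩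
        · by_cases h : i = kk
          · subst h
            rw [update_self]
            norm_num
          · rw [update_of_ne h]; exact hy.1 i
        · have h : i ≠ kk := by rintro rfl; have : k + 1 ≤ k := hi; omega
          rw [update_of_ne h]; exact hy.2 i hi
        · left; rw [update_self]; norm_num

lemma ball_sph (G : Type) [AddCommGroup G] [AddAction G M] [IsIsometricVAdd G M] [Finite G]
  (hc : IsOpenEmbedding c) :
  Sph (E F (pow univ) ((ATow.nul M).tow.sup (pow (c '' ball 0 1)ᶜ))).L r := by
  have h := cQ_sph (F := F) G hc r le_rfl
  have hA : IsClosed (c '' ball 0 1)ᶜ := (hc.isOpenMap _ isOpen_ball).isClosed_compl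
  have hB : IsClosed (c '' cQ r r) := ((cQ_compact r r).image hc.continuous).isClosed
  have hb : ∀ y : Fin r → ℝ, y ∈ ball (0 : Fin r → ℝ) 1 ↔ ∀ i, |y i| < 1 := fun y => by
    rw [mem_ball_zero_iff, pi_norm_lt_iff zero_lt_one]; rfl
  have e1 : (c '' ball 0 1)ᶜ ∩ c '' cQ r r = c '' cB r r := by
    rw [Set.inter_comm, ← Set.sdiff_eq, ← Set.image_sdiff hc.injective]
    congr 1
    ext y
    rw [Set.mem_sdiff, hb]
    push Not
    constructor
    · rintro ⟨h1, i, hi⟩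
      exact ⟨h1, i, i.2, le_antisymm (h1.1 i) hi⟩
    · rintro ⟨h1, i, _, hi⟩
      exact ⟨h1, i, hi.ge⟩
  have e2 : (c '' ball 0 1)ᶜ ∪ c '' cQ r r = univ := by
    rw [Set.union_comm, Set.eq_univ_iff_forall]
    intro x
    by_cases hx : x ∈ c '' ball 0 1
    · obtain ⟨y, hy, rfl⟩ := hx
      exact Or.inl ⟨y, ⟨fun i => ((hb y).1 hy i).le, fun i hi => by have := i.2; omega⟩, rfl⟩
    · exact Or.inr hx
  rw [← e1] at h
  have := (E_exc (F := F) G (a := ATow.nul M) hA hB).sph h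
  rwa [e2] at this

lemma ball_sph' (G : Type) [AddCommGroup G] [AddAction G M] [IsIsometricVAdd G M] [Finite G]
  (hc : IsOpenEmbedding c) {t : ℝ} (ht : 0 < t) :
  Sph (E F (pow univ) ((ATow.nul M).tow.sup (pow (c '' ball 0 t)ᶜ))).L r := by
  have h1 : IsOpenEmbedding (c ∘ Homeomorph.smulOfNeZero t ht.ne') :=
    hc.comp (Homeomorph.isOpenEmbedding _)
  have := ball_sph (F := F) G h1
  rw [Set.image_comp] at this
  have e : (Homeomorph.smulOfNeZero t ht.ne') '' ball (0 : Fin r → ℝ) 1 = ball 0 t := by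
    have := smul_unitBall_of_pos (E := Fin r → ℝ) ht
    rw [← this]; rfl
  rwa [e] at this

/-- complements of nested balls -/
lemma ball_acyc (hc : IsOpenEmbedding c) {t ρ : ℝ} (ht : 0 < t) {y : Fin r → ℝ} (hρ : 0 < ρ)
  (hy : ‖y‖ + ρ ≤ t) (n : ℕ) :
  Acyc F (⊥ : AddSubgroup G) n (pow (c '' ball y ρ)ᶜ) (pow (c '' ball 0 t)ᶜ) := by
  have hyi : ∀ i, |y i| + ρ ≤ t := fun i => (add_le_add_left (norm_le_pi_norm y i) ρ).trans hy
  have hVU : ball y ρ ⊆ ball 0 t := Metric.ball_subset_ball' (by rw [dist_zero_right]; linarith)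
  have hcl : ∀ z : Fin r → ℝ, z ∈ closedBall (0 : Fin r → ℝ) t ↔ ∀ i, |z i| ≤ t := fun z => by
    rw [mem_closedBall_zero_iff, pi_norm_le_iff_of_nonneg ht.le]; rfl
  have hb : ∀ z : Fin r → ℝ, z ∈ ball (0 : Fin r → ℝ) t ↔ ∀ i, |z i| < t := fun z => by
    rw [mem_ball_zero_iff, pi_norm_lt_iff ht]; rfl
  have hbV : ∀ z : Fin r → ℝ, z ∈ ball y ρ ↔ ∀ i, |z i - y i| < ρ := fun z => by
    rw [mem_ball, dist_pi_lt_iff hρ]; rfl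
  have hA : IsClosed (c '' ball 0 t)ᶜ := (hc.isOpenMap _ isOpen_ball).isClosed_compl
  have hQ : IsCompact (closedBall (0 : Fin r → ℝ) t \ ball y ρ) :=
    (isCompact_closedBall _ _).diff isOpen_ball
  have hB : IsClosed (c '' (closedBall 0 t \ ball y ρ)) := (hQ.image hc.continuous).isClosed
  have hbc : ball (0 : Fin r → ℝ) t ⊆ closedBall 0 t := Metric.ball_subset_closedBall
  have e1 : (c '' ball 0 t)ᶜ ∪ c '' (closedBall 0 t \ ball y ρ) = (c '' ball y ρ)ᶜ := by
    ext x
    constructor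
    · rintro (h | ⟨z, hz, rfl⟩)
      · exact fun h' => h (image_mono hVU h')
      · rintro ⟨z', hz', h⟩
        rw [hc.injective h] at hz'
        exact hz.2 hz'
    · intro h
      by_cases hx : x ∈ c '' ball 0 t
      · obtain ⟨z, hz, rfl⟩ := hx
        exact Or.inr ⟨z, ⟨hbc hz, fun h' => h ⟨z, h', rfl⟩⟩, rfl⟩
      · exact Or.inl hx
  have e2 : (c '' ball 0 t)ᶜ ∩ c '' (closedBall 0 t \ ball y ρ) =
      c '' (closedBall 0 t \ ball 0 t) := by
    ext x
    constructor
    · rintro ⟨h, ⟨z, hz, rfl⟩⟩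
      exact ⟨z, ⟨hz.1, fun h' => h ⟨z, h', rfl⟩⟩, rfl⟩
    · rintro ⟨z, hz, rfl⟩
      refine ⟨?_, ⟨z, ⟨hz.1, fun h' => hz.2 (hVU h')⟩, rfl⟩⟩
      rintro ⟨z', hz', h⟩
      rw [hc.injective h] at hz'
      exact hz.2 hz'
  rw [← e1]
  refine Acyc_union hA hB ?_
  rw [e2]
  set K : ℝ := 2 * t / ρ with hK
  have hK0 : 0 ≤ K := by positivity
  have hKρ : K * ρ = 2 * t := by rw [hK]; field_simp
  -- coordinatewise clamp
  have key1 : ∀ a : ℝ, |max (-t) (min t a)| ≤ t := fun a => by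
    rw [abs_le]; exact ⟨le_max_left _ _, max_le (by linarith) (min_le_left _ _)⟩
  have key2 : ∀ a b : ℝ, |b| + ρ ≤ t → ρ ≤ |a - b| → ∀ s : ℝ, 0 ≤ s →
      ρ ≤ |max (-t) (min t (b + (1 + s * K) * (a - b))) - b| := by
    intro a b hb hab s hs
    have hsk : 0 ≤ s * K := mul_nonneg hs hK0
    have hb' := abs_le.1 (show |b| ≤ t - ρ by linarith)
    rcases le_abs.1 hab with h | h
    · have : b + ρ ≤ b + (1 + s * K) * (a - b) := by nlinarith
      have : b + ρ ≤ max (-t) (min t (b + (1 + s * K) * (a - b))) :=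
        le_max_of_le_right (le_min (by linarith) this)
      exact le_abs.2 (Or.inl (by linarith))
    · have : b + (1 + s * K) * (a - b) ≤ b - ρ := by nlinarith
      have : max (-t) (min t (b + (1 + s * K) * (a - b))) ≤ b - ρ :=
        max_le (by linarith) (min_le_of_right_le this)
      exact le_abs.2 (Or.inr (by linarith))
  have key3 : ∀ a b : ℝ, |b| + ρ ≤ t → ∀ s : ℝ, 0 ≤ s → t ≤ |b + (1 + s * K) * (a - b)| →
      t ≤ |max (-t) (min t (b + (1 + s * K) * (a - b)))| := by
    intro a b hb s hs h
    rcases le_abs.1 h with h | h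
    · rw [min_eq_left h, max_eq_right (by linarith), abs_of_pos ht]
    · rw [min_eq_right (by linarith), max_eq_left (by linarith), abs_neg, abs_of_pos ht]
  refine homotopy_c hc hQ ?_ (h := fun s z i => max (-t) (min t (y i + (1 + s * K) * (z i - y i)))) ?_ ?_ ?_ ?_ ?_ n
  · exact fun z hz => ⟨hz.1, fun h' => hz.2 (hVU h')⟩
  · fun_prop
  · rintro s ⟨hs, _⟩ z ⟨hz1, hz2⟩
    rw [hbV] at hz2
    push Not at hz2
    obtain ⟨i, hi⟩ := hz2
    refine ⟨(hcl _).2 fun i => key1 _, fun h => ?_⟩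
    exact absurd ((hbV _).1 h i) (not_lt.2 (key2 _ _ (hyi i) hi s hs))
  · rintro s ⟨hs, _⟩ z ⟨hz1, hz2⟩
    rw [hb] at hz2
    push Not at hz2
    obtain ⟨i, hi⟩ := hz2
    refine ⟨(hcl _).2 fun i => key1 _, fun h => ?_⟩
    refine absurd ((hb _).1 h i) (not_lt.2 (key3 _ _ (hyi i) s hs ?_))
    have hsk : 0 ≤ s * K := mul_nonneg hs hK0
    have hb' := abs_le.1 (show |y i| ≤ t - ρ by linarith [hyi i])
    rcases le_abs.1 hi with h | h
    · exact le_abs.2 (Or.inl (by nlinarith))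
    · exact le_abs.2 (Or.inr (by nlinarith))
  · rintro z ⟨hz1, hz2⟩
    funext i
    have := abs_le.1 ((hcl z).1 hz1 i)
    simp only [zero_mul, add_zero, one_mul, add_sub_cancel]
    rw [min_eq_right this.2, max_eq_right this.1]
  · rintro z ⟨hz1, hz2⟩
    rw [hbV] at hz2
    push Not at hz2
    obtain ⟨i, hi⟩ := hz2
    refine ⟨(hcl _).2 fun i => key1 _, fun h => ?_⟩
    refine absurd ((hb _).1 h i) (not_lt.2 (key3 _ _ (hyi i) 1 zero_le_one ?_))
    have hb' := abs_le.1 (show |y i| ≤ t - ρ by linarith [hyi i])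
    rcases le_abs.1 hi with h | h
    · exact le_abs.2 (Or.inl (by nlinarith))
    · exact le_abs.2 (Or.inr (by nlinarith))
end Cubes
end PG

namespace PG

section Tower
variable {M : Type} [MetricSpace M] [CompactSpace M] {F : Type} [Field F]
  {G : Type} [AddCommGroup G] [AddAction G M] [IsIsometricVAdd G M] [Finite G] {r : ℕ}

lemma univ_min (X : Fam M) : pow univ ⊓ X = X := by
  ext l
  rw [mem_min]
  exact ⟨fun h => h.2, fun h => ⟨fun x _ => trivial, h⟩⟩

/-- passing from one level to a tower of acyclic levels -/
lemma E_level (G : Type) [AddCommGroup G] [AddAction G M] [IsIsometricVAdd G M] {X : Fam M} {τ : Tow M}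
  (h : ∀ i n, Acyc F (⊥ : AddSubgroup G) n (X ⊓ τ.T i) (X ⊓ τ.T 0)) :
  Cx.Qi (E F X (Tow.const (τ.T 0))).L (E F X τ).L := by
  have hm : ∀ i, ∃ j, X ⊓ (Tow.const (τ.T 0)).T i ≤ τ.T j := fun i => ⟨0, min_le_r⟩
  have hW : ∀ i n v, v ∈ (E F X (Tow.const (τ.T 0))).W i n ↔ v ∈ (E F X τ).W 0 n := fun i n v => by
    rw [mem_W, mem_W]; rfl
  set A := E F X τ with hA
  have ac : ∀ i n, ∀ v ∈ A.W 0 (n + 1), A.d v ∈ A.W i (n + 2) → ∃ g ∈ A.W 0 n, v - A.d g ∈ A.W i (n + 1) := by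
    intro i n v hv hdv
    obtain ⟨f, h1, h2, rfl⟩ := mem_W.1 hv
    obtain ⟨f', h1', h2', h3'⟩ := mem_W.1 hdv
    rw [hA, E_d, gm_eq] at h3'
    have hcob : cob f ∈ N F (X ⊓ τ.T i) := by
      have := sub_mem h2' (N_anti (min_le_l (X := X) (Y := τ.T i)) h3')
      rwa [sub_sub_cancel] at this
    obtain ⟨g, hg, hfg⟩ := h i n f ⟨⟨h1, Inv_bot _⟩, h2⟩ hcob
    refine ⟨gm F X g, mem_W.2 ⟨g, hg.1.1, hg.2, rfl⟩, mem_W.2 ⟨f - cob g, sub_mem h1 (cob_len hg.1.1), hfg, ?_⟩⟩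
    rw [map_sub]; rfl
  refine Cx.Qi.of_hom (E_map (F := F) (le_refl X) hm).L fun n => ⟨?_, ?_⟩
  · rw [injective_iff_map_eq_zero]
    intro x hx
    obtain ⟨⟨z, hz⟩, rfl⟩ := Cx.cls_surj _ n x
    obtain ⟨φ, rfl⟩ := FC.cl_surj _ _ z
    rw [Cx.Hom.map_cls, Cx.cls_zero] at hx
    obtain ⟨y, hy⟩ := hx
    obtain ⟨θ, rfl⟩ := FC.cl_surj _ _ y
    have hy' : A.cl (n + 1) (θ ∘ₗ A.d) = A.cl (n + 1) (φ ∘ₗ resG F (le_refl X)) := hy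
    rw [resG_id, comp_id, FC.cl_eq] at hy'
    obtain ⟨i, hi⟩ := hy'
    have hz' : (E F X (Tow.const (τ.T 0))).cl n (φ ∘ₗ A.d) = 0 := hz
    rw [FC.cl_zero] at hz'
    obtain ⟨i0, hi0⟩ := hz'
    rw [Cx.cls_zero]
    obtain ⟨ψ, hψ⟩ := dual_ext A.d (A.W 0 (n + 1)) φ (by
      intro v hv h0
      obtain ⟨g, hg, hvg⟩ := ac i n v hv (by rw [h0]; exact zero_mem _)
      have h1 : φ (A.d g) = 0 := hi0 g ((hW _ _ _).2 hg)
      have h2 := hi _ hvg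
      rw [LinearMap.comp_apply, map_sub A.d, A.dd, h0, sub_zero, map_zero, map_sub, h1, sub_zero] at h2
      exact h2.symm)
    refine ⟨FC.cl _ _ ψ, ?_⟩
    show (E F X (Tow.const (τ.T 0))).cl (n + 1) (ψ ∘ₗ A.d) = (E F X (Tow.const (τ.T 0))).cl (n + 1) φ
    rw [FC.cl_eq]
    exact ⟨0, fun v hv => hψ v ((hW _ _ _).1 hv)⟩
  · intro x
    obtain ⟨⟨z, hz⟩, rfl⟩ := Cx.cls_surj _ n x
    obtain ⟨ψ, rfl⟩ := FC.cl_surj _ _ z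
    have hz' : A.cl n (ψ ∘ₗ A.d) = 0 := hz
    rw [FC.cl_zero] at hz'
    obtain ⟨i, hi⟩ := hz'
    let D : Submodule F (Germ F X) := (A.W 0 n).map A.d
    obtain ⟨ρ, hρ⟩ := dual_ext D.mkQ (A.W i (n + 1) ⊓ ker A.d) ψ (by
      intro v hv h0
      rw [mkQ_apply, Submodule.Quotient.mk_eq_zero] at h0
      obtain ⟨g, hg, rfl⟩ := h0
      cases n with
      | zero => rw [E_h0 X τ g hg]; simp
      | succ m =>
        obtain ⟨u, hu, hgu⟩ := ac i m g hg hv.1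
        have := hi _ hgu
        rwa [LinearMap.comp_apply, map_sub A.d, A.dd, sub_zero] at this)
    obtain ⟨θ, hθ⟩ := dual_ext A.d (A.W i (n + 1)) (ρ ∘ₗ D.mkQ - ψ) (by
      intro v hv h0
      rw [LinearMap.sub_apply, LinearMap.comp_apply, hρ v ⟨hv, h0⟩, sub_self])
    have hcyc : (E F X (Tow.const (τ.T 0))).cl n ((ρ ∘ₗ D.mkQ) ∘ₗ A.d) = 0 := by
      rw [FC.cl_zero]
      refine ⟨0, fun v hv => ?_⟩
      rw [LinearMap.comp_apply, LinearMap.comp_apply]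
      have : D.mkQ (A.d v) = 0 := by
        rw [mkQ_apply, Submodule.Quotient.mk_eq_zero]
        exact ⟨v, (hW _ _ _).1 hv, rfl⟩
      rw [this, map_zero]
    refine ⟨Cx.cls _ n ⟨FC.cl _ (n + 1) (ρ ∘ₗ D.mkQ), hcyc⟩, ?_⟩
    rw [Cx.Hom.map_cls, Cx.cls_eq]
    refine ⟨A.cl _ θ, ?_⟩
    show A.cl (n + 1) (θ ∘ₗ A.d) = A.cl (n + 1) ((ρ ∘ₗ D.mkQ) ∘ₗ resG F (le_refl X)) - A.cl (n + 1) ψ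
    rw [resG_id, comp_id, ← map_sub, FC.cl_eq]
    exact ⟨i, hθ⟩

/-- the tower of complements of balls at a point -/
def ptow (x : M) : ATow M where
  A i := {y | 1 / ((i : ℝ) + 1) ≤ dist x y}
  mono {i j} h y hy := by
    have hy' : 1 / ((i : ℝ) + 1) ≤ dist x y := hy
    refine le_trans (b := 1 / ((i : ℝ) + 1)) ?_ hy'
    exact one_div_le_one_div_of_le (by positivity) (by exact_mod_cast Nat.add_le_add_right h 1)
  closed i := isClosed_le continuous_const (continuous_const.dist continuous_id)

lemma ptow_inv {x : M} {K : AddSubgroup G} (hK : ∀ k ∈ K, k +ᵥ x = x) : (ptow x).IsI K := by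
  intro i k hk y hy
  show _ ≤ dist x (k +ᵥ y)
  have : dist x (k +ᵥ y) = dist x y := by
    conv_lhs => rw [← hK k hk]
    exact dist_vadd _ _ _
  rw [this]; exact hy

lemma ptow_nhds {x : M} {U : Set M} (hU : IsOpen U) (hx : x ∈ U) : ∃ i, Uᶜ ⊆ (ptow x).A i := by
  obtain ⟨ε, hε, h⟩ := isOpen_iff.1 hU x hx
  obtain ⟨i, hi⟩ := exists_nat_one_div_lt hε
  refine ⟨i, fun y hy => ?_⟩
  by_contra hlt
  exact hy (h (by rw [mem_ball, dist_comm]; exact (not_le.1 hlt).trans hi))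

lemma ptow_compl (x : M) (i : ℕ) : IsOpen ((ptow x).A i)ᶜ ∧ x ∈ ((ptow x).A i)ᶜ := by
  refine ⟨((ptow x).closed i).isOpen_compl, fun h => ?_⟩
  have h : 1 / ((i : ℝ) + 1) ≤ dist x x := h
  rw [dist_self] at h
  have : (0:ℝ) < 1 / ((i : ℝ) + 1) := by positivity
  linarith

variable {c : (Fin r → ℝ) → M}

lemma exists_box (hc : IsOpenEmbedding c) {U : Set M} (hU : IsOpen U) (y : Fin r → ℝ) (hy : c y ∈ U) :
  ∃ t > 0, ∀ s ≤ t, c '' ball y s ⊆ U := by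
  obtain ⟨t, ht, h⟩ := isOpen_iff.1 (hU.preimage hc.continuous) y hy
  exact ⟨t, ht, fun s hs => Set.image_subset_iff.2 ((ball_subset_ball hs).trans h)⟩

/-- local spheres -/
lemma pt_sph (G : Type) [AddCommGroup G] [AddAction G M] [IsIsometricVAdd G M] [Finite G]
  (hc : IsOpenEmbedding c) : Sph (E F (pow univ) (ptow (c 0)).tow).L r := by
  let b : ATow M := ⟨fun i => (c '' ball 0 (1 / ((i : ℝ) + 1)))ᶜ, by
    intro i j h
    refine Set.compl_subset_compl.2 (image_mono (ball_subset_ball ?_))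
    exact one_div_le_one_div_of_le (by positivity) (by exact_mod_cast Nat.add_le_add_right h 1),
    fun i => (hc.isOpenMap _ isOpen_ball).isClosed_compl⟩
  have h1 := E_level (F := F) G (X := pow univ) (τ := b.tow) (fun i n => by
    rw [univ_min, univ_min]
    refine ball_acyc hc (by positivity) (by positivity) ?_ n
    rw [norm_zero, zero_add]
    exact one_div_le_one_div_of_le (by positivity) (by simp))
  have h2 := ball_sph' (F := F) G hc (t := 1 / ((0 : ℕ) + 1 : ℝ)) (by positivity)
  have e : E F (pow univ) (Tow.const (b.tow.T 0)) =
      E F (pow univ) ((ATow.nul M).tow.sup (pow (c '' ball 0 (1 / ((0 : ℕ) + 1 : ℝ)))ᶜ)) := E_congr fun i => by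
    rw [univ_min, univ_min]
    ext l
    show l ∈ b.tow.T 0 ↔ l ∈ pow ∅ ∨ l ∈ b.tow.T 0
    have := fun h => pow_empty_le (b.tow.T 0) (a := l) h
    tauto
  rw [← e] at h2
  have h3 := h1.sph h2
  have hx : ∀ i, ∃ j, pow univ ⊓ b.tow.T i ≤ (ptow (c 0)).tow.T j := fun i => by
    obtain ⟨j, hj⟩ := ptow_nhds (hc.isOpenMap _ (isOpen_ball (x := 0) (ε := 1 / ((i : ℝ) + 1))))
      ⟨0, mem_ball_self (by positivity), rfl⟩
    refine ⟨j, ?_⟩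
    rw [univ_min]
    exact pow_mono hj
  have hx' : ∀ i, ∃ j, pow univ ⊓ (ptow (c 0)).tow.T i ≤ b.tow.T j := fun i => by
    obtain ⟨h1, h2⟩ := ptow_compl (c 0) i
    obtain ⟨t, ht, h⟩ := exists_box hc h1 0 h2
    obtain ⟨j, hj⟩ := exists_nat_one_div_lt ht
    refine ⟨j, ?_⟩
    rw [univ_min]
    exact pow_mono (Set.subset_compl_comm.1 (h _ hj.le))
  exact (Cx.Qi.of_hom _ (E_qi hx hx')).sph h3

/-- a local class vanishing on small open sets is zero -/
lemma newman_key (G : Type) [AddCommGroup G] [AddAction G M] [IsIsometricVAdd G M] [Finite G]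
  (hc : IsOpenEmbedding c) {n : ℕ}
  {φ : Dual F (Germ F (pow (univ : Set M)))} {j : ℕ}
  (hφ : ∀ v ∈ (E F (pow univ) (ptow (c 0)).tow).W j n, φ ((E F (pow univ) (ptow (c 0)).tow).d v) = 0)
  (hO : ∀ U : Set M, IsOpen U → c 0 ∈ U → ∃ O ⊆ U, IsOpen O ∧ O.Nonempty ∧ ∃ θ : Dual F (Germ F (pow (univ : Set M))),
  ∀ f ∈ Len M F (n + 1), f ∈ N F (pow Oᶜ) → φ (gm F _ f) = θ (gm F _ (cob f))) :
  ∃ i, ∃ θ : Dual F (Germ F (pow (univ : Set M))),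
  ∀ v ∈ (E F (pow univ) (ptow (c 0)).tow).W i (n + 1), φ v = θ ((E F (pow univ) (ptow (c 0)).tow).d v) := by
  obtain ⟨h1, h2⟩ := ptow_compl (c 0) j
  obtain ⟨t, ht, hU⟩ := exists_box hc h1 0 h2
  have hU := hU t le_rfl
  have hUo : IsOpen (c '' ball 0 t) := hc.isOpenMap _ isOpen_ball
  obtain ⟨O, hOU, hOo, ⟨o, ho⟩, θ, hθ⟩ := hO _ hUo ⟨0, mem_ball_self ht, rfl⟩
  obtain ⟨y, hy, rfl⟩ := hOU ho
  obtain ⟨s, hs, hV⟩ := exists_box hc hOo y ho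
  rw [mem_ball_zero_iff] at hy
  set ρ := min s (t - ‖y‖) with hρ
  have hρ0 : 0 < ρ := lt_min hs (by linarith)
  have hρt : ‖y‖ + ρ ≤ t := by have := min_le_right s (t - ‖y‖); linarith
  have hV := hV ρ (min_le_left _ _)
  obtain ⟨i, hi⟩ := ptow_nhds hUo ⟨0, mem_ball_self ht, rfl⟩
  have hac := ball_acyc (F := F) (G := G) hc ht hρ0 hρt n
  obtain ⟨ψ, hψ⟩ := dual_ext (E F (pow univ) (ptow (c 0)).tow).d
    ((E F (pow univ) (ptow (c 0)).tow).W i (n + 1)) φ (by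
      intro v hv h0
      obtain ⟨f, hf1, hf2, rfl⟩ := mem_W.1 hv
      rw [univ_min] at hf2
      have hf3 : f ∈ N F (pow (c '' ball 0 t)ᶜ) := N_anti (pow_mono hi) hf2
      rw [E_d, gm_eq_zero] at h0
      obtain ⟨g, hg, hfg⟩ := hac f ⟨⟨hf1, Inv_bot _⟩, hf3⟩ (N_anti (pow_mono (Set.subset_univ _)) h0)
      have e1 : φ (gm F _ (cob g)) = 0 := by
        refine hφ (gm F _ g) (mem_W.2 ⟨g, hg.1.1, ?_, rfl⟩)
        rw [univ_min]
        exact N_anti (pow_mono (Set.subset_compl_comm.1 hU)) hg.2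
      have e2 := hθ (f - cob g) (sub_mem hf1 (cob_len hg.1.1))
        (N_anti (pow_mono (Set.compl_subset_compl.2 hV)) hfg)
      rw [map_sub, map_sub, e1, sub_zero, cob_sub, cob_cob, sub_zero] at e2
      rw [e2, gm_eq_zero.2 h0, map_zero])
  exact ⟨i, ψ, fun v hv => (hψ v hv).symm⟩

/-- locally euclidean spaces -/
def LE (M : Type) [TopologicalSpace M] (r : ℕ) : Prop :=
  ∀ x : M, ∃ c : (Fin r → ℝ) → M, IsOpenEmbedding c ∧ c 0 = x

lemma CD_LE (h : LE M r) : CD F G (univ : Set M) r := by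
  choose c hc h0 using h
  obtain ⟨s, hs⟩ := isCompact_univ.elim_finite_subcover (fun x => c x '' ball 0 1)
    (fun x => (hc x).isOpenMap _ isOpen_ball)
    (fun x _ => Set.mem_iUnion.2 ⟨x, 0, mem_ball_self one_pos, h0 x⟩)
  have hcl : ∀ x, IsClosed (c x '' closedBall 0 1) := fun x =>
    ((isCompact_closedBall _ _).image (hc x).continuous).isClosed
  refine (CD_biUnion s (fun x => c x '' closedBall 0 1) hcl fun x _ => ?_).mono
    (hs.trans (Set.iUnion₂_mono fun x _ => image_mono Metric.ball_subset_closedBall))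
  have hinv : ∀ z, invFun (c x) (c x z) = z := Function.leftInverse_invFun (hc x).injective
  have hcont : ContinuousOn (invFun (c x)) (Set.range (c x)) := by
    have e := (hc x).toOpenPartialHomeomorph.continuousOn_symm
    refine ContinuousOn.congr e ?_ |>.mono ?_
    · rintro _ ⟨x, _, rfl⟩
      rw [hinv]
      exact ((hc _).toOpenPartialHomeomorph_left_inv).symm
    · simp
  refine CD_of_inj _ (hcl x) (fun i y => invFun (c x) y i) (fun i => ?_) ?_
  · exact (continuous_apply i).comp_continuousOn (hcont.mono (Set.image_subset_range _ _))
  · rintro _ ⟨y, _, rfl⟩ _ ⟨z, _, rfl⟩ h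
    simp only [hinv] at h
    rw [funext h]
end Tower
end PG

namespace PG

lemma Cx.prod_kill {F : Type} [Field F] {A B C : Cx F} (f : Hom (A.prod B) C) {n : ℕ} (hB : Subsingleton (B.H n))
  (h : ∀ a, f.f (n + 1) (a, 0) ∈ ker (C.d n) → ∃ y, C.d (n + 1) y = f.f (n + 1) (a, 0)) (y : (A.prod B).H n) :
  f.map n y = 0 := by
  obtain ⟨⟨⟨a, b⟩, hz⟩, rfl⟩ := Cx.cls_surj _ n y
  have ha : A.d n a = 0 := congrArg Prod.fst hz
  have hb : b ∈ ker (B.d n) := congrArg Prod.snd hz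
  obtain ⟨w, hw⟩ := (Cx.cls_zero ⟨b, hb⟩).1 (Subsingleton.elim _ _)
  have h0 : (A.prod B).d n (a, 0) = 0 := Prod.ext ha (map_zero (B.d n))
  have e : Cx.cls (A.prod B) n ⟨(a, b), hz⟩ = Cx.cls (A.prod B) n ⟨(a, 0), h0⟩ := by
    rw [Cx.cls_eq]
    refine ⟨((0 : A.V (n + 2)), w), Prod.ext ?_ ?_⟩
    · show A.d (n + 1) 0 = a - a
      rw [map_zero, sub_self]
    · show B.d (n + 1) w = b - 0
      rw [sub_zero, hw]
  rw [e, Cx.Hom.map_cls, Cx.cls_zero]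
  exact h a ((f.comm n (a, 0)).trans ((congrArg (f.f n) h0).trans (map_zero _)))

section Newman
variable {M : Type} [MetricSpace M] [CompactSpace M] {F : Type} [Field F]
  {G : Type} [AddCommGroup G] [AddAction G M] [IsIsometricVAdd G M] [Finite G] {r : ℕ}
  {c : (Fin r → ℝ) → M} {p : ℕ} [hp : Fact p.Prime] [CharP F p] {g : G}

lemma newman_zero (G : Type) [AddCommGroup G] [AddAction G M] [IsIsometricVAdd G M] [Finite G]
  (hc : IsOpenEmbedding c) {n : ℕ}
  {φ : Dual F (Germ F (pow (univ : Set M)))}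
  (hz : (E F (pow univ) (ptow (c 0)).tow).cl (n + 1) φ ∈ ker ((E F (pow univ) (ptow (c 0)).tow).L.d n))
  (hO : ∀ U : Set M, IsOpen U → c 0 ∈ U → ∃ O ⊆ U, IsOpen O ∧ O.Nonempty ∧
  ∀ f ∈ N F (pow Oᶜ), φ (gm F _ f) = 0) :
  Cx.cls _ n ⟨_, hz⟩ = 0 := by
  have hz' : (E F (pow univ) (ptow (c 0)).tow).cl n (φ ∘ₗ (E F (pow univ) (ptow (c 0)).tow).d) = 0 := hz
  rw [FC.cl_zero] at hz'
  obtain ⟨j, hj⟩ := hz'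
  obtain ⟨i, θ, h⟩ := newman_key G hc (n := n) (φ := φ) (j := j) hj (by
    intro U hU hx
    obtain ⟨O, h1, h2, h3, h4⟩ := hO U hU hx
    exact ⟨O, h1, h2, h3, 0, fun f _ hf => by rw [h4 f hf]; rfl⟩)
  rw [Cx.cls_zero]
  refine ⟨(E F (pow univ) (ptow (c 0)).tow).cl _ θ, ?_⟩
  rw [FC.d_cl]
  exact FC.cl_eq.2 ⟨i, fun v hv => (h v hv).symm⟩

lemma sph_nontriv {C : Cx F} {d : ℕ} (h : Sph C d) : ¬ Subsingleton (C.H d) := by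
  intro hs
  have h1 := h.2 d
  rw [if_pos rfl] at h1
  have h2 : finrank F (C.H d) = 0 := finrank_zero_of_subsingleton
  have h3 : finrank F (C.H d) = 1 := h1
  omega

lemma newman_int (hc : IsOpenEmbedding c) (hgp : p • g = 0) (hg0 : g ≠ 0) (hx : g +ᵥ c 0 = c 0)
  (hCD : CD F G (univ : Set M) r)
  (h : Sph (E F (pow (fixS univ g)) (ptow (c 0)).tow).L r) :
  c 0 ∈ interior (fixS univ g) := by
  by_contra hni
  have hM := pt_sph (F := F) G hc
  have ha : (ptow (c 0)).IsI (zmultiples g) := ptow_inv fun k hk => by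
    have : zmultiples g ≤ stabilizer G (c 0) := by
      rw [zmultiples_le]; exact hx
    exact this hk
  have hz := smith_zero (F := F) hgp hg0 isClosed_univ (fun _ _ _ _ => trivial) ha hCD hM h
  have hb := ((E_ses (F := F) (pow_mono (fixS_sub univ g)) (ptow (c 0)).tow).bij_f hz r).2
  refine sph_nontriv hM (subsingleton_of_forall_eq 0 fun y => ?_)
  obtain ⟨w, rfl⟩ := hb y
  obtain ⟨⟨z, hz⟩, rfl⟩ := Cx.cls_surj _ r w
  obtain ⟨ψ, rfl⟩ := FC.cl_surj _ _ z
  rw [Cx.Hom.map_cls]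
  refine newman_zero G hc (φ := ψ ∘ₗ resG F (pow_mono (fixS_sub univ g))) _ ?_
  intro U hU hxU
  refine ⟨U \ fixS univ g, Set.sdiff_subset, hU.sdiff (fixS_closed isClosed_univ g), ?_, ?_⟩
  · rw [Set.sdiff_nonempty]
    intro hs
    exact hni (mem_interior.2 ⟨U, hs, hU, hxU⟩)
  · intro f hf
    have : resG F (pow_mono (fixS_sub univ g)) (gm F _ f) = 0 := by
      rw [resG_gm, gm_eq_zero]
      exact N_anti (pow_mono fun y hy hy' => hy'.2 hy) hf
    rw [LinearMap.comp_apply, this, map_zero]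

lemma aG_fix_local {g : G} (hgX : ∀ l ∈ pow (univ : Set M), tr g l ∈ pow (univ : Set M)) {y : M} {s : ℝ} (hs : 0 < s)
  (h : ball y (2 * s) ⊆ fixS univ g) {f : List M → F} (hf : f ∈ N F (pow (ball y s)ᶜ)) :
  aG F g hgX (gm F _ f) = gm F _ f := by
  rw [aG_gm, gm_eq]
  obtain ⟨ε, hε, hf⟩ := hf
  refine ⟨min ε s, lt_min hε hs, fun l _ hl => ?_⟩
  rw [Pi.sub_apply, trL_apply]
  by_cases hin : ∀ z ∈ l, z ∈ ball y (2 * s)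
  · have : tr g l = l := by
      unfold tr
      conv_rhs => rw [← map_id l]
      exact List.map_congr_left fun z hz => (h (hin z hz)).2
    rw [this, sub_self]
  · push Not at hin
    obtain ⟨z, hz, hzo⟩ := hin
    have h1 : l ∈ pow (ball y s)ᶜ := by
      intro w hw hwb
      refine hzo ?_
      have := hl z hz w hw
      rw [mem_ball] at *
      have h3 := dist_triangle z w y
      have := this.trans_le (min_le_right _ _)
      linarith
    have h2 : tr g l ∈ pow (ball y s)ᶜ := by
      intro w hw hwb
      obtain ⟨w', hw', rfl⟩ := mem_tr.1 hw
      have h3 := (h (ball_subset_ball (by linarith) hwb)).2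
      have h4 : g +ᵥ w' = w' := by
        have := vadd_left_cancel g h3
        exact this
      rw [h4] at hwb
      exact h1 w' hw' hwb
    have hl' := Sm_mono (min_le_left _ _) hl
    rw [hf l h1 hl', hf _ h2 ((tr_Sm g ε l).2 hl'), sub_zero]

lemma newman_cl (hc : IsOpenEmbedding c) (hgp : p • g = 0) (hg0 : g ≠ 0) (hx : g +ᵥ c 0 = c 0)
  (hCD : CD F G (univ : Set M) r)
  (h : Subsingleton ((E F (pow (fixS univ g)) (ptow (c 0)).tow).L.H r)) :
  c 0 ∉ closure (interior (fixS univ g)) := by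
  intro hcl
  have hM := pt_sph (F := F) G hc
  have ha : (ptow (c 0)).IsI (zmultiples g) := ptow_inv fun k hk => by
    have : zmultiples g ≤ stabilizer G (c 0) := by
      rw [zmultiples_le]; exact hx
    exact this hk
  have huniv : ∀ l ∈ pow (univ : Set M), tr g l ∈ pow (univ : Set M) := fun _ _ _ _ => trivial
  obtain ⟨m, S, hN⟩ := smith (F := F) (X := univ) hgp hg0 isClosed_univ (fun _ _ _ _ => trivial) ha hCD huniv
  have hbd := (S.bd (E_bd' isClosed_univ hCD) hN).2
  have key : ∀ b y, ((S.map2 b).L.comp (FC.prodHom _ _)).map r y = 0 := by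
    intro b y
    refine Cx.prod_kill _ h (fun a ha => ?_) y
    obtain ⟨ψ, rfl⟩ := FC.cl_surj _ _ a
    have e : ((S.map2 b).L.comp (FC.prodHom _ _)).f (r + 1)
        (((E F (pow (univ : Set M)) ((ptow (c 0)).tow.sup (pow (fixS univ g)))).im _ (S.D.sop_d b)).cl (r + 1) ψ, 0) =
        (E F (pow (univ : Set M)) (ptow (c 0)).tow).cl (r + 1) (ψ ∘ₗ sop p (aG F g huniv) b) := by
      show (E F (pow (univ : Set M)) (ptow (c 0)).tow).cl (r + 1) _ = _
      congr 1
      refine LinearMap.ext fun v => ?_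
      show ψ _ + 0 = _
      rw [add_zero]; rfl
    rw [e] at ha ⊢
    rw [← Cx.cls_zero ⟨_, ha⟩]
    refine newman_zero G hc ha ?_
    intro U hU hxU
    obtain ⟨y, hyU, hyI⟩ := mem_closure_iff.1 hcl U hU hxU
    obtain ⟨ε, hε, hb⟩ := isOpen_iff.1 (hU.inter isOpen_interior) y ⟨hyU, hyI⟩
    have h2 : ball y (2 * (ε / 2)) ⊆ U ∩ interior (fixS univ g) := by
      rwa [mul_div_cancel₀ _ (two_ne_zero' ℝ)]
    refine ⟨ball y (ε / 2), fun z hz => (h2 (ball_subset_ball (by linarith) hz)).1,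
      isOpen_ball, ⟨y, mem_ball_self (by linarith)⟩, fun f hf => ?_⟩
    have h3 := aG_fix_local (F := F) (g := g) huniv (half_pos hε)
      (h2.trans (inter_subset_right.trans interior_subset)) hf
    rw [LinearMap.comp_apply, SDat.sop_fix h3, map_zero]
  have hprod : ∀ b, Subsingleton (((E F (pow (univ : Set M)) ((ptow (c 0)).tow.sup (pow (fixS univ g)))).im _ (S.D.sop_d b)).L.H r) := by
    intro b
    refine (SDat.prod_sub (D := (E F (pow (fixS univ g)) (ptow (c 0)).tow).L) (subsingleton_of_forall_eq 0 fun y => ?_)).1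
    obtain ⟨w, rfl⟩ := ((S.ses1 b).exact_A r y).1 (key b y)
    have := hbd (!b) (r + 1) (by omega)
    rw [Subsingleton.elim w 0, map_zero]
  refine sph_nontriv hM (subsingleton_of_forall_eq 0 fun y => ?_)
  have := hprod (!true)
  obtain ⟨w, rfl⟩ := ((S.ses1 true).exact_B r y).1 (Subsingleton.elim _ _)
  exact key true w

/-- Newman's theorem: fixed sets have smaller dimension -/
lemma newman [ConnectedSpace M] (hLE : LE M r) (hodd : p ≠ 2) (hgp : p • g = 0) (hg : ∃ y : M, g +ᵥ y ≠ y) {x : M} (hx : g +ᵥ x = x) :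
  ∃ e < r, Sph (E F (pow (fixS univ g)) (ptow x).tow).L e ∧ e % 2 = r % 2 := by
  have hg0 : g ≠ 0 := by rintro rfl; obtain ⟨y, hy⟩ := hg; exact hy (zero_vadd _ _)
  have hCD : CD F G (univ : Set M) r := CD_LE hLE
  have hsph : ∀ x : M, g +ᵥ x = x → ∃ e ≤ r, Sph (E F (pow (fixS univ g)) (ptow x).tow).L e ∧ e % 2 = r % 2 := by
    intro x hx
    obtain ⟨c, hc, rfl⟩ := hLE x
    refine smith_sph hodd hgp hg0 isClosed_univ (fun _ _ _ _ => trivial) (ptow_inv fun k hk => ?_) hCD (pt_sph (F := F) G hc)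
    have : zmultiples g ≤ stabilizer G (c 0) := by
      rw [zmultiples_le]; exact hx
    exact this hk
  have hclosed : IsClosed (interior (fixS (univ : Set M) g)) := by
    refine isClosed_of_closure_subset fun y hy => ?_
    have hyF : g +ᵥ y = y := ((fixS_closed isClosed_univ g).closure_subset_iff.2 interior_subset hy).2
    obtain ⟨e, he, hs, _⟩ := hsph y hyF
    obtain ⟨c, hc, rfl⟩ := hLE y
    by_cases her : e = r
    · subst her; exact newman_int hc hgp hg0 hyF hCD hs
    · exact absurd hy (newman_cl hc hgp hg0 hyF hCD (Cx.sph_sub hs (Ne.symm her)))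
  have hempty : interior (fixS (univ : Set M) g) = ∅ := by
    rcases isClopen_iff.1 ⟨hclosed, isOpen_interior⟩ with h | h
    · exact h
    · obtain ⟨y, hy⟩ := hg
      have : y ∈ interior (fixS (univ : Set M) g) := by rw [h]; trivial
      exact absurd (interior_subset this).2 hy
  obtain ⟨e, he, hs, hpar⟩ := hsph x hx
  refine ⟨e, lt_of_le_of_ne he ?_, hs, hpar⟩
  rintro rfl
  obtain ⟨c, hc, rfl⟩ := hLE x
  have := newman_int hc hgp hg0 hx hCD hs
  rw [hempty] at this
  exact this

end Newman
end PG

namespace PG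

lemma sub_ind {G : Type} [AddCommGroup G] [Finite G] {H' : AddSubgroup G} (P : AddSubgroup G → Prop) (h0 : P H')
  (hs : ∀ H ≤ H', ∀ g ∈ H', g ∉ H → P (H ⊔ zmultiples g) → P H) : ∀ H ≤ H', P H := by
  have : Finite (AddSubgroup G) := inferInstance
  intro H
  induction H using WellFoundedGT.induction with
  | ind H ih =>
    intro hH
    by_cases hle : H' ≤ H
    · rwa [← le_antisymm hH hle] at h0
    · obtain ⟨g, hg, hgH⟩ := not_subset.1 hle
      refine hs H hH g hg hgH (ih _ ?_ (sup_le hH (zmultiples_le.2 hg)))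
      refine lt_of_le_of_ne le_sup_left fun h => hgH ?_
      have : g ∈ H ⊔ zmultiples g := (le_sup_right : _ ≤ H ⊔ zmultiples g) (mem_zmultiples g)
      rwa [← h] at this

lemma lt_sup_zm {G : Type} [AddCommGroup G] {H : AddSubgroup G} {g : G} (hg : g ∉ H) : H < H ⊔ zmultiples g := by
  refine lt_of_le_of_ne le_sup_left fun h => hg ?_
  have : g ∈ H ⊔ zmultiples g := (le_sup_right : _ ≤ H ⊔ zmultiples g) (mem_zmultiples g)
  rwa [← h] at this

lemma zs_mem {G : Type} [AddCommGroup G] {p : ℕ} [hp : Fact p.Prime] {L : AddSubgroup G} {g : G} (hgp : p • g = 0) {c : ℤ}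
  (h : c • g ∈ L) : c • g = 0 ∨ g ∈ L := by
  by_cases hc : (p : ℤ) ∣ c
  · obtain ⟨e, rfl⟩ := hc
    left
    rw [mul_comm, mul_zsmul, natCast_zsmul, hgp, zsmul_zero]
  · right
    have hcop : IsCoprime c (p : ℤ) :=
      ((Nat.prime_iff_prime_int.1 hp.out).coprime_iff_not_dvd.2 hc).symm
    obtain ⟨a, b, hab⟩ := hcop
    have h2 : g = a • (c • g) := by
      have : g = a • (c • g) + b • ((p : ℤ) • g) := by
        rw [← mul_zsmul, ← mul_zsmul, ← add_zsmul, hab, one_zsmul]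
      rwa [natCast_zsmul, hgp, zsmul_zero, add_zero] at this
    rw [h2]
    exact zsmul_mem h a

section Dims
variable {M : Type} [MetricSpace M] [CompactSpace M] {F : Type} [Field F]
  {G : Type} [AddCommGroup G] [AddAction G M] [IsIsometricVAdd G M] [Finite G] {r : ℕ}
  {p : ℕ} [hp : Fact p.Prime] [CharP F p]

/-- fixed set of a subgroup -/
def fixH (M : Type) [MetricSpace M] {G : Type} [AddCommGroup G] [AddAction G M] (H : AddSubgroup G) : Set M :=
  {y | ∀ h ∈ H, h +ᵥ y = y}

lemma fixH_anti {H H' : AddSubgroup G} (h : H ≤ H') : fixH M H' ⊆ fixH M H := fun _ hy g hg => hy g (h hg)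
lemma fixH_closed (H : AddSubgroup G) : IsClosed (fixH M H) := by
  have : fixH M H = ⋂ h ∈ H, {y : M | h +ᵥ y = y} := by
    ext y; simp only [Set.mem_iInter]; exact Iff.rfl
  rw [this]
  exact isClosed_biInter fun h _ => isClosed_eq (isometry_vadd M h).continuous continuous_id
lemma fixH_inv (H K : AddSubgroup G) : SInv (fixH M H) K := fun k _ y hy h hh => by
  rw [vadd_comm, hy h hh]
lemma fixH_iff {H : AddSubgroup G} {y : M} : y ∈ fixH M H ↔ H ≤ stabilizer G y := Iff.rfl
lemma fixH_sup (H K : AddSubgroup G) : fixH M (H ⊔ K) = fixH M H ∩ fixH M K := by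
  ext y
  rw [Set.mem_inter_iff, fixH_iff, fixH_iff, fixH_iff, sup_le_iff]
lemma fixH_zm (H : AddSubgroup G) (g : G) : fixH M (H ⊔ zmultiples g) = fixS (fixH M H) g := by
  rw [fixH_sup]
  ext y
  rw [Set.mem_inter_iff, fixH_iff (H := zmultiples g), zmultiples_le]
  exact Iff.rfl
lemma fixH_bot : fixH M (⊥ : AddSubgroup G) = univ := by
  ext y
  simp only [Set.mem_univ, iff_true]
  rintro h rfl
  exact zero_vadd _ _

lemma sph_uniq {C : Cx F} {d e : ℕ} (h : Sph C d) (h' : Sph C e) : d = e := by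
  have h1 := h.2 d
  have h2 := h'.2 d
  rw [if_pos rfl] at h1
  rw [h1] at h2
  by_contra hne
  rw [if_neg hne] at h2
  omega

variable {S : AddSubgroup G} {a : ATow M}

lemma sph_down (hodd : p ≠ 2) (hexp : ∀ g : G, p • g = 0) (ha : a.IsI S) (hCD : CD F G (univ : Set M) r)
  {H' : AddSubgroup G} (hS : H' ≤ S) : ∀ H ≤ H', ∀ d, Sph (E F (pow (fixH M H)) a.tow).L d →
  ∃ e ≤ d, Sph (E F (pow (fixH M H')) a.tow).L e ∧ e % 2 = d % 2 := by
  refine sub_ind _ (fun d h => ⟨d, le_rfl, h, rfl⟩) ?_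
  intro H hH g hg hgH ih d hd
  have hz : zmultiples g ≤ S := (zmultiples_le.2 hg).trans hS
  obtain ⟨e, h1, h2, h3⟩ := smith_sph hodd (hexp g) (fun h => hgH (h ▸ zero_mem _)) (fixH_closed H) (fixH_inv H _)
    (fun i => (ha i).anti hz) hCD hd
  rw [← fixH_zm] at h2
  obtain ⟨e', h1', h2', h3'⟩ := ih e h2
  exact ⟨e', h1'.trans h1, h2', h3'.trans h3⟩

lemma rel_zero (hodd : p ≠ 2) (hexp : ∀ g : G, p • g = 0) (ha : a.IsI S) (hCD : CD F G (univ : Set M) r)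
  {H' : AddSubgroup G} (hS : H' ≤ S) {d : ℕ} (hd' : Sph (E F (pow (fixH M H')) a.tow).L d) :
  ∀ H ≤ H', Sph (E F (pow (fixH M H)) a.tow).L d →
  ∀ n, Subsingleton ((E F (pow (fixH M H)) (a.tow.sup (pow (fixH M H')))).L.H n) := by
  refine sub_ind _ (fun _ n => ?_) ?_
  · refine E_sub G fun i f hf _ => ⟨0, zero_mem _, ?_⟩
    have e : pow (fixH M H') ⊓ (a.tow.sup (pow (fixH M H'))).T i = pow (fixH M H') := by
      ext l
      exact ⟨fun h => h.1, fun h => ⟨h, Or.inr h⟩⟩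
    rw [e] at hf
    have e2 : f - cob (0 : List M → F) = f := by
      have : cob (0 : List M → F) = 0 := by
        have := (cobL M F).map_zero
        exact this
      rw [this, sub_zero]
    rw [e2]
    exact hf.2
  · intro H hH g hg hgH ih hd
    have hle : H ⊔ zmultiples g ≤ H' := sup_le hH (zmultiples_le.2 hg)
    have hz : zmultiples g ≤ S := (zmultiples_le.2 hg).trans hS
    obtain ⟨e, h1, h2, h3⟩ := smith_sph hodd (hexp g) (fun h => hgH (h ▸ zero_mem _)) (fixH_closed H) (fixH_inv H _)
      (fun i => (ha i).anti hz) hCD hd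
    have h2' := h2
    rw [← fixH_zm] at h2'
    obtain ⟨e', h4, h5, _⟩ := sph_down hodd hexp ha hCD hS _ hle _ h2'
    have h6 := sph_uniq h5 hd'
    have h7 : e = d := by omega
    subst h7
    have hz1 := smith_zero (hexp g) (fun h => hgH (h ▸ zero_mem _)) (fixH_closed H) (fixH_inv H _)
      (fun i => (ha i).anti hz) hCD hd h2
    rw [← fixH_zm] at hz1
    intro n
    obtain ⟨f, g', Q⟩ := E_triple (F := F) (a := a) (fixH_anti (M := M) hle) (fixH_anti (M := M) (le_sup_left : H ≤ H ⊔ zmultiples g))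
    exact Cx.exact_sub (Q.exact_B n) (ih h2' n) (hz1 n)

/-- union of fixed sets -/
def fixU (M : Type) [MetricSpace M] {G : Type} [AddCommGroup G] [AddAction G M] (l : List (AddSubgroup G)) : Set M :=
  {y | ∃ H ∈ l, y ∈ fixH M H}

lemma fixU_closed (l : List (AddSubgroup G)) : IsClosed (fixU M l) := by
  have : fixU M l = ⋃ H ∈ {H | H ∈ l}, fixH M H := by
    ext y; simp only [Set.mem_iUnion, Set.mem_ofPred_eq, exists_prop]; exact Iff.rfl
  rw [this]
  exact Set.Finite.isClosed_biUnion (List.finite_toSet l) fun H _ => fixH_closed H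
lemma fixU_inv (l : List (AddSubgroup G)) (K : AddSubgroup G) : SInv (fixU M l) K :=
  fun k hk y ⟨H, hH, hy⟩ => ⟨H, hH, fixH_inv H K k hk y hy⟩
lemma fixU_cons (D : AddSubgroup G) (l : List (AddSubgroup G)) : fixU M (D :: l) = fixU M l ∪ fixH M D := by
  ext y
  constructor
  · rintro ⟨H, hH, hy⟩
    rcases mem_cons.1 hH with rfl | h
    exacts [Or.inr hy, Or.inl ⟨H, h, hy⟩]
  · rintro (⟨H, hH, hy⟩ | hy)
    exacts [⟨H, List.mem_cons_of_mem _ hH, hy⟩, ⟨D, List.mem_cons_self, hy⟩]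
lemma fixU_inter (D : AddSubgroup G) (l : List (AddSubgroup G)) : fixU M l ∩ fixH M D = fixU M (l.map (· ⊔ D)) := by
  ext y
  constructor
  · rintro ⟨⟨H, hH, hy⟩, hy'⟩
    exact ⟨H ⊔ D, mem_map.2 ⟨H, hH, rfl⟩, by rw [fixH_sup]; exact ⟨hy, hy'⟩⟩
  · rintro ⟨K, hK, hy⟩
    obtain ⟨H, hH, rfl⟩ := mem_map.1 hK
    rw [fixH_sup] at hy
    exact ⟨⟨H, hH, hy.1⟩, hy.2⟩

lemma union_zero {K' H' : AddSubgroup G}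
  (hz : ∀ D, K' < D → D ≤ H' → ∀ n, Subsingleton ((E F (pow (fixH M D)) (a.tow.sup (pow (fixH M H')))).L.H n))
  (hK : K' < H') (n : ℕ) : ∀ l : List (AddSubgroup G), l.length = n → (∀ D ∈ l, K' < D ∧ D ≤ H') →
  ∀ n, Subsingleton ((E F (pow (fixU M (l ++ [H']))) (a.tow.sup (pow (fixH M H')))).L.H n) := by
  induction n with
  | zero =>
    intro l hl _ n
    rw [List.eq_nil_of_length_eq_zero hl]
    have : fixU M ([] ++ [H']) = fixH M H' := by
      ext y
      exact ⟨fun ⟨H, hH, hy⟩ => by rw [List.nil_append, List.mem_singleton] at hH; rwa [← hH],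
        fun hy => ⟨H', by simp, hy⟩⟩
    rw [this]
    exact hz H' hK le_rfl n
  | succ k ih =>
    intro l hl hD n
    obtain ⟨D, l, rfl⟩ := List.exists_cons_of_length_eq_add_one hl
    rw [List.length_cons] at hl
    obtain ⟨h1, h2⟩ := hD D List.mem_cons_self
    have hl' : ∀ D ∈ l, K' < D ∧ D ≤ H' := fun D' h => hD D' (List.mem_cons_of_mem _ h)
    have ih1 := ih l (by omega) hl'
    have ih2 := ih (l.map (· ⊔ D)) (by rw [List.length_map]; omega) (by
      intro D' h
      obtain ⟨D'', h', rfl⟩ := mem_map.1 h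
      exact ⟨h1.trans_le le_sup_right, sup_le (hl' _ h').2 h2⟩)
    have e1 : fixU M (l.map (· ⊔ D) ++ [H']) = fixU M (l ++ [H']) ∩ fixH M D := by
      rw [fixU_inter, List.map_append, map_cons, List.map_nil, sup_eq_left.2 h2]
    rw [e1] at ih2
    have hT : fixH M H' ⊆ fixU M (l ++ [H']) := fun y hy => ⟨H', by simp, hy⟩
    have hT2 : fixH M H' ⊆ fixU M (l ++ [H']) ∩ fixH M D := fun y hy => ⟨hT hy, fixH_anti h2 hy⟩
    rw [List.cons_append, fixU_cons]
    obtain ⟨f, g, Q⟩ := E_triple (F := F) (a := a) hT2 (inter_subset_right : _ ⊆ fixH M D)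
    have h3 : ∀ n, Subsingleton ((E F (pow (fixH M D)) (a.tow.sup (pow (fixU M (l ++ [H']) ∩ fixH M D)))).L.H n) := by
      intro n
      have := hz D h1 h2 n
      exact (Q.bij_g (E_V0 _ _) ih2 n).2.subsingleton
    obtain ⟨f', g', Q'⟩ := E_triple (F := F) (a := a) hT (subset_union_left : _ ⊆ fixU M (l ++ [H']) ∪ fixH M D)
    refine Cx.exact_sub (Q'.exact_B n) (ih1 n) ?_
    have := h3 n
    exact ((E_exc (F := F) G (a := a) (fixU_closed (l ++ [H'])) (fixH_closed D)) n).some.symm.toEquiv.subsingleton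

end Dims
end PG

namespace PG

section Rank
variable {M : Type} [MetricSpace M] [CompactSpace M] {F : Type} [Field F]
  {G : Type} [AddCommGroup G] [AddAction G M] [IsIsometricVAdd G M] [Finite G] {r : ℕ}
  {p : ℕ} [hp : Fact p.Prime] [CharP F p] {S : AddSubgroup G} {a : ATow M}

lemma sph_one {C : Cx F} {d : ℕ} (h : Sph C d) : finrank F (C.H d) = 1 := by
  have h1 := h.2 d
  rwa [if_pos rfl] at h1

/-- the contradiction for a rank two group with equal fixed dimensions -/
lemma rank2_fix (hodd : p ≠ 2) (hexp : ∀ g : G, p • g = 0) (ha : a.IsI S) (hCD : CD F G (univ : Set M) r)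
  {K' H' : AddSubgroup G} (hS : H' ≤ S) {g h : G} (hgH : g ∈ H') (hhH : h ∈ H') (hg : g ∉ K')
  (hh : h ∉ K' ⊔ zmultiples g) (hK : K' < H') {d e : ℕ} (hed : e + 2 ≤ d)
  (hX : Sph (E F (pow (fixH M K')) a.tow).L d)
  (hD : ∀ D, K' < D → D ≤ H' → Sph (E F (pow (fixH M D)) a.tow).L e) : False := by
  set Δ := zmultiples g ⊔ zmultiples h with hΔ
  have hΔH : Δ ≤ H' := sup_le (zmultiples_le.2 hgH) (zmultiples_le.2 hhH)
  have hnt : ∀ γ ∈ Δ, γ ∈ K' → γ = 0 := by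
    intro γ hγ hγK
    obtain ⟨u, hu, v, hv, rfl⟩ := mem_sup.1 hγ
    obtain ⟨m, rfl⟩ := mem_zmultiples_iff.1 hu
    obtain ⟨n, rfl⟩ := mem_zmultiples_iff.1 hv
    have h1 : n • h ∈ K' ⊔ zmultiples g := by
      have : n • h = (m • g + n • h) - m • g := by abel
      rw [this]
      exact sub_mem ((le_sup_left : K' ≤ _) hγK) ((le_sup_right : _ ≤ K' ⊔ zmultiples g) hu)
    rcases zs_mem (hexp h) h1 with h2 | h2
    · rw [h2, add_zero] at hγK ⊢
      exact (zs_mem (hexp g) hγK).resolve_right hg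
    · exact absurd h2 hh
  have hdl : ∀ γ ∈ Δ, γ ≠ 0 → K' < K' ⊔ zmultiples γ := fun γ h1 h2 => lt_sup_zm fun h3 => h2 (hnt γ h1 h3)
  obtain ⟨s, hs⟩ := (Set.toFinite {γ : G | γ ∈ Δ ∧ γ ≠ 0}).exists_finset_coe
  have hs' : ∀ γ, γ ∈ s ↔ γ ∈ Δ ∧ γ ≠ 0 := fun γ => by rw [← mem_coe, hs]; exact Iff.rfl
  set l := s.toList.map (fun γ => K' ⊔ zmultiples γ) with hl
  set Y := fixU M (l ++ [H']) with hY
  have hlm : ∀ D ∈ l, K' < D ∧ D ≤ H' := by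
    intro D hD
    obtain ⟨γ, hγ, rfl⟩ := mem_map.1 hD
    obtain ⟨h1, h2⟩ := (hs' γ).1 (mem_toList.1 hγ)
    exact ⟨hdl γ h1 h2, sup_le hK.le (zmultiples_le.2 (hΔH h1))⟩
  have hz := union_zero (F := F) (M := M) (a := a) (fun D h1 h2 => rel_zero hodd hexp ha hCD hS (hD H' hK le_rfl) D h2 (hD D h1 h2)) hK
    _ l rfl hlm
  have hT : fixH M H' ⊆ Y := fun y hy => ⟨H', by simp, hy⟩
  have hYs : Sph (E F (pow Y) a.tow).L e :=
    (Cx.Qi.of_hom _ ((E_ses (F := F) (pow_mono hT) a.tow).bij_f hz)).sph (hD H' hK le_rfl)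
  have hYX : Y ⊆ fixH M K' := by
    rintro y ⟨D, hD, hy⟩
    rcases mem_append.1 hD with h | h
    · exact fixH_anti (hlm D h).1.le hy
    · rw [List.mem_singleton] at h; subst h; exact fixH_anti hK.le hy
  have Q := E_ses (F := F) (pow_mono hYX) a.tow
  have hgh : g ∉ zmultiples h := by
    intro h1
    obtain ⟨c, hc⟩ := mem_zmultiples_iff.1 h1
    have h2 : c • h ∈ K' ⊔ zmultiples g := by
      rw [hc]; exact (le_sup_right : _ ≤ K' ⊔ zmultiples g) (mem_zmultiples g)
    rcases zs_mem (hexp h) h2 with h3 | h3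
    · rw [h3] at hc; exact hg (hc ▸ zero_mem _)
    · exact hh h3
  have hhg : h ∉ zmultiples g := fun h1 => hh ((le_sup_right : _ ≤ K' ⊔ zmultiples g) h1)
  refine rank2 (F := F) (hexp g) (hexp h) hgh hhg (fixH_closed K') (fixU_closed (l ++ [H'])) hYX (fixH_inv _ _) (fixU_inv _ _)
    (a := a) (fun i => (ha i).anti (hΔH.trans hS)) ?_ hCD (e := e + 1) (d := d) (by omega) ?_ ?_ ?_
  · intro x hx γ hγ hγx
    by_contra hne
    refine hx.2 ⟨K' ⊔ zmultiples γ, List.mem_append_left _ (mem_map.2 ⟨γ, mem_toList.2 ((hs' γ).2 ⟨hγ, hne⟩), rfl⟩), ?_⟩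
    rw [fixH_zm]
    exact ⟨hx.1, hγx⟩
  · rw [(ofBijective _ (Q.bij_δ (n := e) (Cx.sph_sub hX (by omega)) (Cx.sph_sub hX (by omega)))).finrank_eq]
    exact sph_one hYs
  · obtain ⟨d, rfl⟩ : ∃ d', d = d' + 1 := ⟨d - 1, by omega⟩
    refine Eq.trans (ofBijective ((E_map (F := F) (le_refl (pow (fixH M K'))) (E_incl_le (pow Y) a.tow)).L.map (d + 1)) ⟨?_, ?_⟩).finrank_eq.symm (sph_one hX)
    · rw [injective_iff_map_eq_zero]
      intro x hx
      obtain ⟨w, rfl⟩ := (Q.exact_B (d + 1) x).1 hx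
      have := Cx.sph_sub hYs (n := d + 1) (by omega)
      rw [Subsingleton.elim w 0, map_zero]
    · intro x
      have := Cx.sph_sub hYs (n := d) (by omega)
      exact (Q.exact_C d x).1 (Subsingleton.elim _ _)
  · intro n h1 h2
    cases n with
    | zero =>
      have := Cx.sph_sub hX (n := 0) h1.symm.symm
      exact (Q.surj_zero (E_V0 _ _)).subsingleton
    | succ n =>
      exact Cx.exact_sub (Q.exact_C n) (Cx.sph_sub hX h1) (Cx.sph_sub hYs (by omega))

lemma rank_bound (hodd : p ≠ 2) (hexp : ∀ g : G, p • g = 0) (ha : a.IsI S) (hCD : CD F G (univ : Set M) r)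
  (d : ℕ) : ∀ K' ≤ S, Sph (E F (pow (fixH M K')) a.tow).L d →
  (∀ H, K' < H → H ≤ S → ∀ e, Sph (E F (pow (fixH M H)) a.tow).L e → e < d) →
  Nat.card S ≤ p ^ (d / 2) * Nat.card K' := by
  induction d using Nat.strong_induction_on with
  | _ d ih =>
    intro K' hK hd hlt
    by_cases hSK : S ≤ K'
    · rw [le_antisymm hK hSK]
      exact Nat.le_mul_of_pos_left _ (pow_pos hp.out.pos _)
    have hKS : K' < S := lt_of_le_not_ge hK hSK
    obtain ⟨e0, h1, h2, h3⟩ := sph_down hodd hexp ha hCD le_rfl K' hK d hd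
    classical
    let P : ℕ → Prop := fun e => ∃ C, K' < C ∧ C ≤ S ∧ Sph (E F (pow (fixH M C)) a.tow).L e
    have hP0 : P e0 := ⟨S, hKS, le_rfl, h2⟩
    set e := Nat.findGreatest P d with he
    obtain ⟨C', hC1, hC2, hC3⟩ : P e := Nat.findGreatest_spec h1 hP0
    have hmax : ∀ C, K' < C → C ≤ S → ∀ e', Sph (E F (pow (fixH M C)) a.tow).L e' → e' ≤ e := by
      intro C h4 h5 e' h6
      exact Nat.le_findGreatest (hlt C h4 h5 e' h6).le ⟨C, h4, h5, h6⟩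
    have hed := hlt C' hC1 hC2 e hC3
    obtain ⟨e1, h4, h5, h6⟩ := sph_down hodd hexp ha hCD hC2 K' hC1.le d hd
    have h7 := sph_uniq hC3 h5
    have hed2 : e + 2 ≤ d := by omega
    -- everything between K' and a subgroup with dimension e has dimension e
    have hmid : ∀ H', K' < H' → H' ≤ S → Sph (E F (pow (fixH M H')) a.tow).L e → ∀ D, K' < D → D ≤ H' → Sph (E F (pow (fixH M D)) a.tow).L e := by
      intro H' k1 k2 k3 D k4 k5
      obtain ⟨e2, k6, k7, k8⟩ := sph_down hodd hexp ha hCD (k5.trans k2) K' k4.le d hd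
      have k9 := hmax D k4 (k5.trans k2) e2 k7
      obtain ⟨e3, l1, l2, l3⟩ := sph_down hodd hexp ha hCD k2 D k5 e2 k7
      have l4 := sph_uniq k3 l2
      have l5 : e2 = e := by omega
      rwa [l5] at k7
    obtain ⟨g, hgC, hgK⟩ := not_subset.1 (not_le_of_gt hC1)
    set C := K' ⊔ zmultiples g with hC
    have hKC : K' < C := lt_sup_zm hgK
    have hCC : C ≤ C' := sup_le hC1.le (zmultiples_le.2 hgC)
    have hCe := hmid C' hC1 hC2 hC3 C hKC hCC
    have hfin := ih e hed C (hCC.trans hC2) hCe (by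
      intro H k1 k2 e2 k3
      refine lt_of_le_of_ne (hmax H (hKC.trans k1) k2 e2 k3) ?_
      rintro rfl
      obtain ⟨h, hhH, hhC⟩ := not_subset.1 (not_le_of_gt k1)
      exact rank2_fix hodd hexp ha hCD k2 (k1.le ((le_sup_right : _ ≤ C) (mem_zmultiples g))) hhH hgK hhC (hKC.trans k1)
        hed2 hd (hmid H (hKC.trans k1) k2 k3))
    have hcard : Nat.card C ≤ Nat.card K' * p :=
      Nat.le_of_dvd (Nat.mul_pos Nat.card_pos hp.out.pos) (card_sup_dvd K' (hexp g))
    calc Nat.card S ≤ p ^ (e / 2) * Nat.card C := hfin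
      _ ≤ p ^ (e / 2) * (Nat.card K' * p) := Nat.mul_le_mul_left _ hcard
      _ = p ^ (e / 2 + 1) * Nat.card K' := by ring
      _ ≤ p ^ (d / 2) * Nat.card K' := Nat.mul_le_mul_right _ (Nat.pow_le_pow_right hp.out.pos (by omega))

/-- isotropy groups are small -/
lemma stab_bound (F : Type) [Field F] [CharP F p] [ConnectedSpace M] (hLE : LE M r) (hodd : p ≠ 2) (hexp : ∀ g : G, p • g = 0)
  (heff : ∀ g : G, g ≠ 0 → ∃ y : M, g +ᵥ y ≠ y) {x : M} :
  Nat.card (stabilizer G x) ≤ p ^ (r / 2) := by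
  obtain ⟨c, hc, rfl⟩ := hLE x
  have hCD : CD F G (univ : Set M) r := CD_LE hLE
  have ha : (ptow (c 0)).IsI (stabilizer G (c 0)) := ptow_inv fun k hk => hk
  have h0 : Sph (E F (pow (fixH M (⊥ : AddSubgroup G))) (ptow (c 0)).tow).L r := by
    rw [fixH_bot]; exact pt_sph G hc
  have := rank_bound (F := F) hodd hexp ha hCD r ⊥ bot_le h0 (by
    intro H h1 h2 e he
    obtain ⟨g, hg, hg0⟩ := not_subset.1 (not_le_of_gt h1)
    have hg0 : g ≠ 0 := hg0
    obtain ⟨e', h3, h4, h5⟩ := newman (F := F) hLE hodd (hexp g) (heff g hg0) (x := c 0) (h2 hg)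
    rw [← fixH_bot (M := M) (G := G), ← fixH_zm] at h4
    obtain ⟨e2, h6, h7, _⟩ := sph_down hodd hexp ha hCD h2 _ (sup_le bot_le (zmultiples_le.2 hg)) e' h4
    have := sph_uniq he h7
    omega)
  rwa [card_bot, mul_one] at this

end Rank
end PG

namespace PG

section PartB
variable {M : Type} [MetricSpace M] [CompactSpace M] {F : Type} [Field F]
  {G : Type} [AddCommGroup G] [AddAction G M] [IsIsometricVAdd G M] [Finite G] {r : ℕ}
  {p : ℕ} [hp : Fact p.Prime] [CharP F p]

lemma nul_inv (K : AddSubgroup G) : (ATow.nul M).IsI K := fun _ _ _ _ h => h.elim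

lemma fin_fixH (hexp : ∀ g : G, p • g = 0) (hCD : CD F G (univ : Set M) r)
  (h : (E F (pow (univ : Set M)) (ATow.nul M).tow).L.Fin) (H' : AddSubgroup G) :
  (E F (pow (fixH M H')) (ATow.nul M).tow).L.Fin := by
  have := sub_ind (H' := H') (fun H => (E F (pow (fixH M H)) (ATow.nul M).tow).L.Fin → (E F (pow (fixH M H')) (ATow.nul M).tow).L.Fin)
    id (by
      intro H hH g hg hgH ih hf
      apply ih
      rw [fixH_zm]
      exact smith_fin (hexp g) (fun h => hgH (h ▸ zero_mem _)) (fixH_closed H) (fixH_inv H _) (nul_inv _) hCD hf) ⊥ bot_le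
  rw [fixH_bot] at this
  exact this h

lemma empty_zero (G : Type) [AddCommGroup G] [AddAction G M] [IsIsometricVAdd G M] [Finite G] (n : ℕ) :
  Subsingleton ((E F (pow (∅ : Set M)) (ATow.nul M).tow).L.H n) := by
  refine E_sub G fun i f hf _ => ⟨0, zero_mem _, ?_⟩
  have e : pow (∅ : Set M) ⊓ (ATow.nul M).tow.T i = pow (∅ : Set M) := by
    ext l
    exact ⟨fun h => h.1, fun h => ⟨h, h⟩⟩
  rw [e] at hf
  have e2 : f - cob (0 : List M → F) = f := by
    have : cob (0 : List M → F) = 0 := by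
      have := (cobL M F).map_zero
      exact this
    rw [this, sub_zero]
  rw [e2]
  exact hf.2

lemma fin_fixU (hexp : ∀ g : G, p • g = 0) (hCD : CD F G (univ : Set M) r)
  (h : (E F (pow (univ : Set M)) (ATow.nul M).tow).L.Fin) (n : ℕ) :
  ∀ l : List (AddSubgroup G), l.length = n → (E F (pow (fixU M l)) (ATow.nul M).tow).L.Fin := by
  induction n with
  | zero =>
    intro l hl n
    rw [List.eq_nil_of_length_eq_zero hl]
    have : fixU M ([] : List (AddSubgroup G)) = ∅ := by
      ext y
      exact ⟨fun ⟨H, hH, hy⟩ => by simp at hH, fun h => h.elim⟩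
    rw [this]
    have := empty_zero (F := F) (M := M) G n
    infer_instance
  | succ k ih =>
    intro l hl
    obtain ⟨D, l, rfl⟩ := List.exists_cons_of_length_eq_add_one hl
    rw [List.length_cons] at hl
    have ih1 := ih l (by omega)
    have ih2 := ih (l.map (· ⊔ D)) (by rw [List.length_map]; omega)
    rw [← fixU_inter] at ih2
    rw [fixU_cons]
    have Q := E_ses (F := F) (pow_mono (inter_subset_right : fixU M l ∩ fixH M D ⊆ fixH M D)) (ATow.nul M).tow
    have h3 := Q.fin_C (E_V0 _ _) ih2 (fin_fixH hexp hCD h D)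
    have h4 := (E_exc (F := F) G (a := ATow.nul M) (fixU_closed l) (fixH_closed D)).fin h3
    exact (E_ses (F := F) (pow_mono (subset_union_left : fixU M l ⊆ fixU M l ∪ fixH M D)) (ATow.nul M).tow).fin_B ih1 h4

lemma exists_compl_aux {k V : Type} [Field k] [AddCommGroup V] [Module k V] (W : Submodule k V) :
  ∃ K : Submodule k V, (∀ g ∈ W, g ∈ K → g = 0) ∧ Nat.card W * Nat.card K = Nat.card V := by
  obtain ⟨K, hK⟩ := Submodule.exists_isCompl W
  refine ⟨K, fun g h1 h2 => Submodule.disjoint_def.1 hK.disjoint g h1 h2, ?_⟩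
  have e := Nat.card_congr (Submodule.prodEquivOfIsCompl _ _ hK).toEquiv
  rwa [Nat.card_prod] at e

lemma exists_compl (hexp : ∀ g : G, p • g = 0) (H : AddSubgroup G) :
  ∃ K : AddSubgroup G, (∀ g ∈ H, g ∈ K → g = 0) ∧ Nat.card H * Nat.card K = Nat.card G := by
  let _ : Module (ZMod p) G := AddCommGroup.zmodModule hexp
  obtain ⟨K, hK, e⟩ := exists_compl_aux (AddSubgroup.toZModSubmodule p H)
  exact ⟨K.toAddSubgroup, hK, e⟩

lemma euler_AS [ConnectedSpace M] (hLE : LE M r) (hodd : p ≠ 2) (hexp : ∀ g : G, p • g = 0)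
  (heff : ∀ g : G, g ≠ 0 → ∃ y : M, g +ᵥ y ≠ y) {k : ℕ} (hcard : Nat.card G = p ^ k)
  (h : (E F (pow (univ : Set M)) (ATow.nul M).tow).L.Fin) :
  (p : ℤ) ^ (k - r / 2) ∣ (E F (pow (univ : Set M)) (ATow.nul M).tow).L.chi r := by
  classical
  have hCD : CD F G (univ : Set M) r := CD_LE hLE
  have : Finite (AddSubgroup G) := inferInstance
  let _ : Fintype (AddSubgroup G) := ofFinite _
  have key : ∀ n, ∀ s : Finset (AddSubgroup G), s.card = n → (∀ H ∈ s, ∀ H', H < H' → H' ∈ s) →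
      (p : ℤ) ^ (k - r / 2) ∣ (E F (pow (fixU M s.toList)) (ATow.nul M).tow).L.chi r := by
    intro n
    induction n with
    | zero =>
      intro s hs _
      rw [Finset.card_eq_zero.1 hs]
      have : fixU M (∅ : Finset (AddSubgroup G)).toList = ∅ := by
        ext y
        exact ⟨fun ⟨H, hH, hy⟩ => by simp at hH, fun h => h.elim⟩
      rw [this]
      refine Finset.dvd_sum fun i _ => ?_
      have := empty_zero (F := F) (M := M) G i
      have h0 : (E F (pow (∅ : Set M)) (ATow.nul M).tow).L.b i = 0 := finrank_zero_of_subsingleton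
      rw [h0]; simp
    | succ n ih =>
      intro s hs hup
      obtain ⟨H, hH⟩ := s.exists_minimal (Finset.card_pos.1 (by omega))
      set s' := s.erase H with hs'
      have ih' := ih s' (by rw [Finset.card_erase_of_mem hH.1]; omega) (by
        intro D hD D' hDD
        refine mem_erase.2 ⟨?_, hup D (Finset.mem_of_mem_erase hD) D' hDD⟩
        rintro rfl
        exact absurd (hH.2 (Finset.mem_of_mem_erase hD) hDD.le) (not_le_of_gt hDD))
      have e1 : fixU M s.toList = fixU M s'.toList ∪ fixH M H := by
        rw [← fixU_cons]
        ext y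
        constructor
        · rintro ⟨D, hD, hy⟩
          by_cases e : D = H
          · exact ⟨D, by simp [e], hy⟩
          · exact ⟨D, List.mem_cons_of_mem _ (mem_toList.2 (mem_erase.2 ⟨e, mem_toList.1 hD⟩)), hy⟩
        · rintro ⟨D, hD, hy⟩
          refine ⟨D, ?_, hy⟩
          rcases mem_cons.1 hD with rfl | hD
          · exact mem_toList.2 hH.1
          · exact mem_toList.2 (Finset.mem_of_mem_erase (mem_toList.1 hD))
      rw [e1]
      rcases (fixH M H).eq_empty_or_nonempty with he | ⟨x, hx⟩
      · rw [he, Set.union_empty]; exact ih'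
      have Q := E_ses (F := F) (pow_mono (subset_union_left : fixU M s'.toList ⊆ fixU M s'.toList ∪ fixH M H)) (ATow.nul M).tow
      have Qi := E_exc (F := F) G (a := ATow.nul M) (fixU_closed s'.toList) (fixH_closed H)
      have Q2 := E_ses (F := F) (pow_mono (inter_subset_right : fixU M s'.toList ∩ fixH M H ⊆ fixH M H)) (ATow.nul M).tow
      have f1 := fin_fixU hexp hCD h _ s'.toList rfl
      have f2 := fin_fixU hexp hCD h _ (s'.toList.map (· ⊔ H)) rfl
      rw [← fixU_inter] at f2
      have f3 := Q2.fin_C (E_V0 _ _) f2 (fin_fixH hexp hCD h H)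
      have hbd := E_bd (F := F) (a := ATow.nul M) (fixH_closed H) ((fixU_closed s'.toList).inter (fixH_closed H)) inter_subset_right hCD
      rw [Q.chi_add (E_V0 _ _) f1 (Qi.fin f3) (Qi.bd hbd)]
      refine dvd_add ih' ?_
      rw [← Qi.chi]
      obtain ⟨K, hK, hc⟩ := exists_compl hexp H
      have hd := chi_dvd (F := F) (K := K) (a := ATow.nul M) (fun g _ => hexp g) (fixH_closed H) ((fixU_closed s'.toList).inter (fixH_closed H)) inter_subset_right
        (fixH_inv H K) ((fixU_inv _ K).inter (fixH_inv H K)) (nul_inv K) (by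
          intro y hy g hg hgy
          by_contra hne
          have hst : H < stabilizer G y := by
            refine lt_of_le_of_ne (fixH_iff.1 hy.1) fun e => hne ?_
            have h1 : g ∈ H := by rw [e]; exact hgy
            exact hK g h1 hg
          refine hy.2 ⟨⟨stabilizer G y, mem_toList.2 (mem_erase.2 ⟨hst.ne', hup H hH.1 _ hst⟩), fixH_iff.2 le_rfl⟩, hy.1⟩) hCD f3
      refine dvd_trans ?_ hd
      have hb : Nat.card H ≤ p ^ (r / 2) :=
        (AddSubgroup.card_le_of_le (fixH_iff.1 hx)).trans (stab_bound F hLE hodd hexp heff)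
      rw [hcard] at hc
      obtain ⟨i, hi, h1⟩ := (Nat.dvd_prime_pow hp.out).1 (Dvd.intro _ hc)
      obtain ⟨j, hj, h2⟩ := (Nat.dvd_prime_pow hp.out).1 (Dvd.intro_left _ hc)
      rw [h1] at hb
      rw [h1, h2, ← pow_add] at hc
      have h3 := Nat.pow_right_injective hp.out.two_le hc
      have h4 := (Nat.pow_le_pow_iff_right hp.out.one_lt).1 hb
      rw [h2]
      push_cast
      exact pow_dvd_pow _ (by omega)
  have := key _ Finset.univ rfl (fun _ _ _ _ => Finset.mem_univ _)
  have e : fixU M (Finset.univ : Finset (AddSubgroup G)).toList = univ := by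
    ext y
    simp only [Set.mem_univ, iff_true]
    exact ⟨⊥, by simp, by rw [fixH_bot]; trivial⟩
  rwa [e] at this

end PartB
end PG

namespace PG

/-! ### Chains on simplicial gadgets, acyclic carriers -/

/-- A presheaf on finite sets `Fin n`; spot `n` means `n` vertices. -/
structure Sim where
  X : ℕ → Type
  act : ∀ {m n : ℕ}, (Fin m → Fin n) → X n → X m
  act_act : ∀ {l m n : ℕ} (f : Fin l → Fin m) (g : Fin m → Fin n) (x : X n), act f (act g x) = act (g ∘ f) x

namespace Sim
variable (R : Type) [CommRing R] (X : Sim)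

/-- Augmented boundary. -/
noncomputable def bd (n : ℕ) : (X.X (n + 1) →₀ R) →ₗ[R] (X.X n →₀ R) :=
  linearCombination R fun x => ∑ i : Fin (n + 1), single (X.act i.succAbove x) ((-1 : R) ^ (i : ℕ))

variable {R X}
lemma bd_single {n : ℕ} (x : X.X (n + 1)) :
  X.bd R n (single x 1) = ∑ i : Fin (n + 1), single (X.act i.succAbove x) ((-1 : R) ^ (i : ℕ)) := by
  simp [bd]

lemma bd_bd (n : ℕ) (c : X.X (n + 2) →₀ R) : X.bd R n (X.bd R (n + 1) c) = 0 := by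
  suffices h : X.bd R n ∘ₗ X.bd R (n + 1) = 0 from LinearMap.congr_fun h c
  refine lhom_ext' fun x => ext_ring ?_
  have e : ∀ (y : X.X (n + 1)) (r : R), X.bd R n (single y r)
      = ∑ j : Fin (n + 1), single (X.act j.succAbove y) (r * (-1 : R) ^ (j : ℕ)) := by
    intro y r
    simp [bd, Finset.smul_sum]
  simp only [LinearMap.comp_apply, lsingle_apply, bd_single, map_sum, e, X.act_act, LinearMap.zero_apply]
  rw [← Finset.sum_product']
  refine Finset.sum_involution (fun q _ => (q.1.succAbove q.2, q.2.predAbove q.1)) ?_ ?_ (by simp) ?_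
  · rintro ⟨i, j⟩ -
    have h1 : (i.succAbove j).succAbove ∘ (j.predAbove i).succAbove = i.succAbove ∘ j.succAbove :=
      funext fun k => Fin.succAbove_succAbove_succAbove_predAbove i j k
    simp only [h1, ← Finsupp.single_add, ← pow_add, Fin.neg_one_pow_succAbove_add_predAbove, add_neg_cancel,
      Finsupp.single_zero]
  · rintro ⟨i, j⟩ - - h
    exact Fin.succAbove_ne i j (congrArg Prod.fst h)
  · rintro ⟨i, j⟩ -
    exact Prod.ext (Fin.succAbove_succAbove_predAbove i j) (Fin.predAbove_predAbove_succAbove i j)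

/-- A partial cone operator contracts. -/
lemma cone_bd {D : ∀ n, Set (X.X n)} (κ : ∀ n, X.X n → X.X (n + 1))
  (h0 : ∀ n, ∀ x ∈ D n, X.act (succAbove 0) (κ n x) = x)
  (h1 : ∀ n, ∀ x ∈ D (n + 1), ∀ i : Fin (n + 1), X.act (succAbove i.succ) (κ (n + 1) x) = κ n (X.act i.succAbove x))
  {n : ℕ} {z : X.X (n + 1) →₀ R} (hz : z ∈ supported R R (D (n + 1))) :
  X.bd R (n + 1) (mapDomain (κ (n + 1)) z) = z - mapDomain (κ n) (X.bd R n z) := by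
  rw [Finsupp.supported_eq_span_single] at hz
  induction hz using Submodule.span_induction with
  | mem z hz =>
    obtain ⟨x, hx, rfl⟩ := hz
    rw [mapDomain_single, bd_single, Fin.sum_univ_succ, h0 _ x hx, bd_single, Finsupp.mapDomain_finsetSum,
      sub_eq_add_neg, ← Finset.sum_neg_distrib]
    refine congrArg₂ _ (by simp) (sum_congr rfl fun i _ => ?_)
    rw [h1 _ x hx, mapDomain_single, ← Finsupp.single_neg]
    congr 1
    simp [pow_succ]
  | zero => simp
  | add x y _ _ hx hy =>
    rw [Finsupp.mapDomain_add, map_add, hx, hy, map_add, Finsupp.mapDomain_add]; abel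
  | smul a x _ hx =>
    rw [Finsupp.mapDomain_smul, map_smul, hx, map_smul, Finsupp.mapDomain_smul, smul_sub]

section AC
variable {C : ℕ → Type} [∀ n, AddCommGroup (C n)] [∀ n, Module R (C n)] (dC : ∀ n, C (n + 1) →ₗ[R] C n)
  (Γ : ∀ n, X.X n → Submodule R (C n)) (g : ∀ n, (X.X (n + 1) →₀ R) →ₗ[R] C n)
  (h0 : (X.X 0 →₀ R) →ₗ[R] C 0) (h1 : (X.X 1 →₀ R) →ₗ[R] C 1)

open Classical in
/-- The recursively chosen carried map. -/
noncomputable def ach : ∀ n, (X.X n →₀ R) →ₗ[R] C n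
  | 0 => h0
  | 1 => h1
  | n + 2 => linearCombination R fun x =>
      if h : ∃ w ∈ Γ (n + 2) x, dC (n + 1) w = g (n + 1) (single x 1) + ach (n + 1) (X.bd R (n + 1) (single x 1))
      then h.choose else 0

lemma AC {Dm : ∀ n, Set (X.X n)} (hD : ∀ n, ∀ x ∈ Dm (n + 1), ∀ i : Fin (n + 1), X.act i.succAbove x ∈ Dm n)
  (N : ℕ) (hg : ∀ n < N, ∀ x ∈ Dm (n + 2), dC n (g (n + 1) (single x 1)) = - g n (X.bd R (n + 1) (single x 1)))
  (hh : ∀ x ∈ Dm 1, h1 (single x 1) ∈ Γ 1 x ∧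
  dC 0 (h1 (single x 1)) = g 0 (single x 1) + h0 (X.bd R 0 (single x 1)))
  (fill : ∀ n < N, ∀ x ∈ Dm (n + 2), ∀ y ∈ ⨆ i : Fin (n + 2), Γ (n + 1) (X.act i.succAbove x),
  dC n (g (n + 1) (single x 1) + y) = 0 →
  ∃ w ∈ Γ (n + 2) x, dC (n + 1) w = g (n + 1) (single x 1) + y) :
  ∃ h : ∀ n, (X.X n →₀ R) →ₗ[R] C n, h 0 = h0 ∧ h 1 = h1 ∧ ∀ n ≤ N, ∀ x ∈ Dm (n + 1),
  h (n + 1) (single x 1) ∈ Γ (n + 1) x ∧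
  dC n (h (n + 1) (single x 1)) = g n (single x 1) + h n (X.bd R n (single x 1)) := by
  refine ⟨ach dC Γ g h0 h1, rfl, rfl, fun n => ?_⟩
  induction n with
  | zero => intro _ x hx; exact hh x hx
  | succ n ih =>
    intro hn x hx
    have key : ∀ z ∈ supported R R (Dm (n + 1)), dC n (ach dC Γ g h0 h1 (n + 1) z)
        = g n z + ach dC Γ g h0 h1 n (X.bd R n z) := by
      intro z hz
      rw [Finsupp.supported_eq_span_single] at hz
      induction hz using Submodule.span_induction with
      | mem z hz => obtain ⟨x, hx, rfl⟩ := hz; exact (ih (by omega) x hx).2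
      | zero => simp
      | add x y _ _ hx hy => simp only [map_add, hx, hy]; abel
      | smul a x _ hx => simp only [map_smul, hx, smul_add]
    have hb : X.bd R (n + 1) (single x 1) ∈ supported R R (Dm (n + 1)) := by
      rw [bd_single]
      exact Submodule.sum_mem _ fun i _ => single_mem_supported R _ (hD _ x hx i)
    have ex := fill n (by omega) x hx (ach dC Γ g h0 h1 (n + 1) (X.bd R (n + 1) (single x 1))) (by
      rw [bd_single, map_sum]
      refine Submodule.sum_mem _ fun i _ => Submodule.mem_iSup_of_mem i ?_
      rw [← mul_one ((-1 : R) ^ (i : ℕ)), ← smul_eq_mul, ← smul_single, map_smul]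
      exact smul_mem _ _ (ih (by omega) _ (hD _ x hx i)).1) (by
      rw [map_add, hg n (by omega) x hx, key _ hb, bd_bd]; simp)
    have e : ach dC Γ g h0 h1 (n + 2) (single x 1) = ex.choose := by
      rw [ach, linearCombination_single, one_smul, dif_pos ex]
    rw [e]
    exact ex.choose_spec
end AC
end Sim

/-- With supports in a space. -/
structure SimM (M : Type) extends Sim where
  supp : ∀ {n : ℕ}, X n → Set M
  supp_act : ∀ {m n : ℕ} (f : Fin m → Fin n) (x : X n), supp (act f x) ⊆ supp x
  supp_ne : ∀ {n : ℕ} (x : X (n + 1)), (supp x).Nonempty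

namespace SimM
variable {M : Type} [MetricSpace M] (R : Type) [CommRing R] (X Y : SimM M)

/-- Chains supported in a set. -/
def Car (A : Set M) (n : ℕ) : Submodule R (X.X n →₀ R) := supported R R {x | X.supp x ⊆ A}

/-- Small simplices. -/
def sm (δ : ℝ) (n : ℕ) : Set (X.X n) := {x | ∀ a ∈ X.supp x, ∀ b ∈ X.supp x, dist a b < δ}

variable {R X Y}
lemma sm_act {δ : ℝ} {m n : ℕ} (f : Fin m → Fin n) {x : X.X n} (h : x ∈ X.sm δ n) : X.act f x ∈ X.sm δ m :=
  fun a ha b hb => h a (X.supp_act f x ha) b (X.supp_act f x hb)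
lemma sm_mono {δ ε : ℝ} (h : δ ≤ ε) {n : ℕ} : X.sm δ n ⊆ X.sm ε n := fun x hx a ha b hb => (hx a ha b hb).trans_le h
lemma Car_mono {A B : Set M} (h : A ⊆ B) (n : ℕ) : X.Car R A n ≤ X.Car R B n :=
  supported_mono fun x hx => hx.trans h
lemma single_Car {A : Set M} {n : ℕ} {x : X.X n} (h : X.supp x ⊆ A) (r : R) : single x r ∈ X.Car R A n :=
  single_mem_supported R _ h

variable (R Y) in
/-- Local acyclicity. -/
def LA : Prop := ∀ ε > 0, ∃ η > 0, η ≤ ε ∧ ∀ S : Set M, S.Nonempty → (∀ a ∈ S, ∀ b ∈ S, dist a b < η) →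
  ∀ (n : ℕ) (z : Y.X (n + 1) →₀ R), Y.bd R n z = 0 → z ∈ Y.Car R (thickening η S) (n + 1) →
    ∃ w ∈ Y.Car R (thickening ε S) (n + 2), Y.bd R (n + 1) w = z

lemma LA.seq (h : LA R Y) (N : ℕ) {ε : ℝ} (hε : 0 < ε) : ∃ e : ℕ → ℝ, (∀ n, 0 < e n) ∧ (∀ n ≤ N, e 0 ≤ e n ∧ e n ≤ ε) ∧
  ∀ m < N, ∀ S : Set M, S.Nonempty → (∀ a ∈ S, ∀ b ∈ S, dist a b < e 0) →
  ∀ (n : ℕ) (z : Y.X (n + 1) →₀ R), Y.bd R n z = 0 → z ∈ Y.Car R (thickening (e m) S) (n + 1) →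
    ∃ w ∈ Y.Car R (thickening (e (m + 1)) S) (n + 2), Y.bd R (n + 1) w = z := by
  induction N generalizing ε with
  | zero => exact ⟨fun _ => ε, fun _ => hε, fun _ _ => ⟨le_rfl, le_rfl⟩, fun m hm => absurd hm (by omega)⟩
  | succ N ih =>
    obtain ⟨η, hη, hle, hf⟩ := h ε hε
    obtain ⟨e, e1, e2, e3⟩ := ih hη
    refine ⟨fun n => if n ≤ N then e n else ε, fun n => ?_, fun n hn => ?_, fun m hm S hS hd n z hz hc => ?_⟩
    · dsimp only; split_ifs; exacts [e1 n, hε]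
    · simp only [zero_le, if_true]
      split_ifs with h1
      · exact ⟨(e2 n h1).1, (e2 n h1).2.trans hle⟩
      · exact ⟨(e2 0 (by omega)).2.trans hle, le_rfl⟩
    · simp only [zero_le, if_true] at hd
      dsimp only at hc ⊢
      rw [if_pos (by omega)] at hc
      by_cases h1 : m + 1 ≤ N
      · rw [if_pos h1]; exact e3 m (by omega) S hS hd n z hz hc
      · rw [if_neg h1]
        have h2 := e2 m (by omega)
        exact hf S hS (fun a ha b hb => (hd a ha b hb).trans_le (e2 0 (by omega)).2) n z hz
          (Car_mono (thickening_mono h2.2 S) _ hc)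

/-- Carried chain maps exist. -/
theorem AC1 (hY : LA R Y) (h0 : (X.X 0 →₀ R) →ₗ[R] (Y.X 0 →₀ R)) (pt : X.X 1 → Y.X 1)
  (hpt : ∀ x, Y.supp (pt x) ⊆ X.supp x)
  (hh : ∀ x, Y.bd R 0 (single (pt x) 1) = h0 (X.bd R 0 (single x 1))) (N : ℕ) {ε : ℝ} (hε : 0 < ε) :
  ∃ δ > 0, ∃ θ : ∀ n, (X.X n →₀ R) →ₗ[R] (Y.X n →₀ R), θ 0 = h0 ∧ (∀ x, θ 1 (single x 1) = single (pt x) 1) ∧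
  ∀ n ≤ N, ∀ x ∈ X.sm δ (n + 1), θ (n + 1) (single x 1) ∈ Y.Car R (thickening ε (X.supp x)) (n + 1) ∧
  Y.bd R n (θ (n + 1) (single x 1)) = θ n (X.bd R n (single x 1)) := by
  obtain ⟨e, e1, e2, e3⟩ := hY.seq N hε
  obtain ⟨θ, a0, a1, a2⟩ := Sim.AC (X := X.toSim) (C := fun n => Y.X n →₀ R) (fun n => Y.bd R n)
    (fun n x => Y.Car R (thickening (e (n - 1)) (X.supp x)) n) (fun n => 0) h0
    (linearCombination R fun x => single (pt x) 1) (Dm := fun n => X.sm (e 0) n)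
    (fun n x hx i => sm_act _ hx) N (by simp) (fun x hx => by
      simp only [linearCombination_single, one_smul, LinearMap.zero_apply, zero_add]
      exact ⟨single_Car ((hpt x).trans (Metric.self_subset_thickening (e1 _) _)) _, hh x⟩) (fun n hn x hx y hy hz => by
      rw [LinearMap.zero_apply, zero_add] at hz ⊢
      refine e3 n hn (X.supp x) (X.supp_ne x) hx n y hz ?_
      refine iSup_le (fun i => Car_mono (Metric.thickening_subset_of_subset _ (X.supp_act _ x)) _) hy)
  refine ⟨e 0, e1 0, θ, a0, fun x => by rw [a1]; simp, fun n hn x hx => ⟨?_, ?_⟩⟩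
  · exact Car_mono (thickening_mono (e2 n hn).2 _) _ (a2 n hn x hx).1
  · simpa using (a2 n hn x hx).2

/-- Carried null-homotopies exist. -/
theorem AC2 (hY : LA R Y) (N : ℕ) {ε : ℝ} (hε : 0 < ε) :
  ∃ δ > 0, ∀ g : ∀ n, (X.X n →₀ R) →ₗ[R] (Y.X n →₀ R), ∀ δ' ≤ δ, g 0 = 0 →
  (∀ n ≤ N, ∀ x ∈ X.sm δ' (n + 1), g (n + 1) (single x 1) ∈ Y.Car R (thickening δ (X.supp x)) (n + 1)) →
  (∀ n ≤ N, ∀ x ∈ X.sm δ' (n + 1), Y.bd R n (g (n + 1) (single x 1)) = g n (X.bd R n (single x 1))) →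
  ∃ h : ∀ n, (X.X n →₀ R) →ₗ[R] (Y.X (n + 1) →₀ R), h 0 = 0 ∧
  ∀ n ≤ N, ∀ x ∈ X.sm δ' (n + 1), h (n + 1) (single x 1) ∈ Y.Car R (thickening ε (X.supp x)) (n + 2) ∧
  Y.bd R (n + 1) (h (n + 1) (single x 1)) = g (n + 1) (single x 1) - h n (X.bd R n (single x 1)) := by
  classical
  obtain ⟨e, e1, e2, e3⟩ := hY.seq (N + 1) hε
  refine ⟨e 0, e1 0, fun g δ' hδ g0 gc gb => ?_⟩
  have ex : ∀ x ∈ X.sm δ' 1, ∃ w ∈ Y.Car R (thickening (e 1) (X.supp x)) 2,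
      Y.bd R 1 w = g 1 (single x 1) := fun x hx =>
    e3 0 (by omega) (X.supp x) (X.supp_ne x) (sm_mono hδ hx) 0 _ (by rw [gb 0 (by omega) x hx, g0]; rfl) (gc 0 (by omega) x hx)
  choose! w hw hw' using ex
  obtain ⟨h, a0, a1, a2⟩ := Sim.AC (X := X.toSim) (C := fun n => Y.X (n + 1) →₀ R) (fun n => - Y.bd R (n + 1))
    (fun n x => Y.Car R (thickening (e n) (X.supp x)) (n + 1)) (fun n => - g (n + 1)) 0
    (linearCombination R w) (Dm := fun n => X.sm δ' n)
    (fun n x hx i => sm_act _ hx) N (fun n hn x hx => by simp [gb (n + 1) (by omega) x hx]) (fun x hx => by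
      simp only [linearCombination_single, one_smul, LinearMap.zero_apply, add_zero]
      exact ⟨hw x hx, by simp [hw' x hx]⟩) (fun n hn x hx y hy hz => by
      obtain ⟨w, h1, h2⟩ := e3 (n + 1) (by omega) (X.supp x) (X.supp_ne x) (sm_mono hδ hx) (n + 1)
        ((-g (n + 2)) (single x 1) + y) (neg_eq_zero.1 hz) (by
          refine Submodule.add_mem _ ?_ ?_
          · exact Submodule.neg_mem _ (Car_mono (thickening_mono (e2 (n + 1) (by omega)).1 _) _ (gc (n + 1) (by omega) x hx))
          · exact iSup_le (fun i => Car_mono (Metric.thickening_subset_of_subset _ (X.supp_act _ x)) _) hy)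
      exact ⟨-w, Submodule.neg_mem _ h1, by simpa using h2⟩)
  refine ⟨h, a0, fun n hn x hx => ⟨?_, ?_⟩⟩
  · exact Car_mono (thickening_mono (e2 (n + 1) (by omega)).2 _) _ (a2 n hn x hx).1
  · have := (a2 n hn x hx).2
    simp only [LinearMap.neg_apply] at this
    rw [← neg_neg (Y.bd R (n + 1) _), this]; abel
end SimM
end PG

namespace PG

/-- Tuples of points. -/
abbrev Rips (M : Type) : SimM M where
  X n := Fin n → M
  act f v := v ∘ f
  act_act _ _ _ := rfl
  supp v := Set.range v
  supp_act f v := Set.range_comp_subset_range f v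
  supp_ne v := Set.range_nonempty v

/-- The standard simplex. -/
abbrev Dl (n : ℕ) := stdSimplex ℝ (Fin n)

lemma Dl_map {m n : ℕ} (f : Fin m → Fin n) (x : Dl m) (j : Fin n) :
  stdSimplex.map f x j = ∑ i with f i = j, x i := by
  rw [stdSimplex.map_coe, FunOnFinite.linearMap_apply_apply]

/-- Map of simplices, continuous version. -/
noncomputable def dmap {m n : ℕ} (f : Fin m → Fin n) : C(Dl m, Dl n) := ⟨stdSimplex.map f, stdSimplex.continuous_map f⟩

/-- Singular simplices. -/
noncomputable abbrev Sing (M : Type) [TopologicalSpace M] : SimM M where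
  X n := C(Dl n, M)
  act f σ := σ.comp (dmap f)
  act_act f g σ := by
    ext x
    exact congrArg σ (stdSimplex.map_comp_apply f g x)
  supp σ := Set.range σ
  supp_act f σ := Set.range_comp_subset_range _ σ
  supp_ne σ := Set.range_nonempty σ

section
variable {M : Type} [MetricSpace M] {R : Type} [CommRing R]

lemma Rips_cone {A : Set M} {b : M} (hb : b ∈ A) {n : ℕ} {z : (Rips M).X (n + 1) →₀ R}
  (hz : z ∈ (Rips M).Car R A (n + 1)) (h : (Rips M).bd R n z = 0) :
  ∃ w ∈ (Rips M).Car R A (n + 2), (Rips M).bd R (n + 1) w = z := by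
  classical
  refine ⟨mapDomain (fun v : Fin (n + 1) → M => (Fin.cons b v : Fin (n + 2) → M)) z, ?_, ?_⟩
  · rw [SimM.Car, Finsupp.mem_supported]
    refine (Finset.coe_subset.2 Finsupp.mapDomain_support).trans ?_
    intro w hw
    obtain ⟨v, hv, rfl⟩ := Finset.mem_image.1 (mem_coe.1 hw)
    have hv' : Set.range v ⊆ A := hz hv
    rintro _ ⟨i, rfl⟩
    cases i using Fin.cases with
    | zero => exact hb
    | succ i => exact hv' ⟨i, rfl⟩
  · have := Sim.cone_bd (X := (Rips M).toSim) (R := R) (D := fun n => univ)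
      (fun n (v : Fin n → M) => (Fin.cons b v : Fin (n + 1) → M)) (fun n v _ => ?_) (fun n v _ i => ?_) (z := z) (by simp)
    · rw [h] at this; exact this.trans (sub_zero z)
    · funext j; rfl
    · funext j
      cases j using Fin.cases with
      | zero => rfl
      | succ j =>
        change (Fin.cons b v : Fin (n + 2) → M) (i.succ.succAbove j.succ) = v (i.succAbove j)
        rw [Fin.succ_succAbove_succ]; rfl

lemma Rips_LA : (Rips M).LA R := fun ε hε => ⟨ε, hε, le_rfl, fun S ⟨b, hb⟩ _ n z h hz =>
  Rips_cone (Metric.self_subset_thickening hε S hb) hz h⟩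

/-- Cones of maps to a vector space. -/
lemma exists_cone {V : Type} [NormedAddCommGroup V] [NormedSpace ℝ V] {n : ℕ} (τ : C(Dl n, V)) :
  ∃ κ : C(Dl (n + 1), V), (∀ x : Dl (n + 1), x 0 = 1 → κ x = 0) ∧
  ∀ (x : Dl (n + 1)) (y : Dl n), (∀ j, x j.succ = (1 - x 0) * y j) → κ x = (1 - x 0) • τ y := by
  classical
  let t : (Fin n → ℝ) → V := fun v => if h : v ∈ stdSimplex ℝ (Fin n) then τ ⟨v, h⟩ else 0
  have tt : ∀ y : Dl n, t y = τ y := fun y => dif_pos y.2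
  have tc : ContinuousOn t (stdSimplex ℝ (Fin n)) := by
    rw [continuousOn_iff_continuous_domRestrict]
    exact τ.continuous.congr fun y => (tt y).symm
  obtain ⟨C, hC⟩ : ∃ C, ∀ v, ‖t v‖ ≤ C := by
    obtain ⟨C, hC⟩ := (isCompact_range τ.continuous).isBounded.exists_norm_le
    refine ⟨max C 0, fun v => ?_⟩
    by_cases h : v ∈ stdSimplex ℝ (Fin n)
    · rw [show t v = τ ⟨v, h⟩ from dif_pos h]; exact (hC _ ⟨_, rfl⟩).trans (le_max_left _ _)
    · rw [show t v = 0 from dif_neg h, norm_zero]; exact le_max_right _ _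
  have cx : ∀ i : Fin (n + 1), Continuous fun x : Dl (n + 1) => x i := fun i => (continuous_apply i).comp continuous_subtype_val
  let u : Dl (n + 1) → Fin n → ℝ := fun x j => (1 - x 0)⁻¹ * x j.succ
  have hu : ∀ x : Dl (n + 1), x 0 ≠ 1 → u x ∈ stdSimplex ℝ (Fin n) := by
    intro x hx
    have h1 := sum_eq_one x
    rw [Fin.sum_univ_succ] at h1
    have h2 : (0 : ℝ) ≤ 1 - x 0 := sub_nonneg.2 (le_one x 0)
    refine ⟨fun j => mul_nonneg (inv_nonneg.2 h2) (stdSimplex.zero_le x _), ?_⟩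
    change ∑ j : Fin n, (1 - x 0)⁻¹ * x j.succ = 1
    rw [← mul_sum, show ∑ j : Fin n, x j.succ = 1 - x 0 by linarith]
    exact inv_mul_cancel₀ (sub_ne_zero.2 hx.symm)
  refine ⟨⟨fun x => (1 - x 0) • t (u x), ?_⟩, fun x hx => ?_, fun x y hy => ?_⟩
  · rw [continuous_iff_continuousAt]
    intro x
    by_cases hx : x 0 = 1
    · rw [ContinuousAt]
      simp only [hx, sub_self, zero_smul]
      refine squeeze_zero_norm (a := fun x => (1 - x 0) * C) (fun y => ?_) ?_
      · rw [norm_smul, Real.norm_of_nonneg (sub_nonneg.2 (le_one y 0))]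
        exact mul_le_mul_of_nonneg_left (hC _) (sub_nonneg.2 (le_one y 0))
      · have := ((continuous_const.sub (cx 0)).mul (continuous_const (y := C))).tendsto (x := x) (f := fun x => ((1 : ℝ) - x 0) * C)
        simpa [hx] using this
    · have ho : IsOpen {y : Dl (n + 1) | y 0 ≠ 1} := isOpen_ne_fun (cx 0) continuous_const
      have hc : ContinuousOn (fun y : Dl (n + 1) => (1 - y 0) • t (u y)) {y | y 0 ≠ 1} := by
        refine ((continuous_const.sub (cx 0)).continuousOn).smul (tc.comp ?_ fun y hy => hu y hy)
        refine continuousOn_pi.2 fun j => ContinuousOn.mul (ContinuousOn.inv₀ ((continuous_const.sub (cx 0)).continuousOn) ?_) (cx _).continuousOn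
        intro y hy
        exact sub_ne_zero.2 (Ne.symm hy)
      exact hc.continuousAt (ho.mem_nhds hx)
  · simp [hx]
  · by_cases hx : x 0 = 1
    · simp [hx]
    · have : u x = y := by
        funext j
        change (1 - x 0)⁻¹ * x j.succ = y j
        rw [hy, inv_mul_cancel_left₀ (sub_ne_zero.2 (Ne.symm hx))]
      change (1 - x 0) • t (u x) = _
      rw [this, tt]

/-- The tail of a point of the simplex. -/
lemma exists_tail {n : ℕ} (x : Dl (n + 1)) (hx : x 0 ≠ 1) : ∃ y : Dl n, ∀ j, x j.succ = (1 - x 0) * y j := by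
  have h1 := sum_eq_one x
  rw [Fin.sum_univ_succ] at h1
  have h2 : (0 : ℝ) ≤ 1 - x 0 := sub_nonneg.2 (le_one x 0)
  refine ⟨⟨fun j => (1 - x 0)⁻¹ * x j.succ, fun j => mul_nonneg (inv_nonneg.2 h2) (stdSimplex.zero_le x _), ?_⟩, fun j => ?_⟩
  · rw [← mul_sum, show ∑ j : Fin n, x j.succ = 1 - x 0 by linarith]
    exact inv_mul_cancel₀ (sub_ne_zero.2 hx.symm)
  · change _ = (1 - x 0) * ((1 - x 0)⁻¹ * _)
    rw [mul_inv_cancel_left₀ (sub_ne_zero.2 hx.symm)]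

section cone
variable {V : Type} [NormedAddCommGroup V] [NormedSpace ℝ V]

/-- The cone of a singular simplex in a vector space. -/
noncomputable def vc {n : ℕ} (τ : C(Dl n, V)) : C(Dl (n + 1), V) := (exists_cone τ).choose
lemma vc_one {n : ℕ} (τ : C(Dl n, V)) {x : Dl (n + 1)} (h : x 0 = 1) : vc τ x = 0 := (exists_cone τ).choose_spec.1 x h
lemma vc_eq {n : ℕ} (τ : C(Dl n, V)) (x : Dl (n + 1)) (y : Dl n) (h : ∀ j, x j.succ = (1 - x 0) * y j) :
  vc τ x = (1 - x 0) • τ y := (exists_cone τ).choose_spec.2 x y h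

lemma vc_face0 {n : ℕ} (τ : C(Dl n, V)) : (vc τ).comp (dmap (succAbove 0)) = τ := by
  ext1 y
  change vc τ (stdSimplex.map _ y) = _
  have h0 : stdSimplex.map (succAbove 0) y 0 = 0 := by
    rw [Dl_map]; exact sum_eq_zero fun i hi => absurd (mem_filter.1 hi).2 (Fin.succAbove_ne 0 i)
  rw [vc_eq τ _ y, h0, sub_zero, one_smul]
  intro j
  rw [h0, Dl_map, sub_zero, one_mul, sum_eq_single j]
  · intro i hi hij; exact absurd (Fin.succ_injective _ (by simpa using (mem_filter.1 hi).2)) hij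
  · intro h; exact absurd (mem_filter.2 ⟨Finset.mem_univ _, by simp⟩) h

lemma vc_face {n : ℕ} (τ : C(Dl (n + 1), V)) (i : Fin (n + 1)) :
  (vc τ).comp (dmap (succAbove i.succ)) = vc (τ.comp (dmap i.succAbove)) := by
  ext1 x
  change vc τ (stdSimplex.map _ x) = _
  have h0 : stdSimplex.map (succAbove i.succ) x 0 = x 0 := by
    rw [Dl_map, sum_eq_single 0]
    · intro k hk hk0
      obtain ⟨k, rfl⟩ := Fin.exists_succ_eq.2 hk0
      have := (mem_filter.1 hk).2
      rw [Fin.succ_succAbove_succ] at this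
      exact absurd this (Fin.succ_ne_zero _)
    · intro h; exact absurd (mem_filter.2 ⟨Finset.mem_univ _, by simp⟩) h
  by_cases hx : x 0 = 1
  · rw [vc_one _ (h0.trans hx), vc_one _ hx]
  · obtain ⟨y, hy⟩ := exists_tail x hx
    rw [vc_eq _ x y hy, vc_eq τ _ (stdSimplex.map i.succAbove y), h0]
    · rfl
    · intro j
      rw [h0, Dl_map, Dl_map, mul_sum, sum_filter, sum_filter, Fin.sum_univ_succ,
        if_neg (by simpa using (Fin.succ_ne_zero j).symm), zero_add]
      refine sum_congr rfl fun k _ => ?_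
      rw [Fin.succ_succAbove_succ, hy]
      simp only [Fin.succ_inj]

lemma vc_ball {n : ℕ} (τ : C(Dl n, V)) {t : ℝ} (ht : 0 < t) (h : ∀ y, τ y ∈ ball 0 t) (x : Dl (n + 1)) :
  vc τ x ∈ ball 0 t := by
  by_cases hx : x 0 = 1
  · rw [vc_one _ hx]; exact mem_ball_self ht
  · obtain ⟨y, hy⟩ := exists_tail x hx
    have h1 : (0 : ℝ) ≤ 1 - x 0 := sub_nonneg.2 (le_one x 0)
    have h2 : 1 - x 0 ≤ 1 := by linarith [stdSimplex.zero_le x 0]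
    have h3 := h y
    rw [vc_eq _ x y hy, mem_ball_zero_iff, norm_smul, Real.norm_of_nonneg h1]
    rw [mem_ball_zero_iff] at h3
    exact (mul_le_of_le_one_left (norm_nonneg _) h2).trans_lt h3
end cone

lemma Sing_ball {r : ℕ} (c : (Fin r → ℝ) → M) (hc : IsOpenEmbedding c) {t : ℝ} (ht : 0 < t) {n : ℕ}
  {z : (Sing M).X (n + 1) →₀ R} (hz : z ∈ (Sing M).Car R (c '' ball 0 t) (n + 1)) (h : (Sing M).bd R n z = 0) :
  ∃ w ∈ (Sing M).Car R (c '' ball 0 t) (n + 2), (Sing M).bd R (n + 1) w = z := by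
  classical
  let cc : C(Fin r → ℝ, M) := ⟨c, hc.continuous⟩
  have lift : ∀ n (σ : C(Dl n, M)), Set.range σ ⊆ c '' ball 0 t → ∃ τ : C(Dl n, Fin r → ℝ), cc.comp τ = σ ∧
      ∀ y, τ y ∈ ball 0 t := by
    intro n σ hσ
    choose τ h1 h2 using fun y => hσ ⟨y, rfl⟩
    refine ⟨⟨τ, hc.isInducing.continuous_iff.2 (σ.continuous.congr fun y => (h2 y).symm)⟩, ?_, h1⟩
    ext1 y; exact h2 y
  choose! L hL hL' using lift
  have inj : ∀ {n} {a b : C(Dl n, Fin r → ℝ)}, cc.comp a = cc.comp b → a = b := fun h => by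
    ext1 y; exact hc.injective (DFunLike.congr_fun h y)
  refine ⟨mapDomain (fun σ => cc.comp (vc (L _ σ))) z, ?_, ?_⟩
  · rw [SimM.Car, Finsupp.mem_supported]
    refine (Finset.coe_subset.2 Finsupp.mapDomain_support).trans ?_
    intro w hw
    obtain ⟨v, hv, rfl⟩ := Finset.mem_image.1 (mem_coe.1 hw)
    have hv' : Set.range v ⊆ _ := hz hv
    rintro _ ⟨x, rfl⟩
    exact ⟨_, vc_ball _ ht (hL' _ v hv') x, rfl⟩
  · have := Sim.cone_bd (X := (Sing M).toSim) (R := R) (D := fun n => {σ : C(Dl n, M) | Set.range σ ⊆ c '' ball 0 t})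
      (fun n (σ : C(Dl n, M)) => cc.comp (vc (L n σ))) (fun n σ hσ => ?_) (fun n σ hσ i => ?_) (z := z) hz
    · rw [h] at this; exact this.trans (sub_zero z)
    · change (cc.comp (vc (L n σ))).comp (dmap (succAbove 0)) = σ
      rw [ContinuousMap.comp_assoc, vc_face0, hL _ _ hσ]
    · change (cc.comp (vc (L _ σ))).comp (dmap (succAbove i.succ)) = cc.comp (vc (L n (σ.comp (dmap i.succAbove))))
      rw [ContinuousMap.comp_assoc, vc_face]
      congr 2
      refine inj ?_
      refine Eq.trans ?_ (hL n (ContinuousMap.comp σ (dmap i.succAbove)) ((Set.range_comp_subset_range _ σ).trans hσ)).symm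
      rw [← ContinuousMap.comp_assoc, hL _ _ hσ]

lemma Sing_LA [CompactSpace M] {r : ℕ} (hLE : LE M r) : (Sing M).LA R := by
  intro ε hε
  have : ∀ x : M, ∃ (c : (Fin r → ℝ) → M) (t : ℝ), IsOpenEmbedding c ∧ c 0 = x ∧ 0 < t ∧
      c '' ball 0 t ⊆ ball x (ε / 2) := by
    intro x
    obtain ⟨c, hc, h0⟩ := hLE x
    obtain ⟨t, ht, hs⟩ := Metric.mem_nhds_iff.1 (hc.continuous.continuousAt.preimage_mem_nhds
      (by rw [h0]; exact Metric.ball_mem_nhds x (half_pos hε)) : c ⁻¹' ball x (ε / 2) ∈ nhds 0)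
    exact ⟨c, t, hc, h0, ht, Set.image_subset_iff.2 hs⟩
  choose c t hc h0 ht hb using this
  obtain ⟨δ, hδ, hl⟩ := lebesgue_number_lemma_of_metric (s := (univ : Set M)) (c := fun x => c x '' ball 0 (t x))
    isCompact_univ (fun x => (hc x).isOpenMap _ isOpen_ball)
    (fun x _ => Set.mem_iUnion.2 ⟨x, 0, mem_ball_self (ht x), h0 x⟩)
  refine ⟨min (δ / 2) ε, lt_min (half_pos hδ) hε, min_le_right _ _, fun S hS hd n z h hz => ?_⟩
  obtain ⟨a, ha⟩ := hS
  obtain ⟨x, hx⟩ := hl a trivial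
  have hsub : thickening (min (δ / 2) ε) S ⊆ c x '' ball 0 (t x) := by
    intro y hy
    obtain ⟨b, hb, hyb⟩ := mem_thickening_iff.1 hy
    refine hx (mem_ball.2 ?_)
    have h1 := hd b hb a ha
    have h2 := min_le_left (δ / 2) ε
    linarith [dist_triangle y b a]
  obtain ⟨w, hw, hw'⟩ := Sing_ball (c x) (hc x) (ht x) (SimM.Car_mono hsub _ hz) h
  refine ⟨w, SimM.Car_mono (fun y hy => mem_thickening_iff.2 ⟨a, ha, ?_⟩) _ hw, hw'⟩
  have h1 := mem_ball.1 (hb x hy)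
  have h2 := mem_ball.1 (hb x (hx (mem_ball_self hδ)))
  linarith [dist_triangle_right y a x]
end
end PG

namespace PG

/-! ### Barycentric subdivision -/

/-- Affine maps of simplices. -/
def affC {n m : ℕ} (v : Fin n → Dl m) : C(Dl n, Dl m) where
  toFun x := ⟨fun j => ∑ i, x i * v i j, fun j => Finset.sum_nonneg fun i _ => mul_nonneg (x.2.1 i) ((v i).2.1 j), by
    rw [sum_comm]
    simp only [← mul_sum, sum_eq_one, mul_one]⟩
  continuous_toFun := by
    refine Continuous.subtype_mk (continuous_pi fun j => continuous_finsetSum _ fun i _ => ?_) _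
    exact ((continuous_apply i).comp continuous_subtype_val).mul continuous_const

lemma affC_apply {n m : ℕ} (v : Fin n → Dl m) (x : Dl n) (j : Fin m) : affC v x j = ∑ i, x i * v i j := rfl

lemma affC_affC {n m k : ℕ} (v : Fin n → Dl m) (w : Fin k → Dl n) : (affC v).comp (affC w) = affC fun i => affC v (w i) := by
  ext1 x
  apply stdSimplex.ext; funext j
  change affC v (affC w x) j = affC (fun i => affC v (w i)) x j
  simp only [affC_apply, sum_mul, mul_sum]
  rw [sum_comm]
  simp only [mul_assoc]

lemma affC_dmap {n m k : ℕ} (v : Fin n → Dl m) (f : Fin k → Fin n) : (affC v).comp (dmap f) = affC (v ∘ f) := by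
  ext1 x
  apply stdSimplex.ext; funext j
  change affC v (stdSimplex.map f x) j = affC (v ∘ f) x j
  simp only [affC_apply, Dl_map, sum_mul, sum_filter, ite_mul, zero_mul]
  rw [sum_comm]
  refine sum_congr rfl fun i _ => ?_
  rw [Finset.sum_ite_eq, if_pos (Finset.mem_univ _)]; rfl

/-- The vertices of the simplex. -/
def vtx (n : ℕ) (i : Fin n) : Dl n := ⟨Pi.single i 1, single_mem_stdSimplex ℝ i⟩

lemma affC_vtx {n m : ℕ} (v : Fin n → Dl m) (i : Fin n) : affC v (vtx n i) = v i := by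
  apply stdSimplex.ext; funext j
  change ∑ k, (Pi.single i 1 : Fin n → ℝ) k * v k j = v i j
  simp [Pi.single_apply]

lemma affC_id {n : ℕ} : affC (vtx n) = ContinuousMap.id _ := by
  ext1 x
  apply stdSimplex.ext; funext j
  change ∑ k, x k * (Pi.single k 1 : Fin n → ℝ) j = x j
  simp [Pi.single_apply]

lemma affC_dist {n m : ℕ} (v : Fin n → Dl m) (x : Dl n) (q : Dl m) {D : ℝ} (hD : 0 ≤ D) (h : ∀ i, dist (v i) q ≤ D) :
  dist (affC v x) q ≤ D := by
  rw [dist_eq, dist_pi_le_iff hD]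
  intro j
  have h' : ∀ i, |v i j - q j| ≤ D := fun i => (dist_pi_le_iff hD).1 (h i) j
  change |(∑ i, x i * v i j) - q j| ≤ D
  have e : (∑ i, x i * v i j) - q j = ∑ i, x i * (v i j - q j) := by
    simp only [mul_sub, sum_sub_distrib, ← sum_mul, sum_eq_one, one_mul]
  rw [e]
  refine (Finset.abs_sum_le_sum_abs _ _).trans ?_
  have : ∑ i, |x i * (v i j - q j)| ≤ ∑ i, x i * D := Finset.sum_le_sum fun i _ => by
    rw [abs_mul, abs_of_nonneg (stdSimplex.zero_le x i)]
    exact mul_le_mul_of_nonneg_left (h' i) (stdSimplex.zero_le x i)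
  rwa [← sum_mul, sum_eq_one, one_mul] at this

/-- The barycenter. -/
noncomputable def bry (n : ℕ) : Dl (n + 1) := ⟨fun _ => ((n : ℝ) + 1)⁻¹, fun _ => by positivity, by
  have : (n : ℝ) + 1 ≠ 0 := by positivity
  simp [this]⟩

lemma bry_dist {n m : ℕ} (v : Fin (n + 1) → Dl m) {D : ℝ} (hD : 0 ≤ D) (h : ∀ i j, dist (v i) (v j) ≤ D) (i : Fin (n + 1)) :
  dist (v i) (affC v (bry n)) ≤ (1 - ((n : ℝ) + 1)⁻¹) * D := by
  have hn : (0 : ℝ) < n + 1 := by positivity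
  have h1 : (1 - ((n : ℝ) + 1)⁻¹) * D = ((n : ℝ) + 1)⁻¹ * (n * D) := by field_simp; ring
  rw [h1, dist_eq, dist_pi_le_iff (by positivity)]
  intro j
  change |v i j - ∑ k : Fin (n + 1), ((n : ℝ) + 1)⁻¹ * v k j| ≤ _
  have e : v i j - ∑ k : Fin (n + 1), ((n : ℝ) + 1)⁻¹ * v k j = ((n : ℝ) + 1)⁻¹ * ∑ k : Fin (n + 1), (v i j - v k j) := by
    rw [← mul_sum, sum_sub_distrib, sum_const, Finset.card_univ, Fintype.card_fin, nsmul_eq_mul]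
    push_cast
    field_simp
  rw [e, abs_mul, abs_of_pos (inv_pos.2 hn)]
  refine mul_le_mul_of_nonneg_left ((Finset.abs_sum_le_sum_abs _ _).trans ?_) (inv_pos.2 hn).le
  have : ∑ k : Fin (n + 1), |v i j - v k j| ≤ ∑ k : Fin (n + 1), if k = i then 0 else D := Finset.sum_le_sum fun k _ => by
    split_ifs with hk
    · simp [hk]
    · exact (dist_pi_le_iff hD).1 (h i k) j
  refine this.trans_eq ?_
  have e2 : ∀ k : Fin (n + 1), (if k = i then 0 else D) = D - if k = i then D else 0 := fun k => by split_ifs <;> simp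
  simp only [e2, sum_sub_distrib, sum_const, Finset.card_univ, Fintype.card_fin, nsmul_eq_mul,
    sum_ite_eq', Finset.mem_univ, if_true]
  push_cast; ring

section ops
variable {R : Type} [CommRing R] {M : Type} [TopologicalSpace M]

/-- Chains on tuples in a simplex. -/
abbrev RC (R : Type) [CommRing R] (m n : ℕ) := (Fin n → Dl m) →₀ R
/-- Boundary. -/
noncomputable abbrev rb (R : Type) [CommRing R] (m n : ℕ) : RC R m (n + 1) →ₗ[R] RC R m n := (Rips (Dl m)).bd R n
/-- Push forward of tuples by an affine map. -/
noncomputable def pa {l m : ℕ} (u : Fin l → Dl m) (n : ℕ) : RC R l n →ₗ[R] RC R m n :=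
  lmapDomain R R fun v i => affC u (v i)
/-- Push forward to singular simplices. -/
noncomputable def psh {l : ℕ} (σ : C(Dl l, M)) (n : ℕ) : RC R l n →ₗ[R] (C(Dl n, M) →₀ R) :=
  lmapDomain R R fun v => σ.comp (affC v)
/-- The operator on tuples defined by a universal chain. -/
noncomputable def rO {n k : ℕ} (s : RC R n k) (m : ℕ) : RC R m n →ₗ[R] RC R m k :=
  linearCombination R fun v => pa v k s
/-- The operator on singular chains defined by a universal chain. -/
noncomputable def sO {n k : ℕ} (s : RC R n k) : (C(Dl n, M) →₀ R) →ₗ[R] (C(Dl k, M) →₀ R) :=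
  linearCombination R fun σ => psh σ k s

lemma Sim.nat_bd {X Y : Sim} (φ : ∀ n, X.X n → Y.X n)
  (h : ∀ n (x : X.X (n + 1)) (i : Fin (n + 1)), Y.act i.succAbove (φ (n + 1) x) = φ n (X.act i.succAbove x))
  {n : ℕ} (c : X.X (n + 1) →₀ R) : Y.bd R n (mapDomain (φ (n + 1)) c) = mapDomain (φ n) (X.bd R n c) := by
  suffices h : Y.bd R n ∘ₗ lmapDomain R R (φ (n + 1)) = lmapDomain R R (φ n) ∘ₗ X.bd R n from
    LinearMap.congr_fun h c
  refine lhom_ext' fun v => ext_ring ?_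
  simp only [LinearMap.comp_apply, lsingle_apply, lmapDomain_apply, mapDomain_single,
    Sim.bd_single, Finsupp.mapDomain_finsetSum, h]

lemma pa_bd {l m : ℕ} (u : Fin l → Dl m) (n : ℕ) (c : RC R l (n + 1)) : rb R m n (pa u (n + 1) c) = pa u n (rb R l n c) :=
  Sim.nat_bd (X := (Rips (Dl l)).toSim) (Y := (Rips (Dl m)).toSim) (fun n v i => affC u (v i)) (fun _ _ _ => rfl) c

lemma psh_bd {l : ℕ} (σ : C(Dl l, M)) (n : ℕ) (c : RC R l (n + 1)) :
  (Sing M).bd R n (psh σ (n + 1) c) = psh σ n (rb R l n c) :=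
  Sim.nat_bd (X := (Rips (Dl l)).toSim) (Y := (Sing M).toSim) (fun n v => σ.comp (affC v))
    (fun _ v _ => (ContinuousMap.comp_assoc _ _ _).trans (congrArg _ (affC_dmap v _))) c

lemma pa_pa {k l m n : ℕ} (u : Fin l → Dl m) (w : Fin k → Dl l) (c : RC R k n) :
  pa u n (pa w n c) = pa (fun i => affC u (w i)) n c := by
  simp only [pa, lmapDomain_apply, ← Finsupp.mapDomain_comp]
  congr 1
  funext v i
  exact DFunLike.congr_fun (affC_affC u w) (v i)

lemma pa_rO {l m n k : ℕ} (u : Fin l → Dl m) (s : RC R n k) (c : RC R l n) : pa u k (rO s l c) = rO s m (pa u n c) := by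
  suffices h : pa u k ∘ₗ rO s l = rO s m ∘ₗ pa u n from LinearMap.congr_fun h c
  refine lhom_ext' fun v => ext_ring ?_
  simp only [LinearMap.comp_apply, lsingle_apply, rO, linearCombination_single, one_smul, pa_pa]
  rw [show pa u n (single v (1 : R)) = single (fun i => affC u (v i)) 1 from mapDomain_single,
    linearCombination_single, one_smul]

lemma psh_rO {l n k : ℕ} (σ : C(Dl l, M)) (s : RC R n k) (c : RC R l n) : psh σ k (rO s l c) = sO s (psh σ n c) := by
  suffices h : psh σ k ∘ₗ rO s l = sO s ∘ₗ psh σ n from LinearMap.congr_fun h c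
  refine lhom_ext' fun v => ext_ring ?_
  simp only [LinearMap.comp_apply, lsingle_apply, rO, sO, linearCombination_single, one_smul]
  rw [show psh σ n (single v (1 : R)) = single (σ.comp (affC v)) 1 from mapDomain_single,
    linearCombination_single, one_smul]
  simp only [psh, pa, lmapDomain_apply, ← Finsupp.mapDomain_comp]
  congr 1
  funext w
  exact (congrArg _ (affC_affC v w).symm).trans (ContinuousMap.comp_assoc _ _ _).symm

lemma pa_vtx {m n : ℕ} (v : Fin n → Dl m) : pa v n (single (vtx n) (1 : R)) = single v 1 :=
  mapDomain_single.trans (by congr 1; funext i; exact affC_vtx v i)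
lemma psh_vtx {n : ℕ} (σ : C(Dl n, M)) : psh σ n (single (vtx n) (1 : R)) = single σ 1 :=
  mapDomain_single.trans (by rw [affC_id]; rfl)
lemma rO_single {m n k : ℕ} (s : RC R n k) (v : Fin n → Dl m) : rO s m (single v 1) = pa v k s := by simp [rO]
lemma sO_single {n k : ℕ} (s : RC R n k) (σ : C(Dl n, M)) : sO s (single σ 1) = psh σ k s := by simp [sO]

/-- Cone of tuples. -/
noncomputable def cn {m : ℕ} (b : Dl m) (n : ℕ) : RC R m n →ₗ[R] RC R m (n + 1) :=
  lmapDomain R R fun v => (Fin.cons b v : Fin (n + 1) → Dl m)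

lemma cn_bd {m : ℕ} (b : Dl m) (n : ℕ) (c : RC R m (n + 1)) :
  rb R m (n + 1) (cn b (n + 1) c) = c - cn b n (rb R m n c) := by
  refine Sim.cone_bd (X := (Rips (Dl m)).toSim) (D := fun n => univ)
      (fun n (v : Fin n → Dl m) => (Fin.cons b v : Fin (n + 1) → Dl m)) (fun n v _ => rfl) (fun n v _ i => ?_) (by simp)
  funext j
  cases j using Fin.cases with
  | zero => rfl
  | succ j =>
    change (Fin.cons b v : Fin (n + 2) → Dl m) (i.succ.succAbove j.succ) = v (i.succAbove j)
    rw [Fin.succ_succAbove_succ]; rfl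

lemma cn_bd0 {m : ℕ} (b : Dl m) (c : RC R m 0) : rb R m 0 (cn b 0 c) = c := by
  suffices h : rb R m 0 ∘ₗ cn b 0 = LinearMap.id from LinearMap.congr_fun h c
  refine lhom_ext' fun v => ext_ring ?_
  change rb R m 0 (cn b 0 (single v 1)) = single v 1
  rw [show cn b 0 (single v (1 : R)) = single (Fin.cons b v : Fin 1 → Dl m) 1 from mapDomain_single]
  refine (Sim.bd_single (X := (Rips (Dl m)).toSim) _).trans ?_
  rw [Fin.sum_univ_one, Fin.val_zero, pow_zero]
  exact congrArg (fun w => single w (1 : R)) (Subsingleton.elim _ _)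

variable (R) in
/-- Universal subdivision chain. -/
noncomputable def us : ∀ n, RC R n n
  | 0 => single (vtx 0) 1
  | n + 1 => cn (bry n) n (rO (us n) (n + 1) (rb R (n + 1) n (single (vtx (n + 1)) 1)))
variable (R) in
/-- Universal homotopy chain. -/
noncomputable def ut : ∀ n, RC R n (n + 1)
  | 0 => 0
  | n + 1 => cn (bry n) (n + 1) (single (vtx (n + 1)) 1 - rO (ut n) (n + 1) (rb R (n + 1) n (single (vtx (n + 1)) 1)))

lemma us_red {n : ℕ} (h : rb R (n + 1) n (us R (n + 1)) = rO (us R n) (n + 1) (rb R (n + 1) n (single (vtx (n + 1)) 1)))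
  (m : ℕ) (c : RC R m (n + 1)) : rb R m n (rO (us R (n + 1)) m c) = rO (us R n) m (rb R m n c) := by
  suffices h : rb R m n ∘ₗ rO (us R (n + 1)) m = rO (us R n) m ∘ₗ rb R m n from LinearMap.congr_fun h c
  refine lhom_ext' fun v => ext_ring ?_
  simp only [LinearMap.comp_apply, lsingle_apply, rO_single]
  rw [pa_bd, h, pa_rO, ← pa_bd, pa_vtx]

lemma us_bd (n : ℕ) : rb R (n + 1) n (us R (n + 1)) = rO (us R n) (n + 1) (rb R (n + 1) n (single (vtx (n + 1)) 1)) := by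
  induction n with
  | zero => exact cn_bd0 _ _
  | succ n ih => rw [us, cn_bd, us_red ih, Sim.bd_bd, map_zero, map_zero, sub_zero]

lemma ut_red {n : ℕ} (h : rb R (n + 1) (n + 1) (ut R (n + 1)) = single (vtx (n + 1)) 1 - us R (n + 1)
  - rO (ut R n) (n + 1) (rb R (n + 1) n (single (vtx (n + 1)) 1)))
  (m : ℕ) (c : RC R m (n + 1)) : rb R m (n + 1) (rO (ut R (n + 1)) m c) = c - rO (us R (n + 1)) m c - rO (ut R n) m (rb R m n c) := by
  suffices h : rb R m (n + 1) ∘ₗ rO (ut R (n + 1)) m = LinearMap.id - rO (us R (n + 1)) m - rO (ut R n) m ∘ₗ rb R m n from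
    LinearMap.congr_fun h c
  refine lhom_ext' fun v => ext_ring ?_
  simp only [LinearMap.comp_apply, lsingle_apply, rO_single, LinearMap.sub_apply, LinearMap.id_apply]
  rw [pa_bd, h, map_sub, map_sub, pa_rO, ← pa_bd, pa_vtx]

lemma ut_bd (n : ℕ) : rb R (n + 1) (n + 1) (ut R (n + 1)) = single (vtx (n + 1)) 1 - us R (n + 1)
  - rO (ut R n) (n + 1) (rb R (n + 1) n (single (vtx (n + 1)) 1)) := by
  have h0 : ∀ m (c : RC R m 0), rO (us R 0) m c = c := by
    intro m c
    suffices h : rO (us R 0) m = LinearMap.id from LinearMap.congr_fun h c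
    refine lhom_ext' fun v => ext_ring ?_
    simp only [LinearMap.comp_apply, lsingle_apply, rO_single, us, pa_vtx, LinearMap.id_apply]
  induction n with
  | zero =>
    have e : ∀ m (c : RC R m 0), rO (ut R 0) m c = 0 := fun m c => by
      simp [rO, ut, Finsupp.linearCombination_apply, Finsupp.sum]
    have e1 : ut R 1 = cn (bry 0) 1 (single (vtx 1) 1) := by
      rw [ut, e, sub_zero]
    have e2 : us R 1 = cn (bry 0) 0 (rb R 1 0 (single (vtx 1) 1)) := by
      rw [us, h0]
    rw [e1, e2, cn_bd, e, sub_zero]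
  | succ n ih =>
    rw [ut, cn_bd, map_sub, ut_red ih, Sim.bd_bd, map_zero, sub_zero]
    rw [us]
    rw [sub_sub_cancel]
    abel

lemma sO_us (n : ℕ) (c : C(Dl (n + 1), M) →₀ R) : (Sing M).bd R n (sO (us R (n + 1)) c) = sO (us R n) ((Sing M).bd R n c) := by
  suffices h : (Sing M).bd R n ∘ₗ sO (us R (n + 1)) = sO (us R n) ∘ₗ (Sing M).bd R n from LinearMap.congr_fun h c
  refine lhom_ext' fun σ => ext_ring ?_
  simp only [LinearMap.comp_apply, lsingle_apply, sO_single]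
  rw [psh_bd, us_bd, psh_rO, ← psh_bd, psh_vtx]

lemma sO_ut (n : ℕ) (c : C(Dl (n + 1), M) →₀ R) : (Sing M).bd R (n + 1) (sO (ut R (n + 1)) c)
  = c - sO (us R (n + 1)) c - sO (ut R n) ((Sing M).bd R n c) := by
  suffices h : (Sing M).bd R (n + 1) ∘ₗ sO (ut R (n + 1)) = LinearMap.id - sO (us R (n + 1)) - sO (ut R n) ∘ₗ (Sing M).bd R n from
    LinearMap.congr_fun h c
  refine lhom_ext' fun σ => ext_ring ?_
  simp only [LinearMap.comp_apply, lsingle_apply, sO_single, LinearMap.sub_apply, LinearMap.id_apply]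
  rw [psh_bd, ut_bd, map_sub, map_sub, psh_rO, ← psh_bd, psh_vtx]
end ops
end PG

namespace PG

/-! ### Small singular simplices -/
section mesh
variable {R : Type} [CommRing R]

lemma supp_map {α β : Type} {S : Set α} {T : Set β} {C : (α →₀ R) →ₗ[R] (β →₀ R)}
  (h : ∀ x ∈ S, C (single x 1) ∈ supported R R T) {c : α →₀ R} (hc : c ∈ supported R R S) :
  C c ∈ supported R R T := by
  rw [Finsupp.supported_eq_span_single] at hc
  refine (Submodule.span_le (p := (supported R R T).comap C)).2 ?_ hc
  rintro _ ⟨x, hx, rfl⟩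
  exact h x hx

lemma supp_mapD {α β : Type} {S : Set α} {T : Set β} {f : α → β} (h : ∀ x ∈ S, f x ∈ T) {c : α →₀ R}
  (hc : c ∈ supported R R S) : lmapDomain R R f c ∈ supported R R T :=
  supp_map (fun x hx => by
    rw [lmapDomain_apply, mapDomain_single]; exact single_mem_supported R _ (h x hx)) hc

/-- Tuples with a universal mesh bound. -/
def MS (n k : ℕ) (c : ℝ) : Set (Fin k → Dl n) :=
  {w | ∀ (m : ℕ) (v : Fin n → Dl m) (D : ℝ), 0 ≤ D → (∀ i j, dist (v i) (v j) ≤ D) →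
    ∀ i j, dist (affC v (w i)) (affC v (w j)) ≤ c * D}

/-- Contraction rate. -/
noncomputable def rt (n : ℕ) : ℝ := 1 - (n : ℝ)⁻¹
lemma rt_nn (n : ℕ) : 0 ≤ rt n := by
  rcases n with _ | n
  · simp [rt]
  · rw [rt, sub_nonneg]; exact inv_le_one_of_one_le₀ (by push_cast; linarith [Nat.cast_nonneg (α := ℝ) n])

lemma us_MS (n : ℕ) : us R n ∈ supported R R (MS n n (rt n)) := by
  induction n with
  | zero => exact single_mem_supported R _ fun m v D hD h i => i.elim0
  | succ n ih =>
    rw [us, Sim.bd_single (X := (Rips (Dl (n + 1))).toSim), map_sum, map_sum]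
    refine Submodule.sum_mem _ fun i _ => ?_
    rw [← mul_one ((-1 : R) ^ (i : ℕ)), ← smul_eq_mul, ← smul_single, map_smul, map_smul]
    refine smul_mem _ _ ?_
    rw [rO_single]
    refine supp_mapD (S := (fun (w : Fin n → Dl n) j => affC (vtx (n + 1) ∘ i.succAbove) (w j)) '' MS n n (rt n)) ?_
      (supp_mapD (fun x hx => Set.mem_image_of_mem _ hx) ih)
    rintro _ ⟨w, hw, rfl⟩ m v D hD h
    have hw' : ∀ (m : ℕ) (v : Fin n → Dl m) (D : ℝ), 0 ≤ D → (∀ i j, dist (v i) (v j) ≤ D) →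
      ∀ i j, dist (affC v (w i)) (affC v (w j)) ≤ rt n * D := hw
    have e : ∀ j, affC v (affC (vtx (n + 1) ∘ i.succAbove) (w j)) = affC (v ∘ i.succAbove) (w j) := fun j =>
      (DFunLike.congr_fun (affC_affC v (vtx (n + 1) ∘ i.succAbove)) (w j)).trans (by
        congr 1; congr 1; funext k; exact affC_vtx v _)
    have hb : ∀ x : Dl (n + 1), dist (affC v x) (affC v (bry n)) ≤ rt (n + 1) * D := fun x => by
      refine affC_dist v x _ (mul_nonneg (rt_nn _) hD) fun i => ?_
      have := bry_dist v hD h i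
      rw [rt]; push_cast; exact this
    intro a b
    cases a using Fin.cases with
    | zero =>
      rw [dist_comm]
      exact hb _
    | succ a =>
      cases b using Fin.cases with
      | zero => exact hb _
      | succ b =>
        simp only [Fin.cons_succ, e]
        refine (hw' m (v ∘ i.succAbove) D hD (fun _ _ => h _ _) a b).trans (mul_le_mul_of_nonneg_right ?_ hD)
        have hn : (0 : ℝ) < n := by exact_mod_cast a.pos
        rw [rt, rt]
        push_cast
        have : ((n : ℝ) + 1)⁻¹ ≤ (n : ℝ)⁻¹ := inv_anti₀ hn (by linarith)
        linarith

lemma rO_mesh {n m : ℕ} (D : ℝ) (hD : 0 ≤ D) (k : ℕ) : ∀ v : Fin n → Dl m, (∀ i j, dist (v i) (v j) ≤ D) →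
  ((rO (us R n) m) ^ k) (single v 1)
  ∈ supported R R {w : Fin n → Dl m | ∀ i j, dist (w i) (w j) ≤ rt n ^ k * D} := by
  induction k with
  | zero => intro v h; exact single_mem_supported R _ (by simpa using h)
  | succ k ih =>
    intro v h
    rw [show (rO (us R n) m) ^ (k + 1) = rO (us R n) m * (rO (us R n) m) ^ k from pow_succ' _ _, End.mul_apply]
    refine supp_map (fun w hw => ?_) (ih v h)
    rw [rO_single]
    refine supp_mapD (fun u hu => ?_) (us_MS n)
    have hu' : ∀ (m : ℕ) (v : Fin n → Dl m) (D : ℝ), 0 ≤ D → (∀ i j, dist (v i) (v j) ≤ D) →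
      ∀ i j, dist (affC v (u i)) (affC v (u j)) ≤ rt n * D := hu
    intro i j
    rw [pow_succ', mul_assoc]
    exact hu' m w _ (mul_nonneg (pow_nonneg (rt_nn n) k) hD) hw i j

variable {M : Type} [MetricSpace M]

lemma sd_small {n : ℕ} (σ : C(Dl (n + 1), M)) {ε : ℝ} (hε : 0 < ε) : ∀ᶠ k in atTop,
  ((sO (us R (n + 1))) ^ k) (single σ 1) ∈ supported R R ((Sing M).sm ε (n + 1)) := by
  obtain ⟨η, hη, hu⟩ := Metric.uniformContinuous_iff.1 (CompactSpace.uniformContinuous_of_continuous σ.continuous) ε hε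
  set D := Metric.diam (univ : Set (Dl (n + 1)))
  have hD : 0 ≤ D := Metric.diam_nonneg
  have hr : rt (n + 1) < 1 := by
    rw [rt]; have : (0 : ℝ) < ((n + 1 : ℕ) : ℝ)⁻¹ := by positivity
    linarith
  have ht : Filter.Tendsto (fun k => rt (n + 1) ^ k * D) atTop (nhds 0) := by
    simpa using (tendsto_pow_atTop_nhds_zero_of_lt_one (rt_nn (n + 1)) hr).mul_const D
  filter_upwards [ht.eventually (gt_mem_nhds hη)] with k hk
  have e : ∀ c : RC R (n + 1) (n + 1), psh σ (n + 1) (((rO (us R (n + 1)) (n + 1)) ^ k) c)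
      = ((sO (us R (n + 1))) ^ k) (psh σ (n + 1) c) := by
    clear hk ht
    induction k with
    | zero => intro c; rfl
    | succ k ih => intro c; rw [pow_succ', pow_succ', End.mul_apply, End.mul_apply, psh_rO, ih]
  rw [← psh_vtx σ, ← e]
  refine supp_mapD (fun w hw => ?_) (rO_mesh D hD k (vtx (n + 1)) fun i j =>
    Metric.dist_le_diam_of_mem isCompact_univ.isBounded (Set.mem_univ _) (Set.mem_univ _))
  rintro _ ⟨x, rfl⟩ _ ⟨y, rfl⟩
  have hw' : ∀ i j, dist (w i) (w j) ≤ rt (n + 1) ^ k * D := hw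
  have h0 : 0 ≤ rt (n + 1) ^ k * D := mul_nonneg (pow_nonneg (rt_nn _) k) hD
  refine hu ((affC_dist w x _ h0 fun i => ?_).trans_lt hk)
  rw [dist_comm]
  exact affC_dist w y _ h0 fun j => hw' j i

lemma sO_sm {n k : ℕ} (s : RC R n k) {δ : ℝ} {c : C(Dl n, M) →₀ R} (hc : c ∈ supported R R ((Sing M).sm δ n)) :
  sO s c ∈ supported R R ((Sing M).sm δ k) := by
  refine supp_map (fun σ hσ => ?_) hc
  rw [sO_single]
  refine supp_mapD (S := univ) (fun w _ => ?_) (by simp)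
  rintro _ ⟨x, rfl⟩ _ ⟨y, rfl⟩
  exact hσ _ ⟨_, rfl⟩ _ ⟨_, rfl⟩

lemma sO_hom (k : ℕ) : ∃ T : ∀ m, (C(Dl m, M) →₀ R) →ₗ[R] (C(Dl (m + 1), M) →₀ R), T 0 = 0 ∧
  (∀ m c, (Sing M).bd R (m + 1) (T (m + 1) c) + T m ((Sing M).bd R m c) = c - ((sO (us R (m + 1))) ^ k) c) ∧
  (∀ m c, (Sing M).bd R m (((sO (us R (m + 1))) ^ k) c) = ((sO (us R m)) ^ k) ((Sing M).bd R m c)) ∧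
  ∀ m δ c, c ∈ supported R R ((Sing M).sm δ m) → T m c ∈ supported R R ((Sing M).sm δ (m + 1))
  ∧ ((sO (us R m)) ^ k) c ∈ supported R R ((Sing M).sm δ m) := by
  induction k with
  | zero =>
    exact ⟨fun m => 0, rfl, fun m c => by simp, fun m c => rfl, fun m δ c h => ⟨Submodule.zero_mem _, h⟩⟩
  | succ k ih =>
    obtain ⟨T, h0, hT, hS, hs⟩ := ih
    refine ⟨fun m => T m + sO (ut R m) ∘ₗ ((sO (us R m)) ^ k), ?_, fun m c => ?_, fun m c => ?_, fun m δ c h => ⟨?_, ?_⟩⟩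
    · change T 0 + _ = 0
      rw [h0]
      refine LinearMap.ext fun c => (zero_add _).trans ?_
      change sO (ut R 0) _ = 0
      simp [sO, ut, psh, Finsupp.linearCombination_apply, Finsupp.sum]
    · have e := hT m c
      simp only [LinearMap.add_apply, LinearMap.comp_apply, map_add]
      rw [pow_succ', End.mul_apply, ← hS, sO_ut, ← sub_eq_iff_eq_add.2 e.symm]
      abel
    · rw [pow_succ', pow_succ', End.mul_apply, End.mul_apply, sO_us, hS]
    · exact Submodule.add_mem _ (hs m δ c h).1 (sO_sm _ (hs m δ c h).2)
    · rw [pow_succ', End.mul_apply]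
      exact sO_sm _ (hs m δ c h).2

/-- Small simplices theorem. -/
theorem SS {ε : ℝ} (hε : 0 < ε) (n : ℕ) (e : C(Dl (n + 1), M) →₀ R) :
  ∃ (S : ∀ m, (C(Dl m, M) →₀ R) →ₗ[R] (C(Dl m, M) →₀ R)) (T : ∀ m, (C(Dl m, M) →₀ R) →ₗ[R] (C(Dl (m + 1), M) →₀ R)),
  T 0 = 0 ∧ (∀ m c, (Sing M).bd R (m + 1) (T (m + 1) c) + T m ((Sing M).bd R m c) = c - S (m + 1) c) ∧
  (∀ m c, (Sing M).bd R m (S (m + 1) c) = S m ((Sing M).bd R m c)) ∧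
  (∀ m δ c, c ∈ supported R R ((Sing M).sm δ m) → T m c ∈ supported R R ((Sing M).sm δ (m + 1))) ∧
  S (n + 1) e ∈ supported R R ((Sing M).sm ε (n + 1)) := by
  have : ∀ᶠ k in atTop, ∀ σ ∈ e.support,
      ((sO (us R (n + 1))) ^ k) (single σ 1) ∈ supported R R ((Sing M).sm ε (n + 1)) :=
    (Filter.eventually_all_finset _).2 fun σ _ => sd_small σ hε
  obtain ⟨k, hk⟩ := this.exists
  obtain ⟨T, h0, hT, hS, hs⟩ := sO_hom (R := R) (M := M) k
  refine ⟨fun m => (sO (us R m)) ^ k, T, h0, hT, hS, fun m δ c h => (hs m δ c h).1, ?_⟩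
  exact supp_map (S := (e.support : Set _)) (fun σ hσ => hk σ hσ) (Finsupp.mem_supported_support R e)
end mesh
end PG

namespace PG

/-! ### Singular homology and finiteness -/
/-- Homology of a pair of maps. -/
abbrev HQ {R A B C : Type} [CommRing R] [AddCommGroup A] [AddCommGroup B] [AddCommGroup C] [Module R A] [Module R B] [Module R C]
  (f : A →ₗ[R] B) (g : C →ₗ[R] A) : Type := ker f ⧸ (LinearMap.range g).submoduleOf (ker f)

section HSdef
variable (R : Type) [CommRing R] (M : Type) [TopologicalSpace M]

/-- Unaugmented singular boundary. -/
noncomputable def dS : ∀ n, (C(Dl (n + 1), M) →₀ R) →ₗ[R] (C(Dl n, M) →₀ R)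
  | 0 => 0
  | n + 1 => (Sing M).bd R (n + 1)

/-- Singular homology. -/
abbrev HS (n : ℕ) : Type := HQ (dS R M n) (dS R M (n + 1))
/-- Class of a cycle. -/
noncomputable abbrev clS (n : ℕ) : ker (dS R M n) →ₗ[R] HS R M n := mkQ _
variable {R M}
lemma clS_zero {n : ℕ} (x : ker (dS R M n)) : clS R M n x = 0 ↔ ∃ y, (Sing M).bd R (n + 1) y = x := by
  rw [clS, mkQ_apply, Submodule.Quotient.mk_eq_zero]
  exact LinearMap.mem_range
lemma clS_eq {n : ℕ} (x x' : ker (dS R M n)) :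
  clS R M n x = clS R M n x' ↔ ∃ y, (Sing M).bd R (n + 1) y = x - x' := by
  rw [← sub_eq_zero, ← map_sub, clS_zero]; rfl
lemma dS_dS (n : ℕ) (c : C(Dl (n + 2), M) →₀ R) : dS R M n ((Sing M).bd R (n + 1) c) = 0 := by
  cases n with
  | zero => rfl
  | succ n => exact Sim.bd_bd (X := (Sing M).toSim) _ _
lemma dS_z {V : ℕ → Type} [∀ n, AddCommGroup (V n)] [∀ n, Module R (V n)] (h : ∀ n, (C(Dl n, M) →₀ R) →ₗ[R] V n) (h0 : h 0 = 0)
  {n : ℕ} {c : C(Dl (n + 1), M) →₀ R} (hc : dS R M n c = 0) : h n ((Sing M).bd R n c) = 0 := by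
  cases n with
  | zero => rw [h0]; rfl
  | succ n => exact (congrArg (h (n + 1)) hc).trans (map_zero _)

lemma supp_eq {α V : Type} [AddCommGroup V] [Module R V] {S : Set α} {A B : (α →₀ R) →ₗ[R] V}
  (h : ∀ x ∈ S, A (single x 1) = B (single x 1)) {c : α →₀ R} (hc : c ∈ supported R R S) : A c = B c := by
  rw [Finsupp.supported_eq_span_single] at hc
  refine LinearMap.eqOn_span (f := A) (g := B) ?_ hc
  rintro _ ⟨x, hx, rfl⟩
  exact h x hx

lemma dmap_vtx {m n : ℕ} (f : Fin m → Fin n) (i : Fin m) : dmap f (vtx m i) = vtx n (f i) := by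
  apply stdSimplex.ext; funext j
  change stdSimplex.map f (vtx m i) j = (Pi.single (f i) 1 : Fin n → ℝ) j
  rw [Dl_map]
  change ∑ k ∈ _, (Pi.single i 1 : Fin m → ℝ) k = _
  simp [Pi.single_apply, eq_comm]

variable (R M) in
/-- Vertices, moved by a map. -/
noncomputable def vert (ρ : M → M) (n : ℕ) : (C(Dl n, M) →₀ R) →ₗ[R] ((Fin n → M) →₀ R) :=
  lmapDomain R R fun σ i => ρ (σ (vtx n i))
lemma vert_bd (ρ : M → M) (n : ℕ) (c : C(Dl (n + 1), M) →₀ R) :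
  (Rips M).bd R n (vert R M ρ (n + 1) c) = vert R M ρ n ((Sing M).bd R n c) :=
  Sim.nat_bd (X := (Sing M).toSim) (Y := (Rips M).toSim) (fun n σ i => ρ (σ (vtx n i))) (fun n σ i => by
    funext j
    exact congrArg (fun y => ρ (σ y)) (dmap_vtx _ _).symm) c
lemma vert_single (ρ : M → M) (n : ℕ) (σ : C(Dl n, M)) :
  vert R M ρ n (single σ 1) = single (fun i => ρ (σ (vtx n i))) 1 := mapDomain_single

instance Dl0 : IsEmpty (Dl 0) := ⟨fun x => by have := x.2.2; simp at this⟩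
end HSdef

section fin
variable {R : Type} [CommRing R] {M : Type} [MetricSpace M] [CompactSpace M]

/-- Filling tuples by singular simplices. -/
lemma theta {r : ℕ} (hLE : LE M r) (N : ℕ) {ε : ℝ} (hε : 0 < ε) : ∃ δ > 0, ∃ θ : ∀ n, ((Fin n → M) →₀ R) →ₗ[R] (C(Dl n, M) →₀ R),
  (∀ ρ, θ 0 ∘ₗ vert R M ρ 0 = LinearMap.id) ∧ (vert R M id 0 ∘ₗ θ 0 = LinearMap.id) ∧
  ∀ n ≤ N, ∀ x ∈ (Rips M).sm δ (n + 1),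
  θ (n + 1) (single x 1) ∈ (Sing M).Car R (thickening ε (Set.range x)) (n + 1) ∧
  (Sing M).bd R n (θ (n + 1) (single x 1)) = θ n ((Rips M).bd R n (single x 1)) := by
  let em : C(Dl 0, M) := ⟨fun x => (Dl0.false x).elim, continuous_of_const fun x => (Dl0.false x).elim⟩
  have sub : ∀ a b : C(Dl 0, M), a = b := fun a b => ContinuousMap.ext fun x => (Dl0.false x).elim
  obtain ⟨δ, hδ, θ, h0, -, h⟩ := SimM.AC1 (R := R) (X := Rips M) (Y := Sing M) (Sing_LA hLE)
    (lmapDomain R R fun _ => em) (fun v => ContinuousMap.const _ (v 0))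
    (by rintro v _ ⟨y, rfl⟩; exact ⟨0, rfl⟩) (fun v => by
      rw [Sim.bd_single, Sim.bd_single, map_sum]
      refine sum_congr rfl fun i _ => ?_
      rw [lmapDomain_apply, mapDomain_single]
      exact congrArg (fun w => single w _) (sub _ _)) N hε
  refine ⟨δ, hδ, θ, fun ρ => ?_, ?_, h⟩
  · rw [h0]
    refine lhom_ext' fun v => ext_ring ?_
    simp only [LinearMap.comp_apply, lsingle_apply, vert_single, LinearMap.id_apply]
    exact mapDomain_single.trans (congrArg (fun w => single w _) (sub _ _))
  · rw [h0]
    refine lhom_ext' fun v => ext_ring ?_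
    refine (congrArg (vert R M id 0) mapDomain_single).trans ?_
    exact (vert_single _ _ _).trans (congrArg (fun w => single w _) (Subsingleton.elim _ _))

lemma HT {r : ℕ} (hLE : LE M r) (n : ℕ) : ∃ δ > 0, ∃ θ : ∀ n, ((Fin n → M) →₀ R) →ₗ[R] (C(Dl n, M) →₀ R),
  (∀ x ∈ (Rips M).sm δ (n + 2),
  (Sing M).bd R (n + 1) (θ (n + 2) (single x 1)) = θ (n + 1) ((Rips M).bd R (n + 1) (single x 1))) ∧
  ∀ ρ : M → M, (∀ x, dist (ρ x) x < δ) → ∀ c ∈ supported R R ((Sing M).sm δ (n + 1)), dS R M n c = 0 →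
  ∃ w, (Sing M).bd R (n + 1) w = θ (n + 1) (vert R M ρ (n + 1) c) - c := by
  obtain ⟨η, hη, H⟩ := SimM.AC2 (R := R) (X := Sing M) (Y := Sing M) (Sing_LA hLE) (n + 1) one_pos
  obtain ⟨δ, hδ, θ, h0, -, h⟩ := theta (R := R) hLE (n + 1) (half_pos hη)
  have hδ4 : 0 < min (δ / 4) (η / 4) := lt_min (by linarith) (by linarith)
  set δ' := min (δ / 4) (η / 4)
  have d1 : δ' ≤ δ / 4 := min_le_left _ _
  have d2 : δ' ≤ η / 4 := min_le_right _ _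
  refine ⟨δ', hδ4, θ, fun x hx => (h (n + 1) le_rfl x (SimM.sm_mono (by linarith) hx)).2, fun ρ hρ c hc hz => ?_⟩
  have hv : ∀ m, ∀ σ ∈ (Sing M).sm δ' m, (fun i => ρ (σ (vtx m i))) ∈ (Rips M).sm δ m := by
    rintro m σ hσ _ ⟨i, rfl⟩ _ ⟨j, rfl⟩
    have a1 := hρ (σ (vtx m i))
    have a2 := hρ (σ (vtx m j))
    have a3 : dist (σ (vtx m i)) (σ (vtx m j)) < δ' := hσ _ ⟨_, rfl⟩ _ ⟨_, rfl⟩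
    rw [dist_comm] at a2
    have := dist_triangle4 (ρ (σ (vtx m i))) (σ (vtx m i)) (σ (vtx m j)) (ρ (σ (vtx m j)))
    change dist (ρ (σ (vtx m i))) (ρ (σ (vtx m j))) < δ
    linarith
  obtain ⟨k, k0, hk⟩ := H (fun m => θ m ∘ₗ vert R M ρ m - LinearMap.id) δ' (by linarith) (by
      refine LinearMap.ext fun c => ?_
      exact sub_eq_zero.2 (LinearMap.congr_fun (h0 ρ) c))
    (fun m hm σ hσ => by
      refine Submodule.sub_mem _ ?_ (SimM.single_Car (Metric.self_subset_thickening hη _) 1)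
      rw [LinearMap.comp_apply, vert_single]
      refine SimM.Car_mono ?_ _ (h m hm _ (hv _ σ hσ)).1
      intro y hy
      obtain ⟨_, ⟨i, rfl⟩, hd⟩ := mem_thickening_iff.1 hy
      refine mem_thickening_iff.2 ⟨_, ⟨vtx (m + 1) i, rfl⟩, ?_⟩
      have := dist_triangle y (ρ (σ (vtx (m + 1) i))) (σ (vtx (m + 1) i))
      have := hρ (σ (vtx (m + 1) i))
      linarith)
    (fun m hm σ hσ => by
      have e := (h m hm _ (hv _ σ hσ)).2
      simp only [LinearMap.sub_apply, LinearMap.comp_apply, map_sub, vert_single, LinearMap.id_apply]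
      rw [e, ← vert_single (R := R) ρ, vert_bd])
  refine ⟨k (n + 1) c, ?_⟩
  have e := supp_eq (A := (Sing M).bd R (n + 1) ∘ₗ k (n + 1))
    (B := θ (n + 1) ∘ₗ vert R M ρ (n + 1) - LinearMap.id - k n ∘ₗ (Sing M).bd R n) (fun σ hσ => (hk n (by omega) σ hσ).2) hc
  refine e.trans ?_
  have := dS_z k k0 hz
  simp only [LinearMap.sub_apply, LinearMap.comp_apply, LinearMap.id_apply]
  rw [this, sub_zero]

lemma cls_small {n : ℕ} (c : ker (dS R M n)) {ε : ℝ} (hε : 0 < ε) :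
  ∃ c' : ker (dS R M n), clS R M n c' = clS R M n c ∧ c'.1 ∈ supported R R ((Sing M).sm ε (n + 1)) := by
  obtain ⟨S, T, h0, hT, hS, -, hs⟩ := SS hε n c.1
  have e := hT n c.1
  rw [dS_z T h0 c.2, add_zero] at e
  refine ⟨⟨S (n + 1) c.1, ?_⟩, ((clS_eq _ _).2 ⟨_, e⟩).symm, hs⟩
  rw [mem_ker, ← sub_sub_self c.1 (S (n + 1) c.1), ← e, map_sub, dS_dS, sub_zero]
  exact c.2

theorem HS_fin [IsNoetherianRing R] {r : ℕ} (hLE : LE M r) (n : ℕ) : Module.Finite R (HS R M n) := by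
  obtain ⟨δ, hδ, θ, -, hθ⟩ := HT (R := R) hLE n
  obtain ⟨P, -, hP, hcov⟩ := (isCompact_univ (X := M)).finite_cover_balls hδ
  have hr : ∀ x : M, ∃ y ∈ P, dist y x < δ := fun x => by
    obtain ⟨y, hy, h⟩ := Set.mem_iUnion₂.1 (hcov (Set.mem_univ x))
    exact ⟨y, hy, by rw [dist_comm]; exact h⟩
  choose ρ hρ1 hρ2 using hr
  have hfin : Finite {v : Fin (n + 1) → M | ∀ i, v i ∈ P} := by
    have := (Set.Finite.pi (ι := Fin (n + 1)) (t := fun _ => P) fun _ => hP)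
    refine (this.subset fun v hv => ?_).to_subtype
    exact fun i _ => hv i
  have hN' : IsNoetherian R ({v : Fin (n + 1) → M | ∀ i, v i ∈ P} →₀ R) := isNoetherian_of_isNoetherianRing_of_finite R _
  have hN : IsNoetherian R (supported R R {v : Fin (n + 1) → M | ∀ i, v i ∈ P}) :=
    isNoetherian_of_linearEquiv (Finsupp.supportedEquivFinsupp _).symm
  have hv : ∀ c : C(Dl (n + 1), M) →₀ R, vert R M ρ (n + 1) c ∈ supported R R {v : Fin (n + 1) → M | ∀ i, v i ∈ P} :=
    fun c => supp_mapD (R := R) (S := (univ : Set C(Dl (n + 1), M))) (T := {v : Fin (n + 1) → M | ∀ i, v i ∈ P})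
      (f := fun (σ : C(Dl (n + 1), M)) i => ρ (σ (vtx (n + 1) i))) (fun σ _ i => hρ1 _) (by simp)
  let D : Submodule R ((Fin (n + 1) → M) →₀ R) :=
    supported R R {v | ∀ i, v i ∈ P} ⊓ ker (dS R M n ∘ₗ θ (n + 1))
  have hD : IsNoetherian R D := isNoetherian_of_le inf_le_left
  let Q : D →ₗ[R] HS R M n := clS R M n ∘ₗ (θ (n + 1)).restrict (p := D) (q := ker (dS R M n)) fun x hx => hx.2
  refine Module.Finite.of_surjective Q fun x => ?_
  obtain ⟨c, rfl⟩ := mkQ_surjective _ x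
  obtain ⟨c', hc', hs⟩ := cls_small c hδ
  obtain ⟨w, hw⟩ := hθ ρ hρ2 c'.1 hs c'.2
  have hd : dS R M n (θ (n + 1) (vert R M ρ (n + 1) c'.1)) = 0 := by
    rw [← sub_add_cancel (θ (n + 1) (vert R M ρ (n + 1) c'.1)) c'.1, ← hw, map_add, dS_dS, zero_add]
    exact c'.2
  refine ⟨⟨vert R M ρ (n + 1) c'.1, ?_, hd⟩, ?_⟩
  · exact hv c'.1
  refine Eq.trans ?_ hc'
  exact (clS_eq _ _).2 ⟨w, hw⟩
end fin
end PG

namespace PG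

/-! ### Comparison of singular homology with the dual of germs -/

lemma rel_equiv {F A B : Type} [Field F] [AddCommGroup A] [Module F A] [AddCommGroup B] [Module F B] (ρ : Submodule F (A × B))
  (h1 : ∀ a, ∃ b, (a, b) ∈ ρ) (h2 : ∀ b, ∃ a, (a, b) ∈ ρ) (h3 : ∀ a, (a, 0) ∈ ρ → a = 0) (h4 : ∀ b, (0, b) ∈ ρ → b = 0) :
  Nonempty (A ≃ₗ[F] B) := by
  have e1 : Bijective (LinearMap.fst F A B ∘ₗ ρ.subtype) := by
    refine ⟨(injective_iff_map_eq_zero _).2 ?_, fun a => ?_⟩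
    · rintro ⟨⟨a, b⟩, h⟩ (h0 : a = 0)
      subst h0
      exact Subtype.ext (Prod.ext rfl (h4 b h))
    · obtain ⟨b, hb⟩ := h1 a
      exact ⟨⟨_, hb⟩, rfl⟩
  have e2 : Bijective (LinearMap.snd F A B ∘ₗ ρ.subtype) := by
    refine ⟨(injective_iff_map_eq_zero _).2 ?_, fun b => ?_⟩
    · rintro ⟨⟨a, b⟩, h⟩ (h0 : b = 0)
      subst h0
      exact Subtype.ext (Prod.ext (h3 a h) rfl)
    · obtain ⟨a, ha⟩ := h2 b
      exact ⟨⟨_, ha⟩, rfl⟩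
  exact ⟨(ofBijective _ e1).symm.trans (ofBijective _ e2)⟩

section dual
variable {F : Type} [Field F] {M : Type} [MetricSpace M] [CompactSpace M]

lemma mem_Wn {i n : ℕ} {v : Germ F (pow (univ : Set M))} : v ∈ (E F (pow (univ : Set M)) (ATow.nul M).tow).W i n ↔
  ∃ f ∈ Len M F n, f [] = 0 ∧ gm F (pow univ) f = v := by
  rw [mem_W]
  refine exists_congr fun f => and_congr_right fun hf => and_congr_left fun _ => ?_
  constructor
  · rintro ⟨ε, hε, h⟩
    exact h [] (Fam.nil _) (by simp [mem_Sm])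
  · intro h
    refine N_of_zero fun l hl => ?_
    have hl' : ∀ x ∈ l, x ∈ (∅ : Set M) := hl.2
    have : l = [] := List.eq_nil_iff_forall_not_mem.2 fun x hx => hl' x hx
    rw [this, h]

/-- Abstract duality. -/
lemma duality {H : Type} [AddCommGroup H] [Module F H] [Module.Finite F H] (n : ℕ)
  (rel : Submodule F ((List M → F) × Dual F H))
  (h0 : ∀ q ∈ rel, q.1 ∈ Len M F (n + 1) ∧ cob q.1 ∈ N F (pow (univ : Set M)))
  (h1 : ∀ f ∈ Len M F (n + 1), cob f ∈ N F (pow (univ : Set M)) → ∃ ψ, (f, ψ) ∈ rel)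
  (h2 : ∀ ψ, ∃ f, (f, ψ) ∈ rel)
  (h3 : ∀ f, (f, 0) ∈ rel → ∃ g ∈ Len M F n, g [] = 0 ∧ f - cob g ∈ N F (pow (univ : Set M)))
  (h4 : ∀ g ∈ Len M F n, g [] = 0 → (cob g, 0) ∈ rel)
  (h5 : ∀ q ∈ rel, q.1 ∈ N F (pow (univ : Set M)) → q.2 = 0) :
  Nonempty (H ≃ₗ[F] (E F (pow (univ : Set M)) (ATow.nul M).tow).L.H n) := by
  set A := E F (pow (univ : Set M)) (ATow.nul M).tow with hA
  let t1 : ((List M → F) × Dual F H) →ₗ[F] Germ F (pow (univ : Set M)) := gm F (pow univ) ∘ₗ LinearMap.fst F _ _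
  have hker : ∀ φ : Dual F (Germ F (pow (univ : Set M))), A.cl (n + 1) φ ∈ ker (A.L.d n) ↔
      ∀ g ∈ Len M F n, g [] = 0 → φ (gm F (pow univ) (cob g)) = 0 := by
    intro φ
    rw [mem_ker, FC.d_cl, FC.cl_zero]
    constructor
    · rintro ⟨i, hi⟩ g hg hg0
      exact hi _ (mem_Wn.2 ⟨g, hg, hg0, rfl⟩)
    · intro h
      refine ⟨0, fun v hv => ?_⟩
      obtain ⟨g, hg, hg0, rfl⟩ := mem_Wn.1 hv
      exact h g hg hg0
  let ρ : Submodule F (H × A.L.H n) :=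
    { carrier := {q | ∃ z : ker (A.L.d n), ∃ φ, A.cl (n + 1) φ = z.1 ∧ A.L.cls n z = q.2 ∧
        ∀ u ∈ rel, φ (gm F (pow univ) u.1) = u.2 q.1}
      add_mem' := by
        rintro _ _ ⟨z, φ, e, e1, e2⟩ ⟨z', φ', e', e1', e2'⟩
        refine ⟨z + z', φ + φ', by rw [map_add, e, e']; rfl, by rw [map_add, e1, e1']; rfl, fun u hu => ?_⟩
        rw [LinearMap.add_apply, e2 u hu, e2' u hu]; exact (map_add _ _ _).symm
      zero_mem' := ⟨0, 0, by simp, by simp, by simp⟩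
      smul_mem' := by
        rintro c _ ⟨z, φ, e, e1, e2⟩
        refine ⟨c • z, c • φ, by rw [map_smul, e]; rfl, by rw [map_smul, e1]; rfl, fun u hu => ?_⟩
        rw [LinearMap.smul_apply, e2 u hu]; exact (map_smul _ _ _).symm }
  refine rel_equiv ρ (fun x => ?_) (fun y => ?_) (fun x hx => ?_) (fun y hy => ?_)
  · obtain ⟨φ, hφ⟩ := dual_ext t1 rel (Dual.eval F H x ∘ₗ LinearMap.snd F _ _) (fun q hq h => by
      have : q.2 = 0 := h5 q hq (gm_eq_zero.1 h)
      change q.2 x = 0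
      rw [this]; rfl)
    have hk : A.cl (n + 1) φ ∈ ker (A.L.d n) := (hker φ).2 fun g hg hg0 => hφ _ (h4 g hg hg0)
    exact ⟨A.L.cls n ⟨_, hk⟩, ⟨_, hk⟩, φ, rfl, rfl, fun u hu => hφ u hu⟩
  · obtain ⟨⟨z, hz⟩, rfl⟩ := A.L.cls_surj n y
    obtain ⟨φ, rfl⟩ := A.cl_surj (n + 1) z
    obtain ⟨Ξ, hΞ⟩ := dual_ext (LinearMap.snd F (List M → F) (Dual F H)) rel (φ ∘ₗ t1) (by
      rintro ⟨f, ψ⟩ hq (rfl : ψ = 0)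
      obtain ⟨g, hg, hg0, h⟩ := h3 f hq
      exact (congrArg φ (gm_eq.2 h)).trans ((hker φ).1 hz g hg hg0))
    obtain ⟨x, rfl⟩ := (Module.evalEquiv F H).surjective Ξ
    exact ⟨x, ⟨_, hz⟩, φ, rfl, rfl, fun u hu => (hΞ u hu).symm⟩
  · obtain ⟨z, φ, e, e1, e2⟩ := hx
    obtain ⟨w, hw⟩ := (Cx.cls_zero z).1 e1
    obtain ⟨φ', rfl⟩ := A.cl_surj (n + 2) w
    rw [FC.d_cl, ← e, FC.cl_eq] at hw
    obtain ⟨i, hi⟩ := hw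
    refine (Module.forall_dual_apply_eq_zero_iff F x).1 fun ψ => ?_
    obtain ⟨f, hf⟩ := h2 ψ
    rw [← e2 _ hf, ← hi _ (mem_Wn.2 ⟨f, (h0 _ hf).1, (h0 _ hf).1 [] (by simp), rfl⟩)]
    exact (congrArg φ' (gm_eq_zero.2 (h0 _ hf).2)).trans (map_zero _)
  · obtain ⟨z, φ, e, e1, e2⟩ := hy
    rw [← show A.L.cls n z = y from e1, Cx.cls_zero]
    obtain ⟨φ', hφ'⟩ := dual_ext A.d (A.W 0 (n + 1)) φ (fun v hv hd => by
      obtain ⟨f, hf, -, rfl⟩ := mem_Wn.1 hv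
      obtain ⟨ψ, hψ⟩ := h1 f hf (gm_eq_zero.1 hd)
      exact (e2 _ hψ).trans (map_zero ψ))
    exact ⟨A.cl (n + 2) φ', by rw [FC.d_cl, ← e, FC.cl_eq]; exact ⟨0, hφ'⟩⟩
end dual

section ev
variable {R : Type} [CommRing R] {M : Type}
/-- Evaluation of list cochains on tuple chains. -/
noncomputable def ev (f : List M → R) (n : ℕ) : ((Fin n → M) →₀ R) →ₗ[R] R := linearCombination R fun v => f (ofFn v)
lemma ev_single (f : List M → R) {n : ℕ} (v : Fin n → M) : ev f n (single v 1) = f (ofFn v) := by simp [ev]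

lemma cob_ofFn {n : ℕ} : ∀ (f : List M → R) (v : Fin (n + 1) → M),
  cob f (ofFn v) = ∑ i : Fin (n + 1), (-1 : R) ^ (i : ℕ) * f (ofFn (v ∘ i.succAbove)) := by
  induction n with
  | zero =>
    intro f v
    rw [Fin.sum_univ_one, List.ofFn_succ]
    simp [cob]
  | succ n ih =>
    intro f v
    rw [List.ofFn_succ, cob, ih (fun m => f (v 0 :: m)), Fin.sum_univ_succ (n := n + 1), sub_eq_add_neg, ← Finset.sum_neg_distrib]
    refine congrArg₂ _ ?_ (sum_congr rfl fun i _ => ?_)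
    · simp
    · have e : ofFn (v ∘ i.succ.succAbove) = v 0 :: ofFn ((fun i => v (Fin.succ i)) ∘ i.succAbove) := by
        rw [List.ofFn_succ]; simp [comp_def]
      rw [e, Fin.val_succ, pow_succ]; ring

lemma ev_cob (f : List M → R) (n : ℕ) (c : (Fin (n + 1) → M) →₀ R) : ev (cob f) (n + 1) c = ev f n ((Rips M).bd R n c) := by
  suffices h : ev (cob f) (n + 1) = ev f n ∘ₗ (Rips M).bd R n from LinearMap.congr_fun h c
  refine lhom_ext' fun v => ext_ring ?_
  rw [LinearMap.comp_apply, LinearMap.comp_apply, lsingle_apply]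
  refine Eq.trans ?_ (congrArg (ev f n) (Sim.bd_single (X := (Rips M).toSim) v)).symm
  rw [ev_single, cob_ofFn, map_sum]
  refine sum_congr rfl fun i _ => ?_
  simp [ev]

/-- The list cochain of a functional. -/
lemma ev_exists {n : ℕ} (G : ((Fin n → M) →₀ R) →ₗ[R] R) : ∃ f ∈ Len M R n, ev f n = G := by
  let f : List M → R := fun l => if h : l.length = n then G (single (fun i => l.get (i.cast h.symm)) 1) else 0
  refine ⟨f, fun l hl => dif_neg hl, ?_⟩
  refine lhom_ext' fun v => ext_ring ?_
  refine (ev_single f v).trans ((dif_pos (List.length_ofFn)).trans ?_)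
  refine congrArg G (congrArg (fun w => single w (1 : R)) ?_)
  funext i
  simp

lemma len_ext {n : ℕ} {f : List M → R} (hf : f ∈ Len M R n) {P : List M → Prop} (h : ∀ v : Fin n → M, P (ofFn v) → f (ofFn v) = 0) :
  ∀ l, P l → f l = 0 := by
  intro l hl
  by_cases e : l.length = n
  · subst e
    have := List.ofFn_get l
    rw [← this] at hl ⊢
    exact h _ hl
  · exact hf l e

variable [MetricSpace M]
lemma ofFn_Sm {ε : ℝ} {n : ℕ} {v : Fin n → M} : ofFn v ∈ Sm ε ↔ v ∈ (Rips M).sm ε n := by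
  rw [mem_Sm]
  simp only [List.mem_ofFn]
  exact Iff.rfl
lemma ev_N {f : List M → R} {ε : ℝ} (h : ∀ l ∈ pow (univ : Set M), l ∈ Sm ε → f l = 0) {n : ℕ} {c : (Fin n → M) →₀ R}
  (hc : c ∈ supported R R ((Rips M).sm ε n)) : ev f n c = 0 :=
  supp_eq (A := ev f n) (B := 0) (fun v hv => (ev_single f v).trans (h _ (fun _ _ => trivial) (ofFn_Sm.2 hv))) hc
lemma vert_sm {ε : ℝ} {n : ℕ} {c : C(Dl n, M) →₀ R} (hc : c ∈ supported R R ((Sing M).sm ε n)) :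
  vert R M id n c ∈ supported R R ((Rips M).sm ε n) :=
  supp_map (fun σ hσ => by
    rw [vert_single]
    refine single_mem_supported R _ ?_
    rintro _ ⟨i, rfl⟩ _ ⟨j, rfl⟩
    exact hσ _ ⟨_, rfl⟩ _ ⟨_, rfl⟩) hc
end ev
end PG

namespace PG

/-! ### Singular homology over a field is the germ homology -/
lemma Car_sm {R M : Type} [CommRing R] [MetricSpace M] {Y : SimM M} {S : Set M} {δ η ε : ℝ} (hS : ∀ a ∈ S, ∀ b ∈ S, dist a b < δ) (h : 2 * η + δ ≤ ε)
  {n : ℕ} : Y.Car R (thickening η S) n ≤ supported R R (Y.sm ε n) :=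
  supported_mono fun y hy a ha b hb => by
    obtain ⟨a', ha', h1⟩ := mem_thickening_iff.1 (hy ha)
    obtain ⟨b', hb', h2⟩ := mem_thickening_iff.1 (hy hb)
    have := hS a' ha' b' hb'
    have := dist_triangle4 a a' b' b
    rw [dist_comm] at h2
    linarith

section main
variable {F : Type} [Field F] {M : Type} [MetricSpace M] [CompactSpace M]

variable (F M) in
/-- Cochains representing functionals. -/
def relS (n : ℕ) : Submodule F ((List M → F) × Dual F (HS F M n)) where
  carrier := {q | q.1 ∈ Len M F (n + 1) ∧ cob q.1 ∈ N F (pow (univ : Set M)) ∧ ∃ ε > 0, ∀ c : ker (dS F M n),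
    c.1 ∈ supported F F ((Sing M).sm ε (n + 1)) → ev q.1 (n + 1) (vert F M id (n + 1) c.1) = q.2 (clS F M n c)}
  add_mem' := by
    rintro ⟨f, ψ⟩ ⟨f', ψ'⟩ ⟨h1, h2, ε, hε, h3⟩ ⟨h1', h2', ε', hε', h3'⟩
    refine ⟨Submodule.add_mem _ h1 h1', ?_, min ε ε', lt_min hε hε', fun c hc => ?_⟩
    · have := Submodule.add_mem _ h2 h2'
      rwa [← cob_add] at this
    · have e : ev (f + f') (n + 1) = ev f (n + 1) + ev f' (n + 1) := by
        refine lhom_ext' fun v => ext_ring ?_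
        exact (ev_single (f + f') v).trans (congrArg₂ (· + ·) (ev_single f v) (ev_single f' v)).symm
      change ev (f + f') (n + 1) _ = ψ _ + ψ' _
      rw [e, LinearMap.add_apply]
      exact congrArg₂ (· + ·) (h3 c (supported_mono (SimM.sm_mono (min_le_left _ _)) hc))
        (h3' c (supported_mono (SimM.sm_mono (min_le_right _ _)) hc))
  zero_mem' := by
    refine ⟨Submodule.zero_mem _, ?_, 1, one_pos, fun c _ => ?_⟩
    · have := Submodule.zero_mem (N F (pow (univ : Set M)))
      rwa [← cob_zero] at this
    · have e : ev (0 : List M → F) (n + 1) = 0 := by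
        refine lhom_ext' fun v => ext_ring ?_
        exact ev_single 0 v
      exact LinearMap.congr_fun e _
  smul_mem' := by
    rintro a ⟨f, ψ⟩ ⟨h1, h2, ε, hε, h3⟩
    refine ⟨smul_mem _ _ h1, ?_, ε, hε, fun c hc => ?_⟩
    · have := smul_mem _ a h2
      rwa [show a • cob f = cob (a • f) from ((cobL M F).map_smul a f).symm] at this
    · have e : ev (a • f) (n + 1) = a • ev f (n + 1) := by
        refine lhom_ext' fun v => ext_ring ?_
        exact (ev_single (a • f) v).trans (congrArg (a • ·) (ev_single f v)).symm
      change ev (a • f) (n + 1) _ = a • ψ _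
      rw [e, LinearMap.smul_apply]
      exact congrArg (a • ·) (h3 c hc)

lemma relS_3 {r : ℕ} (hLE : LE M r) (n : ℕ) (f : List M → F) (hf : (f, 0) ∈ relS F M n) :
  ∃ g ∈ Len M F n, g [] = 0 ∧ f - cob g ∈ N F (pow (univ : Set M)) := by
  obtain ⟨h1, ⟨ε₁, hε₁, h2⟩, ε₂, hε₂, h3⟩ := hf
  change f ∈ _ at h1
  cases n with
  | zero =>
    refine ⟨0, Submodule.zero_mem _, rfl, N_of_zero ?_⟩
    rw [cob_zero, sub_zero]
    refine fun l _ => len_ext h1 (P := fun _ => True) (fun v _ => ?_) l trivial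
    have := h3 ⟨single (ContinuousMap.const _ (v 0)) 1, rfl⟩ (single_mem_supported F _ (by
      rintro _ ⟨a, rfl⟩ _ ⟨b, rfl⟩
      simpa using hε₂))
    change ev f 1 (vert F M id 1 (single (ContinuousMap.const _ (v 0)) 1)) = 0 at this
    rw [vert_single] at this
    rw [← ev_single (R := F) f v, ← this]
    refine congrArg (fun w => ev f 1 (single w 1)) ?_
    funext i
    exact congrArg v (Subsingleton.elim (α := Fin 1) i 0)
  | succ m =>
    set ε := min ε₁ ε₂
    have hε : 0 < ε := lt_min hε₁ hε₂
    obtain ⟨δ₁, hδ₁, H⟩ := SimM.AC2 (R := F) (X := Rips M) (Y := Rips M) Rips_LA (m + 1) (show 0 < ε / 4 by linarith)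
    obtain ⟨δ₂, hδ₂, θ, -, h0, hθ⟩ := theta (R := F) hLE (m + 1) (show 0 < min (ε / 4) δ₁ from lt_min (by linarith) hδ₁)
    set η := min (ε / 4) δ₁
    have e1 : η ≤ ε / 4 := min_le_left _ _
    have e2 : η ≤ δ₁ := min_le_right _ _
    set δ := min (min δ₁ δ₂) (ε / 4)
    have hδ : 0 < δ := lt_min (lt_min hδ₁ hδ₂) (by linarith)
    have e3 : δ ≤ δ₁ := (min_le_left _ _).trans (min_le_left _ _)
    have e4 : δ ≤ δ₂ := (min_le_left _ _).trans (min_le_right _ _)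
    have e5 : δ ≤ ε / 4 := min_le_right _ _
    obtain ⟨k, -, hk⟩ := H (fun n => LinearMap.id - vert F M id n ∘ₗ θ n) δ e3 (by
        exact sub_eq_zero.2 h0.symm)
      (fun n hn x hx => by
        refine Submodule.sub_mem _ (SimM.single_Car (Metric.self_subset_thickening hδ₁ _) 1) ?_
        refine supp_map (C := vert F M id (n + 1)) (S := {σ : C(Dl (n + 1), M) | Set.range σ ⊆ thickening η (Set.range x)}) (fun σ hσ => ?_)
          (hθ n hn x (SimM.sm_mono e4 hx)).1
        have hσ' : Set.range σ ⊆ thickening η (Set.range x) := hσ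
        rw [vert_single]
        refine SimM.single_Car ?_ 1
        rintro _ ⟨i, rfl⟩
        exact thickening_mono e2 _ (hσ' ⟨_, rfl⟩))
      (fun n hn x hx => by
        simp only [LinearMap.sub_apply, LinearMap.comp_apply, LinearMap.id_apply, map_sub]
        rw [vert_bd, (hθ n hn x (SimM.sm_mono e4 hx)).2])
    obtain ⟨ψ, hψ⟩ := dual_ext ((Rips M).bd F (m + 1)) (supported F F ((Rips M).sm δ (m + 2))) (ev f (m + 2)) (fun v hv hz => by
      have b1 := supp_eq (A := (Rips M).bd F (m + 2) ∘ₗ k (m + 2))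
        (B := (LinearMap.id - vert F M id (m + 2) ∘ₗ θ (m + 2)) - k (m + 1) ∘ₗ (Rips M).bd F (m + 1))
        (fun x hx => (hk (m + 1) le_rfl x hx).2) hv
      have b2 := supp_eq (A := (Sing M).bd F (m + 1) ∘ₗ θ (m + 2)) (B := θ (m + 1) ∘ₗ (Rips M).bd F (m + 1))
        (fun x hx => (hθ (m + 1) le_rfl x (SimM.sm_mono e4 hx)).2) hv
      simp only [LinearMap.sub_apply, LinearMap.comp_apply, LinearMap.id_apply, hz, map_zero, sub_zero] at b1 b2
      have b3 : v = vert F M id (m + 2) (θ (m + 2) v) + (Rips M).bd F (m + 2) (k (m + 2) v) := by rw [b1]; abel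
      have b4 : θ (m + 2) v ∈ supported F F ((Sing M).sm ε (m + 2)) := supp_map (fun x hx =>
        Car_sm (S := Set.range x) (δ := δ) hx (by linarith) (hθ (m + 1) le_rfl x (SimM.sm_mono e4 hx)).1) hv
      have b5 : k (m + 2) v ∈ supported F F ((Rips M).sm ε (m + 3)) := supp_map (fun x hx =>
        Car_sm (S := Set.range x) (δ := δ) hx (by linarith) (hk (m + 1) le_rfl x hx).1) hv
      have c1 : ev f (m + 2) (vert F M id (m + 2) (θ (m + 2) v)) = 0 :=
        h3 ⟨θ (m + 2) v, b2⟩ (supported_mono (SimM.sm_mono (min_le_right _ _)) b4)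
      have c2 : ev f (m + 2) ((Rips M).bd F (m + 2) (k (m + 2) v)) = 0 :=
        (ev_cob f (m + 2) _).symm.trans (ev_N h2 (supported_mono (SimM.sm_mono (min_le_left _ _)) b5))
      rw [b3, map_add, c1, c2, add_zero])
    obtain ⟨g, hg, hgψ⟩ := ev_exists ψ
    refine ⟨g, hg, hg [] (by simp), δ, hδ, fun l _ hl => ?_⟩
    refine len_ext (Submodule.sub_mem _ h1 (cob_len hg)) (P := fun l => l ∈ Sm δ) (fun v hv => ?_) l hl
    change f _ - cob g _ = 0
    rw [← ev_single (R := F) f, ← ev_single (R := F) (cob g), ev_cob, hgψ]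
    exact sub_eq_zero.2 (hψ _ (single_mem_supported F _ (ofFn_Sm.1 hv))).symm

theorem HS_equiv {r : ℕ} (hLE : LE M r) (n : ℕ) : Nonempty (HS F M n ≃ₗ[F] (E F (pow (univ : Set M)) (ATow.nul M).tow).L.H n) := by
  have := HS_fin (R := F) hLE n
  refine duality n (relS F M n) (fun q h => ⟨h.1, h.2.1⟩) ?_ ?_ (relS_3 hLE n) ?_ ?_
  · rintro f hf ⟨ε, hε, h⟩
    obtain ⟨ψ, hψ⟩ := dual_ext (F := F) (V := ker (dS F M n)) (V' := HS F M n) (clS F M n) ((supported F F ((Sing M).sm ε (n + 1))).comap (ker (dS F M n)).subtype)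
      (ev f (n + 1) ∘ₗ vert F M id (n + 1) ∘ₗ (ker (dS F M n)).subtype) (fun c hc hz => by
        obtain ⟨e, he⟩ := (clS_zero c).1 hz
        obtain ⟨S, T, h0, hT, hS, hs, hSe⟩ := SS hε (n + 1) e
        have e1 := hT n c.1
        rw [dS_z T h0 c.2, add_zero, ← he, ← hS, he] at e1
        have e2 : c.1 = (Sing M).bd F (n + 1) (T (n + 1) c.1 + S (n + 2) e) := by rw [map_add, e1]; abel
        change ev f (n + 1) (vert F M id (n + 1) c.1) = 0
        rw [e2, ← vert_bd, ← ev_cob]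
        exact ev_N h (vert_sm (Submodule.add_mem _ (hs _ _ _ hc) hSe)))
    exact ⟨ψ, hf, ⟨ε, hε, h⟩, ε, hε, fun c hc => (hψ c hc).symm⟩
  · intro ψ
    obtain ⟨δ, hδ, θ, t1, t2⟩ := HT (R := F) hLE n
    obtain ⟨Ψ, hΨ⟩ := dual_ext (F := F) (V := ker (dS F M n)) (V' := C(Dl (n + 1), M) →₀ F) (ker (dS F M n)).subtype ⊤ (ψ ∘ₗ clS F M n) (fun v _ hv => by
      rw [show v = 0 from Subtype.ext hv, map_zero])
    have hb : ∀ w, Ψ ((Sing M).bd F (n + 1) w) = 0 := fun w => by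
      refine (hΨ ⟨(Sing M).bd F (n + 1) w, dS_dS n w⟩ trivial).trans ?_
      rw [LinearMap.comp_apply, (clS_zero _).2 ⟨w, rfl⟩, map_zero]
    obtain ⟨f, hf, e⟩ := ev_exists (Ψ ∘ₗ θ (n + 1))
    refine ⟨f, hf, ⟨δ, hδ, fun l _ hl => len_ext (cob_len hf) (P := fun l => l ∈ Sm δ) (fun v hv => ?_) l hl⟩, δ, hδ, fun c hc => ?_⟩
    · rw [← ev_single (R := F) (cob f), ev_cob, e, LinearMap.comp_apply, ← t1 v (ofFn_Sm.1 hv), hb]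
    · obtain ⟨w, hw⟩ := t2 id (fun x => by simpa using hδ) c.1 hc c.2
      change ev f (n + 1) _ = ψ _
      rw [e, LinearMap.comp_apply, ← sub_add_cancel (θ (n + 1) (vert F M id (n + 1) c.1)) c.1, ← hw, map_add, hb, zero_add]
      exact hΨ c trivial
  · intro g hg hg0
    refine ⟨cob_len hg, N_of_zero fun l _ => ?_, 1, one_pos, fun c _ => ?_⟩
    · exact congrFun (cob_cob g) l
    · change ev (cob g) (n + 1) _ = 0
      rw [ev_cob, vert_bd]
      cases n with
      | zero =>
        have : g = 0 := by
          funext l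
          cases l with
          | nil => exact hg0
          | cons a l => exact hg _ (by simp)
        subst this
        have e : ev (0 : List M → F) 0 = 0 := by
          refine lhom_ext' fun v => ext_ring ?_
          exact ev_single 0 v
        exact LinearMap.congr_fun e _
      | succ n =>
        have : (Sing M).bd F (n + 1) c.1 = 0 := c.2
        rw [this, map_zero, map_zero]
  · rintro ⟨f, ψ⟩ ⟨h1, h2, ε, hε, h3⟩ ⟨ε', hε', h⟩
    refine LinearMap.ext fun x => ?_
    obtain ⟨c, rfl⟩ := mkQ_surjective _ x
    obtain ⟨c', hc', hs⟩ := cls_small c (lt_min hε hε')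
    refine (congrArg ψ hc').symm.trans ((h3 c' (supported_mono (SimM.sm_mono (min_le_left _ _)) hs)).symm.trans ?_)
    exact ev_N h (vert_sm (supported_mono (SimM.sm_mono (min_le_right _ _)) hs))
end main
end PG

namespace PG

/-! ### Universal coefficients by counting -/

/-- Multiplication by `p`. -/
abbrev mu (p : ℕ) (A : Type) [AddCommGroup A] : A →+ A := nsmulAddMonoidHom p

section fg
variable {p : ℕ} [hp : Fact p.Prime]

lemma red_ker {α : Type} {x : α →₀ ℤ} (h : mapRange.addMonoidHom (Int.castAddHom (ZMod p)) x = 0) : ∃ y, mu p (α →₀ ℤ) y = x := by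
  refine ⟨x.mapRange (fun k => k / p) (by simp), ?_⟩
  ext a
  have : ((x a : ℤ) : ZMod p) = 0 := DFunLike.congr_fun h a
  have := (ZMod.intCast_zmod_eq_zero_iff_dvd _ _).1 this
  simp [Int.mul_ediv_cancel' this]
lemma red_mu {α : Type} (y : α →₀ ℤ) : mapRange.addMonoidHom (Int.castAddHom (ZMod p)) (mu p (α →₀ ℤ) y) = 0 := by
  ext a
  simp
lemma red_surj {α : Type} : Surjective (mapRange.addMonoidHom (ι := α) (Int.castAddHom (ZMod p))) :=
  Finsupp.mapRange_surjective _ (map_zero _) (ZMod.intCast_surjective)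

lemma index_mu (A : Type) [AddCommGroup A] [Module.Finite ℤ A] :
  (mu p A).range.index = p ^ finrank ℤ A * Nat.card (mu p A).ker := by
  have : AddGroup.FG A := Module.Finite.iff_addGroup_fg.1 inferInstance
  obtain ⟨n, ι, _, q, hq, e, ⟨f⟩⟩ := AddCommGroup.equiv_free_prod_directSum_zmod A
  set T := DirectSum ι fun i => ZMod (q i ^ e i)
  have hT : Finite T := by
    have : ∀ i, NeZero (q i ^ e i) := fun i => ⟨pow_ne_zero _ (hq i).ne_zero⟩
    exact Finite.of_equiv _ (DirectSum.addEquivProd fun i => ZMod (q i ^ e i)).symm.toEquiv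
  have hr : finrank ℤ A = n := by
    let g : A →ₗ[ℤ] (Fin n →₀ ℤ) := ((AddMonoidHom.fst _ _).comp f.toAddMonoidHom).toIntLinearMap
    have hg : Surjective g := fun y => ⟨f.symm (y, 0), by simp [g]⟩
    have h1 := Submodule.finrank_quotient_add_finrank (ker g)
    rw [(g.quotKerEquivOfSurjective hg).finrank_eq] at h1
    have h2 : finrank ℤ (ker g) = 0 := by
      have : Finite (ker g) := by
        refine Finite.of_injective (fun x => (f x.1).2 : _ → T) fun x y h => Subtype.ext (f.injective (Prod.ext ?_ h))
        exact (show (f x.1).1 = 0 from x.2).trans (show (f y.1).1 = 0 from y.2).symm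
      refine Module.finrank_eq_zero_iff_isTorsion.2 fun x => ⟨⟨(Nat.card (ker g) : ℤ), ?_⟩, ?_⟩
      · rw [mem_nonZeroDivisors_iff_ne_zero]; exact_mod_cast Nat.card_pos.ne'
      · exact (Nat.cast_smul_eq_nsmul ℤ _ x).trans card_nsmul_eq_zero'
    rw [h2] at h1
    simpa using h1.symm
  rw [hr]
  have h1 : (mu p A).range = ((mu p (Fin n →₀ ℤ)).range.prod (mu p T).range).comap f.toAddMonoidHom := by
    ext x
    constructor
    · rintro ⟨y, rfl⟩
      exact ⟨⟨(f y).1, by simp⟩, ⟨(f y).2, by simp⟩⟩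
    · rintro ⟨⟨a, ha⟩, ⟨b, hb⟩⟩
      refine ⟨f.symm (a, b), f.injective ?_⟩
      have : f (mu p A (f.symm (a, b))) = p • (a, b) := by simp
      rw [this]
      exact Prod.ext ha hb
  have h2 : Nat.card (mu p A).ker = Nat.card (mu p T).ker := by
    refine Nat.card_congr ⟨fun x => ⟨(f x.1).2, ?_⟩, fun y => ⟨f.symm (0, y.1), ?_⟩, fun x => Subtype.ext ?_, fun y => Subtype.ext ?_⟩
    · have : p • x.1 = 0 := x.2
      change p • (f x.1).2 = 0
      rw [← Prod.smul_snd, ← map_nsmul, this, map_zero]; rfl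
    · have : p • y.1 = 0 := y.2
      change p • f.symm (0, y.1) = 0
      rw [← map_nsmul, Prod.smul_mk, this]; simp
    · have : p • x.1 = 0 := x.2
      have h : p • (f x.1).1 = 0 := by
        rw [← Prod.smul_fst, ← map_nsmul, this, map_zero]; rfl
      have h' : (f x.1).1 = 0 := (smul_eq_zero.1 h).resolve_left hp.out.ne_zero
      refine f.injective ?_
      rw [f.apply_symm_apply]
      exact Prod.ext h'.symm rfl
    · simp
  have h3 : (mu p (Fin n →₀ ℤ)).range.index = p ^ n := by
    have : (mu p (Fin n →₀ ℤ)).range = (mapRange.addMonoidHom (ι := Fin n) (Int.castAddHom (ZMod p))).ker := by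
      ext x
      exact ⟨by rintro ⟨y, rfl⟩; exact red_mu y, fun h => red_ker h⟩
    rw [this, AddSubgroup.index_ker, AddMonoidHom.range_eq_top.2 red_surj, AddSubgroup.card_top, Nat.card_congr Finsupp.equivFunOnFinite,
      Nat.card_fun]
    simp
  have : (mu p T).ker.FiniteIndex := inferInstance
  rw [h1, AddSubgroup.index_comap_of_surjective _ f.surjective, AddSubgroup.index_prod, h2, h3, AddSubgroup.index_range]
end fg

section uct
variable {p : ℕ} {X Y W : Type} [AddCommGroup X] [AddCommGroup Y] [AddCommGroup W]

/-- Size of the `p`-torsion of a cokernel. -/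
noncomputable def tor (p : ℕ) (d : Y →+ W) : ℕ := d.range.relIndex (d.range.comap (mu p W))

lemma count (e : X →ₗ[ℤ] Y) (d : Y →ₗ[ℤ] W) (h : ∀ x, d (e x) = 0) (hY : Injective (mu p Y)) (hW : Injective (mu p W)) :
  (e.toAddMonoidHom.range ⊔ (mu p Y).range).relIndex ((mu p W).range.comap d.toAddMonoidHom)
  = (mu p (HQ d e)).range.index * tor p d.toAddMonoidHom ∧ Nat.card (mu p (HQ d e)).ker = tor p e.toAddMonoidHom := by
  have le : ∀ x, x ∈ e.toAddMonoidHom.range → x ∈ d.toAddMonoidHom.ker := by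
    rintro _ ⟨x, rfl⟩; exact h x
  let q' : ker d →ₗ[ℤ] HQ d e := mkQ ((LinearMap.range e).submoduleOf (ker d))
  let q : d.toAddMonoidHom.ker →+ HQ d e := q'.toAddMonoidHom
  have hq' : Surjective q' := mkQ_surjective _
  have hq : Surjective q := hq'
  have q0 : ∀ z, q z = 0 ↔ z.1 ∈ e.toAddMonoidHom.range := fun z => by
    refine (Submodule.Quotient.mk_eq_zero (M := ker d) (x := z) _).trans ?_
    rfl
  constructor
  · have c1 : e.toAddMonoidHom.range ⊔ (mu p Y).range ≤ d.toAddMonoidHom.ker ⊔ (mu p Y).range := sup_le_sup_right le _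
    have c2 : d.toAddMonoidHom.ker ⊔ (mu p Y).range ≤ (mu p W).range.comap d.toAddMonoidHom := by
      refine sup_le (fun x hx => ?_) ?_
      · exact ⟨0, by rw [map_zero]; exact (show d x = 0 from hx).symm⟩
      · rintro _ ⟨y, rfl⟩
        exact ⟨d y, (map_nsmul d p y).symm⟩
    rw [← AddSubgroup.relIndex_mul_relIndex _ _ _ c1 c2]
    congr 1
    · have s : d.toAddMonoidHom.ker ⊔ (mu p Y).range = d.toAddMonoidHom.ker ⊔ (e.toAddMonoidHom.range ⊔ (mu p Y).range) := by
        rw [← sup_assoc, sup_eq_left.2 (show e.toAddMonoidHom.range ≤ d.toAddMonoidHom.ker from le)]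
      rw [s, AddSubgroup.relIndex_sup_right, ← AddSubgroup.index_comap_of_surjective _ hq]
      refine congrArg AddSubgroup.index ?_
      ext z
      constructor
      · intro hz
        have hz' : z.1 ∈ e.toAddMonoidHom.range ⊔ (mu p Y).range := hz
        obtain ⟨_, ⟨x, rfl⟩, _, ⟨y, rfl⟩, hxy⟩ := mem_sup.1 hz'
        have hz0 : d z.1 = 0 := z.2
        have hy : d y = 0 := by
          refine hW ?_
          rw [map_zero]
          have : d (e x + p • y) = 0 := (congrArg d hxy).trans hz0
          rw [map_add, h, zero_add, map_nsmul] at this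
          exact this
        refine ⟨q ⟨y, hy⟩, ?_⟩
        rw [← sub_eq_zero]
        change p • q _ - q z = 0
        rw [← map_nsmul, ← map_sub, q0]
        refine ⟨-x, ?_⟩
        rw [map_neg]
        change _ = p • y - z.1
        rw [← hxy]
        change _ = p • y - (_ + p • y)
        abel
      · rintro ⟨y, hy⟩
        obtain ⟨y, rfl⟩ := hq y
        have : q (z - p • y) = 0 := by rw [map_sub, map_nsmul, sub_eq_zero]; exact hy.symm
        rw [q0] at this
        refine mem_sup.2 ⟨_, this, p • y.1, ⟨y.1, rfl⟩, ?_⟩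
        change z.1 - p • y.1 + p • y.1 = z.1
        abel
    · rw [sup_comm, ← AddSubgroup.comap_map_eq, relIndex_comap, map_comap_eq, inf_comm, ← map_comap_eq,
        tor, ← AddSubgroup.relIndex_map_map_of_injective d.toAddMonoidHom.range (d.toAddMonoidHom.range.comap (mu p W)) hW]
      congr 1
      ext w
      constructor
      · rintro ⟨_, ⟨y, rfl⟩, rfl⟩
        exact ⟨d y, ⟨y, rfl⟩, (map_nsmul d p y).symm⟩
      · rintro ⟨_, ⟨y, rfl⟩, rfl⟩
        exact ⟨p • y, ⟨y, rfl⟩, map_nsmul d p y⟩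
  · have hle : e.toAddMonoidHom.range.comap (mu p Y) ≤ d.toAddMonoidHom.ker := by
      rintro y ⟨x, hx⟩
      refine hW ?_
      rw [map_zero]
      refine ((map_nsmul d p y).symm).trans ((congrArg d hx.symm).trans (h x))
    rw [tor, ← AddSubgroup.relIndex_addSubgroupOf hle, ← AddSubgroup.relIndex_bot_left, ← AddSubgroup.map_comap_eq_self_of_surjective hq (mu p (HQ d e)).ker,
      ← relIndex_comap]
    congr 1
    · ext z
      exact q0 z
    · ext z
      have : q z ∈ (mu p (HQ d e)).ker ↔ q (p • z) = 0 := by rw [map_nsmul]; rfl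
      exact this.trans (q0 _)
end uct

section appl
variable {p : ℕ} [hp : Fact p.Prime] {M : Type} [TopologicalSpace M]

lemma bd_map {R S : Type} [CommRing R] [CommRing S] (f : R →+* S) (Z : Sim) (n : ℕ) (c : Z.X (n + 1) →₀ R) :
  Z.bd S n (mapRange.addMonoidHom f.toAddMonoidHom c) = mapRange.addMonoidHom f.toAddMonoidHom (Z.bd R n c) := by
  suffices h : (Z.bd S n).toAddMonoidHom.comp (mapRange.addMonoidHom f.toAddMonoidHom) =
    (mapRange.addMonoidHom f.toAddMonoidHom).comp (Z.bd R n).toAddMonoidHom from DFunLike.congr_fun h c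
  have e : ∀ (T : Type) [CommRing T] (x : Z.X (n + 1)) (r : T), Z.bd T n (single x r)
      = ∑ j : Fin (n + 1), single (Z.act j.succAbove x) (r * (-1 : T) ^ (j : ℕ)) := by
    intro T _ x r
    simp [Sim.bd, Finset.smul_sum]
  refine Finsupp.addHom_ext fun x a => ?_
  simp only [AddMonoidHom.comp_apply, LinearMap.toAddMonoidHom_coe, mapRange.addMonoidHom_apply, mapRange_single, e]
  rw [← mapRange.addMonoidHom_apply, map_sum]
  refine sum_congr rfl fun i _ => ?_
  rw [mapRange.addMonoidHom_apply, mapRange_single]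
  exact congrArg _ (by simp)
lemma dS_map {R S : Type} [CommRing R] [CommRing S] (f : R →+* S) (n : ℕ) (c : C(Dl (n + 1), M) →₀ R) :
  dS S M n (mapRange.addMonoidHom f.toAddMonoidHom c) = mapRange.addMonoidHom f.toAddMonoidHom (dS R M n c) := by
  cases n with
  | zero => exact (map_zero _).symm
  | succ n => exact bd_map f (Sing M).toSim _ c

lemma mu_inj (α : Type) : Injective (mu p (α →₀ ℤ)) := fun x y h => by
  ext a
  have : p • x a = p • y a := DFunLike.congr_fun h a
  simpa [hp.out.ne_zero] using this

lemma card_HS (n : ℕ) : Nat.card (HS (ZMod p) M n) =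
  ((dS ℤ M (n + 1)).toAddMonoidHom.range ⊔ (mu p _).range).relIndex ((mu p _).range.comap (dS ℤ M n).toAddMonoidHom) := by
  let π := fun α : Type => mapRange.addMonoidHom (ι := α) (castRingHom (ZMod p)).toAddMonoidHom
  have hs : ∀ α, Surjective (π α) := fun α => red_surj
  have hπ : ∀ m c, dS (ZMod p) M m (π _ c) = π _ (dS ℤ M m c) := fun m c => dS_map (castRingHom (ZMod p)) m c
  have e : Nat.card (HS (ZMod p) M n) = (dS (ZMod p) M (n + 1)).toAddMonoidHom.range.relIndex (dS (ZMod p) M n).toAddMonoidHom.ker := rfl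
  rw [e, ← AddSubgroup.map_comap_eq_self_of_surjective (hs _) (dS (ZMod p) M n).toAddMonoidHom.ker, ← relIndex_comap]
  congr 1
  · ext z
    constructor
    · rintro ⟨x, hx⟩
      obtain ⟨x, rfl⟩ := hs _ x
      have h1 : π _ (dS ℤ M (n + 1) x) = π _ z := (hπ _ _).symm.trans hx
      obtain ⟨y, hy⟩ := red_ker (p := p) (x := z - dS ℤ M (n + 1) x) (by
        refine (map_sub (π _) _ _).trans ?_
        rw [h1, sub_self])
      exact mem_sup.2 ⟨_, ⟨x, rfl⟩, _, ⟨y, rfl⟩, by rw [hy]; exact add_sub_cancel _ _⟩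
    · intro hz
      obtain ⟨_, ⟨x, rfl⟩, _, ⟨y, rfl⟩, rfl⟩ := mem_sup.1 hz
      refine ⟨π _ x, (hπ (n + 1) x).trans ?_⟩
      refine Eq.trans ?_ (map_add (π _) _ _).symm
      rw [show π _ (mu p _ y) = 0 from red_mu y, add_zero]; rfl
  · ext z
    have : z ∈ AddSubgroup.comap (π _) (dS (ZMod p) M n).toAddMonoidHom.ker ↔ π _ (dS ℤ M n z) = 0 := by
      rw [← hπ]; rfl
    exact this.trans ⟨fun h => red_ker h, by rintro ⟨y, hy⟩; rw [show dS ℤ M n z = mu p _ y from hy.symm]; exact red_mu y⟩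

lemma clr {α : Type} (y : α →₀ ℚ) : ∃ k : ℕ, k ≠ 0 ∧ ∃ x : α →₀ ℤ, mapRange.addMonoidHom (castRingHom ℚ).toAddMonoidHom x = k • y := by
  induction y using Finsupp.induction_linear with
  | zero => exact ⟨1, one_ne_zero, 0, by simp⟩
  | add f g hf hg =>
    obtain ⟨k, hk, x, hx⟩ := hf
    obtain ⟨l, hl, y, hy⟩ := hg
    refine ⟨k * l, mul_ne_zero hk hl, l • x + k • y, ?_⟩
    rw [map_add, map_nsmul, map_nsmul, hx, hy, smul_add, ← mul_smul, ← mul_smul, mul_comm l k]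
  | single a q =>
    refine ⟨q.den, q.den_nz, single a q.num, ?_⟩
    rw [mapRange.addMonoidHom_apply, mapRange_single, smul_single]
    refine congrArg _ ?_
    rw [nsmul_eq_mul, Rat.den_mul_eq_num]; rfl

lemma finrank_HS (n : ℕ) : finrank ℚ (HS ℚ M n) = finrank ℤ (HS ℤ M n) := by
  let π := fun α : Type => mapRange.addMonoidHom (ι := α) (castRingHom ℚ).toAddMonoidHom
  have hπ : ∀ m c, dS ℚ M m (π _ c) = π _ (dS ℤ M m c) := fun m c => dS_map (castRingHom ℚ) m c
  have inj : ∀ α, Injective (π α) := fun α => Finsupp.mapRange_injective _ (map_zero _) Int.cast_injective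
  let P : ker (dS ℤ M n) →ₗ[ℤ] HS ℚ M n := (((clS ℚ M n).toAddMonoidHom).comp
    (((π _).comp (ker (dS ℤ M n)).subtype.toAddMonoidHom).codRestrict (ker (dS ℚ M n)).toAddSubgroup fun c => by
      change dS ℚ M n (π _ c.1) = 0
      rw [hπ, c.2, map_zero])).toIntLinearMap
  have P0 : ∀ c, P c = 0 ↔ ∃ y, dS ℚ M (n + 1) y = π _ c.1 := fun c => clS_zero _
  let φ : HS ℤ M n →ₗ[ℤ] HS ℚ M n := liftQ _ P (fun c hc => by
    obtain ⟨y, hy⟩ : ∃ y, dS ℤ M (n + 1) y = c.1 := hc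
    exact (P0 c).2 ⟨π _ y, by rw [hπ, hy]⟩)
  have hφ : ∀ c, φ (clS ℤ M n c) = P c := fun c => Submodule.liftQ_apply _ _ _
  have hu : ∀ k : ℤ, k ≠ 0 → IsUnit (algebraMap ℤ (End ℤ (HS ℚ M n)) k) := fun k hk => by
    rw [End.isUnit_iff]
    refine ⟨fun x y h => ?_, fun x => ⟨(k : ℚ)⁻¹ • x, ?_⟩⟩
    · have h' : k • x = k • y := h
      rw [← Int.cast_smul_eq_zsmul ℚ, ← Int.cast_smul_eq_zsmul ℚ] at h'
      exact smul_right_injective _ (Int.cast_ne_zero.2 hk) h'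
    · change k • (k : ℚ)⁻¹ • x = x
      rw [← Int.cast_smul_eq_zsmul ℚ, smul_inv_smul₀ (Int.cast_ne_zero.2 hk)]
  have : IsLocalizedModule (nonZeroDivisors ℤ) φ := by
    refine ⟨fun k => hu k (nonZeroDivisors.ne_zero k.2), fun y => ?_, fun {a b} h => ?_⟩
    · obtain ⟨c, rfl⟩ := mkQ_surjective _ y
      obtain ⟨k, hk, x, hx⟩ := clr c.1
      have hx0 : dS ℤ M n x = 0 := by
        refine inj _ ?_
        rw [← hπ, map_zero]
        refine (congrArg _ hx).trans ?_
        rw [map_nsmul, c.2, smul_zero]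
      refine ⟨(clS ℤ M n ⟨x, hx0⟩, ⟨(k : ℤ), by rw [mem_nonZeroDivisors_iff_ne_zero]; exact_mod_cast hk⟩), ?_⟩
      refine Eq.trans ?_ (hφ _).symm
      refine (Nat.cast_smul_eq_nsmul ℤ k (clS ℚ M n c)).trans ?_
      rw [← map_nsmul]
      exact congrArg (clS ℚ M n) (Subtype.ext hx.symm)
    · obtain ⟨a, rfl⟩ := mkQ_surjective _ a
      obtain ⟨b, rfl⟩ := mkQ_surjective _ b
      have h0 : P (a - b) = 0 := by
        rw [map_sub, sub_eq_zero, ← hφ, ← hφ]; exact h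
      obtain ⟨y, hy⟩ := (P0 _).1 h0
      obtain ⟨k, hk, x, hx⟩ := clr y
      refine ⟨⟨(k : ℤ), by rw [mem_nonZeroDivisors_iff_ne_zero]; exact_mod_cast hk⟩, ?_⟩
      change (k : ℤ) • clS ℤ M n a = (k : ℤ) • clS ℤ M n b
      rw [← sub_eq_zero, ← smul_sub, ← map_sub, ← map_smul, clS_zero]
      refine ⟨x, inj _ ?_⟩
      refine (hπ (n + 1) x).symm.trans ((congrArg _ hx).trans ?_)
      rw [map_nsmul, hy, ← map_nsmul]
      refine congrArg _ ?_
      exact (Nat.cast_smul_eq_nsmul ℤ k (a - b).1).symm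
  rw [← IsLocalizedModule.finrank_eq (nonZeroDivisors ℤ) φ le_rfl]
  exact congrArg Cardinal.toNat (IsLocalization.rank_eq ℚ (nonZeroDivisors ℤ) le_rfl)

lemma tor_zero : tor p (dS ℤ M 0).toAddMonoidHom = 1 := by
  refine AddSubgroup.relIndex_eq_one.2 fun x hx => ?_
  obtain ⟨y, hy⟩ := hx
  have : (0 : C(Dl 0, M) →₀ ℤ) = p • x := hy
  refine ⟨0, ?_⟩
  rw [map_zero]
  exact ((mu_inj (p := p) _) (this.symm.trans (map_zero (mu p _)).symm)).symm

/-- Euler characteristics agree. -/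
theorem euler_uct {r : ℕ} (hfin : ∀ n, Module.Finite ℤ (HS ℤ M n)) (hf : ∀ n, Module.Finite (ZMod p) (HS (ZMod p) M n))
  (hr : Subsingleton (HS (ZMod p) M (r + 1))) :
  ∑ i ∈ Finset.range (r + 1), (-1 : ℤ) ^ i * (finrank ℚ (HS ℚ M i) : ℤ) =
  ∑ i ∈ Finset.range (r + 1), (-1 : ℤ) ^ i * (finrank (ZMod p) (HS (ZMod p) M i) : ℤ) := by
  let t : ℕ → ℕ := fun n => tor p (dS ℤ M n).toAddMonoidHom
  have key : ∀ n, p ^ finrank (ZMod p) (HS (ZMod p) M n) = p ^ finrank ℚ (HS ℚ M n) * t (n + 1) * t n := fun n => by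
    have h1 := Module.natCard_eq_pow_finrank (K := ZMod p) (V := HS (ZMod p) M n)
    obtain ⟨h2, h3⟩ := count (p := p) (dS ℤ M (n + 1)) (dS ℤ M n) (dS_dS n) (mu_inj _) (mu_inj _)
    rw [Nat.card_zmod, card_HS, h2, index_mu, h3, ← finrank_HS] at h1
    exact h1.symm
  have pw : ∀ n, ∃ s, t n = p ^ s := fun n => by
    obtain ⟨s, -, hs⟩ := (Nat.dvd_prime_pow hp.out).1 (Dvd.intro_left _ (key n).symm)
    exact ⟨s, hs⟩
  choose s hs using pw
  have key' : ∀ n, finrank (ZMod p) (HS (ZMod p) M n) = finrank ℚ (HS ℚ M n) + s (n + 1) + s n := fun n => by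
    have := key n
    rw [hs, hs, ← pow_add, ← pow_add] at this
    exact Nat.pow_right_injective hp.out.two_le this
  have s0 : s 0 = 0 := by
    have := hs 0
    rw [show t 0 = 1 from tor_zero] at this
    exact Nat.pow_right_injective hp.out.two_le (this.symm.trans (pow_zero p).symm)
  have sr : s (r + 1) = 0 := by
    have := key' (r + 1)
    rw [finrank_zero_of_subsingleton] at this
    omega
  have tel : ∀ m, ∑ i ∈ Finset.range m, (-1 : ℤ) ^ i * (finrank (ZMod p) (HS (ZMod p) M i) : ℤ) =
      ∑ i ∈ Finset.range m, (-1 : ℤ) ^ i * (finrank ℚ (HS ℚ M i) : ℤ) - (-1) ^ m * s m := fun m => by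
    induction m with
    | zero => simp [s0]
    | succ m ih =>
      rw [sum_range_succ, sum_range_succ, ih, key' m]
      push_cast
      ring
  rw [tel (r + 1), sr]
  simp
end appl
end PG

namespace PG

/-! ### Comparison with Mathlib's homology -/
lemma HQ_sc {R : Type} [CommRing R] (S : ShortComplex (ModuleCat.{0} R)) {A B C : Type} [AddCommGroup A] [AddCommGroup B] [AddCommGroup C]
  [Module R A] [Module R B] [Module R C] (d : A →ₗ[R] B) (e : C →ₗ[R] A) (e1 : S.X₁ ≃ₗ[R] C) (e2 : S.X₂ ≃ₗ[R] A)
  (h1 : ∀ x, e2 (S.f.hom x) = e (e1 x)) (h2 : ∀ x, S.g.hom x = 0 ↔ d (e2 x) = 0) :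
  finrank R S.homology = finrank R (HQ d e) := by
  rw [S.moduleCatHomologyIso.toLinearEquiv.finrank_eq]
  have hk : (ker S.g.hom).map (e2 : S.X₂ →ₗ[R] A) = ker d := by
    ext y
    constructor
    · rintro ⟨x, hx, rfl⟩
      exact (h2 x).1 hx
    · intro hy
      exact ⟨e2.symm y, (h2 _).2 (by simpa using hy), by simp⟩
  let f := e2.ofSubmodules _ _ hk
  refine (Submodule.Quotient.equiv (LinearMap.range S.moduleCatToCycles) _ f ?_).finrank_eq
  ext y
  constructor
  · rintro ⟨_, ⟨x, rfl⟩, rfl⟩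
    exact ⟨e1 x, (h1 x).symm⟩
  · rintro ⟨c, hc⟩
    refine ⟨_, ⟨e1.symm c, rfl⟩, Subtype.ext ?_⟩
    exact (h1 (e1.symm c)).trans (by rw [e1.apply_symm_apply]; exact hc)

lemma hom_alt {R : Type} [CommRing R] {A B : ModuleCat.{0} R} {V : Type} [AddCommGroup V] [Module R V] (L : B →ₗ[R] V) {m : ℕ}
  (f : Fin m → (A ⟶ B)) (x : A) : L ((∑ i : Fin m, (-1 : ℤ) ^ (i : ℕ) • f i).hom x) = ∑ i : Fin m, (-1 : ℤ) ^ (i : ℕ) • L ((f i).hom x) := by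
  rw [ModuleCat.hom_sum, LinearMap.sum_apply, map_sum]
  refine sum_congr rfl fun i _ => ?_
  rw [ModuleCat.hom_zsmul, LinearMap.smul_apply, map_zsmul]
section
variable (R : Type) [CommRing R] (M : Type) [TopologicalSpace M]
/-- Singular chains in the two models. -/
noncomputable def eS (n : ℕ) : (singularChainComplex R (TopCat.of M)).X n ≃ₗ[R] (C(Dl (n + 1), M) →₀ R) :=
  Finsupp.domLCongr ((TopCat.of M).toSSetObjEquiv (.op (.mk n)))
variable {R M}
lemma eS_d (n : ℕ) (x : (singularChainComplex R (TopCat.of M)).X (n + 1)) :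
  eS R M n (((singularChainComplex R (TopCat.of M)).d (n + 1) n).hom x) = dS R M (n + 1) (eS R M (n + 1) x) := by
  suffices h : (eS R M n).toLinearMap ∘ₗ ((singularChainComplex R (TopCat.of M)).d (n + 1) n).hom = dS R M (n + 1) ∘ₗ (eS R M (n + 1)).toLinearMap from
    LinearMap.congr_fun h x
  refine lhom_ext' fun σ => ext_ring ?_
  have hd : (singularChainComplex R (TopCat.of M)).d (n + 1) n = ∑ i : Fin (n + 2), (-1 : ℤ) ^ (i : ℕ) •
      (((CategoryTheory.SimplicialObject.whiskering _ _).obj (ModuleCat.free R)).obj (TopCat.toSSet.obj (TopCat.of M))).δ i :=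
    AlgebraicTopology.AlternatingFaceMapComplex.obj_d_eq _ n
  change eS R M n (((singularChainComplex R (TopCat.of M)).d (n + 1) n).hom (single σ 1)) = dS R M (n + 1) (eS R M (n + 1) (single σ 1))
  have h1 : eS R M (n + 1) (single σ 1) = single ((TopCat.of M).toSSetObjEquiv (.op (.mk (n + 1))) σ) 1 :=
    Finsupp.domLCongr_single _ _ _
  rw [h1]
  refine Eq.trans ?_ (Sim.bd_single (X := (Sing M).toSim) _).symm
  refine (congrArg (fun D => eS R M n (ModuleCat.Hom.hom D (single σ 1))) hd).trans ?_
  refine (hom_alt (eS R M n).toLinearMap _ _).trans (sum_congr rfl fun i _ => ?_)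
  have h2 : eS R M n (((((CategoryTheory.SimplicialObject.whiskering _ _).obj (ModuleCat.free R)).obj (TopCat.toSSet.obj (TopCat.of M))).δ i).hom
      (single σ 1)) = single ((Sing M).act i.succAbove ((TopCat.of M).toSSetObjEquiv (.op (.mk (n + 1))) σ)) 1 := by
    refine (congrArg (eS R M n) (mapDomain_single (f := (TopCat.toSSet.obj (TopCat.of M)).δ i) (a := σ) (b := (1 : R)))).trans ?_
    exact Finsupp.domLCongr_single _ _ _
  refine (congrArg (fun t => (-1 : ℤ) ^ (i : ℕ) • t) h2).trans ?_
  rcases Nat.even_or_odd (i : ℕ) with h' | h' <;> simp [h'.neg_one_pow]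
lemma finrank_sH (n : ℕ) : finrank R (singularHomology R (TopCat.of M) n) = finrank R (HS R M n) := by
  unfold singularHomology
  set K := singularChainComplex R (TopCat.of M) with hK
  cases n with
  | zero =>
    rw [(K.homologyIsoSc' 1 0 0 (by simp) (by simp)).toLinearEquiv.finrank_eq]
    refine HQ_sc _ _ _ (eS R M 1) (eS R M 0) (eS_d 0) fun x => ?_
    refine iff_of_true ?_ rfl
    change (K.d 0 0).hom x = 0
    rw [K.shape 0 0 (by simp)]; rfl
  | succ n =>
    rw [(K.homologyIsoSc' (n + 2) (n + 1) n (by simp) (by simp)).toLinearEquiv.finrank_eq]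
    refine HQ_sc _ _ _ (eS R M (n + 2)) (eS R M (n + 1)) (eS_d (n + 1)) fun x => ?_
    exact ((eS R M n).map_eq_zero_iff.symm).trans (iff_of_eq (congrArg (· = 0) (eS_d n x)))
end
end PG

namespace PG

lemma LE_chart {M : Type} [TopologicalSpace M] {r : ℕ} [ChartedSpace (EuclideanSpace ℝ (Fin r)) M] (x : M) :
  ∃ c : (Fin r → ℝ) → M, IsOpenEmbedding c ∧ c 0 = x := by
  set e := chartAt (EuclideanSpace ℝ (Fin r)) x
  obtain ⟨ε, hε, hb⟩ := isOpen_iff.1 e.open_target (e x) (e.map_source (mem_chart_source _ x))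
  set u := OpenPartialHomeomorph.univBall (e x) ε
  have hs : (u.trans e.symm).source = univ := by
    refine Set.eq_univ_of_forall fun y => ?_
    rw [OpenPartialHomeomorph.trans_source, univBall_source]
    refine ⟨trivial, hb ?_⟩
    rw [← OpenPartialHomeomorph.univBall_target (e x) hε]
    exact u.map_source (by rw [univBall_source]; trivial)
  refine ⟨_, ((u.trans e.symm).isOpenEmbedding hs).comp (EuclideanSpace.equiv (Fin r) ℝ).symm.toHomeomorph.isOpenEmbedding, ?_⟩
  have h0 : (EuclideanSpace.equiv (Fin r) ℝ).symm.toHomeomorph 0 = 0 := map_zero (EuclideanSpace.equiv (Fin r) ℝ).symm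
  change e.symm (u ((EuclideanSpace.equiv (Fin r) ℝ).symm.toHomeomorph 0)) = x
  rw [h0, OpenPartialHomeomorph.univBall_apply_zero]
  exact e.left_inv (mem_chart_source _ x)

lemma core_metric {p : ℕ} [hp : Fact p.Prime] (hodd : p ≠ 2) {k r : ℕ} {M : Type} [m : MetricSpace M] [CompactSpace M] [ConnectedSpace M]
  {G : Type} [AddCommGroup G] [Finite G] [AddAction G M] [IsIsometricVAdd G M] (hLE : LE M r) (hexp : ∀ g : G, p • g = 0)
  (heff : ∀ g : G, g ≠ 0 → ∃ y : M, g +ᵥ y ≠ y) (hcard : Nat.card G = p ^ k) :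
  (p : ℤ) ^ (k - r / 2) ∣ eulerCharUpTo (TopCat.of M) r := by
  have e := fun n => (HS_equiv (F := ZMod p) hLE n).some
  have hf := fun n => HS_fin (R := ZMod p) hLE n
  have hbd : (E (ZMod p) (pow (univ : Set M)) (ATow.nul M).tow).L.Bd r := E_bd' (G := G) isClosed_univ (CD_LE hLE)
  have hr : Subsingleton (HS (ZMod p) M (r + 1)) := by
    have := hbd (r + 1) (Nat.lt_succ_self r)
    exact (e (r + 1)).injective.subsingleton
  have h := euler_AS (F := ZMod p) hLE hodd hexp heff hcard fun n => by
    have := hf n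
    exact Module.Finite.equiv (e n)
  have hu := euler_uct (fun n => HS_fin (R := ℤ) hLE n) hf hr
  have : eulerCharUpTo (TopCat.of M) r = (E (ZMod p) (pow (univ : Set M)) (ATow.nul M).tow).L.chi r := by
    unfold eulerCharUpTo
    rw [sum_congr rfl fun i _ => by rw [finrank_sH], hu]
    exact sum_congr rfl fun i _ => by rw [(e i).finrank_eq]; rfl
  rwa [this]

lemma core_top {p : ℕ} [hp : Fact p.Prime] (hodd : p ≠ 2) {k r : ℕ} {M : Type} [t : TopologicalSpace M] [CompactSpace M] [ConnectedSpace M]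
  {G : Type} [AddCommGroup G] [Finite G] [AddAction G M] (m : MetricSpace M) (ht : m.toPseudoMetricSpace.toUniformSpace.toTopologicalSpace = t)
  (hm : ∀ (g : G) (x y : M), dist (g +ᵥ x) (g +ᵥ y) = dist x y)
  (hLE : ∀ x : M, ∃ c : (Fin r → ℝ) → M, IsOpenEmbedding c ∧ c 0 = x) (hexp : ∀ g : G, p • g = 0)
  (heff : ∀ g : G, g ≠ 0 → ∃ y : M, g +ᵥ y ≠ y) (hcard : Nat.card G = p ^ k) :
  (p : ℤ) ^ (k - r / 2) ∣ eulerCharUpTo (TopCat.of M) r := by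
  subst ht
  have : IsIsometricVAdd G M := ⟨fun g => Isometry.of_dist_eq (hm g)⟩
  exact core_metric hodd hLE hexp heff hcard

lemma inv_metric {M : Type} [t : TopologicalSpace M] [T2Space M] [CompactSpace M] [TopologicalSpace.MetrizableSpace M]
  {G : Type} [AddCommGroup G] [Finite G] [AddAction G M] (hc : ∀ g : G, Continuous fun x : M => g +ᵥ x) :
  ∃ m : MetricSpace M, m.toPseudoMetricSpace.toUniformSpace.toTopologicalSpace = t ∧ ∀ (g : G) (x y : M), dist (g +ᵥ x) (g +ᵥ y) = dist x y := by
  have := ofFinite G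
  let m0 : MetricSpace M := TopologicalSpace.metrizableSpaceMetric M
  let ι : M → G → M := fun x g => g +ᵥ x
  have hι : Topology.IsEmbedding ι := ((continuous_pi hc).isClosedEmbedding fun x y h => by
    simpa [ι] using congrFun h 0).isEmbedding
  refine ⟨hι.comapMetricSpace ι, rfl, ?_⟩
  have key : ∀ (g : G) (x y : M), dist (ι (g +ᵥ x)) (ι (g +ᵥ y)) ≤ dist (ι x) (ι y) := fun g x y => by
    refine (dist_pi_le_iff dist_nonneg).2 fun h => ?_
    have := dist_le_pi_dist (ι x) (ι y) (h + g)
    simpa [ι, add_vadd] using this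
  intro g x y
  refine le_antisymm (key g x y) ?_
  have := key (-g) (g +ᵥ x) (g +ᵥ y)
  rwa [neg_vadd_vadd, neg_vadd_vadd] at this
end PG

theorem elementary_p_group_action_euler_char
    (p : ℕ) (hp : p.Prime) (hodd : p ≠ 2) (k r : ℕ)
    (M : Type) [TopologicalSpace M] [T2Space M] [CompactSpace M] [ConnectedSpace M]
    [ChartedSpace (EuclideanSpace ℝ (Fin r)) M]
    (φ : Multiplicative (Fin k → ZMod p) →* Equiv.Perm M)
    (hcont : ∀ g, Continuous (φ g)) (hcont' : ∀ g, Continuous ((φ g).symm))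
    (hinj : Function.Injective φ) :
    (p : ℤ) ^ (k - r / 2) ∣ eulerCharUpTo (TopCat.of M) r ∧
      (¬ ((p : ℤ) ∣ eulerCharUpTo (TopCat.of M) r) → k ≤ r / 2) := by
  have hfact : Fact p.Prime := ⟨hp⟩
  have : SecondCountableTopology M := ChartedSpace.secondCountable_of_sigmaCompact (EuclideanSpace ℝ (Fin r)) M
  have : TopologicalSpace.MetrizableSpace M := TopologicalSpace.metrizableSpace_of_t3_secondCountable M
  let _ : AddAction (Fin k → ZMod p) M :=
    { vadd := fun g x => φ (Multiplicative.ofAdd g) x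
      zero_vadd := fun x => by
        change φ 1 x = x
        rw [map_one]; rfl
      add_vadd := fun g h x => by
        change φ (Multiplicative.ofAdd g * Multiplicative.ofAdd h) x = _
        rw [map_mul]; rfl }
  obtain ⟨m, ht, hm⟩ := PG.inv_metric (M := M) (G := Fin k → ZMod p) fun g => hcont _
  have h : (p : ℤ) ^ (k - r / 2) ∣ eulerCharUpTo (TopCat.of M) r := by
    refine PG.core_top (G := Fin k → ZMod p) hodd m ht hm PG.LE_chart (fun g => ?_) (fun g hg => ?_) ?_
    · ext i; simp
    · by_contra hne
      push Not at hne
      refine hg (Multiplicative.ofAdd.injective (hinj ?_))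
      rw [ofAdd_zero, map_one]
      exact Equiv.ext hne
    · simp
  refine ⟨h, fun hn => ?_⟩
  by_contra hk
  exact hn ((dvd_pow_self _ (by omega)).trans h)
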